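/- Let ℓ be an odd prime and let K be a global field with char(K) ≠ ℓ containing a primitive ℓth root of unity. Then there exist a, b ∈ K* satisfying: (i) the fractional ideals (a) and (b) are coprime; (ii) a and b have distinct, nontrivial images in K*/K*^ℓ; (iii) if K is a number field, then a, b ∈ 1 + ℓ³O_K; (iv) setting L := K(a^{1/ℓ}, b^{1/ℓ}) and G := Gal(L/K), for every prime 𝔮 of K unramified in L — with A := O_K if K is a number field and A := O_{{𝔮}} (the ring of {𝔮}-integers) if K is a global function field — and for every σ ∈ G and every ideal class C of Cl(A), there exists a prime 𝔭 of K unramified in L such that the Frobenius (𝔭, L/K) equals σ and 𝔭 ∩ A lies in C. -/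

import Mathlib

open scoped Classical
open IntermediateField

noncomputable section

/-- `K` is a global field: a number field, or a finite extension of a rational function
field `𝔽_q(t)` over a finite field (equivalently, `K` contains a finite subfield `F₀` and an
element `x` transcendental over `F₀` such that `K` is finite over `F₀(x)`). -/
def IsGlobalField (K : Type*) [Field K] : Prop :=
  NumberField K ∨
    ∃ F₀ : Subfield K, Finite F₀ ∧ ∃ x : K, Transcendental F₀ x ∧
      FiniteDimensional (IntermediateField.adjoin F₀ {x}) K

/-- `A ⊆ K^ι` is a diophantine subset of `K^ι`: it is cut out by an existential
polynomial condition over `K`. -/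
def IsDiophantine {K : Type*} [Field K] {ι : Type*} (A : Set (ι → K)) : Prop :=
  ∃ (m : ℕ) (f : MvPolynomial (Fin m ⊕ ι) K),
    A = {a | ∃ r : Fin m → K, MvPolynomial.eval (Sum.elim r a) f = 0}

/-- `x` is a norm of the radical extension `F(y^{1/n})/F`, where `F(y^{1/n})` is realized
inside an algebraic closure of `F` (for `F` containing the `n`-th roots of unity this does
not depend on the choice of the root `z` of `X^n - y`). -/
def IsNormOfRadical (F : Type*) [Field F] (n : ℕ) (y x : F) : Prop :=
  ∀ z : AlgebraicClosure F, z ^ n = algebraMap F (AlgebraicClosure F) y →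
    ∃ w : (IntermediateField.adjoin F {z} : IntermediateField F (AlgebraicClosure F)),
      Algebra.norm F w = x

/-- A finite place (finite prime) of a global field `K`, encoded by its normalized valuation:
a surjective multiplicatively-written `ℤ`-valued valuation on `K`. -/
structure FinPlace (K : Type*) [Field K] where
  val : Valuation K (WithZero (Multiplicative ℤ))
  surj : Function.Surjective val

variable {K : Type*} [Field K]

/-- The normalized additive valuation `v_𝔭 : K → ℤ` attached to a finite place
(with junk value `0` at `x = 0`). -/
def vz (v : FinPlace K) (x : K) : ℤ :=
  if h : v.val x = 0 then 0 else Multiplicative.toAdd (WithZero.unzero h)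

/-- The maximal ideal `𝔭 O_(𝔭)` of the local ring `O_(𝔭) = {x : 0 ≤ v_𝔭(x)}` at a finite
place, as a subset of `K`. -/
def mIdeal (v : FinPlace K) : Set K := {x | x = 0 ∨ 0 < vz v x}

/-- The sum `S + T` of two subsets of `K`. -/
def setSum (S T : Set K) : Set K := {z | ∃ x ∈ S, ∃ y ∈ T, z = x + y}

/-- The Jacobson radical of a (semi-local) subring of `K` given as a subset `S ⊆ K`:
those `x ∈ S` such that `1 - x*r` is a unit of `S` for every `r ∈ S`. -/
def JacRad (S : Set K) : Set K :=
  {x | x ∈ S ∧ ∀ r ∈ S, ∃ u ∈ S, (1 - x * r) * u = 1}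

/-- The cardinality `|𝔽_𝔭|` of the residue field of a finite place. -/
def resCard (v : FinPlace K) : ℕ :=
  Nat.card (IsLocalRing.ResidueField v.val.valuationSubring)

/-- The `ℓ`-th power residue symbol relation: `(u/𝔭)_ℓ = ζ`, i.e. `ζ` is an `ℓ`-th root
of unity with `u^{(|𝔽_𝔭|-1)/ℓ} ≡ ζ (mod 𝔭)`. -/
def IsPowResSymb (ℓ : ℕ) (v : FinPlace K) (u ζ : K) : Prop :=
  ζ ^ ℓ = 1 ∧ v.val (u ^ ((resCard v - 1) / ℓ) - ζ) < 1

/-- The `ℓ`-th power residue symbol `(u/𝔭)_ℓ ∈ μ_ℓ ⊆ K` (junk value `1` if it is not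
uniquely determined, e.g. if `v_𝔭(u) ≠ 0`). -/
def symb (ℓ : ℕ) (v : FinPlace K) (u : K) : K :=
  if h : ∃! ζ : K, IsPowResSymb ℓ v u ζ then h.exists.choose else 1

/-- A finite place `v` of `K` is unramified in a field extension `L/K`: every finite place
`w` of `L` extending (a power of) `v` has ramification index `1`. -/
def UnramifiedIn (v : FinPlace K) (L : Type*) [Field L] [Algebra K L] : Prop :=
  ∀ (w : FinPlace L) (e : ℕ), 0 < e →
    (∀ x : K, w.val (algebraMap K L x) = v.val x ^ e) → e = 1

/-- `σ` is the Frobenius `(𝔭, L/K)` of the finite place `v = 𝔭` of `K` in `L/K`: for some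
finite place `w` of `L` extending `v`, `σ` induces `x ↦ x^{|𝔽_𝔭|}` on the residue field
at `w`. -/
def IsFrobeniusAt (v : FinPlace K) {L : Type*} [Field L] [Algebra K L]
    (σ : L ≃ₐ[K] L) : Prop :=
  ∃ w : FinPlace L, (∀ x : K, w.val (algebraMap K L x) = v.val x) ∧
    ∀ x : L, w.val x ≤ 1 → w.val (σ x - x ^ resCard v) < 1


set_option linter.all false
section Aux
local notation "ϖ" => algebraMap
local notation "ℯ" => Real.exp
local notation "ℌ" => IsDedekindDomain.HeightOneSpectrum
lemma span_smul {R : Type*} [CommSemiring R] (r s : R) : Ideal.span {r} * Ideal.span {s} = Ideal.span {r * s} :=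
  Ideal.span_singleton_mul_span_singleton r s
abbrev FFc (K : Type*) [Field K] (ℓ : ℕ) : Prop :=
    ∃ a b : K, a ≠ 0 ∧ b ≠ 0 ∧
      (∀ v : FinPlace K, vz v a = 0 ∨ vz v b = 0) ∧
      ((¬ ∃ t : K, a = t ^ ℓ) ∧ (¬ ∃ t : K, b = t ^ ℓ) ∧ ¬ ∃ t : K, a = b * t ^ ℓ) ∧
      ∀ α β : AlgebraicClosure K,
        α ^ ℓ = algebraMap K (AlgebraicClosure K) a →
        β ^ ℓ = algebraMap K (AlgebraicClosure K) b →
        ∀ q0 : FinPlace K,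
        ∀ σ : (IntermediateField.adjoin K {α, β} : IntermediateField K (AlgebraicClosure K))
            ≃ₐ[K] (IntermediateField.adjoin K {α, β} : IntermediateField K (AlgebraicClosure K)),
        ∀ D : FinPlace K → ℤ, {v : FinPlace K | D v ≠ 0}.Finite →
          ∃ p : FinPlace K, UnramifiedIn p (IntermediateField.adjoin K {α, β}) ∧
            IsFrobeniusAt p σ ∧
            ∃ x : K, x ≠ 0 ∧ ∀ w : FinPlace K, w ≠ q0 →
              vz w x = (if w = p then 1 else 0) - D w
variable {K : Type*} [Field K]
section AT
open MeasureTheory Filter Topology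
def atL {P : Type*} (N : P → ℕ) (I : P →₀ ℕ) : ℝ := I.sum fun p n => n * Real.log (N p)
def atC {P Γ : Type*} [AddCommGroup Γ] (cl : P → Γ) (I : P →₀ ℕ) : Γ := I.sum fun p n => n • cl p
structure ATd {P Γ : Type*} [AddCommGroup Γ] (N : P → ℕ) (cl : P → Γ) (Φ : ℝ → ℝ) (κ M R : ℝ) :
    Prop where
  two : ∀ p, 2 ≤ N p
  fin : ∀ x : ℕ, {p | N p ≤ x}.Finite
  meas : Measurable Φ
  nonneg : ∀ t, 0 ≤ Φ t
  bdd : ∀ t, Φ t ≤ M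
  supp : ∀ t, R < |t| → Φ t = 0
  pos : 0 < ∫ t, Φ t
  κpos : 0 < κ
  Rpos : 0 < R
  main : ∀ γ t, |(∑' I : P →₀ ℕ, if atC cl I = γ then Φ (t - atL N I) else 0) - κ * ℯ t| ≤ M
variable {P Γ : Type*} [AddCommGroup Γ] {N : P → ℕ} {cl : P → Γ} {Φ : ℝ → ℝ} {κ M R : ℝ}
lemma atL_add (I J : P →₀ ℕ) : atL N (I + J) = atL N I + atL N J := by
  unfold atL; rw [Finsupp.sum_add_index'] <;> intros <;> push_cast <;> ring
lemma atC_add (I J : P →₀ ℕ) : atC cl (I + J) = atC cl I + atC cl J := by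
  unfold atC; rw [Finsupp.sum_add_index'] <;> intros <;> simp [add_smul]
lemma atL_zero : atL N 0 = 0 := by simp [atL]
lemma atC_zero : atC cl 0 = 0 := by simp [atC]
lemma atL_single (p : P) (n : ℕ) : atL N (Finsupp.single p n) = n * Real.log (N p) := by simp [atL]
lemma atC_single (p : P) (n : ℕ) : atC cl (Finsupp.single p n) = n • cl p := by simp [atC]
lemma atL_nonneg (I : P →₀ ℕ) : 0 ≤ atL N I :=
  Finset.sum_nonneg fun p _ => mul_nonneg (by positivity) (Real.log_natCast_nonneg _)
lemma at_log2 (h : ∀ p, 2 ≤ N p) (p : P) : Real.log 2 ≤ Real.log (N p) :=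
  Real.log_le_log (by norm_num) (by exact_mod_cast h p)
lemma atL_ge (I : P →₀ ℕ) (p : P) : I p * Real.log (N p) ≤ atL N I := by
  by_cases hp : p ∈ I.support
  · exact Finset.single_le_sum (f := fun p => (I p : ℝ) * Real.log (N p))
      (fun p _ => mul_nonneg (by positivity) (Real.log_natCast_nonneg _)) hp
  · simp at hp; simp [hp, atL_nonneg]
lemma at_finL (h2 : ∀ p, 2 ≤ N p) (hf : ∀ x : ℕ, {p | N p ≤ x}.Finite) (x : ℝ) :
    {I : P →₀ ℕ | atL N I ≤ x}.Finite := by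
  have hS := hf ⌈ℯ x⌉₊
  set S := hS.toFinset
  set m := ⌈x / Real.log 2⌉₊
  refine (Set.finite_Iic (∑ p ∈ S, Finsupp.single p m)).subset ?_
  intro I hI p
  have hl2 : 0 < Real.log 2 := Real.log_pos (by norm_num)
  have h1 := (atL_ge (N := N) I p).trans hI
  by_cases h0 : I p = 0
  · simp [h0]
  have h3 : Real.log (N p) ≤ x := by
    refine le_trans ?_ h1
    have : (1:ℝ) ≤ I p := by exact_mod_cast Nat.one_le_iff_ne_zero.2 h0
    nlinarith [Real.log_natCast_nonneg (N p)]
  have h4 : p ∈ S := by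
    simp only [S, Set.Finite.mem_toFinset, Set.mem_ofPred_eq]
    have hp : (0:ℝ) < N p := by have := h2 p; positivity
    have := (Real.log_le_iff_le_exp hp).1 h3
    exact_mod_cast this.trans (Nat.le_ceil _)
  have h5 : (∑ q ∈ S, Finsupp.single q m) p = m := by
    rw [Finsupp.finsetSum_apply]
    rw [Finset.sum_eq_single p]
    · simp
    · intro b _ hb; simp [hb]
    · exact fun h => absurd h4 h
  rw [h5]
  have h6 : (I p : ℝ) ≤ x / Real.log 2 := by
    rw [le_div_iff₀ hl2]
    exact le_trans (mul_le_mul_of_nonneg_left (at_log2 h2 p) (by positivity)) h1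
  exact_mod_cast h6.trans (Nat.le_ceil _)
lemma at_countable (hf : ∀ x : ℕ, {p | N p ≤ x}.Finite) : Countable P := by
  rw [← Set.countable_univ_iff]
  have : (Set.univ : Set P) = ⋃ x : ℕ, {p | N p ≤ x} := by
    ext p; simp only [Set.mem_univ, Set.mem_iUnion, Set.mem_ofPred_eq, true_iff]; exact ⟨N p, le_rfl⟩
  rw [this]
  exact Set.countable_iUnion fun x => (hf x).countable
def atS (H : ATd N cl Φ κ M R) (x : ℝ) : Finset (P →₀ ℕ) := (at_finL H.two H.fin x).toFinset
lemma mem_atS (H : ATd N cl Φ κ M R) (x : ℝ) (I : P →₀ ℕ) : I ∈ atS H x ↔ atL N I ≤ x := by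
  simp [atS]
lemma at_zero (H : ATd N cl Φ κ M R) {x t : ℝ} (htx : t + R ≤ x) {I : P →₀ ℕ} (hI : I ∉ atS H x) :
    Φ (t - atL N I) = 0 := by
  apply H.supp
  rw [mem_atS, not_le] at hI
  rw [lt_abs]; right; linarith
lemma at_zero' (H : ATd N cl Φ κ M R) {t : ℝ} (ht : t < -R) (I : P →₀ ℕ) :
    Φ (t - atL N I) = 0 := by
  apply H.supp
  have := atL_nonneg (N := N) I
  rw [lt_abs]; right; linarith
def atT (N : P → ℕ) (Φ : ℝ → ℝ) (c : (P →₀ ℕ) → ℂ) (t : ℝ) : ℂ := ∑' I, c I * (Φ (t - atL N I) : ℂ)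
lemma atT_eq (H : ATd N cl Φ κ M R) (c : (P →₀ ℕ) → ℂ) {x t : ℝ} (htx : t + R ≤ x) :
    atT N Φ c t = ∑ I ∈ atS H x, c I * (Φ (t - atL N I) : ℂ) :=
  tsum_eq_sum fun I hI => by rw [at_zero H htx hI]; simp
lemma atT_zero (H : ATd N cl Φ κ M R) (c : (P →₀ ℕ) → ℂ) {t : ℝ} (ht : t < -R) :
    atT N Φ c t = 0 := by
  unfold atT; simp [at_zero' H ht]
lemma atT_meas (H : ATd N cl Φ κ M R) (c : (P →₀ ℕ) → ℂ) : Measurable (atT N Φ c) := by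
  refine measurable_of_tendsto_metrizable (f := fun (n : ℕ) t => ∑ I ∈ atS H n, c I * (Φ (t - atL N I) : ℂ))
    (fun n => ?_) ?_
  · refine Finset.measurable_sum _ fun I _ => ?_
    have := H.meas
    fun_prop
  · rw [tendsto_pi_nhds]
    intro t
    refine tendsto_const_nhds.congr' ?_
    filter_upwards [eventually_ge_atTop ⌈t + R⌉₊] with n hn
    exact atT_eq H c ((Nat.le_ceil _).trans (by exact_mod_cast hn))
variable [Fintype Γ]
lemma at_main_sum (H : ATd N cl Φ κ M R) (f : Γ → ℂ) (t : ℝ) :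
    ‖atT N Φ (fun I => f (atC cl I)) t - κ * ℯ t * ∑ γ, f γ‖ ≤ M * ∑ γ, ‖f γ‖ := by
  have h1 : atT N Φ (fun I => f (atC cl I)) t = ∑ γ, f γ *
      ((∑' I : P →₀ ℕ, if atC cl I = γ then Φ (t - atL N I) else 0 : ℝ) : ℂ) := by
    rw [atT_eq H _ (le_refl (t + R))]
    have : ∀ γ, (∑' I : P →₀ ℕ, if atC cl I = γ then Φ (t - atL N I) else 0 : ℝ) =
        ∑ I ∈ atS H (t+R), if atC cl I = γ then Φ (t - atL N I) else 0 := fun γ =>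
      tsum_eq_sum fun I hI => by rw [at_zero H le_rfl hI]; simp
    simp_rw [this]
    push_cast
    simp_rw [Finset.mul_sum]
    rw [Finset.sum_comm]
    refine Finset.sum_congr rfl fun I _ => ?_
    rw [Finset.sum_eq_single (atC cl I)]
    · rw [if_pos rfl]
    · intro b _ hb; rw [if_neg (Ne.symm hb)]; simp
    · intro h; exact absurd (Finset.mem_univ _) h
  rw [h1, Finset.mul_sum, ← Finset.sum_sub_distrib, Finset.mul_sum]
  refine (norm_sum_le _ _).trans (Finset.sum_le_sum fun γ _ => ?_)
  have h2 := H.main γ t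
  set A := (∑' I : P →₀ ℕ, if atC cl I = γ then Φ (t - atL N I) else 0 : ℝ)
  have : f γ * (A : ℂ) - κ * (ℯ t : ℂ) * f γ = f γ * ((A - κ * ℯ t : ℝ) : ℂ) := by
    push_cast; ring
  rw [this, norm_mul, mul_comm M]
  refine mul_le_mul_of_nonneg_left ?_ (norm_nonneg _)
  rw [Complex.norm_real]; exact h2
end AT
section AT2
open MeasureTheory Filter Topology
lemma at_mellinE {ι : Type*} [Countable ι] {Ψ : ℝ → ℝ} (hm : Measurable Ψ) (hn : ∀ t, 0 ≤ Ψ t)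
    (L c : ι → ℝ) (hc : ∀ i, 0 ≤ c i) (s : ℝ) :
    ∫⁻ t, (∑' i, ENNReal.ofReal (c i * Ψ (t - L i))) * ENNReal.ofReal (ℯ (-s * t)) =
      (∑' i, ENNReal.ofReal (c i * ℯ (-s * L i))) *
        ∫⁻ u, ENNReal.ofReal (Ψ u * ℯ (-s * u)) := by
  simp_rw [← ENNReal.tsum_mul_right]
  rw [lintegral_tsum]
  · refine tsum_congr fun i => ?_
    rw [← lintegral_const_mul]
    · rw [← lintegral_add_right_eq_self _ (L i)]
      refine lintegral_congr fun t => ?_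
      rw [← ENNReal.ofReal_mul (mul_nonneg (hc i) (hn _)),
        ← ENNReal.ofReal_mul (mul_nonneg (hc i) (Real.exp_pos _).le)]
      congr 1
      rw [add_sub_cancel_right, mul_add, Real.exp_add]; ring
    · fun_prop
  · intro i; fun_prop
lemma at_exp_lip {R : ℝ} (hR : 0 < R) {s s' t : ℝ} (hs : s ∈ Set.Icc (1:ℝ) 2) (hs' : s' ∈ Set.Icc (1:ℝ) 2)
    (ht : -R ≤ t) : |ℯ (-s * t) - ℯ (-s' * t)| ≤
      (2 + R * ℯ (2 * R)) * |s - s'| * ℯ (-(1/2) * t) := by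
  have key : ∀ u ∈ Set.Icc (1:ℝ) 2, |t| * ℯ (-u * t) ≤
      (2 + R * ℯ (2 * R)) * ℯ (-(1/2) * t) := by
    intro u hu
    rcases le_total 0 t with h | h
    · rw [abs_of_nonneg h]
      have h1 : t ≤ 2 * ℯ (1/2 * t) := by
        have := Real.add_one_le_exp (1/2 * t); linarith
      have h2 : ℯ (-u * t) ≤ ℯ (-1 * t) := Real.exp_le_exp.2 (by nlinarith [hu.1])
      have h3 : ℯ (-(1/2) * t) = ℯ (1/2 * t) * ℯ (-1 * t) := by
        rw [← Real.exp_add]; congr 1; ring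
      have h4 := Real.exp_pos (-1 * t)
      have h5 := Real.exp_pos (-u * t)
      have h6 := Real.exp_pos (1/2 * t)
      calc t * ℯ (-u * t) ≤ (2 * ℯ (1/2 * t)) * ℯ (-1 * t) := by gcongr
        _ = 2 * ℯ (-(1/2) * t) := by rw [h3]; ring
        _ ≤ _ := by
          have : 0 ≤ R * ℯ (2 * R) := by positivity
          nlinarith [Real.exp_pos (-(1/2) * t)]
    · rw [abs_of_nonpos h]
      have h2 : ℯ (-u * t) ≤ ℯ (2 * R) := Real.exp_le_exp.2 (by nlinarith [hu.1, hu.2])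
      have h3 : 1 ≤ ℯ (-(1/2) * t) := Real.one_le_exp (by linarith)
      calc -t * ℯ (-u * t) ≤ R * ℯ (2 * R) := by
            apply mul_le_mul <;> first | linarith | positivity
        _ ≤ (2 + R * ℯ (2 * R)) * 1 := by linarith
        _ ≤ _ := by gcongr
  have wl : ∀ u ∈ Set.Icc (1:ℝ) 2, ∀ u' ∈ Set.Icc (1:ℝ) 2, ℯ (-u * t) - ℯ (-u' * t) ≤
      (2 + R * ℯ (2 * R)) * |u - u'| * ℯ (-(1/2) * t) := by
    intro u hu u' hu'
    have h1 : ℯ (-u' * t) = ℯ (-u * t) * ℯ ((u - u') * t) := by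
      rw [← Real.exp_add]; congr 1; ring
    have h2 := Real.add_one_le_exp ((u - u') * t)
    have h3 : ℯ (-u * t) - ℯ (-u' * t) ≤ ℯ (-u * t) * (|u - u'| * |t|) := by
      rw [h1, ← abs_mul]
      have := neg_abs_le ((u - u') * t)
      nlinarith [Real.exp_pos (-u * t)]
    refine h3.trans ?_
    have := mul_le_mul_of_nonneg_left (key u hu) (abs_nonneg (u - u'))
    linarith
  rw [abs_sub_le_iff]
  refine ⟨wl s hs s' hs', ?_⟩
  rw [abs_sub_comm]
  exact wl s' hs' s hs
section
variable {T : ℝ → ℂ} {B R : ℝ} (hT : Measurable T) (hB : ∀ t, ‖T t‖ ≤ B) (h0 : ∀ t < -R, T t = 0)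
  (hR : 0 < R)
include hT hB h0 hR
lemma at_dom (u : ℝ) (t : ℝ) : ‖T t * (ℯ (-u * t) : ℂ)‖ ≤
    (Set.Ici (-R)).indicator (fun t => B * ℯ (-u * t)) t := by
  rw [norm_mul, Complex.norm_real, Real.norm_of_nonneg (Real.exp_pos _).le]
  by_cases h : -R ≤ t
  · rw [Set.indicator_of_mem (by exact h)]
    gcongr; exact hB t
  · rw [h0 t (not_le.1 h), Set.indicator_of_notMem (by exact h)]; simp
omit hT hB h0 hR in
lemma at_int_exp (B R : ℝ) {u : ℝ} (hu : 0 < u) :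
    Integrable ((Set.Ici (-R)).indicator (fun t => B * ℯ (-u * t))) := by
  rw [integrable_indicator_iff measurableSet_Ici, integrableOn_Ici_iff_integrableOn_Ioi]
  exact (exp_neg_integrableOn_Ioi _ hu).const_mul _
lemma at_integrable {u : ℝ} (hu : 0 < u) : Integrable (fun t => T t * (ℯ (-u * t) : ℂ)) :=
  (at_int_exp B R hu).mono' (by fun_prop) (Eventually.of_forall (at_dom hT hB h0 hR u))
lemma at_lip : ∃ D : ℝ, ∀ s ∈ Set.Icc (1:ℝ) 2, ∀ s' ∈ Set.Icc (1:ℝ) 2,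
    ‖(∫ t, T t * (ℯ (-s * t) : ℂ)) - ∫ t, T t * (ℯ (-s' * t) : ℂ)‖ ≤ D * |s - s'| := by
  have hB0 : 0 ≤ B := (norm_nonneg _).trans (hB 0)
  refine ⟨(2 + R * ℯ (2 * R)) * ∫ t, (Set.Ici (-R)).indicator (fun t => B * ℯ (-(1/2) * t)) t, ?_⟩
  intro s hs s' hs'
  rw [← integral_sub (at_integrable hT hB h0 hR (by linarith [hs.1])) (at_integrable hT hB h0 hR (by linarith [hs'.1]))]
  rw [mul_right_comm, ← integral_const_mul]
  refine norm_integral_le_of_norm_le ((at_int_exp B R (by norm_num)).const_mul _) (Eventually.of_forall fun t => ?_)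
  rw [← mul_sub, norm_mul, ← Complex.ofReal_sub, Complex.norm_real, Real.norm_eq_abs]
  by_cases h : -R ≤ t
  · rw [Set.indicator_of_mem (by exact h)]
    have := mul_le_mul (hB t) (at_exp_lip hR hs hs' h) (abs_nonneg _) hB0
    linarith
  · rw [h0 t (not_le.1 h), Set.indicator_of_notMem (by exact h)]; simp
end
lemma at_mellinC {ι : Type*} [Countable ι] {Ψ : ℝ → ℝ} (L : ι → ℝ) (c : ι → ℂ) (s : ℝ)
    (hc : ∀ i, ‖c i‖ ≤ 1) (hi : Integrable fun u => Ψ u * ℯ (-s * u))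
    (hs : Summable fun i => ℯ (-s * L i)) :
    ∫ t, (∑' i, c i * (Ψ (t - L i) : ℂ)) * (ℯ (-s * t) : ℂ) =
      (∑' i, c i * (ℯ (-s * L i) : ℂ)) * ((∫ u, Ψ u * ℯ (-s * u) : ℝ) : ℂ) := by
  simp_rw [← tsum_mul_right]
  have e : ∀ i, (fun t => c i * (Ψ (t - L i) : ℂ) * (ℯ (-s * t) : ℂ)) =
    fun t => (c i * (ℯ (-s * L i) : ℂ)) * ((Ψ (t - L i) * ℯ (-s * (t - L i)) : ℝ) : ℂ) := by
    intro i; ext t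
    have : ℯ (-s * t) = ℯ (-s * L i) * ℯ (-s * (t - L i)) := by
      rw [← Real.exp_add]; congr 1; ring
    rw [this]; push_cast; ring
  have hi' : ∀ i, Integrable (fun t => ((Ψ (t - L i) * ℯ (-s * (t - L i)) : ℝ) : ℂ)) := fun i =>
    (hi.comp_sub_right (L i)).ofReal
  have h1 : ∀ i, Integrable (fun t => c i * (Ψ (t - L i) : ℂ) * (ℯ (-s * t) : ℂ)) := by
    intro i; rw [e]; exact (hi' i).const_mul _
  have h2 : ∀ i, ∫ t, c i * (Ψ (t - L i) : ℂ) * (ℯ (-s * t) : ℂ) =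
      c i * (ℯ (-s * L i) : ℂ) * ((∫ u, Ψ u * ℯ (-s * u) : ℝ) : ℂ) := by
    intro i
    rw [e, integral_const_mul, integral_sub_right_eq_self (fun t => ((Ψ t * ℯ (-s * t) : ℝ) : ℂ)) (L i),
      integral_complex_ofReal]
  have h3 : ∀ i, ∫ t, ‖c i * (Ψ (t - L i) : ℂ) * (ℯ (-s * t) : ℂ)‖ =
      ‖c i‖ * ℯ (-s * L i) * ∫ t, ‖((Ψ t * ℯ (-s * t) : ℝ) : ℂ)‖ := by
    intro i
    simp_rw [fun t => congrFun (e i) t, norm_mul (c i * _)]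
    rw [integral_const_mul, integral_sub_right_eq_self (fun t => ‖((Ψ t * ℯ (-s * t) : ℝ) : ℂ)‖) (L i),
      norm_mul, Complex.norm_real, Real.norm_of_nonneg (Real.exp_pos _).le]
  rw [← integral_tsum_of_summable_integral_norm h1]
  · exact tsum_congr h2
  · simp_rw [h3]
    refine Summable.mul_right _ ?_
    refine Summable.of_nonneg_of_le (fun i => by positivity) (fun i => ?_) hs
    exact mul_le_of_le_one_left (Real.exp_pos _).le (hc i)
end AT2
section AT3
open MeasureTheory Filter Topology
variable {P Γ : Type*} [AddCommGroup Γ] {N : P → ℕ} {cl : P → Γ} {Φ : ℝ → ℝ} {κ M R : ℝ} [Fintype Γ]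
lemma ATd.M0 (H : ATd N cl Φ κ M R) : 0 ≤ M := (H.nonneg 0).trans (H.bdd 0)
lemma ATd.intΦ (H : ATd N cl Φ κ M R) (s : ℝ) : Integrable fun u => Φ u * ℯ (-s * u) := by
  refine Integrable.mono' (g := (Set.Icc (-R) R).indicator fun u => M * ℯ (-s * u)) ?_ ?_ ?_
  · rw [integrable_indicator_iff measurableSet_Icc]
    exact (by fun_prop : Continuous fun u => M * ℯ (-s * u)).continuousOn.integrableOn_Icc
  · have := H.meas; fun_prop
  · refine Eventually.of_forall fun t => ?_
    rw [norm_mul, Real.norm_of_nonneg (H.nonneg _), Real.norm_of_nonneg (Real.exp_pos _).le]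
    by_cases h : t ∈ Set.Icc (-R) R
    · rw [Set.indicator_of_mem h]; gcongr; exact H.bdd t
    · rw [Set.indicator_of_notMem h, H.supp t]
      · simp
      · rw [← not_le, abs_le]; exact h
def atH (Φ : ℝ → ℝ) (s : ℝ) : ℝ := ∫ u, Φ u * ℯ (-s * u)
lemma ATd.hatpos (H : ATd N cl Φ κ M R) (s : ℝ) : 0 < atH Φ s := by
  have h0 : ∀ u, 0 ≤ Φ u * ℯ (-s * u) := fun u => mul_nonneg (H.nonneg u) (Real.exp_pos _).le
  rw [atH, integral_pos_iff_support_of_nonneg h0 (H.intΦ s)]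
  have hi : Integrable Φ := by simpa using H.intΦ 0
  have := H.pos
  rw [integral_pos_iff_support_of_nonneg H.nonneg hi] at this
  convert this using 2
  ext u; simp [Real.exp_ne_zero]
lemma ATd.hatcont (H : ATd N cl Φ κ M R) : ∃ D : ℝ, ∀ s ∈ Set.Icc (1:ℝ) 2, ∀ s' ∈ Set.Icc (1:ℝ) 2,
    |atH Φ s - atH Φ s'| ≤ D * |s - s'| := by
  obtain ⟨D, hD⟩ := at_lip (T := fun t => (Φ t : ℂ)) (B := M) (R := R) (by have := H.meas; fun_prop)
    (fun t => by rw [Complex.norm_real, Real.norm_of_nonneg (H.nonneg _)]; exact H.bdd t)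
    (fun t ht => by rw [H.supp t (by rw [lt_abs]; right; linarith)]; simp) H.Rpos
  refine ⟨D, fun s hs s' hs' => ?_⟩
  have := hD s hs s' hs'
  simp_rw [← Complex.ofReal_mul, integral_complex_ofReal, ← Complex.ofReal_sub, Complex.norm_real] at this
  exact this
lemma ATd.hatbd (H : ATd N cl Φ κ M R) : ∃ δ > 0, ∃ D, ∀ s ∈ Set.Icc (1:ℝ) 2, δ ≤ atH Φ s ∧ atH Φ s ≤ D := by
  obtain ⟨D, hD⟩ := H.hatcont
  have hc : ContinuousOn (atH Φ) (Set.Icc 1 2) := by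
    have hl : LipschitzOnWith D.toNNReal (atH Φ) (Set.Icc 1 2) := by
      refine LipschitzOnWith.of_dist_le_mul fun s hs s' hs' => ?_
      rw [Real.dist_eq, Real.dist_eq]
      exact (hD s hs s' hs').trans (by gcongr; exact Real.le_coe_toNNReal D)
    exact hl.continuousOn
  obtain ⟨x, hx, hmin⟩ := isCompact_Icc.exists_isMinOn (⟨1, by norm_num⟩ : (Set.Icc (1:ℝ) 2).Nonempty) hc
  obtain ⟨z, hz, hmax⟩ := isCompact_Icc.exists_isMaxOn (⟨1, by norm_num⟩ : (Set.Icc (1:ℝ) 2).Nonempty) hc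
  exact ⟨atH Φ x, H.hatpos x, atH Φ z, fun s hs => ⟨hmin hs, hmax hs⟩⟩
def atZ (N : P → ℕ) (Φ : ℝ → ℝ) (t : ℝ) : ℝ := ∑' I, Φ (t - atL N I)
lemma atT_one (t : ℝ) : atT N Φ (fun _ => 1) t = (atZ N Φ t : ℂ) := by
  simp [atT, atZ, Complex.ofReal_tsum]
lemma ATd.summ (H : ATd N cl Φ κ M R) (t : ℝ) : Summable fun I => Φ (t - atL N I) :=
  summable_of_ne_finset_zero (s := atS H (t + R)) fun I hI => at_zero H le_rfl hI
lemma ATd.Z_est (H : ATd N cl Φ κ M R) (t : ℝ) :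
    |atZ N Φ t - κ * Fintype.card Γ * ℯ t| ≤ M * Fintype.card Γ := by
  have := at_main_sum H (fun _ => 1) t
  rw [atT_one] at this
  simp only [Finset.sum_const, Finset.card_univ, nsmul_eq_mul, mul_one, norm_one] at this
  rw [← Real.norm_eq_abs, ← Complex.norm_real]; push_cast
  convert this using 2
  push_cast; ring
lemma ATd.Z_nonneg (H : ATd N cl Φ κ M R) (t : ℝ) : 0 ≤ atZ N Φ t := tsum_nonneg fun _ => H.nonneg _
lemma ATd.Z_zero (H : ATd N cl Φ κ M R) {t : ℝ} (ht : t < -R) : atZ N Φ t = 0 := by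
  unfold atZ; simp [at_zero' H ht]
lemma ATd.melZ (H : ATd N cl Φ κ M R) (s : ℝ) :
    ∫⁻ t, ENNReal.ofReal (atZ N Φ t * ℯ (-s * t)) =
      (∑' I : P →₀ ℕ, ENNReal.ofReal (ℯ (-s * atL N I))) * ENNReal.ofReal (atH Φ s) := by
  have : Countable P := at_countable H.fin
  have h := at_mellinE H.meas H.nonneg (atL N) (fun _ => 1) (by simp) s
  simp only [one_mul] at h
  rw [atH, ofReal_integral_eq_lintegral_ofReal (H.intΦ s)
    (Eventually.of_forall fun u => mul_nonneg (H.nonneg u) (Real.exp_pos _).le), ← h]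
  refine lintegral_congr fun t => ?_
  rw [ENNReal.ofReal_mul (H.Z_nonneg t), atZ, ENNReal.ofReal_tsum_of_nonneg (fun _ => H.nonneg _) (H.summ t)]
lemma ATd.Z_bound (H : ATd N cl Φ κ M R) (s t : ℝ) : atZ N Φ t * ℯ (-s * t) ≤
    (Set.Ici (-R)).indicator (fun t => (κ * Fintype.card Γ) * ℯ (-(s-1) * t)) t +
    (Set.Ici (-R)).indicator (fun t => (M * Fintype.card Γ) * ℯ (-s * t)) t := by
  by_cases h : -R ≤ t
  · rw [Set.indicator_of_mem (by exact h), Set.indicator_of_mem (by exact h)]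
    have := (abs_sub_le_iff.1 (H.Z_est t)).1
    have e : ℯ (-(s-1) * t) = ℯ t * ℯ (-s * t) := by
      rw [← Real.exp_add]; congr 1; ring
    rw [e]
    nlinarith [Real.exp_pos (-s * t)]
  · rw [H.Z_zero (not_le.1 h), Set.indicator_of_notMem (by exact h), Set.indicator_of_notMem (by exact h)]; simp
lemma ATd.summable (H : ATd N cl Φ κ M R) {s : ℝ} (hs : 1 < s) :
    Summable fun I : P →₀ ℕ => ℯ (-s * atL N I) := by
  have h1 : ∫⁻ t, ENNReal.ofReal (atZ N Φ t * ℯ (-s * t)) ≠ ⊤ := by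
    refine ne_top_of_le_ne_top ?_ (lintegral_mono fun t => ENNReal.ofReal_le_ofReal (H.Z_bound s t))
    have := ((at_int_exp (κ * Fintype.card Γ) R (by linarith : 0 < s - 1)).add
      (at_int_exp (M * Fintype.card Γ) R (by linarith : 0 < s)))
    exact this.lintegral_lt_top.ne
  rw [H.melZ] at h1
  have h2 : (∑' I : P →₀ ℕ, ENNReal.ofReal (ℯ (-s * atL N I))) ≠ ⊤ := by
    intro h; rw [h, ENNReal.top_mul] at h1
    · exact h1 rfl
    · simpa using H.hatpos s
  have := ENNReal.summable_toReal h2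
  simpa [ENNReal.toReal_ofReal (Real.exp_pos _).le] using this
def atz (N : P → ℕ) (s : ℝ) : ℝ := ∑' I : P →₀ ℕ, ℯ (-s * atL N I)
lemma ATd.melZ' (H : ATd N cl Φ κ M R) {s : ℝ} (hs : 1 < s) :
    Integrable (fun t => atZ N Φ t * ℯ (-s * t)) ∧
    ∫ t, atZ N Φ t * ℯ (-s * t) = atz N s * atH Φ s := by
  have hm : Measurable (atZ N Φ) := by
    have := Complex.measurable_re.comp (atT_meas H (fun _ => 1))
    convert this using 1
    ext t; simp [atT_one]
  have hn : ∀ t, 0 ≤ atZ N Φ t * ℯ (-s * t) := fun t => mul_nonneg (H.Z_nonneg t) (Real.exp_pos _).le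
  have hz : 0 ≤ atz N s := tsum_nonneg fun _ => (Real.exp_pos _).le
  have h := H.melZ s
  rw [← ENNReal.ofReal_tsum_of_nonneg (fun _ => (Real.exp_pos _).le) (H.summable hs), ← atz,
    ← ENNReal.ofReal_mul hz] at h
  have hi : Integrable (fun t => atZ N Φ t * ℯ (-s * t)) := by
    refine ⟨by fun_prop, ?_⟩
    rw [hasFiniteIntegral_iff_ofReal (Eventually.of_forall hn), h]; exact ENNReal.ofReal_lt_top
  refine ⟨hi, ?_⟩
  rw [integral_eq_lintegral_of_nonneg_ae (Eventually.of_forall hn) hi.1, h,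
    ENNReal.toReal_ofReal (mul_nonneg hz (H.hatpos s).le)]
lemma ATd.z_le (H : ATd N cl Φ κ M R) : ∃ C, 0 < C ∧ ∀ s, 1 < s → s ≤ 2 → atz N s ≤ C / (s - 1) := by
  obtain ⟨δ, hδ, D, hD⟩ := H.hatbd
  have hh : (0:ℝ) ≤ Fintype.card Γ := by positivity
  set A := κ * Fintype.card Γ with hA
  set B := M * Fintype.card Γ with hB
  have hA0 : 0 ≤ A := mul_nonneg H.κpos.le hh
  have hB0 : 0 ≤ B := mul_nonneg H.M0 hh
  refine ⟨(A * ℯ R + B * ℯ (2*R)) / δ + 1, by positivity, fun s hs hs2 => ?_⟩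
  have h1 := (H.melZ' hs).2
  have hI : ∀ (C u : ℝ), 0 < u → ∫ t, (Set.Ici (-R)).indicator (fun t => C * ℯ (-u * t)) t = C * (ℯ (u * R) / u) := by
    intro C u hu
    rw [integral_indicator measurableSet_Ici, integral_Ici_eq_integral_Ioi, integral_const_mul]
    rw [integral_exp_mul_Ioi (by linarith)]
    congr 1
    rw [neg_mul_neg, div_neg, neg_div, neg_neg]
  have i1 := at_int_exp A R (by linarith : 0 < s - 1)
  have i2 := at_int_exp B R (by linarith : 0 < s)
  have h2 : ∫ t, atZ N Φ t * ℯ (-s * t) ≤ A * (ℯ ((s-1) * R) / (s-1)) + B * (ℯ (s * R) / s) := by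
    rw [← hI A (s-1) (by linarith), ← hI B s (by linarith), ← integral_add i1 i2]
    exact integral_mono (H.melZ' hs).1 (i1.add i2) fun t => H.Z_bound s t
  rw [h1] at h2
  have hR := H.Rpos
  have h3 : A * (ℯ ((s-1) * R) / (s-1)) ≤ A * ℯ R / (s-1) := by
    rw [mul_div_assoc]
    have : ℯ ((s-1) * R) ≤ ℯ R := Real.exp_le_exp.2 (by nlinarith)
    gcongr
  have h4 : B * (ℯ (s * R) / s) ≤ B * ℯ (2 * R) / (s-1) := by
    rw [mul_div_assoc]
    gcongr <;> linarith
  have hd := (hD s ⟨hs.le, hs2⟩).1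
  have hz : 0 ≤ atz N s := tsum_nonneg fun _ => (Real.exp_pos _).le
  have h5 : atz N s * δ ≤ (A * ℯ R + B * ℯ (2*R)) / (s-1) := by
    rw [add_div]
    nlinarith
  have h6 : 0 < s - 1 := by linarith
  rw [le_div_iff₀ h6]
  rw [le_div_iff₀ h6] at h5
  have : atz N s * (s-1) ≤ (A * ℯ R + B * ℯ (2*R)) / δ := by
    rw [le_div_iff₀ hδ]; linarith
  linarith
lemma ATd.not_summable (H : ATd N cl Φ κ M R) :
    ¬ Summable fun I : P →₀ ℕ => ℯ (- atL N I) := by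
  intro hs
  have h := H.melZ 1
  have hs' : Summable fun I : P →₀ ℕ => ℯ (-1 * atL N I) := by simpa using hs
  rw [← ENNReal.ofReal_tsum_of_nonneg (fun _ => (Real.exp_pos _).le) hs',
    ← ENNReal.ofReal_mul (tsum_nonneg fun _ => (Real.exp_pos _).le)] at h
  set A := κ * Fintype.card Γ with hA
  set B := M * Fintype.card Γ with hB
  have hc : (0:ℝ) < Fintype.card Γ := by exact_mod_cast Fintype.card_pos
  have hA0 : 0 < A := mul_pos H.κpos hc
  obtain ⟨t0, ht0⟩ : ∃ t0 : ℝ, ∀ t ≥ t0, A / 2 ≤ atZ N Φ t * ℯ (-1 * t) := by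
    refine ⟨Real.log (2 * B / A + 1), fun t ht => ?_⟩
    have hB0 : 0 ≤ B := mul_nonneg H.M0 hc.le
    have h1 := (abs_sub_le_iff.1 (H.Z_est t)).2
    have h2 : 2 * B / A + 1 ≤ ℯ t := by
      rw [← Real.exp_log (by positivity : 0 < 2 * B / A + 1)]; exact Real.exp_le_exp.2 ht
    have h3 : 2 * B ≤ A * ℯ t := by
      have : 2 * B / A ≤ ℯ t := by linarith
      rw [div_le_iff₀ hA0] at this; linarith
    have h4 : A / 2 * ℯ t ≤ atZ N Φ t := by linarith
    have h5 : ℯ t * ℯ (-1 * t) = 1 := by rw [← Real.exp_add]; simp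
    have := mul_le_mul_of_nonneg_right h4 (Real.exp_pos (-1 * t)).le
    rw [mul_assoc, h5] at this; linarith
  have h6 : ∫⁻ t in Set.Ici t0, ENNReal.ofReal (A/2) ≤ ∫⁻ t, ENNReal.ofReal (atZ N Φ t * ℯ (-1 * t)) := by
    refine le_trans ?_ (setLIntegral_le_lintegral (Set.Ici t0) _)
    exact setLIntegral_mono' measurableSet_Ici fun t ht => ENNReal.ofReal_le_ofReal (ht0 t ht)
  rw [h] at h6
  rw [setLIntegral_const, Real.volume_Ici, ENNReal.mul_top] at h6
  · simp at h6
  · simp [hA0]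
end AT3
section AT4
open MeasureTheory Filter Topology
lemma at_euler {P : Type*} (f : P → ℂ) (hf : ∀ p, ‖f p‖ ≤ 1/2)
    (hs : Summable fun I : P →₀ ℕ => ‖I.prod fun p n => f p ^ n‖) :
    (∑' I : P →₀ ℕ, I.prod fun p n => f p ^ n) = Complex.exp (∑' p, - Complex.log (1 - f p)) := by
  set F : (P →₀ ℕ) → ℂ := fun I => I.prod fun p n => f p ^ n with hF
  have hFadd : ∀ I J, F (I + J) = F I * F J := fun I J =>
    Finsupp.prod_add_index' (by simp) (by intros; rw [pow_add])
  have hF1 : ∀ p, F (Finsupp.single p 1) = f p := fun p => by simp [hF]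
  have hFs : Summable F := hs.of_norm
  have hp : Summable fun p => ‖f p‖ := by
    have := hs.comp_injective (Finsupp.single_left_injective (α := P) (b := (1:ℕ)) one_ne_zero)
    refine this.congr fun p => ?_
    show ‖F (Finsupp.single p 1)‖ = _
    rw [hF1 p]
  have hl : Summable fun p => Complex.log (1 - f p) := by
    refine Summable.of_norm (Summable.of_nonneg_of_le (fun _ => norm_nonneg _) (fun p => ?_) (hp.mul_left (3/2)))
    rw [sub_eq_add_neg]
    simpa using Complex.norm_log_one_add_half_le_self (z := - f p) (by simpa using hf p)
  let G : Finset P → ℂ := fun S => ∑' I, if Disjoint I.support S then F I else 0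
  have hGs : ∀ S : Finset P, Summable fun I => if Disjoint I.support S then F I else 0 := fun S =>
    Summable.of_norm (Summable.of_nonneg_of_le (fun _ => norm_nonneg _) (fun I => by
      show _ ≤ ‖F I‖
      split_ifs
      · exact le_rfl
      · rw [norm_zero]; exact norm_nonneg _) hs)
  have hG : ∀ S : Finset P, (∑' I, F I) * ∏ p ∈ S, (1 - f p) = G S := by
    intro S
    induction S using Finset.induction_on with
    | empty => simp [G]
    | insert p S hpS ih =>
      rw [Finset.prod_insert hpS, mul_left_comm, ih, sub_mul, one_mul]
      have inj : Function.Injective fun I : P →₀ ℕ => I + Finsupp.single p 1 := add_left_injective _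
      let g : (P →₀ ℕ) → ℂ := fun I => if Disjoint I.support S ∧ I p ≠ 0 then F I else 0
      have e1 : f p * G S = ∑' I, g I := by
        have hsup : Function.support g ⊆ Set.range fun I : P →₀ ℕ => I + Finsupp.single p 1 := by
          intro I hI
          have : I p ≠ 0 := by
            by_contra h; apply hI; simp [g, h]
          refine ⟨I - Finsupp.single p 1, ?_⟩
          refine tsub_add_cancel_of_le ?_
          rw [Finsupp.single_le_iff]; omega
        rw [← inj.tsum_eq hsup, ← tsum_mul_left]
        refine tsum_congr fun I => ?_
        simp only [g]
        have : Disjoint (I + Finsupp.single p 1).support S ↔ Disjoint I.support S := by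
          rw [Finset.disjoint_left, Finset.disjoint_left]
          constructor
          · intro h q hq; apply h; simp only [Finsupp.mem_support_iff, Finsupp.add_apply] at hq ⊢; omega
          · intro h q hq hqS
            have hqp : q ≠ p := by rintro rfl; exact hpS hqS
            refine h ?_ hqS
            simpa [Finsupp.single_apply, hqp.symm] using hq
        have h2 : ((I + Finsupp.single p 1 : P →₀ ℕ) : P → ℕ) p ≠ 0 := by simp
        simp only [this, h2, ne_eq, not_false_eq_true, and_true]
        split_ifs
        · rw [hFadd, hF1, mul_comm]
        · simp
      have hgs : Summable g :=
        Summable.of_norm (Summable.of_nonneg_of_le (fun _ => norm_nonneg _) (fun I => by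
          show _ ≤ ‖F I‖
          simp only [g]; split_ifs
          · exact le_rfl
          · rw [norm_zero]; exact norm_nonneg _) hs)
      rw [e1]
      simp only [G]
      rw [← (hGs S).tsum_sub hgs]
      refine tsum_congr fun I => ?_
      simp only [g, Finset.disjoint_insert_right, Finsupp.mem_support_iff, ne_eq, not_not]
      by_cases h1 : Disjoint I.support S <;> by_cases h2 : I p = 0 <;> simp [h1, h2]
  have ht1 : Tendsto G atTop (𝓝 1) := by
    have : (1:ℂ) = ∑' I : P →₀ ℕ, if I = 0 then F 0 else 0 := by rw [tsum_ite_eq]; simp [hF]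
    rw [this]
    refine tendsto_tsum_of_dominated_convergence hs (fun I => ?_) (Eventually.of_forall fun S I => ?_)
    · refine tendsto_const_nhds.congr' ?_
      filter_upwards [eventually_ge_atTop I.support] with S hS
      by_cases h : I = 0
      · simp [h]
      · rw [if_neg h, if_neg]
        intro hd
        have := hd.eq_bot_of_le hS
        simp at this; exact h this
    · split_ifs <;> simp [hF]
  have ht2 : Tendsto (fun S : Finset P => (∑' I, F I) * ∏ p ∈ S, (1 - f p)) atTop
      (𝓝 ((∑' I, F I) * Complex.exp (∑' p, Complex.log (1 - f p)))) := by
    refine Tendsto.const_mul _ ?_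
    have := (Complex.continuous_exp.tendsto _).comp hl.hasSum
    refine this.congr fun S => ?_
    simp only [Function.comp]
    rw [Complex.exp_sum]
    refine Finset.prod_congr rfl fun p _ => Complex.exp_log ?_
    intro h
    have h3 : f p = 1 := by linear_combination -h
    have := hf p; rw [h3] at this; norm_num at this
  simp_rw [hG] at ht2
  have := tendsto_nhds_unique ht2 ht1
  rw [tsum_neg, Complex.exp_neg]
  exact eq_inv_of_mul_eq_one_left this
variable {P Γ : Type*} [AddCommGroup Γ] {N : P → ℕ} {cl : P → Γ} {Φ : ℝ → ℝ} {κ M R : ℝ} [Fintype Γ]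
def atq (N : P → ℕ) (s : ℝ) (p : P) : ℝ := ℯ (-s * Real.log (N p))
def atLf (N : P → ℕ) (cl : P → Γ) (χ : AddChar Γ ℂ) (s : ℝ) : ℂ :=
  ∑' I : P →₀ ℕ, χ (atC cl I) * (ℯ (-s * atL N I) : ℂ)
def atell (N : P → ℕ) (cl : P → Γ) (χ : AddChar Γ ℂ) (s : ℝ) : ℂ :=
  ∑' p, - Complex.log (1 - χ (cl p) * (atq N s p : ℂ))
lemma at_norm (χ : AddChar Γ ℂ) (g : Γ) : ‖χ g‖ = 1 := AddChar.norm_apply χ g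
lemma atq_pos (s : ℝ) (p : P) : 0 < atq N s p := Real.exp_pos _
lemma ATd.q_le (H : ATd N cl Φ κ M R) {s : ℝ} (hs : 1 ≤ s) (p : P) : atq N s p ≤ 1/2 := by
  have h := at_log2 H.two p
  have h2 : 0 < Real.log 2 := Real.log_pos (by norm_num)
  rw [atq, show (1/2:ℝ) = ℯ (-Real.log 2) by rw [Real.exp_neg, Real.exp_log]; norm_num; norm_num]
  apply Real.exp_le_exp.2; nlinarith
lemma atq_anti {s s' : ℝ} (h : s ≤ s') (p : P) : atq N s' p ≤ atq N s p := by
  unfold atq; apply Real.exp_le_exp.2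
  nlinarith [Real.log_natCast_nonneg (N p)]
lemma ATd.z_norm (H : ATd N cl Φ κ M R) (χ : AddChar Γ ℂ) (s : ℝ) (p : P) :
    ‖χ (cl p) * (atq N s p : ℂ)‖ = atq N s p := by
  rw [norm_mul, at_norm, one_mul, Complex.norm_real, Real.norm_of_nonneg (atq_pos s p).le]
lemma at_term (χ : AddChar Γ ℂ) (s : ℝ) (I : P →₀ ℕ) : χ (atC cl I) * (ℯ (-s * atL N I) : ℂ) =
    I.prod fun p n => (χ (cl p) * (atq N s p : ℂ)) ^ n := by
  induction I using Finsupp.induction_linear with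
  | zero => simp [atC_zero, atL_zero]
  | add I J hI hJ =>
    rw [Finsupp.prod_add_index' (by simp) (by intros; rw [pow_add]), ← hI, ← hJ, atC_add, atL_add,
      AddChar.map_add_eq_mul, mul_add, Real.exp_add]; push_cast; ring
  | single p n =>
    rw [Finsupp.prod_single_index (by simp), atC_single, atL_single, AddChar.map_nsmul_eq_pow, mul_pow, atq,
      ← Complex.ofReal_pow, ← Real.exp_nat_mul]
    congr 3; ring
lemma ATd.qsum (H : ATd N cl Φ κ M R) {s : ℝ} (hs : 1 < s) : Summable (atq N s) := by
  have := (H.summable hs).comp_injective (Finsupp.single_left_injective (α := P) (b := (1:ℕ)) one_ne_zero)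
  refine this.congr fun p => ?_
  show ℯ (-s * atL N (Finsupp.single p 1)) = _
  simp [atq, atL_single]
lemma ATd.euler (H : ATd N cl Φ κ M R) (χ : AddChar Γ ℂ) {s : ℝ} (hs : 1 < s) :
    atLf N cl χ s = Complex.exp (atell N cl χ s) := by
  unfold atLf atell
  rw [tsum_congr (fun I => at_term χ s I)]
  refine at_euler _ (fun p => ?_) ?_
  · rw [H.z_norm]; exact H.q_le hs.le p
  · refine (H.summable hs).congr fun I => ?_
    rw [← at_term, norm_mul, at_norm, one_mul, Complex.norm_real, Real.norm_of_nonneg (Real.exp_pos _).le]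
lemma ATd.ell_est (H : ATd N cl Φ κ M R) : ∃ C, ∀ (γ : Γ) (s : ℝ), 1 < s →
    ‖(∑ χ : AddChar Γ ℂ, χ (-γ) * atell N cl χ s) -
      ((Fintype.card Γ * ∑' p, if cl p = γ then atq N s p else 0 : ℝ) : ℂ)‖ ≤ C := by
  have h2 := H.qsum (s := 2) (by norm_num)
  refine ⟨∑ χ : AddChar Γ ℂ, ∑' p, atq N 2 p, fun γ s hs => ?_⟩
  have hq := H.qsum hs
  have hz : ∀ χ : AddChar Γ ℂ, Summable fun p => χ (cl p) * (atq N s p : ℂ) := fun χ =>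
    Summable.of_norm (by simp_rw [H.z_norm]; exact hq)
  have hb : ∀ (χ : AddChar Γ ℂ) p, ‖- Complex.log (1 - χ (cl p) * (atq N s p : ℂ)) - χ (cl p) * (atq N s p : ℂ)‖ ≤ atq N 2 p := by
    intro χ p
    set z := χ (cl p) * (atq N s p : ℂ)
    have hn : ‖-z‖ = atq N s p := by rw [norm_neg]; exact H.z_norm χ s p
    have h1 := H.q_le hs.le p
    have h := Complex.norm_log_one_add_sub_self_le (z := -z) (by rw [hn]; linarith)
    rw [hn] at h
    have e : -Complex.log (1 - z) - z = -(Complex.log (1 + -z) - -z) := by rw [sub_eq_add_neg 1 z]; ring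
    rw [e, norm_neg]
    refine h.trans ?_
    have h3 : (1 - atq N s p)⁻¹ ≤ 2 := by
      rw [inv_le_comm₀ (by linarith) (by norm_num)]; linarith
    have h4 : atq N s p ^ 2 ≤ atq N 2 p := by
      have := atq_anti (N := N) hs.le p
      calc atq N s p ^ 2 ≤ atq N 1 p ^ 2 := by gcongr; exact (atq_pos s p).le
        _ = atq N 2 p := by unfold atq; rw [← Real.exp_nat_mul]; congr 1; push_cast; ring
    have h5 : 0 ≤ (1 - atq N s p)⁻¹ := by rw [inv_nonneg]; linarith
    nlinarith [sq_nonneg (atq N s p)]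
  have hbs : ∀ χ : AddChar Γ ℂ, Summable fun p => - Complex.log (1 - χ (cl p) * (atq N s p : ℂ)) - χ (cl p) * (atq N s p : ℂ) :=
    fun χ => Summable.of_norm_bounded h2 (hb χ)
  have e1 : ∀ χ : AddChar Γ ℂ, atell N cl χ s = (∑' p, χ (cl p) * (atq N s p : ℂ)) +
      ∑' p, (- Complex.log (1 - χ (cl p) * (atq N s p : ℂ)) - χ (cl p) * (atq N s p : ℂ)) := by
    intro χ
    rw [← (hz χ).tsum_add (hbs χ)]
    exact tsum_congr fun p => by ring
  have e2 : (∑ χ : AddChar Γ ℂ, χ (-γ) * ∑' p, χ (cl p) * (atq N s p : ℂ)) =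
      ((Fintype.card Γ * ∑' p, if cl p = γ then atq N s p else 0 : ℝ) : ℂ) := by
    simp_rw [← tsum_mul_left]
    rw [← Summable.tsum_finsetSum (fun χ _ => (hz χ).mul_left _)]
    push_cast
    refine tsum_congr fun p => ?_
    have := AddChar.sum_apply_eq_ite (α := Γ) (-γ + cl p)
    simp_rw [AddChar.map_add_eq_mul] at this
    simp_rw [← mul_assoc]
    rw [← Finset.sum_mul, this]
    by_cases h : cl p = γ
    · simp [h]
    · rw [if_neg h, if_neg]
      · simp
      · intro h'; apply h; rw [neg_add_eq_zero] at h'; exact h'.symm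
  simp_rw [e1, mul_add]
  rw [Finset.sum_add_distrib, e2, add_sub_cancel_left]
  refine (norm_sum_le _ _).trans (Finset.sum_le_sum fun χ _ => ?_)
  rw [norm_mul, at_norm, one_mul]
  refine tsum_of_norm_bounded h2.hasSum (hb χ)
end AT4
section AT5
open MeasureTheory Filter Topology
lemma at_r {P : Type*} (f : (P →₀ ℕ) → ℝ) (hf : ∀ I J, f (I + J) = f I * f J) (h1 : ∀ I, f I = 1 ∨ f I = -1)
    (K : P →₀ ℕ) : 0 ≤ ∑ I ∈ Finset.Iic K, f I ∧ ((∀ p, Even (K p)) → 1 ≤ ∑ I ∈ Finset.Iic K, f I) := by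
  have h0 : f 0 = 1 := by
    have := hf 0 0; rw [add_zero] at this
    rcases h1 0 with h | h <;> rw [h] at this ⊢; norm_num at this
  induction K using Finsupp.induction with
  | zero =>
    have : Finset.Iic (0 : P →₀ ℕ) = {0} := by ext I; simp
    simp [this, h0]
  | single_add p n K hp hn ih =>
    have hKp : K p = 0 := by simpa using hp
    have e : ∑ I ∈ Finset.Iic (Finsupp.single p n + K), f I =
        (∑ j ∈ Finset.range (n+1), f (Finsupp.single p j)) * ∑ I ∈ Finset.Iic K, f I := by
      rw [Finset.sum_mul_sum, ← Finset.sum_product']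
      refine Finset.sum_nbij' (fun I => (I p, I.erase p)) (fun x => Finsupp.single p x.1 + x.2) ?_ ?_ ?_ ?_ ?_
      · intro I hI
        rw [Finset.mem_Iic] at hI
        have h2 := hI p
        simp only [Finset.mem_product, Finset.mem_range, Finset.mem_Iic]
        simp [hKp] at h2
        refine ⟨by omega, fun q => ?_⟩
        have h3 := hI q
        by_cases hq : q = p
        · simp [hq]
        · rw [Finsupp.erase_ne hq]; simpa [Finsupp.single_apply, Ne.symm hq] using h3
      · rintro ⟨j, I⟩ h
        simp only [Finset.mem_product, Finset.mem_range, Finset.mem_Iic] at h ⊢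
        refine add_le_add ?_ h.2
        rw [Finsupp.single_le_iff]; simp; omega
      · intro I _; exact Finsupp.single_add_erase p I
      · rintro ⟨j, I⟩ h
        simp only [Finset.mem_product, Finset.mem_range, Finset.mem_Iic] at h ⊢
        have h2 : I p = 0 := by have := h.2 p; omega
        refine Prod.ext (by simp [h2]) ?_
        ext q
        by_cases hq : q = p
        · simp [hq, h2]
        · simp [Finsupp.erase_ne hq, Finsupp.single_apply, Ne.symm hq]
      · intro I _
        rw [← hf]; simp only; rw [Finsupp.single_add_erase]
    have hg : ∀ n : ℕ, 0 ≤ (∑ j ∈ Finset.range (n+1), f (Finsupp.single p j)) ∧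
        (Even n → 1 ≤ (∑ j ∈ Finset.range (n+1), f (Finsupp.single p j))) := by
      have hpow : ∀ j, f (Finsupp.single p j) = f (Finsupp.single p 1) ^ j := by
        intro j; induction j with
        | zero => rw [Finsupp.single_zero, h0, pow_zero]
        | succ j ih => rw [Finsupp.single_add, hf, ih, pow_succ]
      intro n
      rw [Finset.sum_congr rfl fun j _ => hpow j]
      rcases h1 (Finsupp.single p 1) with h | h <;> rw [h]
      · simp; positivity
      · rw [neg_one_geom_sum]
        constructor
        · split_ifs <;> norm_num
        · intro hn; rw [if_neg]; rw [Nat.not_even_iff_odd]; exact hn.add_one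
    rw [e]
    refine ⟨mul_nonneg (hg n).1 ih.1, fun hev => ?_⟩
    have a1 := (hg n).2 (by simpa [hKp] using hev p)
    have a2 := ih.2 (fun q => by
      by_cases hq : q = p
      · simp [hq, hKp]
      · simpa [Finsupp.single_apply, Ne.symm hq] using hev q)
    nlinarith
variable {P Γ : Type*} [AddCommGroup Γ] {N : P → ℕ} {cl : P → Γ} {Φ : ℝ → ℝ} {κ M R : ℝ}
def atΨ (Φ : ℝ → ℝ) (y : ℝ) : ℝ := ∫ w, Φ w * Φ (y - w)
lemma ATd.intΦ0 [Fintype Γ] (H : ATd N cl Φ κ M R) : Integrable Φ := by simpa using H.intΦ 0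
lemma ATd.Ψmeas [Fintype Γ] (H : ATd N cl Φ κ M R) : Measurable (atΨ Φ) := by
  have hm := H.meas
  have : StronglyMeasurable (Function.uncurry fun y w => Φ w * Φ (y - w)) := by
    apply Measurable.stronglyMeasurable; unfold Function.uncurry; fun_prop
  exact this.integral_prod_right.measurable
lemma ATd.Ψnonneg [Fintype Γ] (H : ATd N cl Φ κ M R) (y : ℝ) : 0 ≤ atΨ Φ y :=
  integral_nonneg fun w => mul_nonneg (H.nonneg _) (H.nonneg _)
lemma ATd.Ψsupp [Fintype Γ] (H : ATd N cl Φ κ M R) {y : ℝ} (hy : 2 * R < |y|) : atΨ Φ y = 0 := by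
  unfold atΨ
  have : ∀ w, Φ w * Φ (y - w) = 0 := by
    intro w
    by_cases h : R < |w|
    · rw [H.supp w h, zero_mul]
    · rw [H.supp (y - w), mul_zero]
      have := abs_sub_abs_le_abs_sub y w
      linarith
  simp [this]
lemma ATd.Ψint [Fintype Γ] (H : ATd N cl Φ κ M R) : ∫ y, atΨ Φ y = (∫ t, Φ t) ^ 2 := by
  have := integral_convolution (ContinuousLinearMap.mul ℝ ℝ) (μ := volume) (ν := volume) H.intΦ0 H.intΦ0
  simp only [ContinuousLinearMap.mul_apply'] at this
  rw [sq, ← this]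
  rfl
lemma ATd.prodInt [Fintype Γ] (H : ATd N cl Φ κ M R) (a b : ℝ) : Integrable fun w => Φ (w - a) * Φ (b - w) := by
  have h1 : Integrable fun w => Φ (w - a) := H.intΦ0.comp_sub_right a
  refine h1.mul_bdd (c := M) ?_ ?_
  · have := H.meas
    exact (by fun_prop : Measurable fun w => Φ (b - w)).aestronglyMeasurable
  · exact Eventually.of_forall fun w => by rw [Real.norm_of_nonneg (H.nonneg _)]; exact H.bdd _
lemma ATd.prodΨ [Fintype Γ] (H : ATd N cl Φ κ M R) (a b : ℝ) : ∫ w, Φ (w - a) * Φ (b - w) = atΨ Φ (b - a) := by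
  unfold atΨ
  rw [← integral_sub_right_eq_self (fun w => Φ w * Φ (b - a - w)) a]
  congr 1; ext w; congr 2; ring
lemma ATd.S2 [Fintype Γ] (H : ATd N cl Φ κ M R) (f : (P →₀ ℕ) → ℝ) (x : ℝ) :
    (∫ w, atT N Φ (fun I => (f I : ℂ)) w * (atZ N Φ (x - w) : ℂ)) =
     ((∑ K ∈ atS H (x + 2 * R), (∑ I ∈ Finset.Iic K, f I) * atΨ Φ (x - atL N K) : ℝ) : ℂ) := by
  set S := atS H (x + 2 * R) with hS
  have e1 : ∀ w, atT N Φ (fun I => (f I : ℂ)) w * (atZ N Φ (x - w) : ℂ) =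
      ((∑ I ∈ S, ∑ J ∈ S, f I * (Φ (w - atL N I) * Φ (x - atL N J - w)) : ℝ) : ℂ) := by
    intro w
    have hz : ∀ w, x - w + R ≤ x + 2 * R → atZ N Φ (x - w) = ∑ J ∈ S, Φ (x - w - atL N J) := fun w hw =>
      tsum_eq_sum fun I hI => at_zero H hw hI
    have e2 : ((∑ I ∈ S, ∑ J ∈ S, f I * (Φ (w - atL N I) * Φ (x - atL N J - w)) : ℝ) : ℂ) =
        (∑ I ∈ S, (f I : ℂ) * (Φ (w - atL N I) : ℂ)) * ((∑ J ∈ S, Φ (x - w - atL N J) : ℝ) : ℂ) := by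
      push_cast
      rw [Finset.sum_mul_sum]
      refine Finset.sum_congr rfl fun I _ => Finset.sum_congr rfl fun J _ => ?_
      rw [sub_right_comm x w]; ring
    rw [e2]
    by_cases h1 : w < -R
    · rw [atT_zero H _ h1]; simp [at_zero' H h1]
    by_cases h2 : x - w < -R
    · rw [H.Z_zero h2]; simp [at_zero' H h2]
    rw [hz w (by linarith), atT_eq H _ (x := x + 2 * R) (by linarith)]
  simp_rw [e1]
  rw [integral_complex_ofReal]
  congr 1
  rw [integral_finset_sum _ fun I _ => integrable_finset_sum _ fun J _ => (H.prodInt _ _).const_mul _]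
  have e3 : ∀ I ∈ S, (∫ w, ∑ J ∈ S, f I * (Φ (w - atL N I) * Φ (x - atL N J - w))) =
      ∑ J ∈ S, f I * atΨ Φ (x - atL N (I + J)) := by
    intro I _
    rw [integral_finset_sum _ fun J _ => (H.prodInt _ _).const_mul _]
    refine Finset.sum_congr rfl fun J _ => ?_
    rw [integral_const_mul, H.prodΨ, atL_add]; congr 2; ring
  rw [Finset.sum_congr rfl e3, ← Finset.sum_product']
  rw [← Finset.sum_filter_add_sum_filter_not (S ×ˢ S) (fun x => x.1 + x.2 ∈ S)]
  have e4 : ∑ y ∈ S ×ˢ S with ¬ (y.1 + y.2 ∈ S), f y.1 * atΨ Φ (x - atL N (y.1 + y.2)) = 0 := by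
    refine Finset.sum_eq_zero ?_
    rintro ⟨I, J⟩ h
    simp only [Finset.mem_filter, hS, mem_atS] at h
    rw [H.Ψsupp, mul_zero]
    rw [lt_abs]; right; linarith [h.2]
  rw [e4, add_zero]
  rw [← Finset.sum_fiberwise_of_maps_to (s := Finset.filter (fun x => x.1 + x.2 ∈ S) (S ×ˢ S)) (t := S)
    (g := fun x => x.1 + x.2) (fun x hx => (Finset.mem_filter.1 hx).2)]
  refine Finset.sum_congr rfl fun K hK => ?_
  rw [Finset.sum_mul]
  refine Finset.sum_nbij' (fun x => x.1) (fun I => (I, K - I)) ?_ ?_ ?_ ?_ ?_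
  · rintro ⟨I, J⟩ h
    simp only [Finset.mem_filter] at h
    rw [Finset.mem_Iic, ← h.2]; exact le_self_add
  · intro I hI
    rw [Finset.mem_Iic] at hI
    have e : I + (K - I) = K := add_tsub_cancel_of_le hI
    have e' : atL N I + atL N (K - I) = atL N K := by rw [← atL_add, e]
    rw [hS, mem_atS] at hK
    simp only [Finset.mem_filter, Finset.mem_product, e, hS, mem_atS]
    have := atL_nonneg (N := N) I
    have := atL_nonneg (N := N) (K - I)
    refine ⟨⟨⟨?_, ?_⟩, ?_⟩, ?_⟩ <;> first | linarith | trivial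
  · rintro ⟨I, J⟩ h
    simp only [Finset.mem_filter] at h
    rw [← h.2]; simp
  · intro I _; rfl
  · rintro ⟨I, J⟩ h
    simp only [Finset.mem_filter] at h
    rw [← h.2]
end AT5
section AT6
open MeasureTheory Filter Topology
variable {P Γ : Type*} [AddCommGroup Γ] {N : P → ℕ} {cl : P → Γ} {Φ : ℝ → ℝ} {κ M R : ℝ} [Fintype Γ]
def atA (N : P → ℕ) (cl : P → Γ) (Φ : ℝ → ℝ) (χ : AddChar Γ ℂ) (s : ℝ) : ℂ :=
  ∫ t, atT N Φ (fun I => χ (atC cl I)) t * (ℯ (-s * t) : ℂ)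
lemma ATd.T_bd (H : ATd N cl Φ κ M R) {χ : AddChar Γ ℂ} (hχ : χ ≠ 0) (t : ℝ) :
    ‖atT N Φ (fun I => χ (atC cl I)) t‖ ≤ M * Fintype.card Γ := by
  have := at_main_sum H χ t
  rw [AddChar.sum_eq_ite, if_neg hχ, mul_zero, sub_zero] at this
  simpa [at_norm] using this
lemma ATd.A_lip (H : ATd N cl Φ κ M R) {χ : AddChar Γ ℂ} (hχ : χ ≠ 0) :
    ∃ D : ℝ, ∀ s ∈ Set.Icc (1:ℝ) 2, ∀ s' ∈ Set.Icc (1:ℝ) 2, ‖atA N cl Φ χ s - atA N cl Φ χ s'‖ ≤ D * |s - s'| :=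
  at_lip (atT_meas H _) (H.T_bd hχ) (fun t ht => atT_zero H _ ht) H.Rpos
lemma ATd.A_eq (H : ATd N cl Φ κ M R) (χ : AddChar Γ ℂ) {s : ℝ} (hs : 1 < s) :
    atA N cl Φ χ s = atLf N cl χ s * (atH Φ s : ℂ) := by
  have : Countable P := at_countable H.fin
  exact at_mellinC (atL N) (fun I => χ (atC cl I)) s (fun I => (at_norm χ _).le) (H.intΦ s) (H.summable hs)
lemma ATd.A_conj (H : ATd N cl Φ κ M R) (χ : AddChar Γ ℂ) (s : ℝ) :
    atA N cl Φ (-χ) s = (starRingEnd ℂ) (atA N cl Φ χ s) := by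
  unfold atA
  rw [← integral_conj]
  congr 1; ext t
  rw [map_mul, Complex.conj_ofReal]
  congr 1
  unfold atT
  rw [Complex.conj_tsum]
  refine tsum_congr fun I => ?_
  rw [map_mul, Complex.conj_ofReal]
  simp only
  rw [AddChar.neg_apply, AddChar.map_neg_eq_conj]
lemma ATd.real_ne (H : ATd N cl Φ κ M R) {χ : AddChar Γ ℂ} (hχ : χ ≠ 0) (hr : -χ = χ) :
    atA N cl Φ χ 1 ≠ 0 := by
  intro h0
  set f : (P →₀ ℕ) → ℝ := fun I => (χ (atC cl I)).re with hf
  have hre : ∀ I, ((f I : ℝ) : ℂ) = χ (atC cl I) := by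
    intro I
    rw [← Complex.conj_eq_iff_re, ← AddChar.map_neg_eq_conj, ← AddChar.neg_apply, hr]
  have hmul : ∀ I J, f (I + J) = f I * f J := by
    intro I J
    have : ((f (I + J) : ℝ) : ℂ) = ((f I * f J : ℝ) : ℂ) := by
      push_cast; rw [hre, hre, hre, atC_add, AddChar.map_add_eq_mul]
    exact_mod_cast this
  have hpm : ∀ I, f I = 1 ∨ f I = -1 := by
    intro I
    have h1 : ‖((f I : ℝ) : ℂ)‖ = 1 := by rw [hre]; exact at_norm _ _
    rw [Complex.norm_real, Real.norm_eq_abs] at h1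
    rcases abs_cases (f I) with h | h
    · left; linarith
    · right; linarith
  set T := atT N Φ (fun I => χ (atC cl I)) with hT
  set B := M * Fintype.card Γ with hB
  have hB0 : 0 ≤ B := mul_nonneg H.M0 (by positivity)
  set A := κ * Fintype.card Γ with hA
  have hA0 : 0 ≤ A := mul_nonneg H.κpos.le (by positivity)
  have hTm : Measurable T := atT_meas H _
  have hTb : ∀ t, ‖T t‖ ≤ B := H.T_bd hχ
  have hT0 : ∀ t, t < -R → T t = 0 := fun t ht => atT_zero H _ ht
  have hR := H.Rpos
  have hS2 : ∀ x, -2 * R ≤ x → ‖∫ w, T w * (atZ N Φ (x - w) : ℂ)‖ ≤ B * (A * 1) + B * B * (x + 2 * R) := by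
    intro x hx
    have hint : Integrable fun t => T t * (ℯ (-1 * t) : ℂ) := at_integrable hTm hTb hT0 hR one_pos
    have hle : -R ≤ x + R := by linarith
    have key : ∀ w, T w * (atZ N Φ (x - w) : ℂ) = (A * ℯ x : ℝ) * (T w * (ℯ (-1 * w) : ℂ))
        + T w * ((atZ N Φ (x - w) - A * ℯ (x - w) : ℝ) : ℂ) := by
      intro w
      rw [sub_eq_add_neg x w, Real.exp_add]; push_cast; rw [neg_one_mul]; ring
    have hZm : Measurable (atZ N Φ) := by
      have := Complex.measurable_re.comp (atT_meas H (fun _ => 1))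
      convert this using 1
      ext t; simp [atT_one]
    have hg : Integrable (fun w => T w * (atZ N Φ (x - w) : ℂ)) := by
      refine Integrable.mono' (g := (Set.Icc (-R) (x + R)).indicator (fun _ => B * (B + A * ℯ (x + R)))) ?_ ?_ ?_
      · rw [integrable_indicator_iff measurableSet_Icc]; exact continuousOn_const.integrableOn_Icc
      · exact (by fun_prop : Measurable (fun w => T w * (atZ N Φ (x - w) : ℂ))).aestronglyMeasurable
      · refine Eventually.of_forall fun w => ?_
        by_cases h1 : w < -R
        · rw [hT0 w h1, zero_mul, norm_zero]; apply Set.indicator_nonneg; intros; positivity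
        by_cases h2 : w ≤ x + R
        · rw [Set.indicator_of_mem (show w ∈ Set.Icc (-R) (x+R) from ⟨not_lt.1 h1, h2⟩), norm_mul, Complex.norm_real,
            Real.norm_of_nonneg (H.Z_nonneg _)]
          refine mul_le_mul (hTb w) ?_ (H.Z_nonneg _) hB0
          have h3 := (abs_sub_le_iff.1 (H.Z_est (x - w))).1
          have h4 : A * ℯ (x - w) ≤ A * ℯ (x + R) := by gcongr; linarith
          linarith
        · rw [H.Z_zero (by linarith)]; simp only [Complex.ofReal_zero, mul_zero, norm_zero]
          apply Set.indicator_nonneg; intros; positivity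
    have hint2 : Integrable (fun w => T w * ((atZ N Φ (x - w) - A * ℯ (x - w) : ℝ) : ℂ)) := by
      have := hg.sub (hint.const_mul ((A * ℯ x : ℝ) : ℂ))
      refine this.congr (Eventually.of_forall fun w => ?_)
      simp only [Pi.sub_apply]; rw [key w]; ring
    simp_rw [key]
    rw [integral_add (hint.const_mul _) hint2, integral_const_mul]
    have h00 : (∫ w, T w * (ℯ (-1 * w) : ℂ)) = 0 := h0
    rw [h00, mul_zero, zero_add]
    have hd : ∀ w, ‖T w * ((atZ N Φ (x - w) - A * ℯ (x - w) : ℝ) : ℂ)‖ ≤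
        (Set.Icc (-R) (x + R)).indicator (fun _ => B * B) w +
        (Set.Ioi (x + R)).indicator (fun w => B * A * ℯ x * ℯ (- w)) w := by
      intro w
      rw [norm_mul, Complex.norm_real, Real.norm_eq_abs]
      by_cases h1 : w < -R
      · rw [hT0 w h1]; simp only [norm_zero, zero_mul]
        apply add_nonneg <;> apply Set.indicator_nonneg <;> intros <;> positivity
      · by_cases h2 : w ≤ x + R
        · rw [Set.indicator_of_mem (show w ∈ Set.Icc (-R) (x+R) from ⟨not_lt.1 h1, h2⟩),
            Set.indicator_of_notMem (by simpa using h2), add_zero]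
          exact mul_le_mul (hTb w) (H.Z_est _) (abs_nonneg _) hB0
        · rw [Set.indicator_of_notMem (fun h => h2 h.2), Set.indicator_of_mem (by simpa using h2), zero_add,
            H.Z_zero (by linarith), zero_sub, abs_neg, abs_of_nonneg (by positivity), sub_eq_add_neg x w, Real.exp_add]
          rw [mul_assoc B, mul_assoc B, mul_assoc A]
          gcongr; exact hTb w
    have hi1 : Integrable ((Set.Icc (-R) (x + R)).indicator (fun _ => B * B)) := by
      rw [integrable_indicator_iff measurableSet_Icc]; exact continuousOn_const.integrableOn_Icc
    have hi2 : Integrable ((Set.Ioi (x + R)).indicator (fun w => B * A * ℯ x * ℯ (- w))) := by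
      rw [integrable_indicator_iff measurableSet_Ioi]; exact (integrableOn_exp_neg_Ioi _).const_mul _
    refine (norm_integral_le_of_norm_le (hi1.add hi2) (Eventually.of_forall hd)).trans ?_
    simp only [Pi.add_apply]
    rw [integral_add hi1 hi2, integral_indicator measurableSet_Icc, integral_indicator measurableSet_Ioi,
      integral_const_mul (B * A * ℯ x), integral_exp_neg_Ioi]
    simp only [integral_const, measureReal_restrict_apply_univ, Real.volume_real_Icc_of_le hle, smul_eq_mul]
    have : ℯ x * ℯ (-(x+R)) ≤ 1 := by
      rw [← Real.exp_add]; apply Real.exp_le_one_iff.2; linarith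
    have h3 : B * A * ℯ x * ℯ (-(x+R)) ≤ B * (A * 1) := by
      rw [mul_assoc, mul_assoc]; gcongr
    nlinarith
  have hPc : Countable P := at_countable H.fin
  have hr' := at_r f hmul hpm
  have hlow : ∀ x, (∑' J : P →₀ ℕ, ENNReal.ofReal (1 * atΨ Φ (x - 2 * atL N J))) ≤
      (Set.Ici (-2 * R)).indicator (fun x => ENNReal.ofReal (B * (A * 1) + B * B * (x + 2 * R))) x := by
    intro x
    by_cases hx : -2 * R ≤ x
    · rw [Set.indicator_of_mem (by exact hx)]
      set S := atS H (x + 2 * R) with hS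
      have h1 := H.S2 f x
      simp_rw [hre] at h1
      have h2 := hS2 x hx
      rw [h1, Complex.norm_real] at h2
      have h3 := (le_abs_self _).trans h2
      refine le_trans ?_ (ENNReal.ofReal_le_ofReal h3)
      have hz : ∀ J : P →₀ ℕ, J + J ∉ S → ENNReal.ofReal (1 * atΨ Φ (x - 2 * atL N J)) = 0 := by
        intro J hJ
        rw [hS, mem_atS, atL_add] at hJ
        rw [H.Ψsupp]; · simp
        rw [lt_abs]; right; linarith
      set U := S.filter (fun K => ∃ J, J + J = K) with hU
      have hinj : Function.Injective fun J : P →₀ ℕ => J + J := by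
        intro J J' h; ext p; have := DFunLike.congr_fun h p; simp at this; omega
      set V := S.preimage (fun J => J + J) hinj.injOn with hV
      rw [tsum_eq_sum (s := V) (fun J hJ => hz J (by simpa [hV] using hJ)),
        ← ENNReal.ofReal_sum_of_nonneg (fun J _ => by rw [one_mul]; exact H.Ψnonneg _)]
      apply ENNReal.ofReal_le_ofReal
      calc ∑ J ∈ V, 1 * atΨ Φ (x - 2 * atL N J) ≤ ∑ J ∈ V, (∑ I ∈ Finset.Iic (J + J), f I) * atΨ Φ (x - atL N (J + J)) := by
            refine Finset.sum_le_sum fun J _ => ?_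
            rw [atL_add, ← two_mul]
            refine mul_le_mul_of_nonneg_right ((hr' _).2 fun p => ?_) (H.Ψnonneg _)
            exact ⟨J p, rfl⟩
        _ = ∑ K ∈ V.image (fun J => J + J), (∑ I ∈ Finset.Iic K, f I) * atΨ Φ (x - atL N K) := by
            rw [Finset.sum_image hinj.injOn]
        _ ≤ _ := by
            refine Finset.sum_le_sum_of_subset_of_nonneg ?_ fun K _ _ => mul_nonneg (hr' K).1 (H.Ψnonneg _)
            intro K hK
            obtain ⟨J, hJ, rfl⟩ := Finset.mem_image.1 hK
            simpa [hV] using hJ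
    · rw [Set.indicator_of_notMem (by exact hx)]
      refine le_of_eq (ENNReal.tsum_eq_zero.2 fun J => ?_)
      rw [H.Ψsupp]; · simp
      have := atL_nonneg (N := N) J
      rw [lt_abs]; right; linarith
  have hmel := at_mellinE H.Ψmeas H.Ψnonneg (fun J => 2 * atL N J) (fun _ => 1) (by simp) (1/2)
  have hfin : ∫⁻ t, (∑' J : P →₀ ℕ, ENNReal.ofReal (1 * atΨ Φ (t - 2 * atL N J))) * ENNReal.ofReal (ℯ (-(1/2) * t)) < ⊤ := by
    have hi := at_int_exp ((B * A + 4 * (B * B)) * ℯ (R/2)) (2 * R) (u := 1/4) (by norm_num)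
    refine lt_of_le_of_lt (lintegral_mono (g := fun t => ENNReal.ofReal ((Set.Ici (-(2*R))).indicator
      (fun t => (B * A + 4 * (B * B)) * ℯ (R/2) * ℯ (-(1/4) * t)) t)) fun t => ?_) hi.lintegral_lt_top
    refine (mul_le_mul_left (hlow t) _).trans ?_
    simp only
    by_cases ht : -2 * R ≤ t
    · rw [Set.indicator_of_mem (by exact ht), Set.indicator_of_mem (show t ∈ Set.Ici (-(2*R)) by rw [Set.mem_Ici]; linarith),
        ← ENNReal.ofReal_mul (by have : 0 ≤ t + 2 * R := by linarith
                                 positivity)]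
      apply ENNReal.ofReal_le_ofReal
      have e1 : ℯ (-(1/2) * t) = ℯ (-(1/4) * t) * ℯ (-(1/4) * t) := by
        rw [← Real.exp_add]; congr 1; ring
      have e2 : ℯ (-(1/4) * t) ≤ ℯ (R/2) := by apply Real.exp_le_exp.2; linarith
      have e3 : (t + 2 * R) * ℯ (-(1/4) * t) ≤ 4 * ℯ (R/2) := by
        have h5 : (t + 2 * R) / 4 ≤ ℯ ((t + 2 * R)/4) := (by linarith [Real.add_one_le_exp ((t + 2 * R)/4)])
        have h6 : ℯ (R/2) = ℯ ((t + 2 * R)/4) * ℯ (-(1/4) * t) := by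
          rw [← Real.exp_add]; congr 1; ring
        rw [h6]
        nlinarith [Real.exp_pos (-(1/4) * t)]
      rw [e1, ← mul_assoc]
      refine mul_le_mul_of_nonneg_right ?_ (Real.exp_pos _).le
      have h7 := mul_le_mul_of_nonneg_left e2 (mul_nonneg hB0 hA0)
      have h8 := mul_le_mul_of_nonneg_left e3 (mul_nonneg hB0 hB0)
      nlinarith
    · rw [Set.indicator_of_notMem (by exact ht)]; simp
  have hpos : ∫⁻ u, ENNReal.ofReal (atΨ Φ u * ℯ (-(1/2) * u)) ≠ 0 := by
    intro h
    have hm := H.Ψmeas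
    rw [lintegral_eq_zero_iff (by fun_prop)] at h
    have : ∫ y, atΨ Φ y = 0 := by
      rw [← integral_zero ℝ ℝ]
      refine integral_congr_ae ?_
      filter_upwards [h] with y hy
      have hy' : atΨ Φ y * ℯ (-(1/2) * y) ≤ 0 := by simpa using hy
      have := Real.exp_pos (-(1/2) * y)
      nlinarith [H.Ψnonneg y]
    rw [H.Ψint] at this
    have := H.pos
    simp_all
  rw [hmel] at hfin
  have hsum : (∑' J : P →₀ ℕ, ENNReal.ofReal (1 * ℯ (-(1/2) * (2 * atL N J)))) ≠ ⊤ := by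
    intro h; rw [h, ENNReal.top_mul hpos] at hfin; exact lt_irrefl _ hfin
  apply H.not_summable
  have := ENNReal.summable_toReal hsum
  refine this.congr fun J => ?_
  rw [ENNReal.toReal_ofReal (by positivity), one_mul]; congr 1; ring
end AT6
section AT7
open MeasureTheory Filter Topology
variable {P Γ : Type*} [AddCommGroup Γ] {N : P → ℕ} {cl : P → Γ} {Φ : ℝ → ℝ} {κ M R : ℝ} [Fintype Γ]
lemma ATd.L_bd1 (H : ATd N cl Φ κ M R) (χ : AddChar Γ ℂ) : ∃ C : ℝ, χ ≠ 0 → ∀ s, 1 < s → s ≤ 2 →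
    ‖atLf N cl χ s‖ ≤ C ∧ (atA N cl Φ χ 1 = 0 → ‖atLf N cl χ s‖ ≤ C * (s - 1)) := by
  by_cases hχ : χ = 0
  · exact ⟨0, fun h => absurd hχ h⟩
  obtain ⟨D, hD⟩ := H.A_lip hχ
  obtain ⟨δ, hδ, D', hD'⟩ := H.hatbd
  have hD0 : 0 ≤ D := by
    have := hD 1 (by norm_num) 2 (by norm_num)
    norm_num at this
    exact (norm_nonneg _).trans this
  refine ⟨(D + ‖atA N cl Φ χ 1‖) / δ, fun _ s hs hs2 => ?_⟩
  have h1 := hD s ⟨hs.le, hs2⟩ 1 (by norm_num)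
  rw [abs_of_pos (by linarith)] at h1
  have h2 := H.A_eq χ hs
  have h3 : ‖atLf N cl χ s‖ * δ ≤ ‖atA N cl Φ χ s‖ := by
    rw [h2, norm_mul, Complex.norm_real, Real.norm_of_nonneg (H.hatpos s).le]
    gcongr; exact (hD' s ⟨hs.le, hs2⟩).1
  have h4 : ‖atA N cl Φ χ s‖ ≤ D * (s - 1) + ‖atA N cl Φ χ 1‖ := by
    have := norm_sub_norm_le (atA N cl Φ χ s) (atA N cl Φ χ 1); linarith
  constructor
  · rw [le_div_iff₀ hδ]; nlinarith
  · intro h0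
    rw [h0, norm_zero, add_zero] at h4 ⊢
    rw [div_mul_eq_mul_div, le_div_iff₀ hδ]; linarith
lemma ATd.L_bd (H : ATd N cl Φ κ M R) : ∃ C : ℝ, 1 ≤ C ∧ ∀ χ : AddChar Γ ℂ, χ ≠ 0 → ∀ s, 1 < s → s ≤ 2 →
    ‖atLf N cl χ s‖ ≤ C ∧ (atA N cl Φ χ 1 = 0 → ‖atLf N cl χ s‖ ≤ C * (s - 1)) := by
  choose C hC using H.L_bd1
  have h0 : ∀ χ, C χ ≤ 1 + ∑ χ, |C χ| := fun χ => by
    have := Finset.single_le_sum (f := fun χ => |C χ|) (fun _ _ => abs_nonneg _) (Finset.mem_univ χ)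
    linarith [le_abs_self (C χ)]
  refine ⟨1 + ∑ χ, |C χ|, by linarith [Finset.sum_nonneg (s := Finset.univ) (f := fun χ => |C χ|) fun _ _ => abs_nonneg _], fun χ hχ s hs hs2 => ?_⟩
  obtain ⟨h1, h2⟩ := hC χ hχ s hs hs2
  refine ⟨h1.trans (h0 χ), fun h => (h2 h).trans ?_⟩
  have : 0 ≤ s - 1 := by linarith
  gcongr; exact h0 χ
lemma ATd.L_le_z (H : ATd N cl Φ κ M R) (χ : AddChar Γ ℂ) {s : ℝ} (hs : 1 < s) : ‖atLf N cl χ s‖ ≤ atz N s := by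
  refine tsum_of_norm_bounded (H.summable hs).hasSum fun I => ?_
  rw [norm_mul, at_norm, one_mul, Complex.norm_real, Real.norm_of_nonneg (Real.exp_pos _).le]
lemma ATd.prod_ge (H : ATd N cl Φ κ M R) : ∃ c > 0, ∀ s, 1 < s → c ≤ ∏ χ : AddChar Γ ℂ, ‖atLf N cl χ s‖ := by
  obtain ⟨C, hC⟩ := H.ell_est
  refine ⟨ℯ (-C), Real.exp_pos _, fun s hs => ?_⟩
  have h := hC 0 s hs
  simp only [neg_zero, AddChar.map_zero_eq_one, one_mul] at h
  simp_rw [H.euler _ hs]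
  rw [← norm_prod, ← Complex.exp_sum, Complex.norm_exp]
  apply Real.exp_le_exp.2
  set X := ∑ χ : AddChar Γ ℂ, atell N cl χ s
  set Y : ℝ := Fintype.card Γ * ∑' p, if cl p = 0 then atq N s p else 0
  have hY : 0 ≤ Y := by
    refine mul_nonneg (by positivity) (tsum_nonneg fun p => ?_)
    split_ifs
    · exact (atq_pos s p).le
    · exact le_rfl
  have h1 := (Complex.abs_re_le_norm (X - (Y:ℂ))).trans h
  rw [Complex.sub_re, Complex.ofReal_re] at h1
  linarith [(abs_le.1 h1).1]
lemma ATd.A_ne (H : ATd N cl Φ κ M R) {χ : AddChar Γ ℂ} (hχ : χ ≠ 0) : atA N cl Φ χ 1 ≠ 0 := by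
  by_cases hr : -χ = χ
  · exact H.real_ne hχ hr
  intro h0
  have h0' : atA N cl Φ (-χ) 1 = 0 := by rw [H.A_conj, h0, map_zero]
  have hχ' : -χ ≠ 0 := by simpa using hχ
  obtain ⟨c, hc, hcp⟩ := H.prod_ge
  obtain ⟨C, hC1, hC⟩ := H.L_bd
  obtain ⟨C0, hC0, hz⟩ := H.z_le
  set U := ((Finset.univ.erase (0 : AddChar Γ ℂ)).erase χ).erase (-χ) with hU
  have key : ∀ s, 1 < s → s ≤ 2 → c ≤ C0 * (C ^ 2 * C ^ U.card) * (s - 1) := by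
    intro s hs hs2
    refine (hcp s hs).trans ?_
    have hs0 : 0 < s - 1 := by linarith
    rw [← Finset.mul_prod_erase Finset.univ _ (Finset.mem_univ (0 : AddChar Γ ℂ)),
      ← Finset.mul_prod_erase _ _ (Finset.mem_erase.2 ⟨hχ, Finset.mem_univ χ⟩),
      ← Finset.mul_prod_erase _ _ (Finset.mem_erase.2 ⟨hr, Finset.mem_erase.2 ⟨hχ', Finset.mem_univ (-χ)⟩⟩), ← hU]
    have hr : ∏ χ ∈ U, ‖atLf N cl χ s‖ ≤ C ^ U.card := by
      rw [← Finset.prod_const]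
      refine Finset.prod_le_prod (fun _ _ => norm_nonneg _) fun ψ hψ => ?_
      simp only [hU, Finset.mem_erase] at hψ
      exact (hC ψ hψ.2.2.1 s hs hs2).1
    calc _ ≤ (C0 / (s-1)) * ((C * (s-1)) * ((C * (s-1)) * C ^ U.card)) := by
          have hp0 : 0 ≤ ∏ χ ∈ U, ‖atLf N cl χ s‖ := Finset.prod_nonneg fun _ _ => norm_nonneg _
          gcongr
          · exact (H.L_le_z 0 hs).trans (hz s hs hs2)
          · exact (hC χ hχ s hs hs2).2 h0
          · exact (hC (-χ) hχ' s hs hs2).2 h0'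
      _ = _ := by field_simp
  set W := C0 * (C ^ 2 * C ^ U.card) with hW
  have hWp : 0 < W := by positivity
  have h1 := key (1 + min 1 (c / (2 * W))) (by have : 0 < c / (2 * W) := by positivity
                                               linarith [lt_min one_pos this]) (by linarith [min_le_left 1 (c / (2 * W))])
  have h2 : W * min 1 (c / (2 * W)) ≤ W * (c / (2 * W)) := by gcongr; exact min_le_right _ _
  have h3 : W * (c / (2 * W)) = c / 2 := by field_simp
  rw [add_sub_cancel_left] at h1
  linarith
lemma ATd.ell_cont (H : ATd N cl Φ κ M R) (χ : AddChar Γ ℂ) {s0 : ℝ} (hs0 : 1 < s0) :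
    ContinuousOn (atell N cl χ) (Set.Ici s0) := by
  refine continuousOn_tsum (u := fun p => 3/2 * atq N s0 p) (fun p => ?_) ((H.qsum hs0).mul_left _) ?_
  · refine ContinuousOn.neg (ContinuousOn.clog ?_ ?_)
    · unfold atq; fun_prop
    · intro s hs
      left
      have hs : s0 ≤ s := hs
      have h1 := H.q_le (by linarith : 1 ≤ s) p
      have h2 := (Complex.abs_re_le_norm (χ (cl p) * (atq N s p : ℂ))).trans (H.z_norm χ s p).le
      rw [Complex.sub_re, Complex.one_re]
      linarith [(abs_le.1 h2).2]
  · intro p s hs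
    have hs : s0 ≤ s := hs
    rw [norm_neg]
    have h1 := H.q_le (by linarith : 1 ≤ s) p
    have h3 := Complex.norm_log_one_add_half_le_self (z := -(χ (cl p) * (atq N s p : ℂ))) (by rw [norm_neg, H.z_norm]; exact h1)
    rw [← sub_eq_add_neg, norm_neg, H.z_norm] at h3
    refine h3.trans ?_
    gcongr; exact atq_anti hs p
lemma ATd.ell_bd (H : ATd N cl Φ κ M R) {χ : AddChar Γ ℂ} (hχ : χ ≠ 0) :
    ∃ C s1, 1 < s1 ∧ ∀ s, 1 < s → s ≤ s1 → ‖atell N cl χ s‖ ≤ C := by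
  have hA := H.A_ne hχ
  obtain ⟨D, hD⟩ := H.A_lip hχ
  obtain ⟨D2, hD2⟩ := H.hatcont
  have hh1 := H.hatpos 1
  set l1 := atA N cl Φ χ 1 / (atH Φ 1 : ℂ) with hl1
  have hl0 : l1 ≠ 0 := div_ne_zero hA (by exact_mod_cast hh1.ne')
  have htA : Tendsto (atA N cl Φ χ) (𝓝[Set.Icc 1 2] 1) (𝓝 (atA N cl Φ χ 1)) := by
    have hl : LipschitzOnWith D.toNNReal (atA N cl Φ χ) (Set.Icc 1 2) := by
      refine LipschitzOnWith.of_dist_le_mul fun s hs s' hs' => ?_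
      rw [dist_eq_norm, Real.dist_eq]
      exact (hD s hs s' hs').trans (mul_le_mul_of_nonneg_right (Real.le_coe_toNNReal _) (abs_nonneg _))
    exact hl.continuousOn 1 (by norm_num)
  have htH : Tendsto (atH Φ) (𝓝[Set.Icc 1 2] 1) (𝓝 (atH Φ 1)) := by
    have hl : LipschitzOnWith D2.toNNReal (atH Φ) (Set.Icc 1 2) := by
      refine LipschitzOnWith.of_dist_le_mul fun s hs s' hs' => ?_
      rw [Real.dist_eq, Real.dist_eq]
      exact (hD2 s hs s' hs').trans (mul_le_mul_of_nonneg_right (Real.le_coe_toNNReal _) (abs_nonneg _))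
    exact hl.continuousOn 1 (by norm_num)
  have htH' : Tendsto (fun s => (atH Φ s : ℂ)) (𝓝[Set.Icc 1 2] 1) (𝓝 (atH Φ 1 : ℂ)) :=
    (Complex.continuous_ofReal.tendsto _).comp htH
  have ht : Tendsto (fun s => atA N cl Φ χ s / (atH Φ s : ℂ) / l1) (𝓝[Set.Icc 1 2] 1) (𝓝 1) := by
    have := ((htA.div htH' (by exact_mod_cast hh1.ne')).div_const l1)
    rwa [div_self hl0] at this
  have hev := ht (Metric.ball_mem_nhds (1:ℂ) (by norm_num : (0:ℝ) < 1/2))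
  rw [mem_map, Metric.mem_nhdsWithin_iff] at hev
  obtain ⟨ε, hε, hev⟩ := hev
  set s1 := 1 + min 1 (ε/2) with hs1
  have hm : 0 < min 1 (ε/2) := lt_min one_pos (by linarith)
  have hm1 := min_le_left 1 (ε/2)
  have hm2 := min_le_right 1 (ε/2)
  have hL : ∀ s, 1 < s → s ≤ s1 → ‖atLf N cl χ s / l1 - 1‖ ≤ 1/2 := by
    intro s h1 h2
    have : s ∈ Metric.ball 1 ε ∩ Set.Icc 1 2 := by
      refine ⟨?_, by linarith, by linarith⟩
      rw [Metric.mem_ball, Real.dist_eq, abs_of_pos (by linarith)]; linarith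
    have := hev this
    rw [Set.mem_preimage, Metric.mem_ball, dist_eq_norm, H.A_eq χ h1, mul_div_cancel_right₀] at this
    · exact this.le
    · exact_mod_cast (H.hatpos s).ne'
  set g : ℝ → ℂ := fun s => Complex.log (atLf N cl χ s / l1) - atell N cl χ s with hg
  have hslit : ∀ s, 1 < s → s ≤ s1 → atLf N cl χ s / l1 ∈ Complex.slitPlane := by
    intro s h1 h2
    left
    have h3 := (Complex.abs_re_le_norm _).trans (hL s h1 h2)
    rw [Complex.sub_re, Complex.one_re] at h3
    linarith [(abs_le.1 h3).1]
  have hgc : ContinuousOn g (Set.Ioc 1 s1) := by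
    intro s hs
    have h1 : ContinuousWithinAt (atell N cl χ) (Set.Ioc 1 s1) s := by
      have h2 : ContinuousAt (atell N cl χ) s :=
        (H.ell_cont χ (by linarith [hs.1] : 1 < (1 + s)/2)).continuousAt (Ici_mem_nhds (by linarith [hs.1]))
      exact h2.continuousWithinAt
    refine ContinuousWithinAt.sub ?_ h1
    refine ContinuousWithinAt.clog ?_ (hslit s hs.1 hs.2)
    refine ContinuousWithinAt.div_const ?_ _
    have h3 : ContinuousWithinAt (fun s => Complex.exp (atell N cl χ s)) (Set.Ioc 1 s1) s := h1.cexp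
    exact h3.congr (fun x hx => H.euler χ hx.1) (H.euler χ hs.1)
  have hge : ∀ s ∈ Set.Ioc 1 s1, Complex.exp (g s) = l1⁻¹ := by
    intro s hs
    rw [hg]; simp only
    rw [Complex.exp_sub, Complex.exp_log, ← H.euler χ hs.1]
    · have : atLf N cl χ s ≠ 0 := by rw [H.euler χ hs.1]; exact Complex.exp_ne_zero _
      field_simp
    · exact Complex.slitPlane_ne_zero (hslit s hs.1 hs.2)
  have hmem : s1 ∈ Set.Ioc 1 s1 := ⟨by linarith, le_rfl⟩
  have hconst : ∀ s ∈ Set.Ioc 1 s1, g s = g s1 := by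
    intro s hs
    set k : ℝ → ℝ := fun s => ((g s - g s1) / (2 * Real.pi * Complex.I)).re with hk
    have hkc : ContinuousOn k (Set.Ioc 1 s1) :=
      Complex.continuous_re.comp_continuousOn ((hgc.sub continuousOn_const).div_const _)
    have hint : ∀ x ∈ Set.Ioc 1 s1, ∃ n : ℤ, g x = g s1 + n * (2 * Real.pi * Complex.I) := fun x hx =>
      Complex.exp_eq_exp_iff_exists_int.1 ((hge x hx).trans (hge s1 hmem).symm)
    have hpi : (2 * Real.pi * Complex.I : ℂ) ≠ 0 := Complex.two_pi_I_ne_zero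
    have hkint : ∀ x ∈ Set.Ioc 1 s1, ∀ n : ℤ, g x = g s1 + n * (2 * Real.pi * Complex.I) → k x = n := by
      intro x hx n hn
      rw [hk]; simp only
      rw [hn, add_sub_cancel_left, mul_div_cancel_right₀ _ hpi]; simp
    have hk0 : k s1 = 0 := by simp [hk]
    have hpc : IsPreconnected (k '' Set.Ioc 1 s1) := isPreconnected_Ioc.image k hkc
    obtain ⟨n, hn⟩ := hint s hs
    have hks := hkint s hs n hn
    suffices n = 0 by rw [hn, this]; simp
    by_contra hne
    have hoc := hpc.ordConnected
    have m0 : (0:ℝ) ∈ k '' Set.Ioc 1 s1 := ⟨s1, hmem, hk0⟩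
    have mn : (n:ℝ) ∈ k '' Set.Ioc 1 s1 := ⟨s, hs, hks⟩
    have hall : ∀ y ∈ k '' Set.Ioc 1 s1, ∃ m : ℤ, y = m := by
      rintro _ ⟨x, hx, rfl⟩
      obtain ⟨m, hm⟩ := hint x hx
      exact ⟨m, hkint x hx m hm⟩
    rcases lt_or_gt_of_ne hne with h | h
    · have hn1 : (n:ℝ) ≤ -1 := by exact_mod_cast Int.le_sub_one_of_lt h
      obtain ⟨m, hm⟩ := hall (-(1/2)) (hoc.out mn m0 ⟨by linarith, by linarith⟩)
      have : (2 * m : ℤ) = -1 := by have : (2 * m : ℝ) = -1 := by rw [← hm]; norm_num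
                                    exact_mod_cast this
      omega
    · have hn1 : (1:ℝ) ≤ n := by exact_mod_cast h
      obtain ⟨m, hm⟩ := hall (1/2) (hoc.out m0 mn ⟨by linarith, by linarith⟩)
      have : (2 * m : ℤ) = 1 := by have : (2 * m : ℝ) = 1 := by rw [← hm]; norm_num
                                   exact_mod_cast this
      omega
  refine ⟨3/4 + ‖g s1‖, s1, by linarith, fun s h1 h2 => ?_⟩
  have e : atell N cl χ s = Complex.log (atLf N cl χ s / l1) - g s1 := by
    rw [← hconst s ⟨h1, h2⟩, hg]; simp
  rw [e]
  refine (norm_sub_le _ _).trans (add_le_add_left ?_ _)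
  have h3 := Complex.norm_log_one_add_half_le_self (z := atLf N cl χ s / l1 - 1) (hL s h1 h2)
  rw [add_sub_cancel] at h3
  linarith [hL s h1 h2]
theorem ATd.infinite (H : ATd N cl Φ κ M R) (γ : Γ) : {p | cl p = γ}.Infinite := by
  intro hfin
  obtain ⟨C, hC⟩ := H.ell_est
  have hb : ∀ χ : AddChar Γ ℂ, ∃ C s1, 1 < s1 ∧ (χ ≠ 0 → ∀ s, 1 < s → s ≤ s1 → ‖atell N cl χ s‖ ≤ C) := by
    intro χ
    by_cases hχ : χ = 0
    · exact ⟨0, 2, by norm_num, fun h => absurd hχ h⟩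
    · obtain ⟨C, s1, h1, h2⟩ := H.ell_bd hχ
      exact ⟨C, s1, h1, fun _ => h2⟩
  choose B s1 hs1 hB using hb
  set S : Finset P := hfin.toFinset with hS
  set W := C + (Fintype.card Γ * S.card : ℝ) + ∑ χ, |B χ| with hW
  have hell : ∀ s, 1 < s → (∀ χ, s ≤ s1 χ) → ‖atell N cl (0 : AddChar Γ ℂ) s‖ ≤ W := by
    intro s hs hsχ
    have h := hC γ s hs
    rw [← Finset.add_sum_erase Finset.univ _ (Finset.mem_univ (0 : AddChar Γ ℂ))] at h
    rw [AddChar.zero_apply, one_mul] at h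
    set X := ∑ χ ∈ Finset.univ.erase (0 : AddChar Γ ℂ), χ (-γ) * atell N cl χ s
    set Y : ℝ := Fintype.card Γ * ∑' p, if cl p = γ then atq N s p else 0 with hY
    have hX : ‖X‖ ≤ ∑ χ, |B χ| := by
      refine (norm_sum_le _ _).trans ((Finset.sum_le_sum fun χ hχ => ?_).trans
        (Finset.sum_le_sum_of_subset_of_nonneg (Finset.erase_subset 0 Finset.univ) fun _ _ _ => abs_nonneg _))
      rw [norm_mul, at_norm, one_mul]
      exact (hB χ (Finset.mem_erase.1 hχ).1 s hs (hsχ χ)).trans (le_abs_self _)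
    have hY1 : |Y| ≤ Fintype.card Γ * S.card := by
      rw [hY, tsum_eq_sum (s := S) (fun p hp => by
        rw [if_neg]; intro h; exact hp (by simpa [hS] using h)), abs_mul, abs_of_nonneg (by positivity)]
      gcongr
      refine (Finset.abs_sum_le_sum_abs _ _).trans ?_
      rw [Finset.cast_card]
      refine Finset.sum_le_sum fun p _ => ?_
      split_ifs
      · rw [abs_of_pos (atq_pos s p)]; linarith [H.q_le hs.le p]
      · simp
    have e : atell N cl (0 : AddChar Γ ℂ) s = (atell N cl (0 : AddChar Γ ℂ) s + X - (Y:ℂ)) - X + (Y:ℂ) := by ring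
    rw [e]
    refine (norm_add_le _ _).trans ?_
    have := norm_sub_le (atell N cl (0 : AddChar Γ ℂ) s + X - (Y:ℂ)) X
    rw [Complex.norm_real, Real.norm_eq_abs]
    linarith
  have hz : ∀ s, 1 < s → (∀ χ, s ≤ s1 χ) → atz N s ≤ ℯ W := by
    intro s hs hsχ
    have h1 : atLf N cl (0 : AddChar Γ ℂ) s = (atz N s : ℂ) := by
      unfold atLf atz; rw [Complex.ofReal_tsum]; simp
    have h2 := H.euler (0 : AddChar Γ ℂ) hs
    have h3 : ‖(atz N s : ℂ)‖ ≤ ℯ W := by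
      rw [← h1, h2, Complex.norm_exp]
      exact Real.exp_le_exp.2 ((Complex.re_le_norm _).trans (hell s hs hsχ))
    rw [Complex.norm_real] at h3
    exact (le_abs_self _).trans h3
  apply H.not_summable
  refine summable_of_sum_le (c := ℯ W) (fun _ => (Real.exp_pos _).le) fun u => ?_
  have hlim : Tendsto (fun s : ℝ => ∑ I ∈ u, ℯ (-s * atL N I)) (𝓝[>] 1) (𝓝 (∑ I ∈ u, ℯ (-1 * atL N I))) :=
    ((by fun_prop : Continuous (fun s : ℝ => ∑ I ∈ u, ℯ (-s * atL N I))).tendsto 1).mono_left nhdsWithin_le_nhds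
  simp only [neg_one_mul] at hlim
  refine le_of_tendsto hlim ?_
  have hall : ∀ᶠ s in 𝓝[>] (1:ℝ), ∀ χ, s ≤ s1 χ := by
    rw [eventually_all]
    intro χ
    exact nhdsWithin_le_nhds (Iic_mem_nhds (hs1 χ))
  filter_upwards [hall, self_mem_nhdsWithin] with s h1 h2
  exact ((H.summable h2).sum_le_tsum u fun _ _ => (Real.exp_pos _).le).trans (hz s h2 h1)
end AT7
section Fr
open IsDedekindDomain
def plc {A : Type*} [CommRing A] [IsDedekindDomain A] (F : Type*) [Field F] [Algebra A F]
    [IsFractionRing A F] (P : ℌ A) : FinPlace F :=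
  ⟨P.valuation F, P.valuation_surjective F⟩
lemma FinPlace.ext' {v w : FinPlace K} (h : v.val = w.val) : v = w := by
  cases v; cases w; simp_all
lemma FinPlace.eq_of_le {v w : FinPlace K} (h : ∀ x, v.val x = 1 → w.val x = 1)
    (h1 : ∀ x, v.val x < 1 → w.val x ≤ 1) : v = w := by
  obtain ⟨π, hπ⟩ := v.surj (WithZero.exp (-1))
  have hπ0 : v.val π ≠ 0 := by rw [hπ]; simp
  have hπ0' : π ≠ 0 := by intro h; simp [h] at hπ0
  have key : ∀ x, x ≠ 0 → ∃ n : ℤ, v.val x = v.val π ^ n ∧ w.val x = w.val π ^ n := by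
    intro x hx
    have hx0 : v.val x ≠ 0 := by simpa using hx
    obtain ⟨n, hn⟩ : ∃ n : ℤ, v.val x = WithZero.exp n := ⟨_, (WithZero.exp_log hx0).symm⟩
    refine ⟨-n, ?_, ?_⟩
    · rw [hn, hπ, ← WithZero.exp_zsmul]; simp
    · have : v.val (x * π ^ n) = 1 := by
        rw [map_mul, map_zpow₀, hn, hπ, ← WithZero.exp_zsmul, ← WithZero.exp_add]; simp
      have := h _ this
      rw [map_mul, map_zpow₀] at this
      rw [zpow_neg]
      exact eq_inv_of_mul_eq_one_left this
  have hwπ : w.val π = WithZero.exp (-1) := by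
    have hw0 : w.val π ≠ 0 := by simpa using hπ0'
    obtain ⟨m, hm⟩ : ∃ n : ℤ, w.val π = WithZero.exp n := ⟨_, (WithZero.exp_log hw0).symm⟩
    have hle := h1 π (by rw [hπ]; rw [← WithZero.exp_zero, WithZero.exp_lt_exp]; norm_num)
    rw [hm, ← WithZero.exp_zero, WithZero.exp_le_exp] at hle
    obtain ⟨x, hx⟩ := w.surj (WithZero.exp (-1))
    have hx0 : x ≠ 0 := by rintro rfl; rw [map_zero] at hx; exact WithZero.exp_ne_zero hx.symm
    obtain ⟨n, hn, hn'⟩ := key x hx0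
    rw [hx, hm, ← WithZero.exp_zsmul, WithZero.exp_inj, smul_eq_mul] at hn'
    have : m ∣ 1 := ⟨-n, by linarith [mul_comm m n]⟩
    have := Int.isUnit_iff.1 (isUnit_of_dvd_one this)
    rw [hm]
    congr 1; omega
  apply FinPlace.ext'
  ext x
  by_cases hx : x = 0
  · simp [hx]
  obtain ⟨n, hn, hn'⟩ := key x hx
  rw [hn, hn', hπ, hwπ]
variable {A : Type*} [CommRing A] [IsDedekindDomain A] [Algebra A K] [IsFractionRing A K]
lemma plc_frac (P : ℌ A) (x : K) (hx : P.valuation K x ≤ 1) :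
    ∃ a b : A, b ∉ P.asIdeal ∧ x = ϖ A K a / ϖ A K b := by
  obtain ⟨a, b, h⟩ := P.exists_primeCompl_mul_eq_of_integer x hx
  refine ⟨a, b, b.2, ?_⟩
  rw [← h, mul_div_cancel_right₀]
  intro h0
  rw [map_eq_zero_iff _ (IsFractionRing.injective A K)] at h0
  exact b.2 (by rw [h0]; exact zero_mem _)
lemma plc_lt_one_iff (P : ℌ A) (a : A) :
    (plc K P).val (ϖ A K a) < 1 ↔ a ∈ P.asIdeal := by
  simpa [plc] using P.valuation_lt_one_iff_mem (K := K) a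
lemma plc_le_one (P : ℌ A) (a : A) :
    (plc K P).val (ϖ A K a) ≤ 1 := P.valuation_le_one a
lemma plc_eq_one_iff (P : ℌ A) (a : A) :
    (plc K P).val (ϖ A K a) = 1 ↔ a ∉ P.asIdeal := by
  rw [← plc_lt_one_iff (K := K), not_lt]
  exact ⟨fun h => h.ge, fun h => le_antisymm (plc_le_one P a) h⟩
lemma FinPlace.eq_plc (w : FinPlace K) (h : ∀ a : A, w.val (ϖ A K a) ≤ 1) :
    ∃ P : ℌ A, plc K P = w := by
  let I : Ideal A :=
    { carrier := {a | w.val (ϖ A K a) < 1}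
      add_mem' := fun {a b} ha hb => by
        simp only [Set.mem_ofPred_eq, map_add] at *
        exact (w.val.map_add _ _).trans_lt (max_lt ha hb)
      zero_mem' := by simp
      smul_mem' := fun c a ha => by
        simp only [Set.mem_ofPred_eq, smul_eq_mul, map_mul] at *
        exact (mul_le_of_le_one_left' (h c)).trans_lt ha }
  have hI : ∀ a, a ∈ I ↔ w.val (ϖ A K a) < 1 := fun a => Iff.rfl
  have hI' : ∀ a, a ∉ I → w.val (ϖ A K a) = 1 := fun a ha =>
    le_antisymm (h a) (not_lt.1 ha)
  have hp : I.IsPrime := by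
    constructor
    · rw [Ideal.ne_top_iff_one, hI]; simp
    · intro a b hab
      by_contra! hc
      rw [hI, map_mul, map_mul, hI' a hc.1, hI' b hc.2] at hab
      simp at hab
  have hb : I ≠ ⊥ := by
    intro hb
    obtain ⟨x, hx⟩ := w.surj (WithZero.exp (-1))
    obtain ⟨a, b, hb0, rfl⟩ := IsFractionRing.div_surjective (A := A) x
    have hb1 : b ≠ 0 := nonZeroDivisors.ne_zero hb0
    have ha1 : a ≠ 0 := by
      rintro rfl; rw [map_zero, zero_div, map_zero] at hx; exact WithZero.exp_ne_zero hx.symm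
    rw [map_div₀, hI' a (by rwa [hb, Ideal.mem_bot]), hI' b (by rwa [hb, Ideal.mem_bot]), div_one,
      ← WithZero.exp_zero, WithZero.exp_inj] at hx
    norm_num at hx
  let P : ℌ A := ⟨I, hp, hb⟩
  refine ⟨P, FinPlace.eq_of_le ?_ ?_⟩
  · intro x hx
    obtain ⟨a, b, hb, rfl⟩ := plc_frac P x (le_of_eq hx)
    have : a ∉ I := by
      intro ha
      rw [map_div₀, (plc_eq_one_iff P b).2 hb, div_one] at hx
      exact (plc_eq_one_iff P a).1 hx ha
    rw [map_div₀, hI' a this, hI' b hb, div_one]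
  · intro x hx
    obtain ⟨a, b, hb, rfl⟩ := plc_frac P x (le_of_lt hx)
    rw [map_div₀, hI' b hb, div_one]
    exact h a
end Fr
section Fr2
open IsDedekindDomain
instance FinPlace.pid (v : FinPlace K) : IsPrincipalIdealRing v.val.valuationSubring := by
  rw [(Valuation.valuationSubring.integers v.val).isPrincipalIdealRing_iff_not_denselyOrdered,
    WithZero.denselyOrdered_set_iff_subsingleton]
  simpa using v.val.toMonoidWithZeroHom.range_nontrivial
structure KumD (K L : Type*) [Field K] [Field L] [Algebra K L] (ℓ : ℕ) (ω : K) (a b : K) (α β : L) : Prop where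
  prime : ℓ.Prime
  prim : IsPrimitiveRoot ω ℓ
  ha : α ^ ℓ = ϖ K L a
  hb : β ^ ℓ = ϖ K L b
  gal : ∀ σ τ : L ≃ₐ[K] L, σ α = τ α → σ β = τ β → σ = τ
variable {L : Type*} [Field L] [Algebra K L] [FiniteDimensional K L] [IsGalois K L]
  {ℓ : ℕ} {ω a b : K} {α β : L}
lemma KumD.sum_root (H : KumD K L ℓ ω a b α β) (x y : L) (hx : x ≠ 0) (c : K) (h : x ^ ℓ = ϖ K L c) (hy : y ^ ℓ = x ^ ℓ) :
    ∑ i ∈ Finset.range ℓ, (x / y) ^ i = if y = x then (ℓ : L) else 0 := by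
  have hy0 : y ≠ 0 := by
    rintro rfl; rw [zero_pow H.prime.ne_zero] at hy; exact hx (pow_eq_zero_iff H.prime.ne_zero |>.1 hy.symm)
  split_ifs with hh
  · simp [hh, hx]
  · have h1 : x / y ≠ 1 := by
      intro h; apply hh; rw [div_eq_one_iff_eq hy0] at h; exact h.symm
    rw [geom_sum_eq h1, div_pow, hy, div_self (pow_ne_zero _ hx)]; simp
lemma KumD.repr (H : KumD K L ℓ ω a b α β) (hα : α ≠ 0) (hβ : β ≠ 0) (x : L) :
    ∑ i ∈ Finset.range ℓ, ∑ j ∈ Finset.range ℓ,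
      ϖ K L (Algebra.trace K L (x * α⁻¹ ^ i * β⁻¹ ^ j)) * (α ^ i * β ^ j) = (ℓ : L) ^ 2 * x := by
  simp_rw [trace_eq_sum_automorphisms, Finset.sum_mul]
  have : ∀ i j, ∑ σ : L ≃ₐ[K] L, σ (x * α⁻¹ ^ i * β⁻¹ ^ j) * (α ^ i * β ^ j) =
      ∑ σ : L ≃ₐ[K] L, σ x * ((α / σ α) ^ i * (β / σ β) ^ j) := by
    intro i j
    refine Finset.sum_congr rfl fun σ _ => ?_
    simp only [map_mul, map_pow, map_inv₀, div_pow, inv_pow]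
    field_simp
  rw [Finset.sum_congr rfl fun i _ => Finset.sum_congr rfl fun j _ => this i j]
  rw [Finset.sum_congr rfl fun i _ => Finset.sum_comm, Finset.sum_comm]
  have : ∀ σ : L ≃ₐ[K] L, ∑ i ∈ Finset.range ℓ, ∑ j ∈ Finset.range ℓ,
      σ x * ((α / σ α) ^ i * (β / σ β) ^ j) = if σ = 1 then (ℓ : L) ^ 2 * x else 0 := by
    intro σ
    rw [Finset.sum_congr rfl fun i _ => (Finset.mul_sum _ _ _).symm, ← Finset.mul_sum]
    rw [Finset.sum_congr rfl fun i _ => (Finset.mul_sum _ _ _).symm, ← Finset.sum_mul]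
    rw [H.sum_root α _ hα a H.ha (by rw [← map_pow, H.ha]; simp),
      H.sum_root β _ hβ b H.hb (by rw [← map_pow, H.hb]; simp)]
    by_cases h1 : σ = 1
    · subst h1; simp; ring
    · rw [if_neg h1]
      by_cases h2 : σ α = α
      · have h3 : σ β ≠ β := fun h3 => h1 (H.gal σ 1 (by simpa using h2) (by simpa using h3))
        simp [h3]
      · simp [h2]
  rw [Finset.sum_congr rfl fun σ _ => this σ]
  simp
variable {R : Type*} [CommRing R] [IsDedekindDomain R] [Algebra R K] [IsFractionRing R K]
   [Algebra R L] [IsScalarTower R K L]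
lemma KumD.int_repr (H : KumD K L ℓ ω a b α β) (r s l : R) (hr : a * ϖ R K r = 1)
    (hs : b * ϖ R K s = 1) (hl : (ℓ:K) * ϖ R K l = 1) (x : L) (hx : IsIntegral R x) :
    ∃ c : ℕ → ℕ → R, x = ∑ i ∈ Finset.range ℓ, ∑ j ∈ Finset.range ℓ, ϖ R L (c i j) * (α ^ i * β ^ j) := by
  have ha0 : a ≠ 0 := by rintro rfl; simp at hr
  have hb0 : b ≠ 0 := by rintro rfl; simp at hs
  have hα : α ≠ 0 := by
    rintro rfl; have := H.ha; rw [zero_pow H.prime.ne_zero] at this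
    exact ha0 (by simpa using this.symm)
  have hβ : β ≠ 0 := by
    rintro rfl; have := H.hb; rw [zero_pow H.prime.ne_zero] at this
    exact hb0 (by simpa using this.symm)
  have hia : IsIntegral R α⁻¹ := by
    refine IsIntegral.of_pow H.prime.pos ?_
    rw [inv_pow, H.ha, ← map_inv₀, inv_eq_of_mul_eq_one_right hr, ← IsScalarTower.algebraMap_apply]
    exact isIntegral_algebraMap
  have hib : IsIntegral R β⁻¹ := by
    refine IsIntegral.of_pow H.prime.pos ?_
    rw [inv_pow, H.hb, ← map_inv₀, inv_eq_of_mul_eq_one_right hs, ← IsScalarTower.algebraMap_apply]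
    exact isIntegral_algebraMap
  have : ∀ i j, ∃ c : R, ϖ R K c = Algebra.trace K L (x * α⁻¹ ^ i * β⁻¹ ^ j) := fun i j =>
    IsIntegrallyClosed.isIntegral_iff.1 (Algebra.isIntegral_trace ((hx.mul (hia.pow i)).mul (hib.pow j)))
  choose c hc using this
  refine ⟨fun i j => l ^ 2 * c i j, ?_⟩
  have h := H.repr hα hβ x
  have hl' : (ℓ:L) * ϖ R L l = 1 := by
    have := congrArg (ϖ K L) hl
    rwa [map_mul, ← IsScalarTower.algebraMap_apply, map_natCast, map_one] at this
  have h2 : x = ϖ R L l ^ 2 * ((ℓ:L)^2 * x) := by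
    rw [← mul_assoc, ← mul_pow, mul_comm _ (ℓ:L), hl']; simp
  rw [h2, ← h, Finset.mul_sum]
  refine Finset.sum_congr rfl fun i _ => ?_
  rw [Finset.mul_sum]
  refine Finset.sum_congr rfl fun j _ => ?_
  rw [← hc, ← IsScalarTower.algebraMap_apply, map_mul, map_pow]
  ring
def FrC (R : Type*) {L : Type*} [CommRing R] [Field L] [Algebra R L] (σ : L →+* L) (q : ℕ) (π : R) (x : L) : Prop :=
  IsIntegral R x ∧ IsIntegral R (σ x) ∧ ∃ s, IsIntegral R s ∧ σ x - x ^ q = ϖ R L π * s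
omit [IsDedekindDomain R] in
lemma FrC.mul {σ : L →+* L} {q : ℕ} {π : R} {x y : L} (hx : FrC R σ q π x) (hy : FrC R σ q π y) :
    FrC R σ q π (x * y) := by
  obtain ⟨hx, hx', s, hs, h⟩ := hx
  obtain ⟨hy, hy', t, ht, h'⟩ := hy
  refine ⟨hx.mul hy, by rw [map_mul]; exact hx'.mul hy', s * σ y + x ^ q * t, (hs.mul hy').add ((hx.pow q).mul ht), ?_⟩
  rw [map_mul, mul_pow]
  linear_combination σ y * h + x ^ q * h'
omit [IsDedekindDomain R] in
lemma FrC.add {σ : L →+* L} {p f : ℕ} (hp : p.Prime) {π r : R} (hr : (p : R) = π * r) {x y : L} (hx : FrC R σ (p ^ f) π x) (hy : FrC R σ (p ^ f) π y) :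
    FrC R σ (p ^ f) π (x + y) := by
  obtain ⟨hx, hx', s, hs, h⟩ := hx
  obtain ⟨hy, hy', t, ht, h'⟩ := hy
  obtain ⟨u, hu⟩ := exists_add_pow_prime_pow_eq hp (⟨x, hx⟩ : integralClosure R L) ⟨y, hy⟩ f
  have hu' := congrArg (fun z : integralClosure R L => (z : L)) hu
  simp only [AddMemClass.coe_add, SubmonoidClass.coe_pow, MulMemClass.coe_mul] at hu'
  have hp' : ((p : integralClosure R L) : L) = ϖ R L π * ϖ R L r := by
    rw [← map_mul, ← hr]; simp
  rw [hp'] at hu'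
  have hu2 : IsIntegral R (u : L) := u.2
  refine ⟨hx.add hy, by rw [map_add]; exact hx'.add hy', s + t - ϖ R L r * (x * y * u), (hs.add ht).sub (isIntegral_algebraMap.mul ((hx.mul hy).mul hu2)), ?_⟩
  rw [map_add, hu']
  linear_combination h + h'
lemma FrC.int (H : KumD K L ℓ ω a b α β) {r s l : R} (hr : a * ϖ R K r = 1)
    (hs : b * ϖ R K s = 1) (hl : (ℓ:K) * ϖ R K l = 1)
    {σ : L ≃ₐ[K] L} {p f : ℕ} (hp : p.Prime) {π r' : R} (hr' : (p : R) = π * r')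
    (hα : FrC R (σ : L →+* L) (p ^ f) π α) (hβ : FrC R (σ : L →+* L) (p ^ f) π β)
    (hR : ∀ c : R, π ∣ c - c ^ (p ^ f)) (x : L) (hx : IsIntegral R x) : FrC R (σ : L →+* L) (p ^ f) π x := by
  obtain ⟨c, rfl⟩ := H.int_repr r s l hr hs hl x hx
  have hσR : ∀ c : R, σ (ϖ R L c) = ϖ R L c := fun c => by
    rw [IsScalarTower.algebraMap_apply R K L]; simp
  have hc : ∀ c : R, FrC R (σ : L →+* L) (p ^ f) π (ϖ R L c) := by
    intro c
    obtain ⟨d, hd⟩ := hR c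
    refine ⟨isIntegral_algebraMap, ?_, ϖ R L d, isIntegral_algebraMap, ?_⟩
    · simp only [RingHom.coe_coe, hσR]; exact isIntegral_algebraMap
    · simp only [RingHom.coe_coe, hσR]; rw [← map_pow, ← map_sub, hd, map_mul]
  have hpow : ∀ y, FrC R (σ : L →+* L) (p ^ f) π y → ∀ n, FrC R (σ : L →+* L) (p ^ f) π (y ^ n) := by
    intro y hy n
    induction n with
    | zero => simpa using hc 1
    | succ n ih => rw [pow_succ]; exact ih.mul hy
  have hsum : ∀ (T : Finset ℕ) (g : ℕ → L), (∀ i ∈ T, FrC R (σ : L →+* L) (p ^ f) π (g i)) →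
      FrC R (σ : L →+* L) (p ^ f) π (∑ i ∈ T, g i) := by
    intro T g hg
    induction T using Finset.induction_on with
    | empty => simpa using hc 0
    | insert i T hi ih =>
      rw [Finset.sum_insert hi]
      exact FrC.add hp hr' (hg i (by simp)) (ih fun j hj => hg j (by simp [hj]))
  exact hsum _ _ fun i _ => hsum _ _ fun j _ => (hc _).mul ((hpow _ hα _).mul (hpow _ hβ _))
lemma FrC.gap {σ : L ≃ₐ[K] L} {q : ℕ} {π : R} (hq : 1 < q)
    (h : ∀ x, IsIntegral R x → FrC R (σ : L →+* L) q π x) (w : FinPlace L)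
    (hw : ∀ x, IsIntegral R x → w.val x ≤ 1) (x : L) (hx : IsIntegral R x) (hx1 : w.val x < 1) :
    w.val x ≤ w.val (ϖ R L π) := by
  have key : ∀ n : ℕ, IsIntegral R ((σ ^ n) x) ∧ ∃ s, IsIntegral R s ∧ (σ ^ n) x = x ^ (q ^ n) + ϖ R L π * s := by
    intro n
    induction n with
    | zero => exact ⟨by simpa using hx, 0, isIntegral_zero, by simp⟩
    | succ n ih =>
      obtain ⟨h0, s, hs, hs'⟩ := ih
      obtain ⟨h1, h2, t, ht, h3⟩ := h _ h0
      have e1 : (σ ^ (n+1)) x = σ ((σ ^ n) x) := by rw [pow_succ']; rfl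
      obtain ⟨u, hu⟩ := sub_dvd_pow_sub_pow (⟨(σ ^ n) x, h0⟩ : integralClosure R L) ⟨x ^ q ^ n, hx.pow _⟩ q
      have hu' := congrArg (fun z : integralClosure R L => (z : L)) hu
      simp only [AddSubgroupClass.coe_sub, SubmonoidClass.coe_pow, MulMemClass.coe_mul] at hu'
      have hu2 : IsIntegral R (u : L) := u.2
      refine ⟨by rw [e1]; exact h2, s * u + t, (hs.mul hu2).add ht, ?_⟩
      rw [e1, pow_succ, pow_mul]
      simp only [RingHom.coe_coe] at h3
      have h5 : (σ ^ n) x - x ^ q ^ n = ϖ R L π * s := by rw [hs']; ring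
      linear_combination h3 + hu' + u * h5
  obtain ⟨N, hN, hN'⟩ := (isOfFinOrder_of_finite σ).exists_pow_eq_one
  obtain ⟨-, s, hs, h1⟩ := key N
  rw [hN'] at h1
  simp only [AlgEquiv.one_apply] at h1
  by_contra! hlt
  have h2 : w.val (x ^ q ^ N) < w.val x := by
    rcases eq_or_ne (w.val x) 0 with h0 | h0
    · simp [h0] at hlt
    rw [map_pow]
    calc w.val x ^ q ^ N ≤ w.val x ^ 2 := by
          apply pow_le_pow_right_of_le_one' hx1.le
          calc 2 ≤ q := hq
            _ ≤ q ^ N := Nat.le_self_pow hN.ne' q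
      _ = w.val x * w.val x := sq _
      _ < w.val x * 1 := (mul_lt_mul_iff_right₀ (zero_lt_iff.2 h0)).2 hx1
      _ = w.val x := mul_one _
  have h3 : w.val (ϖ R L π * s) < w.val x := by
    rw [map_mul]; exact (mul_le_of_le_one_right' (hw s hs)).trans_lt hlt
  have h4 := (w.val.map_add (x ^ q ^ N) (ϖ R L π * s)).trans_lt (max_lt h2 h3)
  rw [← h1] at h4
  exact lt_irrefl _ h4
end Fr2
section Fr3
open IsDedekindDomain
lemma FinPlace.int_le {L : Type*} [Field L] {R : Type*} [CommRing R] [Algebra R L] (w : FinPlace L)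
    (hw : ∀ r : R, w.val (ϖ R L r) ≤ 1) (x : L) (hx : IsIntegral R x) : w.val x ≤ 1 := by
  let φ : R →+* w.val.valuationSubring := (ϖ R L).codRestrict w.val.valuationSubring hw
  have h := IsIntegral.map_of_comp_eq φ (RingHom.id L) (by ext; rfl) hx
  obtain ⟨y, hy⟩ := IsIntegrallyClosed.isIntegral_iff.1 h
  have : x = (y : L) := hy.symm
  rw [this]; exact y.2
lemma frob_place {L : Type*} [Field L] {R : Type*} [CommRing R] [Algebra R L]
    [IsDedekindDomain (integralClosure R L)] [IsFractionRing (integralClosure R L) L]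
    [Algebra K L] [FiniteDimensional K L] [IsGalois K L] [Algebra R K] [IsScalarTower R K L]
    [IsDedekindDomain R] [IsFractionRing R K]
    {σ : L ≃ₐ[K] L} {q : ℕ} {π : R} (hq : 1 < q)
    (h : ∀ x, IsIntegral R x → FrC R (σ : L →+* L) q π x) (w : FinPlace L)
    (hw : ∀ r : R, w.val (ϖ R L r) ≤ 1) (hπ : w.val (ϖ R L π) < 1) :
    w.val (ϖ R L π) = WithZero.exp (-1) ∧
    ∀ x, w.val x ≤ 1 → w.val (σ x - x ^ q) < 1 := by
  have hw' := fun x => w.int_le hw x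
  obtain ⟨P, rfl⟩ := w.eq_plc (A := integralClosure R L) (fun a => hw' _ a.2)
  constructor
  · obtain ⟨x, hx⟩ := (plc L P).surj (WithZero.exp (-1))
    have hlt : WithZero.exp (-1) < (1 : WithZero (Multiplicative ℤ)) := by
      rw [← WithZero.exp_zero, WithZero.exp_lt_exp]; norm_num
    obtain ⟨s, t, ht, rfl⟩ := plc_frac P x (by change (plc L P).val x ≤ 1; rw [hx]; exact hlt.le)
    rw [map_div₀, (plc_eq_one_iff P t).2 ht, div_one] at hx
    have h1 := FrC.gap hq h _ hw' (ϖ _ L s) s.2 (by rw [hx]; exact hlt)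
    rw [hx] at h1
    refine le_antisymm ?_ h1
    rcases eq_or_ne ((plc L P).val (ϖ R L π)) 0 with h0 | h0
    · rw [h0]; exact zero_le'
    rw [← WithZero.exp_log h0, ← WithZero.exp_zero, WithZero.exp_lt_exp] at hπ
    rw [← WithZero.exp_log h0, WithZero.exp_le_exp]
    omega
  · have hc : ∀ x : integralClosure R L, (plc L P).val (σ x - (x : L) ^ q) < 1 := by
      intro x
      obtain ⟨-, -, s, hs, h1⟩ := h x x.2
      simp only [RingHom.coe_coe] at h1
      rw [h1, map_mul]
      exact (mul_le_of_le_one_right' (hw' s hs)).trans_lt hπ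
    intro x hx
    obtain ⟨s, t, ht, rfl⟩ := plc_frac P x hx
    have e : ∀ x : integralClosure R L, ϖ _ L x = (x : L) := fun _ => rfl
    simp only [e] at hx ⊢
    have ht1 : (plc L P).val (t : L) = 1 := (plc_eq_one_iff P t).2 ht
    have hst : (plc L P).val (σ t) = 1 := by
      have := Valuation.map_add_eq_of_lt_right (plc L P).val (x := σ t - (t:L)^q) (y := (t:L)^q) (by
        rw [map_pow, ht1, one_pow]; exact hc t)
      rw [sub_add_cancel] at this
      rw [this, map_pow, ht1, one_pow]
    have hst0 : σ (t:L) ≠ 0 := by intro h; rw [h] at hst; simp at hst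
    have ht0 : (t:L) ≠ 0 := by intro h; rw [h] at ht1; simp at ht1
    have : σ ((s:L) / t) - ((s:L)/t)^q = ((σ s - (s:L)^q) * (t:L)^q - (s:L)^q * (σ t - (t:L)^q)) / (σ t * (t:L)^q) := by
      rw [map_div₀, div_pow]; field_simp; ring
    rw [this, map_div₀, map_mul, hst, map_pow, ht1, one_pow, mul_one, div_one]
    refine (Valuation.map_sub _ _ _).trans_lt (max_lt ?_ ?_)
    · rw [map_mul, map_pow, ht1, one_pow, mul_one]; exact hc s
    · rw [map_mul]
      exact (mul_le_of_le_one_left' (hw' _ ((s.2 : IsIntegral R (s:L)).pow q))).trans_lt (hc t)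
lemma prim_dvd (v : FinPlace K) [Finite (IsLocalRing.ResidueField v.val.valuationSubring)] {ℓ : ℕ} {ω : K}
    (hp : ℓ.Prime) (hω : IsPrimitiveRoot ω ℓ) (hl : v.val (ℓ : K) = 1) : ℓ ∣ resCard v - 1 := by
  let R := v.val.valuationSubring
  have hω1 : v.val ω = 1 := by
    have := congrArg v.val hω.pow_eq_one
    rw [map_pow, map_one] at this
    exact (pow_eq_one_iff.1 this).resolve_right hp.ne_zero
  let o : R := ⟨ω, hω1.le⟩
  let κ := IsLocalRing.ResidueField R
  have ho : IsPrimitiveRoot o ℓ := by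
    apply IsPrimitiveRoot.of_map_of_injective (f := ϖ R K) _ (IsFractionRing.injective R K)
    exact hω
  have hlκ : (ℓ : κ) ≠ 0 := by
    intro h
    have h2 : (IsLocalRing.residue R) (ℓ : R) = 0 := by rw [map_natCast]; exact h
    rw [IsLocalRing.residue_eq_zero_iff, Valuation.mem_maximalIdeal_iff] at h2
    have : ((ℓ : R) : K) = ℓ := by simp
    rw [this, hl] at h2
    exact lt_irrefl _ h2
  have hroot : Polynomial.eval o (Polynomial.cyclotomic ℓ R) = 0 :=
    ho.isRoot_cyclotomic hp.pos
  have hroot2 : Polynomial.eval (IsLocalRing.residue R o) (Polynomial.cyclotomic ℓ κ) = 0 := by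
    rw [← Polynomial.map_cyclotomic ℓ (IsLocalRing.residue R), Polynomial.eval_map, Polynomial.eval₂_at_apply, hroot, map_zero]
  haveI := Fact.mk hp
  have hne : IsLocalRing.residue R o ≠ 1 := by
    intro h
    rw [h, Polynomial.eval_one_cyclotomic_prime] at hroot2
    exact hlκ hroot2
  have hpow : IsLocalRing.residue R o ^ ℓ = 1 := by rw [← map_pow, ho.pow_eq_one, map_one]
  have hord := orderOf_eq_prime hpow hne
  letI : Fintype κ := Fintype.ofFinite κ
  have h0 : IsLocalRing.residue R o ≠ 0 := by intro h; rw [h, zero_pow hp.ne_zero] at hpow; exact zero_ne_one hpow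
  have := FiniteField.pow_card_sub_one_eq_one _ h0
  rw [← orderOf_dvd_iff_pow_eq_one, hord] at this
  rwa [resCard, Nat.card_eq_fintype_card]
set_option maxHeartbeats 1000000 in
theorem frob_main {L : Type*} [Field L] [Algebra K L] [FiniteDimensional K L] [IsGalois K L]
    {ℓ : ℕ} {ω a b : K} {α β : L} (H : KumD K L ℓ ω a b α β) (v : FinPlace K)
    [Finite (IsLocalRing.ResidueField v.val.valuationSubring)]
    (ha : v.val a = 1) (hb : v.val b = 1) (hl : v.val (ℓ : K) = 1) (i j : ℕ) (σ : L ≃ₐ[K] L)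
    (hi : v.val (a ^ ((resCard v - 1) / ℓ) - ω ^ i) < 1)
    (hj : v.val (b ^ ((resCard v - 1) / ℓ) - ω ^ j) < 1)
    (hσi : σ α = ϖ K L ω ^ i * α) (hσj : σ β = ϖ K L ω ^ j * β) :
    UnramifiedIn v L ∧ IsFrobeniusAt v σ := by
  have hdvd := prim_dvd v H.prime H.prim hl
  let R := v.val.valuationSubring
  let κ := IsLocalRing.ResidueField R
  letI : Fintype κ := Fintype.ofFinite κ
  haveI : IsDedekindDomain (integralClosure R L) := integralClosure.isDedekindDomain R K L
  haveI : IsFractionRing (integralClosure R L) L := integralClosure.isFractionRing_of_finite_extension K L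
  obtain ⟨p, hpc⟩ := CharP.exists κ
  obtain ⟨f, hp, hf⟩ := FiniteField.card κ p
  have hq : resCard v = p ^ (f : ℕ) := by rw [resCard, Nat.card_eq_fintype_card]; exact hf
  have hq1 : 1 < resCard v := by rw [resCard, Nat.card_eq_fintype_card]; exact Fintype.one_lt_card
  obtain ⟨π0, hπ0⟩ := v.surj (WithZero.exp (-1))
  have hlt : WithZero.exp (-1) < (1 : WithZero (Multiplicative ℤ)) := by
    rw [← WithZero.exp_zero, WithZero.exp_lt_exp]; norm_num
  have hπn : π0 ≠ 0 := by rintro rfl; rw [map_zero] at hπ0; exact WithZero.exp_ne_zero hπ0.symm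
  let π : R := ⟨π0, by change v.val π0 ≤ 1; rw [hπ0]; exact hlt.le⟩
  have hdiv : ∀ r : R, v.val (r : K) < 1 → π ∣ r := by
    intro r hr
    refine ⟨⟨r / π0, ?_⟩, ?_⟩
    · change v.val _ ≤ 1
      rw [map_div₀, hπ0]
      rcases eq_or_ne (v.val (r:K)) 0 with h0 | h0
      · rw [h0]; simp
      rw [← WithZero.exp_log h0, ← WithZero.exp_zero, WithZero.exp_lt_exp] at hr
      rw [← WithZero.exp_log h0, ← WithZero.exp_sub, ← WithZero.exp_zero, WithZero.exp_le_exp]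
      omega
    · ext; simp [π]; field_simp
  have hres : ∀ r : R, IsLocalRing.residue R r = 0 → π ∣ r := by
    intro r hr
    rw [IsLocalRing.residue_eq_zero_iff, Valuation.mem_maximalIdeal_iff] at hr
    exact hdiv r hr
  obtain ⟨r', hr'⟩ := hres (p : R) (by rw [map_natCast]; exact CharP.cast_eq_zero κ p)
  have hR : ∀ c : R, π ∣ c - c ^ (p ^ (f:ℕ)) := by
    intro c
    apply hres
    rw [map_sub, map_pow, ← hf, FiniteField.pow_card, sub_self]
  have hω1 : v.val ω = 1 := by
    have := congrArg v.val H.prim.pow_eq_one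
    rw [map_pow, map_one] at this
    exact (pow_eq_one_iff.1 this).resolve_right H.prime.ne_zero
  have hgen : ∀ (c : K) (γ : L) (n : ℕ), v.val c = 1 → γ ^ ℓ = ϖ K L c →
      v.val (c ^ ((resCard v - 1) / ℓ) - ω ^ n) < 1 → σ γ = ϖ K L ω ^ n * γ →
      FrC R (σ : L →+* L) (p ^ (f:ℕ)) π γ := by
    intro c γ n hc hγ hn hσ
    have hI : IsIntegral R γ := by
      refine IsIntegral.of_pow H.prime.pos ?_
      rw [hγ]
      exact isIntegral_algebraMap (R := R) (x := ⟨c, hc.le⟩)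
    have hIo : IsIntegral R (ϖ K L ω) := isIntegral_algebraMap (R := R) (x := ⟨ω, hω1.le⟩)
    refine ⟨hI, by simp only [RingHom.coe_coe, hσ]; exact (hIo.pow n).mul hI, ?_⟩
    obtain ⟨t, ht⟩ := hdiv ⟨c ^ ((resCard v - 1) / ℓ) - ω ^ n, hn.le⟩ hn
    have ht' := congrArg (fun z : R => ϖ R L z) ht
    have e0 : ∀ z : R, ϖ R L z = ϖ K L (z : K) := fun _ => rfl
    refine ⟨- ϖ R L t * γ, (isIntegral_algebraMap.neg).mul hI, ?_⟩
    have e2 : γ ^ (p ^ (f:ℕ)) = γ * ϖ K L (c ^ ((resCard v - 1) / ℓ)) := by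
      rw [map_pow, ← hγ, ← pow_mul, Nat.mul_div_cancel' hdvd, ← pow_succ', hq]
      congr 1
      have := hp.pos
      have : 0 < p ^ (f:ℕ) := by positivity
      omega
    simp only [map_mul] at ht'
    rw [e0] at ht'
    simp only [map_sub, map_pow] at ht'
    simp only [RingHom.coe_coe]
    rw [hσ, e2, map_pow]
    linear_combination (-γ) * ht'
  have hall : ∀ x, IsIntegral R x → FrC R (σ : L →+* L) (resCard v) π x := by
    intro x hx
    rw [hq]
    have hinv : ∀ c : K, v.val c = 1 → ∃ r : R, c * ϖ R K r = 1 := by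
      intro c hc
      refine ⟨⟨c⁻¹, ?_⟩, ?_⟩
      · change v.val c⁻¹ ≤ 1; rw [map_inv₀, hc]; simp
      · apply mul_inv_cancel₀; rintro rfl; simp at hc
    obtain ⟨r, hr⟩ := hinv a ha
    obtain ⟨s, hs⟩ := hinv b hb
    obtain ⟨l, hl⟩ := hinv _ hl
    exact FrC.int H hr hs hl hp hr' (hgen a α i ha H.ha hi hσi) (hgen b β j hb H.hb hj hσj) hR x hx
  have e0 : ∀ z : R, ϖ R L z = ϖ K L (z : K) := fun _ => rfl
  constructor
  · intro w e he hw
    have h1 := (frob_place hq1 hall w (fun r => by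
      rw [e0, hw]; exact pow_le_one' r.2 e) (by
      rw [e0, hw]; change v.val π0 ^ e < 1
      rw [hπ0]; exact pow_lt_one' hlt he.ne')).1
    rw [e0, hw] at h1
    change v.val π0 ^ e = _ at h1
    rw [hπ0, ← WithZero.exp_nsmul, WithZero.exp_inj] at h1
    simp at h1
    exact h1
  · have hne : Ideal.span {(ϖ R (integralClosure R L) π)} ≠ ⊤ := by
      rw [Ne, Ideal.span_singleton_eq_top]
      rintro ⟨u, hu⟩
      have h1 : (((u⁻¹ : (integralClosure R L)ˣ) : integralClosure R L) : L) = ϖ K L (π0⁻¹) := by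
        have h2 : (u : integralClosure R L) * ((u⁻¹ : (integralClosure R L)ˣ)) = 1 := u.mul_inv
        have h3 := congrArg (fun z : integralClosure R L => (z : L)) h2
        simp only [MulMemClass.coe_mul, hu] at h3
        have h4 : ϖ K L π0 * (((u⁻¹ : (integralClosure R L)ˣ) : integralClosure R L) : L) = 1 := h3
        rw [map_inv₀]; exact eq_inv_of_mul_eq_one_right h4
      have h2 : IsIntegral R (ϖ K L π0⁻¹) := h1 ▸ ((u⁻¹ : (integralClosure R L)ˣ) : integralClosure R L).2
      rw [isIntegral_algebraMap_iff (ϖ K L).injective] at h2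
      obtain ⟨y, hy⟩ := IsIntegrallyClosed.isIntegral_iff.1 h2
      have h3 : v.val π0⁻¹ ≤ 1 := by rw [← hy]; exact y.2
      rw [map_inv₀, hπ0, ← WithZero.exp_neg, ← WithZero.exp_zero, WithZero.exp_le_exp] at h3
      norm_num at h3
    obtain ⟨M, hM, hM'⟩ := Ideal.exists_le_maximal _ hne
    have hπM : ϖ R (integralClosure R L) π ∈ M := hM' (Ideal.mem_span_singleton_self _)
    let P : ℌ (integralClosure R L) := ⟨M, hM.isPrime, by
      intro h
      rw [h, Ideal.mem_bot] at hπM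
      have h2 := congrArg (fun z : integralClosure R L => (z : L)) hπM
      have h3 : ϖ K L π0 = 0 := h2
      exact hπn (by simpa using h3)⟩
    have hPR : ∀ r : R, (plc L P).val (ϖ R L r) ≤ 1 := fun r =>
      plc_le_one P (ϖ R (integralClosure R L) r)
    have hPπ : (plc L P).val (ϖ R L π) < 1 := (plc_lt_one_iff (K := L) P (ϖ R (integralClosure R L) π)).2 hπM
    obtain ⟨h1, h2⟩ := frob_place hq1 hall (plc L P) hPR hPπ
    refine ⟨plc L P, fun x => ?_, h2⟩
    by_cases hx : x = 0
    · simp [hx]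
    have hunit : ∀ y : K, v.val y = 1 → (plc L P).val (ϖ K L y) = 1 := by
      intro y hy
      have hy0 : y ≠ 0 := by rintro rfl; simp at hy
      have h3 : (plc L P).val (ϖ K L y) ≤ 1 := hPR ⟨y, hy.le⟩
      have h4 : (plc L P).val (ϖ K L y⁻¹) ≤ 1 :=
        hPR ⟨y⁻¹, by change v.val y⁻¹ ≤ 1; rw [map_inv₀, hy]; simp⟩
      rw [map_inv₀, map_inv₀] at h4
      refine le_antisymm h3 ?_
      have h6 : (plc L P).val (ϖ K L y) ≠ 0 := by
        rw [Ne, map_eq_zero, map_eq_zero]; exact hy0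
      exact (inv_le_one₀ (zero_lt_iff.2 h6)).1 h4
    have hv0 : v.val x ≠ 0 := by simpa using hx
    set n := WithZero.log (v.val x) with hn
    have hvx : v.val x = WithZero.exp n := (WithZero.exp_log hv0).symm
    have h3 := hunit (x * π0 ^ n) (by
      rw [map_mul, map_zpow₀, hvx, hπ0, ← WithZero.exp_zsmul, ← WithZero.exp_add]; simp)
    have h5 : (plc L P).val (ϖ K L π0) = WithZero.exp (-1) := h1
    rw [map_mul, map_mul, map_zpow₀, map_zpow₀, h5, ← WithZero.exp_zsmul] at h3
    rw [eq_inv_of_mul_eq_one_left h3, hvx, ← WithZero.exp_neg]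
    simp
end Fr3
section Fr4
open IsDedekindDomain
lemma kum_root {E : Type*} [Field E] [Algebra K E] {ℓ : ℕ} {ω : K} (hp : ℓ.Prime) (hω : IsPrimitiveRoot ω ℓ)
    {a : K} (ha : a ≠ 0) {x y : E} (hx : x ^ ℓ = ϖ K E a) (hy : y ^ ℓ = ϖ K E a) :
    ∃ i, y = ϖ K E ω ^ i * x := by
  have hx0 : x ≠ 0 := by
    rintro rfl; rw [zero_pow hp.ne_zero] at hx; exact ha (by simpa using hx.symm)
  have h1 : (y / x) ^ ℓ = 1 := by rw [div_pow, hx, hy, div_self]; simpa using ha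
  haveI : NeZero ℓ := ⟨hp.ne_zero⟩
  obtain ⟨i, -, hi⟩ := (hω.map_of_injective (ϖ K E).injective).eq_pow_of_pow_eq_one h1
  exact ⟨i, by rw [hi]; field_simp⟩
variable {ℓ : ℕ} {ω a b : K} {α β : AlgebraicClosure K}
lemma kum_setup (hp : ℓ.Prime) (hω : IsPrimitiveRoot ω ℓ) (hl : (ℓ : K) ≠ 0) (ha : a ≠ 0) (hb : b ≠ 0)
    (hα : α ^ ℓ = ϖ K _ a) (hβ : β ^ ℓ = ϖ K _ b) :
    FiniteDimensional K (adjoin K {α, β}) ∧ IsGalois K (adjoin K {α, β}) ∧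
    KumD K (adjoin K {α, β}) ℓ ω a b ⟨α, subset_adjoin K _ (by simp)⟩ ⟨β, subset_adjoin K _ (by simp)⟩ := by
  have hI : ∀ x : AlgebraicClosure K, IsIntegral K x := fun x => Algebra.IsIntegral.isIntegral x
  have hfd : FiniteDimensional K (adjoin K {α, β}) :=
    finiteDimensional_adjoin fun x _ => hI x
  refine ⟨hfd, ?_, ?_⟩
  · have hsep : ∀ x : AlgebraicClosure K, ∀ c : K, c ≠ 0 → x ^ ℓ = ϖ K _ c → IsSeparable K x := by
      intro x c hc hx
      refine Polynomial.Separable.of_dvd (Polynomial.separable_X_pow_sub_C c hl hc) (minpoly.dvd K x ?_)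
      simp [hx]
    haveI : Algebra.IsSeparable K (adjoin K {α, β}) := by
      rw [isSeparable_adjoin_iff_isSeparable]
      rintro x (rfl | rfl)
      · exact hsep _ a ha hα
      · exact hsep _ b hb hβ
    haveI : Normal K (adjoin K {α, β}) := by
      rw [IntermediateField.normal_iff_forall_map_le]
      intro σ
      rw [adjoin_map, adjoin_le_iff]
      rintro _ ⟨x, hx, rfl⟩
      have hω' : ∀ i : ℕ, ϖ K (AlgebraicClosure K) ω ^ i ∈ adjoin K {α, β} := fun i =>
        pow_mem (IntermediateField.algebraMap_mem _ _) i
      rcases hx with rfl | rfl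
      · obtain ⟨i, hi⟩ := kum_root hp hω ha hα (y := σ x) (by rw [← map_pow, hα]; simp)
        change σ x ∈ _
        rw [hi]; exact mul_mem (hω' i) (subset_adjoin K _ (by simp))
      · obtain ⟨i, hi⟩ := kum_root hp hω hb hβ (y := σ x) (by rw [← map_pow, hβ]; simp)
        change σ x ∈ _
        rw [hi]; exact mul_mem (hω' i) (subset_adjoin K _ (by simp))
    exact ⟨⟩
  · refine ⟨hp, hω, Subtype.ext hα, Subtype.ext hβ, fun σ τ h1 h2 => ?_⟩
    have : (σ : adjoin K {α, β} →ₐ[K] adjoin K {α, β}) = (τ : adjoin K {α, β} →ₐ[K] adjoin K {α, β}) := by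
      refine IntermediateField.algHom_ext_of_eq_adjoin (S := adjoin K {α, β}) (s := {α, β}) _ rfl ?_
      rintro x (rfl | rfl)
      · exact h1
      · exact h2
    ext x
    exact congrArg Subtype.val (DFunLike.congr_fun this x)
theorem frob_final (hp : ℓ.Prime) (hω : IsPrimitiveRoot ω ℓ) (hl : (ℓ : K) ≠ 0) (ha : a ≠ 0) (hb : b ≠ 0)
    (hα : α ^ ℓ = ϖ K _ a) (hβ : β ^ ℓ = ϖ K _ b)
    (σ : adjoin K {α, β} ≃ₐ[K] adjoin K {α, β}) :
    ∃ i j : ℕ, ∀ v : FinPlace K, Finite (IsLocalRing.ResidueField v.val.valuationSubring) →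
      v.val a = 1 → v.val b = 1 → v.val (ℓ : K) = 1 →
      v.val (a ^ ((resCard v - 1) / ℓ) - ω ^ i) < 1 → v.val (b ^ ((resCard v - 1) / ℓ) - ω ^ j) < 1 →
      UnramifiedIn v (adjoin K {α, β}) ∧ IsFrobeniusAt v σ := by
  obtain ⟨h1, h2, h3⟩ := kum_setup hp hω hl ha hb hα hβ
  obtain ⟨i, hi⟩ := kum_root hp hω ha h3.ha (y := σ ⟨α, subset_adjoin K _ (by simp)⟩)
    (by rw [← map_pow, h3.ha]; simp)
  obtain ⟨j, hj⟩ := kum_root hp hω hb h3.hb (y := σ ⟨β, subset_adjoin K _ (by simp)⟩)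
    (by rw [← map_pow, h3.hb]; simp)
  refine ⟨i, j, fun v hf va vb vl vi vj => ?_⟩
  exact frob_main h3 v va vb vl i j σ vi vj hi hj
end Fr4
section LS
open MeasureTheory Module Set
open scoped Pointwise
variable {E : Type*} [NormedAddCommGroup E] [NormedSpace ℝ E] [FiniteDimensional ℝ E]
  [MeasurableSpace E] [BorelSpace E] (μ : Measure E) [μ.IsAddHaarMeasure]
  (Λ : Submodule ℤ E) [DiscreteTopology Λ] [IsZLattice ℝ Λ]
lemma ls_finite (R : ℝ) : {x : Λ | ‖(x : E)‖ ≤ R}.Finite := by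
  have h : (Metric.closedBall (0:E) R ∩ (Λ : Set E)).Finite := by
    refine Metric.finite_isBounded_inter_isClosed DiscreteTopology.isDiscrete Metric.isBounded_closedBall ?_
    change IsClosed (Λ.toAddSubgroup : Set E)
    exact AddSubgroup.isClosed_of_discrete
  refine Set.Finite.of_finite_image (f := Subtype.val) (h.subset ?_) Subtype.val_injective.injOn
  rintro _ ⟨x, hx, rfl⟩
  exact ⟨by simpa using hx, x.2⟩
lemma ls_dom : ∃ (D : Set E) (ρ : ℝ), 0 < ρ ∧ IsAddFundamentalDomain Λ D μ ∧ MeasurableSet D ∧ D ⊆ Metric.ball 0 ρ := by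
  have b := Module.Free.chooseBasis ℤ Λ
  obtain ⟨ρ, hρ, h⟩ := (ZSpan.fundamentalDomain_isBounded (b.ofZLatticeBasis ℝ Λ)).subset_ball_lt 0 0
  exact ⟨_, ρ, hρ, ZLattice.isAddFundamentalDomain b μ, ZSpan.fundamentalDomain_measurableSet _, h⟩
lemma ls_card (R : ℝ) (hR : 0 < R) : ∃ C : ℝ, ∀ ε > 0, ε ≤ R →
    ((ls_finite Λ (R / ε)).toFinset.card : ℝ) ≤ C / ε ^ finrank ℝ E := by
  obtain ⟨D, ρ, hρ, hD, hDm, hDρ⟩ := ls_dom (Measure.addHaar) Λ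
  set μ : Measure E := Measure.addHaar
  have hfin : ∀ r, μ (Metric.closedBall 0 r) ≠ ⊤ := fun r => measure_closedBall_lt_top.ne
  have hDf : μ D ≠ ⊤ := measure_ne_top_of_subset (hDρ.trans Metric.ball_subset_closedBall) (hfin ρ)
  have hD0 : 0 < μ.real D := by
    rw [← ZLattice.covolume_eq_measure_fundamentalDomain Λ μ hD]
    exact ZLattice.covolume_pos Λ μ
  refine ⟨(μ.real (Metric.closedBall 0 (R + ρ * R))) / μ.real D, fun ε hε hεR => ?_⟩
  set T := (ls_finite Λ (R / ε)).toFinset with hT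
  have h1 : (T.card : ℝ) * μ.real D = μ.real (⋃ x ∈ T, (x +ᵥ D)) := by
    have hv : ∀ b : Λ, μ (b +ᵥ D) = μ D := fun b => measure_vadd μ (b:E) D
    rw [measureReal_biUnion_finset₀ (h := fun b _ => by rw [hv]; exact hDf)]
    · simp [measureReal_def, hv]
    · intro x _ y _ hxy
      exact hD.aedisjoint hxy
    · intro x _; exact (hDm.const_vadd x).nullMeasurableSet
  have h2 : (⋃ x ∈ T, (x +ᵥ D)) ⊆ Metric.closedBall 0 ((R + ρ * R) / ε) := by
    intro y hy
    simp only [mem_iUnion] at hy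
    obtain ⟨x, hx, d, hd, rfl⟩ := hy
    simp only [hT, Set.Finite.mem_toFinset, mem_ofPred_eq] at hx
    have := hDρ hd
    rw [mem_ball_zero_iff] at this
    rw [mem_closedBall_zero_iff]
    change ‖(x : E) + d‖ ≤ _
    refine (norm_add_le _ _).trans ?_
    rw [add_div]
    have : ρ ≤ ρ * R / ε := by rw [le_div_iff₀ hε]; gcongr
    linarith
  have h3 := measureReal_mono h2 (hfin _)
  rw [← h1] at h3
  have h4 : μ.real (Metric.closedBall (0:E) ((R + ρ * R) / ε)) = μ.real (Metric.closedBall 0 (R + ρ * R)) / ε ^ finrank ℝ E := by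
    rw [div_eq_inv_mul, measureReal_def, Measure.addHaar_closedBall_mul_of_pos _ _ (by positivity),
      ENNReal.toReal_mul, ENNReal.toReal_ofReal (by positivity), measureReal_def]
    rw [inv_pow]; ring
  rw [h4] at h3
  rw [div_right_comm, le_div_iff₀ hD0]
  exact h3
def LSc {F : Type*} [NormedAddCommGroup F] [NormedSpace ℝ F] (R : ℝ) (k : ℕ) (g : E → F) : Prop :=
  ∃ C : ℝ, 0 ≤ C ∧ ∀ ε > 0, ε ≤ R → ∀ x ∈ Metric.ball (0:E) R,
    ‖∑' l : Λ, g (ε • (x + l)) - (ε ^ finrank ℝ E * ZLattice.covolume Λ μ)⁻¹ • ∫ y, g y ∂μ‖ ≤ C * ε ^ k / ε ^ finrank ℝ E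
variable {F : Type*} [NormedAddCommGroup F] [NormedSpace ℝ F]
lemma ls_tsum {g : E → F} {R r : ℝ} (hr : 0 ≤ r) (h0 : ∀ y, r < ‖y‖ → g y = 0) {ε : ℝ} (hε : 0 < ε) (hεR : ε ≤ R) {x : E} (hx : x ∈ Metric.ball (0:E) R) :
    ∀ l : Λ, l ∉ (ls_finite Λ ((r + R * R) / ε)).toFinset → g (ε • (x + l)) = 0 := by
  intro l hl
  simp only [Set.Finite.mem_toFinset, mem_ofPred_eq, not_le] at hl
  apply h0
  rw [mem_ball_zero_iff] at hx
  rw [norm_smul, Real.norm_of_nonneg hε.le]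
  rw [div_lt_iff₀ hε] at hl
  have h1 : ‖(l:E)‖ ≤ ‖x + l‖ + ‖x‖ := by
    have := norm_sub_le (x + (l:E)) x; simpa using this
  have h2 : ε * ‖x‖ ≤ R * R := mul_le_mul hεR hx.le (norm_nonneg _) (hε.le.trans hεR)
  nlinarith
lemma ls_supp {g : E → F} (hs : HasCompactSupport g) : ∃ r, 0 ≤ r ∧ ∀ y, r < ‖y‖ → g y = 0 := by
  obtain ⟨r, hr⟩ := (hs.isCompact.isBounded).subset_closedBall 0
  refine ⟨max r 0, le_max_right _ _, fun y hy => ?_⟩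
  by_contra hne
  have := hr (subset_tsupport g hne)
  rw [mem_closedBall_zero_iff] at this
  have := le_max_left r 0
  linarith
lemma ls_zero {R : ℝ} (hR : 0 < R) {g : E → F} (hg : Continuous g) (hs : HasCompactSupport g) : LSc μ Λ R 0 g := by
  obtain ⟨r, hr, h0⟩ := ls_supp hs
  obtain ⟨B, hB⟩ := hg.bounded_above_of_compact_support hs
  have hB0 : 0 ≤ B := (norm_nonneg _).trans (hB 0)
  obtain ⟨C, hC⟩ := ls_card Λ (max R (r + R * R)) (by positivity)
  have hv := ZLattice.covolume_pos Λ μ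
  refine ⟨max 0 (C * B + (ZLattice.covolume Λ μ)⁻¹ * ‖∫ y, g y ∂μ‖), le_max_left _ _, fun ε hε hεR x hx => ?_⟩
  rw [tsum_eq_sum (s := (ls_finite Λ ((r + R * R) / ε)).toFinset) (ls_tsum Λ hr h0 hε hεR hx)]
  have h1 : ‖∑ l ∈ (ls_finite Λ ((r + R * R) / ε)).toFinset, g (ε • (x + l))‖ ≤ C / ε ^ finrank ℝ E * B := by
    refine (norm_sum_le _ _).trans ((Finset.sum_le_sum fun l _ => hB _).trans ?_)
    rw [Finset.sum_const, nsmul_eq_mul]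
    gcongr
    refine le_trans ?_ (hC ε hε (hεR.trans (le_max_left _ _)))
    gcongr
    exact le_max_right _ _
  refine (norm_sub_le _ _).trans ?_
  rw [norm_smul, norm_inv, Real.norm_of_nonneg (by positivity), pow_zero, mul_one]
  calc _ ≤ C / ε ^ finrank ℝ E * B + (ε ^ finrank ℝ E * ZLattice.covolume Λ μ)⁻¹ * ‖∫ y, g y ∂μ‖ := by gcongr
    _ = (C * B + (ZLattice.covolume Λ μ)⁻¹ * ‖∫ y, g y ∂μ‖) / ε ^ finrank ℝ E := by
      rw [mul_inv]; ring
    _ ≤ _ := by gcongr; exact le_max_right _ _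
lemma ls_intfd [CompleteSpace F] {g : E → F} (hg : ContDiff ℝ 1 g) (hs : HasCompactSupport g) : ∫ y, fderiv ℝ g y ∂μ = 0 := by
  have hc : Continuous (fderiv ℝ g) := hg.continuous_fderiv one_ne_zero
  have hi : Integrable (fderiv ℝ g) μ := hc.integrable_of_hasCompactSupport (hs.fderiv ℝ)
  ext v
  rw [ContinuousLinearMap.integral_apply hi]
  have := integral_smul_fderiv_eq_neg_fderiv_smul_of_integrable (μ := μ) (𝕜 := ℝ) (f := fun _ : E => (1:ℝ)) (g := g) (v := v) (by simp)
    (by simpa using hi.apply_continuousLinearMap v) (by simpa using hg.continuous.integrable_of_hasCompactSupport hs)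
    (fun _ _ => by fun_prop) (fun x _ => (hg.differentiable one_ne_zero) x)
  simpa using this
lemma ls_step [CompleteSpace F] {R : ℝ} (hR : 0 < R) {D : Set E} (hD : IsAddFundamentalDomain Λ D μ) (hDm : MeasurableSet D)
    (hDR : D ⊆ Metric.ball 0 R) {g : E → F} (hg : ContDiff ℝ 1 g) (hs : HasCompactSupport g) {k : ℕ}
    (h : LSc μ Λ R k (fderiv ℝ g)) : LSc μ Λ R (k + 1) g := by
  obtain ⟨C, hC0, hC⟩ := h
  obtain ⟨r, hr, h0⟩ := ls_supp hs
  have h0' : ∀ y, r < ‖y‖ → fderiv ℝ g y = 0 := by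
    intro y hy
    have : g =ᶠ[nhds y] fun _ => 0 := by
      filter_upwards [(isOpen_lt continuous_const continuous_norm).mem_nhds hy] with z hz using h0 z hz
    rw [this.fderiv_eq]; simp
  have hv := ZLattice.covolume_pos Λ μ
  have hDv := ZLattice.covolume_eq_measure_fundamentalDomain Λ μ hD
  have hDf : μ D ≠ ⊤ := measure_ne_top_of_subset hDR measure_ball_lt_top.ne
  refine ⟨C * (2 * R), by positivity, fun ε hε hεR x hx => ?_⟩
  set T := (ls_finite Λ ((r + R * R) / ε)).toFinset with hT
  set G : E → F := fun x => ∑ l ∈ T, g (ε • (x + l)) with hG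
  rw [tsum_eq_sum (s := T) (ls_tsum Λ hr h0 hε hεR hx)]
  have hd : ∀ y ∈ Metric.ball (0:E) R, ‖ε • ∑ l ∈ T, fderiv ℝ g (ε • (y + l))‖ ≤ ε * (C * ε ^ k / ε ^ finrank ℝ E) := by
    intro y hy
    have := hC ε hε hεR y hy
    rw [tsum_eq_sum (s := T) (ls_tsum Λ hr h0' hε hεR hy), ls_intfd μ hg hs, smul_zero, sub_zero] at this
    rw [norm_smul, Real.norm_of_nonneg hε.le]
    gcongr
  have hder : ∀ y ∈ Metric.ball (0:E) R, HasFDerivWithinAt G (ε • ∑ l ∈ T, fderiv ℝ g (ε • (y + l))) (Metric.ball 0 R) y := by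
    intro y hy
    refine HasFDerivAt.hasFDerivWithinAt ?_
    rw [Finset.smul_sum]
    refine HasFDerivAt.fun_sum fun l _ => ?_
    have h1 : HasFDerivAt (fun y : E => ε • (y + (l:E))) (ε • ContinuousLinearMap.id ℝ E) y :=
      ((hasFDerivAt_id y).add_const _).const_smul ε
    have h2 := ((hg.differentiable one_ne_zero) (ε • (y + (l:E)))).hasFDerivAt.comp y h1
    have h3 : (fderiv ℝ g (ε • (y + (l:E)))).comp (ε • ContinuousLinearMap.id ℝ E) = ε • fderiv ℝ g (ε • (y + (l:E))) :=
      ContinuousLinearMap.ext fun v => (fderiv ℝ g (ε • (y + (l:E)))).map_smul ε v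
    rw [h3] at h2
    exact h2
  have hlip : ∀ y ∈ D, ‖G x - G y‖ ≤ C * (2 * R) * ε ^ (k+1) / ε ^ finrank ℝ E := by
    intro y hy
    have h1 := Convex.norm_image_sub_le_of_norm_hasFDerivWithin_le hder hd (convex_ball _ _) (hDR hy) hx
    have h2 : ‖x - y‖ ≤ 2 * R := by
      have hy' := hDR hy
      rw [mem_ball_zero_iff] at hx hy'
      linarith [norm_sub_le x y]
    calc _ ≤ _ := h1
      _ ≤ ε * (C * ε ^ k / ε ^ finrank ℝ E) * (2 * R) := by gcongr
      _ = _ := by ring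
  have hGc : Continuous G := by
    have := hg.continuous
    fun_prop
  have hcs : HasCompactSupport fun y => g (ε • y) := hs.comp_smul hε.ne'
  have hgi : Integrable (fun y => g (ε • y)) μ :=
    (hg.continuous.comp (continuous_const_smul ε)).integrable_of_hasCompactSupport hcs
  have hGD : IntegrableOn G D μ :=
    (hGc.continuousOn.integrableOn_compact (isCompact_closedBall 0 R)).mono_set (hDR.trans Metric.ball_subset_closedBall)
  haveI : VAddInvariantMeasure Λ E μ := inferInstanceAs (VAddInvariantMeasure Λ.toAddSubgroup E μ)
  have havg : ∫ y in D, G y ∂μ = (ε ^ finrank ℝ E)⁻¹ • ∫ y, g y ∂μ := by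
    have h1 := Measure.integral_comp_smul μ g ε
    rw [abs_of_pos (by positivity)] at h1
    rw [← h1, hD.integral_eq_tsum'' _ hgi, tsum_eq_sum (s := T)]
    · rw [integral_finsetSum]
      · refine Finset.sum_congr rfl fun l _ => ?_
        congr 1; ext y
        rw [add_comm]; rfl
      · intro l _
        have : Continuous fun y : E => g (ε • (y + (l:E))) := by have := hg.continuous; fun_prop
        exact (this.continuousOn.integrableOn_compact (isCompact_closedBall 0 R)).mono_set (hDR.trans Metric.ball_subset_closedBall)
    · intro l hl
      refine setIntegral_eq_zero_of_forall_eq_zero fun y hy => ?_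
      have := ls_tsum Λ hr h0 hε hεR (hDR hy) l hl
      rw [add_comm] at this; exact this
  have key : G x - (ε ^ finrank ℝ E * ZLattice.covolume Λ μ)⁻¹ • ∫ y, g y ∂μ = (ZLattice.covolume Λ μ)⁻¹ • ∫ y in D, (G x - G y) ∂μ := by
    have hci : IntegrableOn (fun _ : E => G x) D μ := integrableOn_const hDf (by simp)
    rw [integral_sub hci hGD, setIntegral_const, havg, smul_sub, smul_smul, ← hDv,
      inv_mul_cancel₀ hv.ne', one_smul, smul_smul, mul_inv, mul_comm]
  change ‖G x - _‖ ≤ _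
  rw [key, norm_smul, norm_inv, Real.norm_of_nonneg hv.le]
  have := norm_setIntegral_le_of_norm_le_const (lt_top_iff_ne_top.2 hDf) hlip
  rw [← hDv] at this
  rw [inv_mul_le_iff₀ hv, mul_comm]
  exact this
end LS
section LS2
universe u
open MeasureTheory Module Set
lemma ls_main {E : Type u} [NormedAddCommGroup E] [NormedSpace ℝ E] [FiniteDimensional ℝ E]
  [MeasurableSpace E] [BorelSpace E] (μ : Measure E) [μ.IsAddHaarMeasure]
  (Λ : Submodule ℤ E) [DiscreteTopology Λ] [IsZLattice ℝ Λ] {g : E → ℝ} (hg : ContDiff ℝ (⊤:ℕ∞) g) (hs : HasCompactSupport g) (R₀ : ℝ) :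
  ∃ C : ℝ, ∀ ε > 0, ε ≤ R₀ → |∑' l : Λ, g (ε • (l:E)) - (ε ^ finrank ℝ E * ZLattice.covolume Λ μ)⁻¹ * ∫ y, g y ∂μ| ≤ C := by
  obtain ⟨D, ρ, hρ, hD, hDm, hDρ⟩ := ls_dom μ Λ
  set R := max ρ R₀
  have hR : 0 < R := lt_of_lt_of_le hρ (le_max_left _ _)
  have hDR : D ⊆ Metric.ball 0 R := hDρ.trans (Metric.ball_subset_ball (le_max_left _ _))
  have ind : ∀ (k : ℕ) (F : Type u) [NormedAddCommGroup F] [NormedSpace ℝ F] [CompleteSpace F] (g : E → F),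
      ContDiff ℝ (⊤:ℕ∞) g → HasCompactSupport g → LSc μ Λ R k g := by
    intro k
    induction k with
    | zero => intro F _ _ _ g hg hs; exact ls_zero μ Λ hR hg.continuous hs
    | succ k ih =>
      intro F _ _ _ g hg hs
      exact ls_step μ Λ hR hD hDm hDR (hg.of_le (by exact_mod_cast le_top)) hs (ih (E →L[ℝ] F) _ (hg.fderiv_right (by simp)) (hs.fderiv ℝ))
  have h0 : LSc μ Λ R (finrank ℝ E + 1) g :=
    ls_step μ Λ hR hD hDm hDR (hg.of_le (by exact_mod_cast le_top)) hs (ind _ (E →L[ℝ] ℝ) _ (hg.fderiv_right (by simp)) (hs.fderiv ℝ))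
  obtain ⟨C, hC0, hC⟩ := h0
  refine ⟨C * R, fun ε hε hεR => ?_⟩
  have hεR' : ε ≤ R := hεR.trans (le_max_right _ _)
  have := hC ε hε hεR' 0 (by simpa using hR)
  simp only [zero_add, smul_eq_mul, Real.norm_eq_abs] at this
  refine this.trans ?_
  rw [pow_succ, mul_comm (ε ^ _) ε, ← mul_assoc, mul_div_assoc, div_self (by positivity), mul_one]
  gcongr
end LS2
section NF1
open NumberField NumberField.mixedEmbedding NumberField.Units NumberField.Units.dirichletUnitTheorem Module
def st1 (t : ℝ) : ℝ := Real.smoothTransition (t+1) - Real.smoothTransition t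
lemma st1_nonneg (t : ℝ) : 0 ≤ st1 t := sub_nonneg.2 (Real.smoothTransition.monotone (by linarith))
lemma st1_zero {t : ℝ} (h : 1 ≤ |t|) : st1 t = 0 := by
  unfold st1
  rcases le_abs'.1 h with h | h
  · rw [Real.smoothTransition.zero_of_nonpos (by linarith), Real.smoothTransition.zero_of_nonpos (by linarith), sub_zero]
  · rw [Real.smoothTransition.one_of_one_le (by linarith), Real.smoothTransition.one_of_one_le h, sub_self]
lemma st1_fin (t : ℝ) : ∃ T : Finset ℤ, (∀ m ∉ T, st1 (t + m) = 0) ∧ ∑ m ∈ T, st1 (t + m) = 1 := by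
  refine ⟨{⌊-t⌋, ⌊-t⌋ + 1}, fun m hm => ?_, ?_⟩
  · apply st1_zero
    simp only [Finset.mem_insert, Finset.mem_singleton, not_or] at hm
    have h1 := Int.floor_le (-t)
    have h2 := Int.lt_floor_add_one (-t)
    rcases lt_or_gt_of_ne hm.1 with h | h
    · have : (m:ℝ) ≤ ⌊-t⌋ - 1 := by exact_mod_cast (Int.le_sub_one_iff.2 h)
      rw [le_abs']; left; linarith
    · have : (⌊-t⌋:ℝ) + 2 ≤ m := by
        have : ⌊-t⌋ + 2 ≤ m := by omega
        exact_mod_cast this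
      rw [le_abs']; right; linarith
  · rw [Finset.sum_pair (by omega)]
    have h1 := Int.floor_le (-t)
    have h2 := Int.lt_floor_add_one (-t)
    unfold st1
    push_cast
    rw [Real.smoothTransition.zero_of_nonpos (x := t + ⌊-t⌋) (by linarith), Real.smoothTransition.one_of_one_le (x := t + (⌊-t⌋ + 1) + 1) (by linarith),
      add_assoc t]
    ring
lemma st1_prod {r : ℕ} (t : Fin r → ℝ) : ∃ T : Finset (Fin r → ℤ), (∀ e ∉ T, ∏ i, st1 (t i + e i) = 0) ∧ ∑ e ∈ T, ∏ i, st1 (t i + e i) = 1 := by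
  choose T hT hT' using fun i => st1_fin (t i)
  refine ⟨Fintype.piFinset T, fun e he => ?_, ?_⟩
  · rw [Fintype.mem_piFinset] at he
    push Not at he
    obtain ⟨i, hi⟩ := he
    exact Finset.prod_eq_zero (Finset.mem_univ i) (hT i _ hi)
  · rw [← Finset.prod_univ_sum T (fun i m => st1 (t i + (m:ℝ)))]
    simp [hT']
lemma st1_contDiff : ContDiff ℝ (⊤:ℕ∞) st1 :=
  (Real.smoothTransition.contDiff.comp (contDiff_id.add contDiff_const)).sub Real.smoothTransition.contDiff
def ph (x : ℝ) : ℝ := expNegInvGlue (x - 1) * expNegInvGlue (2 - x)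
lemma ph_contDiff : ContDiff ℝ (⊤:ℕ∞) ph :=
  (expNegInvGlue.contDiff.comp (contDiff_id.sub contDiff_const)).mul (expNegInvGlue.contDiff.comp (contDiff_const.sub contDiff_id))
lemma ph_nonneg (x : ℝ) : 0 ≤ ph x := mul_nonneg (expNegInvGlue.nonneg _) (expNegInvGlue.nonneg _)
lemma ph_zero1 {x : ℝ} (h : x ≤ 1) : ph x = 0 := by
  unfold ph; rw [expNegInvGlue.zero_of_nonpos (by linarith), zero_mul]
lemma ph_zero2 {x : ℝ} (h : 2 ≤ x) : ph x = 0 := by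
  unfold ph; rw [expNegInvGlue.zero_of_nonpos (x := 2 - x) (by linarith), mul_zero]
lemma ph_pos {x : ℝ} (h : 1 < x) (h' : x < 2) : 0 < ph x :=
  mul_pos (expNegInvGlue.pos_of_pos (by linarith)) (expNegInvGlue.pos_of_pos (by linarith))
variable (K) [NumberField K]
abbrev ubas : Basis (Fin (rank K)) ℝ (logSpace K) := (basisUnitLattice K).ofZLatticeBasis ℝ (unitLattice K)
def nfF (z : mixedSpace K) : ℝ := ph (mixedEmbedding.norm z) * ∏ i, st1 ((ubas K).repr (logMap z) i)
lemma nfF_nonneg (z) : 0 ≤ nfF K z := mul_nonneg (ph_nonneg _) (Finset.prod_nonneg fun _ _ => st1_nonneg _)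
lemma nap_contDiffAt {z : mixedSpace K} {w : InfinitePlace K} (h : normAtPlace w z ≠ 0) :
    ContDiffAt ℝ (⊤:ℕ∞) (normAtPlace w : mixedSpace K → ℝ) z := by
  rcases InfinitePlace.isReal_or_isComplex w with hw | hw
  · have e : (normAtPlace w : mixedSpace K → ℝ) = fun z => ‖z.1 ⟨w, hw⟩‖ := funext fun z => normAtPlace_apply_of_isReal hw z
    rw [normAtPlace_apply_of_isReal hw, norm_ne_zero_iff] at h
    rw [e]
    refine ContDiffAt.norm ℝ ?_ h
    fun_prop
  · have e : (normAtPlace w : mixedSpace K → ℝ) = fun z => ‖z.2 ⟨w, hw⟩‖ := funext fun z => normAtPlace_apply_of_isComplex hw z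
    rw [normAtPlace_apply_of_isComplex hw, norm_ne_zero_iff] at h
    rw [e]
    refine ContDiffAt.norm ℝ ?_ h
    fun_prop
lemma nfF_contDiff : ContDiff ℝ (⊤:ℕ∞) (nfF K) := by
  rw [contDiff_iff_contDiffAt]
  intro z
  by_cases hz : mixedEmbedding.norm z = 0
  · have : nfF K =ᶠ[nhds z] fun _ => 0 := by
      have ho : {y : mixedSpace K | mixedEmbedding.norm y < 1} ∈ nhds z :=
        (isOpen_lt (mixedEmbedding.continuous_norm K) continuous_const).mem_nhds (by simp [hz])
      filter_upwards [ho] with y hy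
      rw [nfF, ph_zero1 (le_of_lt hy), zero_mul]
    exact contDiffAt_const.congr_of_eventuallyEq this
  · have hw := mixedEmbedding.norm_ne_zero_iff.1 hz
    have hn : ContDiffAt ℝ (⊤:ℕ∞) (mixedEmbedding.norm : mixedSpace K → ℝ) z := by
      change ContDiffAt ℝ _ (fun x => ∏ w, (normAtPlace w x) ^ (InfinitePlace.mult w)) z
      exact contDiffAt_prod fun w _ => (nap_contDiffAt K (hw w)).pow _
    have hl : ContDiffAt ℝ (⊤:ℕ∞) (logMap : mixedSpace K → logSpace K) z := by
      rw [contDiffAt_pi]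
      intro w
      change ContDiffAt ℝ _ (fun z => InfinitePlace.mult w.val * (Real.log (normAtPlace w.val z) -
        Real.log (mixedEmbedding.norm z) * (finrank ℚ K : ℝ)⁻¹)) z
      exact contDiffAt_const.mul (((nap_contDiffAt K (hw w)).log (hw w)).sub ((hn.log hz).mul contDiffAt_const))
    refine (ph_contDiff.contDiffAt.comp z hn).mul (contDiffAt_prod fun i _ => ?_)
    refine st1_contDiff.contDiffAt.comp z ?_
    have := ((LinearMap.toContinuousLinearMap ((ubas K).coord i)).contDiff (n := (⊤:ℕ∞))).contDiffAt (x := logMap z)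
    exact this.comp z hl
lemma bd_aux {ι : Type*} [Fintype ι] (m x : ι → ℝ) (i₀ : ι) (hm : ∀ i, 1 ≤ m i) {b : ℝ} (hb : 0 ≤ b) (hS : ∑ i, m i * x i ≤ 1)
    (h : ∀ i, i ≠ i₀ → |x i| ≤ b) (i : ι) : x i ≤ 1 + ∑ i, m i * b + b := by
  have hs0 : 0 ≤ ∑ i, m i * b := Finset.sum_nonneg fun i _ => mul_nonneg (by linarith [hm i]) hb
  by_cases hi : i = i₀
  · by_contra hcon
    push Not at hcon
    rw [← Finset.add_sum_erase _ _ (Finset.mem_univ i)] at hS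
    have h3 : -∑ j ∈ Finset.univ.erase i, m j * b ≤ ∑ j ∈ Finset.univ.erase i, m j * x j := by
      rw [← Finset.sum_neg_distrib]
      refine Finset.sum_le_sum fun j hj => ?_
      have := (abs_le.1 (h j (hi ▸ Finset.ne_of_mem_erase hj))).1
      nlinarith [hm j]
    have h4 : ∑ j ∈ Finset.univ.erase i, m j * b ≤ ∑ j, m j * b :=
      Finset.sum_le_sum_of_subset_of_nonneg (Finset.erase_subset _ _) fun j _ _ => mul_nonneg (by linarith [hm j]) hb
    have h5 : x i ≤ m i * x i := le_mul_of_one_le_left (by linarith) (hm i)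
    linarith
  · have := (abs_le.1 (h i hi)).2
    linarith
lemma nfF_supp : HasCompactSupport (nfF K) := by
  obtain ⟨B₀, hB⟩ : ∃ B₀ : ℝ, ∑ i, ‖ubas K i‖ = B₀ := ⟨_, rfl⟩
  have hB₀ : 0 ≤ B₀ := hB ▸ Finset.sum_nonneg fun _ _ => norm_nonneg _
  refine HasCompactSupport.of_support_subset_isCompact (isCompact_closedBall 0 (ℯ (1 + ∑ w : InfinitePlace K, (InfinitePlace.mult w : ℝ) * (B₀ + 1) + (B₀ + 1)))) fun z hz => ?_
  rw [Function.mem_support] at hz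
  have hn1 : 1 < mixedEmbedding.norm z := by
    by_contra h; exact hz (by rw [nfF, ph_zero1 (not_lt.1 h), zero_mul])
  have hn2 : mixedEmbedding.norm z < 2 := by
    by_contra h; exact hz (by rw [nfF, ph_zero2 (not_lt.1 h), zero_mul])
  have hc : ∀ i, |(ubas K).repr (logMap z) i| ≤ 1 := by
    intro i; by_contra h
    exact hz (by rw [nfF, Finset.prod_eq_zero (Finset.mem_univ i) (st1_zero (le_of_lt (not_le.1 h))), mul_zero])
  have hl : ‖logMap z‖ ≤ B₀ := by
    rw [← (ubas K).sum_repr (logMap z), ← hB]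
    refine (norm_sum_le _ _).trans (Finset.sum_le_sum fun i _ => ?_)
    rw [_root_.norm_smul]
    exact (mul_le_mul_of_nonneg_right (hc i) (norm_nonneg _)).trans (by rw [one_mul])
  have hw := mixedEmbedding.norm_ne_zero_iff.1 (by linarith : mixedEmbedding.norm z ≠ 0)
  have hL0 : 0 ≤ Real.log (mixedEmbedding.norm z) := Real.log_nonneg hn1.le
  have hL1 : Real.log (mixedEmbedding.norm z) ≤ 1 := by
    have := Real.log_le_log (by linarith) hn2.le
    linarith [Real.log_two_lt_d9]
  have hd : (1:ℝ) ≤ finrank ℚ K := by exact_mod_cast (finrank_pos : 0 < finrank ℚ K)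
  have hLd : Real.log (mixedEmbedding.norm z) * (finrank ℚ K : ℝ)⁻¹ ≤ 1 :=
    mul_le_one₀ hL1 (by positivity) (inv_le_one_of_one_le₀ hd)
  have hLd0 : 0 ≤ Real.log (mixedEmbedding.norm z) * (finrank ℚ K : ℝ)⁻¹ := by positivity
  have hm : ∀ w : InfinitePlace K, (1:ℝ) ≤ InfinitePlace.mult w := fun w => by exact_mod_cast InfinitePlace.one_le_mult
  have hne : ∀ w : InfinitePlace K, w ≠ w₀ → |Real.log (normAtPlace w z)| ≤ B₀ + 1 := by
    intro w hww
    have h1 := (norm_le_pi_norm (logMap z) ⟨w, hww⟩).trans hl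
    rw [logMap_apply, norm_mul, Real.norm_of_nonneg (by positivity), Real.norm_eq_abs] at h1
    have h2 : |Real.log (normAtPlace w z) - Real.log (mixedEmbedding.norm z) * (finrank ℚ K : ℝ)⁻¹| ≤ B₀ :=
      (le_mul_of_one_le_left (abs_nonneg _) (hm w)).trans h1
    rw [abs_le] at h2 ⊢
    constructor <;> linarith
  have hS : ∑ w : InfinitePlace K, InfinitePlace.mult w * Real.log (normAtPlace w z) = Real.log (mixedEmbedding.norm z) := by
    rw [mixedEmbedding.norm_apply, Real.log_prod (fun w _ => pow_ne_zero _ (hw w))]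
    simp
  have hall := bd_aux _ _ w₀ hm (by linarith : 0 ≤ B₀ + 1) (hS.trans_le hL1) hne
  rw [mem_closedBall_zero_iff, norm_eq_sup'_normAtPlace]
  refine Finset.sup'_le _ _ fun w _ => ?_
  have := Real.exp_le_exp.2 (hall w)
  rwa [Real.exp_log (lt_of_le_of_ne (normAtPlace_nonneg _ _) (hw w).symm)] at this
lemma nfF_int : 0 < ∫ z, nfF K z := by
  have hd : (finrank ℚ K : ℝ) ≠ 0 := by exact_mod_cast (finrank_pos : 0 < finrank ℚ K).ne'
  refine Continuous.integral_pos_of_hasCompactSupport_nonneg_nonzero (x := ((3/2:ℝ)^(finrank ℚ K : ℝ)⁻¹) • (1 : mixedSpace K)) (nfF_contDiff K).continuous (nfF_supp K) (nfF_nonneg K) ?_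
  have h1 : ∀ i, st1 ((ubas K).repr (0 : logSpace K) i) = 1 := by
    intro i; simp [st1]
  rw [nfF, logMap_real, mixedEmbedding.norm_smul, map_one, mul_one, abs_of_pos (by positivity), ← Real.rpow_natCast, ← Real.rpow_mul (by norm_num),
    inv_mul_cancel₀ hd, Real.rpow_one]
  simp only [h1, Finset.prod_const_one, mul_one]
  exact (ph_pos (by norm_num) (by norm_num)).ne'
lemma nfF_units (z : mixedSpace K) (hz : mixedEmbedding.norm z ≠ 0) :
    ∃ T : Finset (𝓞 K)ˣ, (∀ u ∉ T, nfF K (u • z) = 0) ∧ ∑ u ∈ T, nfF K (u • z) = torsionOrder K * ph (mixedEmbedding.norm z) := by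
  set f : torsion K × (Fin (rank K) → ℤ) → (𝓞 K)ˣ := fun ζe => ζe.1 * ∏ i, (fundSystem K i) ^ (ζe.2 i) with hf
  have hbij : Function.Bijective f := by
    rw [Function.bijective_iff_existsUnique]
    intro u
    obtain ⟨x, hx, hx'⟩ := exist_unique_eq_mul_prod K u
    exact ⟨x, hx.symm, fun y hy => hx' y hy.symm⟩
  set E := Equiv.ofBijective f hbij
  have hval : ∀ ζe, nfF K (f ζe • z) = ph (mixedEmbedding.norm z) * ∏ i, st1 ((ubas K).repr (logMap z) i + ζe.2 i) := by
    intro ζe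
    have hlog : logMap (f ζe • z) = ∑ i, ζe.2 i • ubas K i + logMap z := by
      rw [logMap_unit_smul _ hz, hf]
      simp only [ofMul_mul, map_add, ofMul_prod, map_sum, ofMul_zpow, map_zsmul]
      rw [logEmbedding_eq_zero_iff.2 ζe.1.2, zero_add]
      congr 1
      refine Finset.sum_congr rfl fun i _ => ?_
      rw [logEmbedding_fundSystem, Basis.ofZLatticeBasis_apply]
    rw [nfF, norm_unit_smul, hlog]
    congr 1
    refine Finset.prod_congr rfl fun i _ => ?_
    rw [map_add, Finsupp.add_apply, add_comm]
    congr 2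
    have : ∑ i, ζe.2 i • ubas K i = ∑ i, (ζe.2 i : ℝ) • ubas K i := by
      refine Finset.sum_congr rfl fun i _ => ?_
      rw [Int.cast_smul_eq_zsmul]
    rw [this, (ubas K).repr_sum_self]
  haveI : Fintype (torsion K) := Fintype.ofFinite _
  obtain ⟨T, hT, hT'⟩ := st1_prod (fun i => (ubas K).repr (logMap z) i)
  refine ⟨(Finset.univ ×ˢ T).map E.toEmbedding, fun u hu => ?_, ?_⟩
  · obtain ⟨ζe, rfl⟩ := E.surjective u
    change nfF K (f ζe • z) = 0
    rw [hval, hT, mul_zero]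
    intro h
    exact hu (Finset.mem_map.2 ⟨ζe, by simp [h], rfl⟩)
  · rw [Finset.sum_map]
    change ∑ x ∈ _, nfF K (f x • z) = _
    simp only [hval]
    rw [Finset.sum_product]
    simp only [← Finset.mul_sum, hT', mul_one, Finset.sum_const, Finset.card_univ, nsmul_eq_mul]
    simp [torsionOrder, Nat.card_eq_fintype_card]
end NF1
section ID
open IsDedekindDomain nonZeroDivisors
variable {A : Type*} [CommRing A] [IsDedekindDomain A]
def idl (I : ℌ A →₀ ℕ) : Ideal A := I.prod fun p n => p.asIdeal ^ n
lemma idl_ne (I : ℌ A →₀ ℕ) : idl I ≠ ⊥ := by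
  rw [idl, Finsupp.prod, ← Ideal.zero_eq_bot, Finset.prod_ne_zero_iff]
  exact fun p _ => pow_ne_zero _ p.ne_bot
lemma idl_add (I J : ℌ A →₀ ℕ) : idl (I + J) = idl I * idl J :=
  Finsupp.prod_add_index' (fun _ => pow_zero _) (fun _ _ _ => pow_add _ _ _)
lemma idl_single (p : ℌ A) (n : ℕ) : idl (Finsupp.single p n) = p.asIdeal ^ n :=
  Finsupp.prod_single_index (pow_zero _)
lemma idl_inj : Function.Injective (idl : (ℌ A →₀ ℕ) → Ideal A) := by
  intro I J h
  have hc : ∀ (I : ℌ A →₀ ℕ) v, FractionalIdeal.count (FractionRing A) v (idl I : FractionalIdeal A⁰ (FractionRing A)) = I v := by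
    intro I v
    induction I using Finsupp.induction with
    | zero => simp [idl, FractionalIdeal.count_one]
    | single_add p n f hp hn ih =>
      rw [idl_add, FractionalIdeal.coeIdeal_mul, FractionalIdeal.count_mul _ _ (by simpa using idl_ne _) (by simpa using idl_ne _), ih,
        idl_single, FractionalIdeal.coeIdeal_pow, FractionalIdeal.count_pow, FractionalIdeal.count_maximal]
      simp only [Finsupp.add_apply, Finsupp.single_apply]
      split_ifs <;> simp
  ext v
  have h1 := hc I v
  rw [h, hc J v] at h1
  exact_mod_cast h1.symm
lemma idl_surj {J : Ideal A} (hJ : J ≠ ⊥) : ∃ I, idl I = J := by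
  induction J using UniqueFactorizationMonoid.induction_on_prime with
  | h₁ => exact absurd rfl hJ
  | h₂ x hx => exact ⟨0, by rw [Ideal.isUnit_iff] at hx; rw [hx]; simp [idl]⟩
  | h₃ a p ha hp ih =>
    obtain ⟨I, hI⟩ := ih ha
    exact ⟨Finsupp.single ⟨p, Ideal.isPrime_of_prime hp, hp.ne_zero⟩ 1 + I, by rw [idl_add, idl_single, hI]; simp⟩
end ID
section ID2
open IsDedekindDomain nonZeroDivisors
variable {A : Type*} [CommRing A] [IsDedekindDomain A]
def idlc (I : ℌ A →₀ ℕ) : ClassGroup A := ClassGroup.mk0 ⟨idl I, mem_nonZeroDivisors_of_ne_zero (idl_ne I)⟩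
lemma idlc_add (I J : ℌ A →₀ ℕ) : idlc (I + J) = idlc I * idlc J := by
  rw [idlc, idlc, idlc, ← map_mul]; congr 1; exact Subtype.ext (idl_add I J)
def prc (p : ℌ A) : Additive (ClassGroup A) := Additive.ofMul (idlc (Finsupp.single p 1))
lemma atC_idl (I : ℌ A →₀ ℕ) : atC prc I = Additive.ofMul (idlc I) := by
  set f : (ℌ A →₀ ℕ) →+ Additive (ClassGroup A) :=
    { toFun := fun I => Additive.ofMul (idlc I)
      map_zero' := by
        have h := idlc_add (0 : ℌ A →₀ ℕ) 0
        rw [add_zero] at h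
        exact ofMul_eq_zero.2 (left_eq_mul.1 h)
      map_add' := fun I J => by rw [idlc_add]; rfl }
  change _ = f I
  conv_rhs => rw [← I.sum_single]
  rw [map_finsuppSum]
  refine Finset.sum_congr rfl fun p _ => ?_
  have : Finsupp.single p (I p) = I p • Finsupp.single p 1 := by simp
  change I p • prc p = f (Finsupp.single p (I p))
  rw [this, map_nsmul]; rfl
lemma atL_idl [Module.Free ℤ A] [Module.Finite ℤ A] [CharZero A] (I : ℌ A →₀ ℕ) : ℯ (atL (fun p : ℌ A => Ideal.absNorm p.asIdeal) I) = Ideal.absNorm (idl I) := by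
  rw [atL, Finsupp.sum, Real.exp_sum, idl, Finsupp.prod, map_prod, Nat.cast_prod]
  refine Finset.prod_congr rfl fun p _ => ?_
  have : 0 < Ideal.absNorm p.asIdeal := Nat.pos_of_ne_zero fun h => p.ne_bot (Ideal.absNorm_eq_zero_iff.1 h)
  rw [map_pow, mul_comm, Real.exp_mul, Real.exp_log (by exact_mod_cast this)]
  simp
end ID2
section NF2
open IsDedekindDomain nonZeroDivisors NumberField NumberField.mixedEmbedding NumberField.Units NumberField.Units.dirichletUnitTheorem Module
variable (K) [NumberField K]
lemma nf_sum (J : (Ideal (𝓞 K))⁰) {ε : ℝ} (hε : 0 < ε) :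
    ∑' l : idealLattice K (FractionalIdeal.mk0 K J), nfF K (ε • (l : mixedSpace K)) = torsionOrder K * ∑' I : ℌ (𝓞 K) →₀ ℕ,
      if idlc I * ClassGroup.mk0 J = 1 then ph (ε ^ finrank ℚ K * (Ideal.absNorm (idl I) * Ideal.absNorm (J : Ideal (𝓞 K)))) else 0 := by
  set S : Set (ℌ (𝓞 K) →₀ ℕ) := {I | idlc I * ClassGroup.mk0 J = 1}
  have hJ0 : (J : Ideal (𝓞 K)) ≠ 0 := nonZeroDivisors.coe_ne_zero J
  have hg : ∀ I : S, ∃ g : 𝓞 K, g ≠ 0 ∧ Ideal.span {g} = idl I.1 * J := by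
    intro I
    have h := I.2
    simp only [S, Set.mem_ofPred_eq, idlc] at h
    rw [← map_mul, ClassGroup.mk0_eq_one_iff] at h
    obtain ⟨g, hg⟩ := h.principal
    refine ⟨g, ?_, hg.symm⟩
    rintro rfl
    have : idl I.1 * (J : Ideal (𝓞 K)) = 0 := by simpa using hg
    exact mul_ne_zero (idl_ne _) hJ0 this
  choose g hg0 hg using hg
  have hmem : ∀ x : 𝓞 K, x ∈ (J : Ideal (𝓞 K)) → mixedEmbedding K x ∈ idealLattice K (FractionalIdeal.mk0 K J) := by
    intro x hx
    rw [mem_idealLattice]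
    exact ⟨x, by simpa using hx, rfl⟩
  have hgJ : ∀ (q : S × (𝓞 K)ˣ), (q.2 : 𝓞 K) * g q.1 ∈ (J : Ideal (𝓞 K)) := by
    intro q
    refine Ideal.mul_mem_left _ _ (Ideal.mul_le_right (I := idl q.1.1) ?_)
    rw [← hg]; exact Ideal.mem_span_singleton_self _
  set e : S × (𝓞 K)ˣ → idealLattice K (FractionalIdeal.mk0 K J) := fun q => ⟨mixedEmbedding K ((q.2 : 𝓞 K) * g q.1 : 𝓞 K), hmem _ (hgJ q)⟩
  have hspan : ∀ q : S × (𝓞 K)ˣ, Ideal.span {(q.2 : 𝓞 K) * g q.1} = idl q.1.1 * J := fun q => by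
    rw [Ideal.span_singleton_mul_left_unit q.2.isUnit, hg]
  have hinj : Function.Injective e := by
    intro q q' h
    have h1 : ((q.2 : 𝓞 K) * g q.1 : 𝓞 K) = (q'.2 : 𝓞 K) * g q'.1 := by
      have := mixedEmbedding_injective K (Subtype.ext_iff.1 h)
      exact RingOfIntegers.coe_injective this
    have h2 : q.1 = q'.1 := by
      have := hspan q
      rw [h1, hspan q'] at this
      exact Subtype.ext (idl_inj (mul_right_cancel₀ hJ0 this)).symm
    refine Prod.ext h2 ?_
    rw [← h2] at h1
    exact Units.ext (mul_right_cancel₀ (hg0 _) h1)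
  set f : idealLattice K (FractionalIdeal.mk0 K J) → ℝ := fun l => nfF K (ε • (l : mixedSpace K))
  have hfin : f.support.Finite := by
    obtain ⟨r, hr, h0⟩ := ls_supp (nfF_supp K)
    refine (ls_finite (idealLattice K (FractionalIdeal.mk0 K J)) (r / ε)).subset fun l hl => ?_
    by_contra hcon
    simp only [Set.mem_ofPred_eq, not_le] at hcon
    refine hl (h0 _ ?_)
    rw [_root_.norm_smul, Real.norm_of_nonneg hε.le, mul_comm]
    exact (div_lt_iff₀ hε).1 hcon
  have hrange : f.support ⊆ Set.range e := by
    intro l hl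
    obtain ⟨x, hx, hxl⟩ := (mem_idealLattice K _).1 l.2
    simp only [FractionalIdeal.coe_mk0] at hx
    obtain ⟨y, hy, rfl⟩ := hx
    have hy0 : y ≠ 0 := by
      rintro rfl
      apply hl
      change nfF K (ε • (l : mixedSpace K)) = 0
      rw [← hxl]
      simp only [Algebra.linearMap_apply, map_zero, smul_zero]
      rw [nfF, map_zero, ph_zero1 (by norm_num), zero_mul]
    obtain ⟨I', hI'⟩ := Ideal.dvd_iff_le.2 ((Ideal.span_singleton_le_iff_mem _).2 hy)
    have hI0 : I' ≠ 0 := by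
      rintro rfl
      rw [mul_zero, Ideal.zero_eq_bot, Ideal.span_singleton_eq_bot] at hI'
      exact hy0 hI'
    obtain ⟨I, rfl⟩ := idl_surj hI0
    have hIS : I ∈ S := by
      simp only [S, Set.mem_ofPred_eq, idlc]
      rw [← map_mul, ClassGroup.mk0_eq_one_iff]
      exact ⟨y, by rw [Ideal.submodule_span_eq, hI', mul_comm]; rfl⟩
    have h3 : Associated (g ⟨I, hIS⟩) y := by
      rw [← Ideal.span_singleton_eq_span_singleton, hg, hI', mul_comm]
    obtain ⟨u, hu⟩ := h3
    refine ⟨(⟨I, hIS⟩, u), Subtype.ext ?_⟩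
    rw [← hxl, ← hu, mul_comm]
    rfl
  rw [← hinj.tsum_eq hrange]
  have hfin' : (Function.support fun q => f (e q)).Finite := by
    refine Set.Finite.of_finite_image (f := e) (hfin.subset ?_) hinj.injOn
    rintro _ ⟨q, hq, rfl⟩; exact hq
  rw [(summable_of_hasFiniteSupport hfin').tsum_prod, ← tsum_mul_left]
  trans ∑' I : S, (torsionOrder K : ℝ) * ph (ε ^ finrank ℚ K * (Ideal.absNorm (idl I.1) * Ideal.absNorm (J : Ideal (𝓞 K))))
  · refine tsum_congr fun I => ?_
    set z : mixedSpace K := ε • mixedEmbedding K (g I)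
    have hz : mixedEmbedding.norm z = ε ^ finrank ℚ K * (Ideal.absNorm (idl I.1) * Ideal.absNorm (J : Ideal (𝓞 K))) := by
      simp only [z]
      rw [mixedEmbedding.norm_smul, abs_of_pos hε, norm_eq_norm, ← Nat.cast_mul, ← map_mul, ← hg, Ideal.absNorm_span_singleton]
      congr 1
      rw [← Algebra.coe_norm_int, Nat.cast_natAbs]
      push_cast
      rfl
    have hz0 : mixedEmbedding.norm z ≠ 0 := by
      rw [hz]
      refine mul_ne_zero (by positivity) (mul_ne_zero ?_ ?_)
      · exact_mod_cast fun h => idl_ne _ (Ideal.absNorm_eq_zero_iff.1 h)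
      · exact_mod_cast fun h => hJ0 (Ideal.absNorm_eq_zero_iff.1 h)
    obtain ⟨T, hT, hT'⟩ := nfF_units K z hz0
    have hfe : ∀ u : (𝓞 K)ˣ, f (e (I, u)) = nfF K (u • z) := by
      intro u
      change nfF K (ε • mixedEmbedding K ((u : 𝓞 K) * g I : 𝓞 K)) = _
      rw [unitSMul_smul, mul_smul_comm, ← map_mul]
      rfl
    rw [tsum_congr hfe, tsum_eq_sum (s := T) (fun u hu => hT u hu), hT', hz]
  · rw [tsum_subtype S (fun I => (torsionOrder K : ℝ) * ph (ε ^ finrank ℚ K * (Ideal.absNorm (idl I) * Ideal.absNorm (J : Ideal (𝓞 K)))))]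
    refine tsum_congr fun I => ?_
    by_cases h : I ∈ S
    · rw [Set.indicator_of_mem h, if_pos (show idlc I * ClassGroup.mk0 J = 1 from h)]
    · rw [Set.indicator_of_notMem h, if_neg (show ¬ idlc I * ClassGroup.mk0 J = 1 from h), mul_zero]
end NF2
section NF3
open IsDedekindDomain nonZeroDivisors NumberField NumberField.mixedEmbedding NumberField.Units Module MeasureTheory
lemma ph_bdd : ∃ C, ∀ x, ph x ≤ C := by
  have hs : HasCompactSupport ph := HasCompactSupport.intro (isCompact_Icc (a := (1:ℝ)) (b := 2)) fun x hx => by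
    simp only [Set.mem_Icc, not_and_or, not_le] at hx
    rcases hx with h | h
    · exact ph_zero1 h.le
    · exact ph_zero2 h.le
  obtain ⟨C, hC⟩ := ph_contDiff.continuous.bounded_above_of_compact_support hs
  exact ⟨C, fun x => (le_abs_self _).trans (hC x)⟩
variable (K) [NumberField K]
lemma nf_atd : ∃ κ M : ℝ, ATd (fun p : ℌ (𝓞 K) => Ideal.absNorm p.asIdeal) prc (fun s => ph (ℯ (-s))) κ M 1 := by
  obtain ⟨C0, hC0⟩ := ph_bdd
  set c₀ : ℝ := (2⁻¹) ^ InfinitePlace.nrComplexPlaces K * √|(discr K : ℝ)|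
  have hd : 0 < √|(discr K : ℝ)| := Real.sqrt_pos.2 (abs_pos.2 (by exact_mod_cast discr_ne_zero K))
  have hc₀ : 0 < c₀ := by positivity
  set W : ℝ := (torsionOrder K : ℝ) with hWd
  have hW : 0 < W := by simp only [W]; exact_mod_cast torsionOrder_pos K
  set κ := (∫ z, nfF K z) / (W * c₀)
  have hκ : 0 < κ := div_pos (nfF_int K) (by positivity)
  have key : ∀ γ : Additive (ClassGroup (𝓞 K)), ∃ M, ∀ t : ℝ, |(∑' I : ℌ (𝓞 K) →₀ ℕ, if atC prc I = γ then ph (ℯ (-(t - atL (fun p : ℌ (𝓞 K) => Ideal.absNorm p.asIdeal) I))) else 0) - κ * ℯ t| ≤ M := by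
    intro γ
    obtain ⟨J, hJ⟩ := ClassGroup.mk0_surjective (γ.toMul)⁻¹
    set n := finrank ℚ K
    have hn : 0 < n := finrank_pos
    have hNJ : (1:ℝ) ≤ Ideal.absNorm (J : Ideal (𝓞 K)) := by
      exact_mod_cast Nat.one_le_iff_ne_zero.2 fun h => nonZeroDivisors.coe_ne_zero J (Ideal.absNorm_eq_zero_iff.1 h)
    set NJ : ℝ := ((Ideal.absNorm (J : Ideal (𝓞 K)) : ℕ) : ℝ) with hNJd
    obtain ⟨C, hC⟩ := ls_main (volume : Measure (mixedSpace K)) (idealLattice K (FractionalIdeal.mk0 K J)) (nfF_contDiff K) (nfF_supp K) (ℯ 1)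
    refine ⟨C / W + κ, fun t => ?_⟩
    have hcl : ∀ I : ℌ (𝓞 K) →₀ ℕ, (atC prc I = γ) ↔ idlc I * ClassGroup.mk0 J = 1 := by
      intro I
      rw [atC_idl, hJ, mul_inv_eq_one]; rfl
    have hexp : ∀ I : ℌ (𝓞 K) →₀ ℕ, ℯ (-(t - atL (fun p : ℌ (𝓞 K) => Ideal.absNorm p.asIdeal) I)) = ℯ (-t) * Ideal.absNorm (idl I) := by
      intro I
      rw [← atL_idl, ← Real.exp_add]; congr 1; ring
    simp_rw [hcl, hexp]
    have hcov : ZLattice.covolume (idealLattice K (FractionalIdeal.mk0 K J)) (volume : Measure (mixedSpace K)) = NJ * c₀ := by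
      rw [covolume_idealLattice, FractionalIdeal.coe_mk0, FractionalIdeal.coeIdeal_absNorm]
      simp only [NJ, c₀]; push_cast; ring
    have hC0 : 0 ≤ C := (abs_nonneg _).trans (hC (ℯ 1) (Real.exp_pos _) le_rfl)
    rcases le_or_gt (-1) t with ht | ht
    · set ε : ℝ := (ℯ (-t) / NJ) ^ ((n:ℝ)⁻¹)
      have hε0 : 0 < ℯ (-t) / NJ := by positivity
      have hε : 0 < ε := Real.rpow_pos_of_pos hε0 _
      have hεn : ε ^ n = ℯ (-t) / NJ := Real.rpow_inv_natCast_pow hε0.le hn.ne'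
      have hε1 : ε ≤ ℯ 1 := by
        refine le_of_pow_le_pow_left₀ hn.ne' (Real.exp_pos _).le ?_
        rw [hεn]
        calc ℯ (-t) / NJ ≤ ℯ (-t) := div_le_self (Real.exp_pos _).le hNJ
          _ ≤ ℯ 1 := Real.exp_le_exp.2 (by linarith)
          _ ≤ ℯ 1 ^ n := le_self_pow₀ (Real.one_le_exp (by norm_num)) hn.ne'
      have h := hC ε hε hε1
      rw [nf_sum K J hε, mixedEmbedding.finrank, hεn, hcov] at h
      have h2 : ∀ I : ℌ (𝓞 K) →₀ ℕ, ℯ (-t) / NJ * (Ideal.absNorm (idl I) * NJ) = ℯ (-t) * Ideal.absNorm (idl I) := fun I => by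
        field_simp
      simp_rw [show (Ideal.absNorm (J : Ideal (𝓞 K)) : ℝ) = NJ from rfl, h2] at h
      have h3 : (ℯ (-t) / NJ * (NJ * c₀))⁻¹ * ∫ z, nfF K z = W * (κ * ℯ t) := by
        simp only [κ]; rw [Real.exp_neg]; field_simp
      rw [h3, ← mul_sub, abs_mul, abs_of_pos hW] at h
      calc _ ≤ C / W := by rw [le_div_iff₀' hW]; exact h
        _ ≤ _ := by linarith
    · have : ∀ I : ℌ (𝓞 K) →₀ ℕ, (if idlc I * ClassGroup.mk0 J = 1 then ph (ℯ (-t) * Ideal.absNorm (idl I)) else 0) = 0 := by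
        intro I
        split_ifs
        · apply ph_zero2
          have h1 : (1:ℝ) ≤ Ideal.absNorm (idl I) := by
            exact_mod_cast Nat.one_le_iff_ne_zero.2 fun h => idl_ne I (Ideal.absNorm_eq_zero_iff.1 h)
          have h2 := Real.add_one_le_exp (-t)
          nlinarith
        · rfl
      simp_rw [this]
      rw [tsum_zero, zero_sub, abs_neg, abs_of_pos (by positivity)]
      have : ℯ t ≤ 1 := Real.exp_le_one_iff.2 (by linarith)
      have : 0 ≤ C / W := by positivity
      nlinarith
  choose Mf hMf using key
  obtain ⟨M, hM⟩ := (Set.finite_range Mf).bddAbove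
  have hMa : ∀ γ, Mf γ ≤ max M C0 := fun γ => (hM ⟨γ, rfl⟩).trans (le_max_left _ _)
  have hcont : Continuous fun s : ℝ => ph (ℯ (-s)) := ph_contDiff.continuous.comp (Real.continuous_exp.comp continuous_neg)
  have hsupp : ∀ s : ℝ, 1 < |s| → ph (ℯ (-s)) = 0 := by
    intro s hs
    rcases lt_abs.1 hs with h | h
    · exact ph_zero1 (Real.exp_le_one_iff.2 (by linarith))
    · apply ph_zero2
      have := Real.add_one_le_exp (-s); linarith
  refine ⟨κ, max M C0, ?_⟩
  constructor
  · intro p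
    have h0 : Ideal.absNorm p.asIdeal ≠ 0 := fun h => p.ne_bot (Ideal.absNorm_eq_zero_iff.1 h)
    have h1 : Ideal.absNorm p.asIdeal ≠ 1 := fun h => p.isPrime.ne_top (Ideal.absNorm_eq_one_iff.1 h)
    change 2 ≤ Ideal.absNorm p.asIdeal
    omega
  · intro x
    have := Ideal.finite_setOf_absNorm_le (S := 𝓞 K) x
    refine Set.Finite.of_finite_image (f := fun p : ℌ (𝓞 K) => p.asIdeal) (this.subset ?_) fun p _ q _ h => HeightOneSpectrum.ext h
    rintro _ ⟨p, hp, rfl⟩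
    exact hp
  · exact hcont.measurable
  · exact fun t => ph_nonneg _
  · exact fun t => (hC0 _).trans (le_max_right _ _)
  · exact hsupp
  · have hs : HasCompactSupport fun s : ℝ => ph (ℯ (-s)) := HasCompactSupport.intro (isCompact_Icc (a := (-1:ℝ)) (b := 1)) fun s hs => hsupp s (by
      by_contra h; exact hs (abs_le.1 (not_lt.1 h)))
    refine hcont.integral_pos_of_hasCompactSupport_nonneg_nonzero hs (fun t => ph_nonneg _) (x := -Real.log (3/2)) ?_
    rw [neg_neg, Real.exp_log (by norm_num)]
    exact (ph_pos (by norm_num) (by norm_num)).ne'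
  · exact hκ
  · norm_num
  · exact fun γ t => (hMf γ t).trans (hMa γ)
lemma nf_primes (γ : ClassGroup (𝓞 K)) : {p : ℌ (𝓞 K) | prc p = Additive.ofMul γ}.Infinite := by
  obtain ⟨κ, M, h⟩ := nf_atd K
  exact h.infinite _
end NF3
section VZ
open IsDedekindDomain nonZeroDivisors
lemma val_exp (v : FinPlace K) {x : K} (hx : x ≠ 0) : v.val x = WithZero.exp (vz v x) := by
  have h : v.val x ≠ 0 := (Valuation.ne_zero_iff _).2 hx
  rw [vz, dif_neg h]
  exact (WithZero.coe_unzero h).symm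
lemma vz_of (v : FinPlace K) {x : K} {n : ℤ} (h : v.val x = WithZero.exp n) : vz v x = n := by
  have hx : x ≠ 0 := by rintro rfl; rw [map_zero] at h; exact WithZero.exp_ne_zero h.symm
  rw [val_exp v hx] at h; exact WithZero.exp_injective h
lemma vz_mul (v : FinPlace K) {x y : K} (hx : x ≠ 0) (hy : y ≠ 0) : vz v (x * y) = vz v x + vz v y :=
  vz_of v (by rw [map_mul, val_exp v hx, val_exp v hy, WithZero.exp_add])
lemma vz_one (v : FinPlace K) : vz v (1 : K) = 0 := vz_of v (by simp)
lemma vz_div (v : FinPlace K) {x y : K} (hx : x ≠ 0) (hy : y ≠ 0) : vz v (x / y) = vz v x - vz v y := by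
  have := vz_mul v (div_ne_zero hx hy) hy
  rw [div_mul_cancel₀ _ hy] at this; omega
lemma vz_pow (v : FinPlace K) {x : K} (hx : x ≠ 0) (n : ℕ) : vz v (x ^ n) = n * vz v x := by
  induction n with
  | zero => simp [vz_one]
  | succ n ih => rw [pow_succ, vz_mul v (pow_ne_zero _ hx) hx, ih]; push_cast; ring
lemma vz_zero_of (v : FinPlace K) {x : K} (h : v.val x = 1) : vz v x = 0 := vz_of v (by simpa using h)
lemma vz_nonpos (v : FinPlace K) {x : K} (h : v.val x ≤ 1) : vz v x ≤ 0 := by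
  by_cases hx : x = 0
  · simp [hx, vz]
  · rw [val_exp v hx, ← WithZero.exp_zero, WithZero.exp_le_exp] at h; exact h
lemma one_of_lt (v : FinPlace K) {x y : K} (h : v.val (x - y) < 1) (hy : v.val y = 1) : v.val x = 1 := by
  have : x = (x - y) + y := by ring
  rw [this, Valuation.map_add_eq_of_lt_right _ (by rwa [hy]), hy]
lemma pow_of_lt (v : FinPlace K) {x y : K} (h : v.val (x - y) < 1) (hy : v.val y = 1) (n : ℕ) : v.val (x ^ n - y ^ n) < 1 := by
  rw [← (Commute.all x y).geom_sum₂_mul, map_mul]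
  refine mul_lt_one_of_nonneg_of_lt_one_right ?_ zero_le h
  refine Valuation.map_sum_le _ fun i _ => ?_
  rw [map_mul, map_pow, map_pow, one_of_lt v h hy, hy]; simp
variable {A : Type*} [CommRing A] [IsDedekindDomain A]
lemma pow_dvd_idl (P : ℌ A) (X : ℌ A →₀ ℕ) (n : ℕ) : P.asIdeal ^ n ∣ idl X ↔ n ≤ X P := by
  constructor
  · rintro ⟨J, hJ⟩
    have hJ0 : J ≠ ⊥ := by
      rintro rfl; exact idl_ne X (by rw [hJ]; simp)
    obtain ⟨Y, rfl⟩ := idl_surj hJ0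
    rw [← idl_single, ← idl_add] at hJ
    rw [idl_inj hJ]; simp
  · intro h
    have : X = Finsupp.single P n + (X - Finsupp.single P n) := by
      rw [add_tsub_cancel_of_le]; exact Finsupp.single_le_iff.2 h
    rw [this, idl_add, idl_single]; exact dvd_mul_right _ _
variable [Algebra A K] [IsFractionRing A K]
lemma plc_le_iff (P : ℌ A) (x : A) (n : ℕ) : (plc K P).val (ϖ A K x) ≤ WithZero.exp (-(n:ℤ)) ↔ x ∈ P.asIdeal ^ n := by
  change P.valuation K (ϖ A K x) ≤ _ ↔ _
  rw [HeightOneSpectrum.valuation_of_algebraMap, P.intValuation_le_pow_iff_mem]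
lemma vz_plc (P : ℌ A) {x : A} {X : ℌ A →₀ ℕ} (h : Ideal.span {x} = idl X) :
    vz (plc K P) (ϖ A K x) = -(X P : ℤ) := by
  have hx : x ≠ 0 := by rintro rfl; exact idl_ne X (by rw [← h]; simp)
  have hx' : ϖ A K x ≠ 0 := by simpa using hx
  have h1 : ∀ n : ℕ, (vz (plc K P) (ϖ A K x) ≤ -(n:ℤ)) ↔ n ≤ X P := by
    intro n
    rw [← pow_dvd_idl, ← h, Ideal.dvd_span_singleton, ← plc_le_iff (K := K), val_exp _ hx', WithZero.exp_le_exp]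
  have h2 := vz_nonpos _ (plc_le_one (K := K) P x)
  have h3 := (h1 (X P)).2 le_rfl
  have h4 := (h1 (-(vz (plc K P) (ϖ A K x))).toNat).1 (by omega)
  omega
def plcMap (P : ℌ A) : A →+* IsLocalRing.ResidueField (plc K P).val.valuationSubring :=
  (IsLocalRing.residue _).comp ((ϖ A K).codRestrict (plc K P).val.valuationSubring (fun a => plc_le_one P a))
lemma residue_eq_iff (v : FinPlace K) (x y : v.val.valuationSubring) : IsLocalRing.residue _ x = IsLocalRing.residue _ y ↔ v.val ((x:K) - y) < 1 := by
  rw [← sub_eq_zero, ← map_sub, IsLocalRing.residue_eq_zero_iff]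
  exact Valuation.mem_maximalIdeal_iff _ v.val
lemma plcMap_ker (P : ℌ A) : RingHom.ker (plcMap (K := K) P) = P.asIdeal := by
  ext a
  rw [RingHom.mem_ker, ← plc_lt_one_iff (K := K), plcMap, RingHom.comp_apply, ← map_zero (IsLocalRing.residue _), residue_eq_iff]
  simp only [ZeroMemClass.coe_zero, sub_zero]
  rfl
lemma plcMap_surj (P : ℌ A) : Function.Surjective (plcMap (K := K) P) := by
  intro x
  obtain ⟨⟨x, hx⟩, rfl⟩ := IsLocalRing.residue_surjective x
  obtain ⟨a, b, hb, rfl⟩ := plc_frac P x hx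
  have hm : P.asIdeal.IsMaximal := P.isMaximal
  obtain ⟨c, hc⟩ := Ideal.Quotient.exists_inv (I := P.asIdeal) (a := Ideal.Quotient.mk _ b) (by rwa [Ne, Ideal.Quotient.eq_zero_iff_mem])
  obtain ⟨c, rfl⟩ := Ideal.Quotient.mk_surjective c
  rw [← map_mul, ← map_one (Ideal.Quotient.mk _), Ideal.Quotient.eq] at hc
  refine ⟨a * c, ?_⟩
  rw [plcMap, RingHom.comp_apply, residue_eq_iff]
  have hb0 : ϖ A K b ≠ 0 := by
    intro h; rw [map_eq_zero_iff _ (IsFractionRing.injective A K)] at h; exact hb (h ▸ zero_mem _)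
  have h1 := (plc_eq_one_iff (K := K) P b).2 hb
  have : (ϖ A K (a * c)) - ϖ A K a / ϖ A K b = ϖ A K (a * (b * c - 1)) / ϖ A K b := by
    field_simp; simp; ring
  change (plc K P).val ((ϖ A K (a * c)) - ϖ A K a / ϖ A K b) < 1
  rw [this, map_div₀, h1, div_one, plc_lt_one_iff]
  exact Ideal.mul_mem_left _ _ hc
lemma plc_approx (P : ℌ A) (x : K) (hx : (plc K P).val x ≤ 1) : ∃ r : A, (plc K P).val (ϖ A K r - x) < 1 := by
  obtain ⟨r, hr⟩ := plcMap_surj (K := K) P (IsLocalRing.residue _ ⟨x, hx⟩)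
  exact ⟨r, (residue_eq_iff _ _ _).1 hr⟩
lemma plc_card (P : ℌ A) : resCard (plc K P) = Nat.card (A ⧸ P.asIdeal) := by
  rw [resCard, ← plcMap_ker (K := K) P]
  exact (Nat.card_congr (RingHom.quotientKerEquivOfSurjective (plcMap_surj P)).toEquiv).symm
lemma plc_fin (P : ℌ A) [Finite (A ⧸ P.asIdeal)] : Finite (IsLocalRing.ResidueField (plc K P).val.valuationSubring) := by
  have : Finite (A ⧸ RingHom.ker (plcMap (K := K) P)) := by rwa [plcMap_ker]
  exact Finite.of_equiv _ (RingHom.quotientKerEquivOfSurjective (plcMap_surj P)).toEquiv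
lemma cyc_root {F : Type*} [Field F] [Finite F] {ℓ : ℕ} (hp : ℓ.Prime) (hd : ℓ ∣ Nat.card F - 1) (hlt : ℓ + 1 < Nat.card F)
    (z : F) (hz : z ^ ℓ = 1) : ∃ u : F, u ≠ 0 ∧ u ≠ 1 ∧ u ^ ((Nat.card F - 1) / ℓ) = z := by
  have := Fintype.ofFinite F
  obtain ⟨g, hg⟩ := IsCyclic.exists_generator (α := Fˣ)
  have hgo : orderOf g = Nat.card F - 1 := by
    rw [orderOf_eq_card_of_forall_mem_zpowers hg, Nat.card_units]
  obtain ⟨s, hs⟩ := hd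
  have hs' : (Nat.card F - 1) / ℓ = s := by rw [hs]; exact Nat.mul_div_cancel_left _ hp.pos
  have hs1 : 1 < s := by
    by_contra h
    have : ℓ * s ≤ ℓ * 1 := Nat.mul_le_mul_left _ (not_lt.1 h)
    omega
  rw [hs']
  have hz0 : z ≠ 0 := by rintro rfl; rw [zero_pow hp.ne_zero] at hz; exact zero_ne_one hz
  obtain ⟨m, hm⟩ := (mem_powers_iff_mem_zpowers (x := g)).2 (hg (Units.mk0 z hz0))
  simp only at hm
  have h1 : orderOf g ∣ m * ℓ := by
    rw [orderOf_dvd_iff_pow_eq_one, pow_mul, hm]; ext; simpa using hz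
  rw [hgo, hs, mul_comm] at h1
  obtain ⟨r, rfl⟩ := Nat.dvd_of_mul_dvd_mul_right hp.pos h1
  have h2 : ((g ^ r : Fˣ) : F) ^ s = z := by
    rw [← Units.val_pow_eq_pow_val, ← pow_mul, mul_comm, hm]; rfl
  by_cases h3 : g ^ r = 1
  · refine ⟨(g ^ ℓ : Fˣ), Units.ne_zero _, ?_, ?_⟩
    · rw [Ne, Units.val_eq_one, ← orderOf_dvd_iff_pow_eq_one, hgo, hs]
      intro h
      have := Nat.le_of_dvd hp.pos h
      nlinarith [hp.pos]
    · rw [← h2, h3, ← Units.val_pow_eq_pow_val, ← pow_mul, ← hs, ← hgo, pow_orderOf_eq_one]; simp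
  · exact ⟨(g ^ r : Fˣ), Units.ne_zero _, by rwa [Ne, Units.val_eq_one], h2⟩
lemma res_root (v : FinPlace K) [Finite (IsLocalRing.ResidueField v.val.valuationSubring)] {ℓ : ℕ} {ω : K}
    (hp : ℓ.Prime) (hω : IsPrimitiveRoot ω ℓ) (hl : v.val (ℓ : K) = 1) (hlt : ℓ + 1 < resCard v) (i : ℕ) :
    ∃ u : K, v.val u = 1 ∧ v.val (u - 1) = 1 ∧ v.val (u ^ ((resCard v - 1) / ℓ) - ω ^ i) < 1 := by
  have hω1 : v.val ω = 1 := by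
    have := congrArg v.val hω.pow_eq_one
    rw [map_pow, map_one] at this
    exact (pow_eq_one_iff.1 this).resolve_right hp.ne_zero
  let w : v.val.valuationSubring := ⟨ω, hω1.le⟩
  obtain ⟨u, hu0, hu1, hu⟩ := cyc_root hp (prim_dvd v hp hω hl) hlt (IsLocalRing.residue _ (w ^ i)) (by
    rw [← map_pow, ← pow_mul, mul_comm, pow_mul, ← map_one (IsLocalRing.residue _)]
    congr 1
    have : w ^ ℓ = 1 := Subtype.ext hω.pow_eq_one
    rw [this, one_pow])
  obtain ⟨u, rfl⟩ := IsLocalRing.residue_surjective u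
  refine ⟨u, le_antisymm u.2 (not_lt.1 fun h => hu0 ?_), le_antisymm ?_ (not_lt.1 fun h => hu1 ?_), ?_⟩
  · rw [← map_zero (IsLocalRing.residue _), residue_eq_iff]; simpa using h
  · exact (u - 1).2
  · rw [← map_one (IsLocalRing.residue _), residue_eq_iff]; simpa using h
  · rw [← map_pow] at hu
    exact (residue_eq_iff _ _ _).1 hu
end VZ
section NF4
open IsDedekindDomain nonZeroDivisors NumberField
lemma inj_choice {α ι : Type*} [Finite ι] : ∀ S : ι → Set α, (∀ i, (S i).Infinite) → ∃ f : ι → α, Function.Injective f ∧ ∀ i, f i ∈ S i := by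
  induction ι using Finite.induction_empty_option with
  | of_equiv e ih =>
    intro S hS
    obtain ⟨f, hf, h⟩ := ih (fun i => S (e i)) fun i => hS _
    exact ⟨f ∘ e.symm, hf.comp e.symm.injective, fun i => by simpa using h (e.symm i)⟩
  | h_empty => exact fun S _ => ⟨fun i => i.elim, fun i => i.elim, fun i => i.elim⟩
  | h_option ih =>
    intro S hS
    obtain ⟨f, hf, h⟩ := ih (fun i => S (some i)) fun i => hS _
    obtain ⟨x, hx, hx'⟩ := (hS none).exists_notMem_finite (Set.finite_range f)
    refine ⟨fun o => o.elim x f, ?_, ?_⟩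
    · rintro (_ | i) (_ | j) h'
      · rfl
      · exact absurd ⟨j, h'.symm⟩ hx'
      · exact absurd ⟨i, h'⟩ hx'
      · exact congrArg some (hf h')
    · rintro (_ | i)
      · exact hx
      · exact h i
lemma prim_one (v : FinPlace K) {ℓ : ℕ} {ω : K} (hp : ℓ.Prime) (hω : IsPrimitiveRoot ω ℓ) (hl : v.val (ℓ : K) = 1) :
    v.val ω = 1 ∧ v.val (ω - 1) = 1 := by
  have hω1 : v.val ω = 1 := by
    have := congrArg v.val hω.pow_eq_one
    rw [map_pow, map_one] at this
    exact (pow_eq_one_iff.1 this).resolve_right hp.ne_zero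
  refine ⟨hω1, le_antisymm ((Valuation.map_sub _ _ _).trans (by simp [hω1])) (not_lt.1 fun h => ?_)⟩
  have h1 := hω.geom_sum_eq_zero hp.one_lt
  have h2 : v.val (∑ i ∈ Finset.range ℓ, (ω ^ i - 1)) < 1 := by
    refine Valuation.map_sum_lt _ one_ne_zero fun i _ => ?_
    simpa using pow_of_lt v h (map_one _) i
  rw [Finset.sum_sub_distrib, h1] at h2
  simp [hl] at h2
variable {A : Type*} [CommRing A] [IsDedekindDomain A]
lemma crt (s : Finset (ℌ A)) (r : ℌ A → A) (n : ℕ) : ∃ y, ∀ P ∈ s, y - r P ∈ P.asIdeal ^ n := by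
  obtain ⟨y, hy⟩ := IsDedekindDomain.exists_forall_sub_mem_ideal (s := s) (fun P : ℌ A => P.asIdeal) (fun _ => n)
    (fun P _ => P.prime) (fun P _ Q _ h h' => h (HeightOneSpectrum.ext h')) (fun P => r P)
  exact ⟨y, fun P hP => hy P hP⟩
variable [Algebra A K] [IsFractionRing A K]
variable (A) in
lemma vz_fin {x : K} (hx : x ≠ 0) : {P : ℌ A | vz (plc K P) x ≠ 0}.Finite := by
  obtain ⟨a, b, hb, rfl⟩ := IsFractionRing.div_surjective (A := A) x
  have hb0 : b ≠ 0 := nonZeroDivisors.ne_zero hb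
  have ha0 : a ≠ 0 := by rintro rfl; simp at hx
  obtain ⟨X, hX⟩ := idl_surj (J := Ideal.span {a}) (by simpa using ha0)
  obtain ⟨Y, hY⟩ := idl_surj (J := Ideal.span {b}) (by simpa using hb0)
  refine (X.support ∪ Y.support).finite_toSet.subset fun P hP => ?_
  by_contra h
  simp only [Finset.coe_union, Set.mem_union, Finset.mem_coe, Finsupp.mem_support_iff, not_or, not_not] at h
  apply hP
  rw [vz_div _ (by simpa using ha0) (by simpa using hb0), vz_plc P hX.symm, vz_plc P hY.symm, h.1, h.2]; simp
variable (K) in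
lemma div_cls (D : ℌ A → ℤ) (hD : {P | D P ≠ 0}.Finite) : ∃ γ : ClassGroup A, ∀ p : ℌ A, prc p = Additive.ofMul γ →
    ∃ x : K, x ≠ 0 ∧ ∀ P : ℌ A, vz (plc K P) x = (if P = p then 1 else 0) - D P := by
  let Dp : ℌ A →₀ ℕ := Finsupp.ofSupportFinite (fun P => (D P).toNat) (hD.subset fun P h h' => h (by simp [h']))
  let Dm : ℌ A →₀ ℕ := Finsupp.ofSupportFinite (fun P => (-D P).toNat) (hD.subset fun P h h' => h (by simp [h']))
  refine ⟨idlc Dp * (idlc Dm)⁻¹, fun p hp => ?_⟩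
  have h1 : idlc (Finsupp.single p 1 + Dm) = idlc Dp := by
    have : idlc (Finsupp.single p 1) = idlc Dp * (idlc Dm)⁻¹ := hp
    rw [idlc_add, this, inv_mul_cancel_right]
  obtain ⟨x, y, hx, hy, h⟩ := (ClassGroup.mk0_eq_mk0_iff ..).1 h1
  simp only at h
  obtain ⟨X, hX⟩ := idl_surj (J := Ideal.span {x}) (by simpa using hx)
  obtain ⟨Y, hY⟩ := idl_surj (J := Ideal.span {y}) (by simpa using hy)
  rw [← hX, ← hY, ← idl_add, ← idl_add] at h
  have h2 := idl_inj h
  refine ⟨ϖ A K x / ϖ A K y, div_ne_zero (by simpa using hx) (by simpa using hy), fun P => ?_⟩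
  have h3 := DFunLike.congr_fun h2 P
  simp only [Finsupp.add_apply, Finsupp.single_apply] at h3
  have h4 : (Dp P : ℤ) - Dm P = D P := by
    change ((D P).toNat : ℤ) - (-D P).toNat = D P
    omega
  rw [vz_div _ (by simpa using hx) (by simpa using hy), vz_plc P hX.symm, vz_plc P hY.symm]
  have h5 : (if p = P then 1 else 0) = (if P = p then 1 else 0 : ℕ) := by simp [eq_comm]
  rw [h5] at h3
  have h6 : (((if P = p then 1 else 0 : ℕ) : ℤ)) = (if P = p then 1 else 0 : ℤ) := by split_ifs <;> rfl
  rw [← h6]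
  omega
lemma nf_pick [CharZero K] (m : ℕ) (hm : m ≠ 0) (T : Finset (ℌ A)) (P0 : ℌ A) (hT : ∀ P ∈ T, (m : A) ∉ P.asIdeal) (hP0 : (m : A) ∉ P0.asIdeal)
    (hPT : P0 ∉ T) (u : ℌ A → K) (hu : ∀ P ∈ T, (plc K P).val (u P) = 1) (hu1 : ∀ P ∈ T, (plc K P).val (u P - 1) = 1) :
    ∃ a : K, a ≠ 0 ∧ (∃ c : A, c ≠ 0 ∧ a = 1 + m ^ 3 * (ϖ A K c)⁻¹) ∧ (∀ P : ℌ A, (m:A) ∈ P.asIdeal → (plc K P).val a = 1) ∧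
      vz (plc K P0) a = 1 ∧ ∀ P ∈ T, (plc K P).val (a - u P) < 1 := by
  have hmA : (m : A) ≠ 0 := by
    intro h; apply hm
    have := congrArg (ϖ A K) h
    simpa using this
  have hmv : ∀ P : ℌ A, (m : A) ∉ P.asIdeal → (plc K P).val (m : K) = 1 := fun P h => by
    have := (plc_eq_one_iff (K := K) P (m:A)).2 h; simpa using this
  have hr : ∀ P : ℌ A, ∃ r : A, P ∈ T → (plc K P).val (ϖ A K r - m ^ 3 / (u P - 1)) < 1 := by
    intro P
    by_cases h : P ∈ T
    · obtain ⟨r, hr⟩ := plc_approx P ((m:K) ^ 3 / (u P - 1)) (by rw [map_div₀, map_pow, hu1 P h, hmv P (hT P h)]; simp)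
      exact ⟨r, fun _ => hr⟩
    · exact ⟨0, fun h' => absurd h' h⟩
  choose r hr using hr
  have hfin : {P : ℌ A | (m : A) ∈ P.asIdeal}.Finite := by
    refine (vz_fin A (K := K) (x := (m : K)) (by exact_mod_cast hm)).subset fun P hP h => ?_
    have := (plc_lt_one_iff (K := K) P (m:A)).2 hP
    rw [map_natCast, val_exp _ (by exact_mod_cast hm), h] at this
    simp at this
  obtain ⟨π, hπ⟩ := P0.intValuation_exists_uniformizer
  obtain ⟨c, hc⟩ := crt (hfin.toFinset ∪ T ∪ {P0}) (fun P => if (m : A) ∈ P.asIdeal then 1 else if P ∈ T then r P else π) 2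
  have hc1 : ∀ P : ℌ A, (m : A) ∈ P.asIdeal → c ∉ P.asIdeal := by
    intro P hP hcP
    have := hc P (by simp [hP])
    rw [if_pos hP] at this
    have h2 := Ideal.pow_le_self two_ne_zero this
    exact P.isPrime.ne_top ((Ideal.eq_top_iff_one _).2 (by simpa using sub_mem hcP h2))
  have hc2 : vz (plc K P0) (ϖ A K c) = -1 := by
    have := hc P0 (by simp)
    rw [if_neg hP0, if_neg hPT, ← plc_le_iff (K := K), map_sub] at this
    have hπ' : (plc K P0).val (ϖ A K π) = WithZero.exp (-1) := by
      rw [← hπ]; exact P0.valuation_of_algebraMap π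
    apply vz_of
    rw [← hπ', ← sub_add_cancel (ϖ A K c) (ϖ A K π)]
    apply Valuation.map_add_eq_of_lt_right
    rw [hπ']
    exact this.trans_lt (by rw [WithZero.exp_lt_exp]; norm_num)
  have hcK : ϖ A K c ≠ 0 := by intro h; rw [h] at hc2; simp [vz] at hc2
  have hc0 : c ≠ 0 := by rintro rfl; simp at hcK
  have ha : (1 + (m:K) ^ 3 * (ϖ A K c)⁻¹) = (m ^ 3 + ϖ A K c) / ϖ A K c := by field_simp; ring
  have hv0 : (plc K P0).val ((m:K) ^ 3 + ϖ A K c) = 1 := by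
    rw [Valuation.map_add_eq_of_lt_left, map_pow, hmv P0 hP0, one_pow]
    rw [map_pow, hmv P0 hP0, one_pow, val_exp _ hcK, hc2, ← WithZero.exp_zero, WithZero.exp_lt_exp]; norm_num
  have hn0 : (m:K) ^ 3 + ϖ A K c ≠ 0 := by intro h; rw [h] at hv0; simp at hv0
  refine ⟨1 + m ^ 3 * (ϖ A K c)⁻¹, ?_, ⟨c, hc0, rfl⟩, ?_, ?_, ?_⟩
  · rw [ha]; exact div_ne_zero hn0 hcK
  · intro P hP
    have h1 := (plc_eq_one_iff (K := K) P c).2 (hc1 P hP)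
    have h2 : (plc K P).val ((m:K) ^ 3 + ϖ A K c) = 1 := by
      rw [Valuation.map_add_eq_of_lt_right, h1]
      rw [map_pow, h1]
      refine pow_lt_one₀ zero_le ?_ (by norm_num)
      have := (plc_lt_one_iff (K := K) P (m:A)).2 hP; simpa using this
    rw [ha, map_div₀, h1, h2, div_one]
  · rw [ha, vz_div _ hn0 hcK, hc2, vz_zero_of _ hv0]; norm_num
  · intro P hP
    have h1 := hc P (by simp [hP])
    rw [if_neg (hT P hP), if_pos hP] at h1
    have h2 := (plc_lt_one_iff (K := K) P _).2 (Ideal.pow_le_self two_ne_zero h1)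
    have h3 : (plc K P).val (ϖ A K c - (m:K) ^ 3 / (u P - 1)) < 1 := by
      have := Valuation.map_add_lt _ h2 (hr P hP)
      rw [map_sub, sub_add_sub_cancel] at this; exact this
    have hu1' : u P - 1 ≠ 0 := by intro h; have := hu1 P hP; rw [h] at this; simp at this
    have h4 : (plc K P).val (ϖ A K c) = 1 := one_of_lt _ h3 (by rw [map_div₀, map_pow, hu1 P hP, hmv P (hT P hP)]; simp)
    have h5 : 1 + (m:K) ^ 3 * (ϖ A K c)⁻¹ - u P = - (ϖ A K c - (m:K) ^ 3 / (u P - 1)) * (u P - 1) / ϖ A K c := by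
      field_simp; ring
    rw [h5, map_div₀, map_mul, Valuation.map_neg, hu1 P hP, h4, mul_one, div_one]; exact h3
lemma nf_places [NumberField K] (w : FinPlace K) : ∃ P : ℌ (𝓞 K), plc K P = w := by
  refine w.eq_plc fun a => w.int_le (R := ℤ) (fun n => ?_) _ (RingOfIntegers.isIntegral_coe a)
  have := intCast_mem w.val.valuationSubring n
  rw [Valuation.mem_valuationSubring_iff] at this
  simpa only [eq_intCast] using this
end NF4
section NF5
open IsDedekindDomain nonZeroDivisors NumberField
lemma not_pow {v : FinPlace K} {a t : K} {ℓ : ℕ} (hp : ℓ.Prime) (ht : t ≠ 0) (h : vz v a = 1) (h' : a = t ^ ℓ) : False := by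
  rw [h', vz_pow v ht] at h
  have : (ℓ:ℤ) ∣ 1 := ⟨_, h.symm⟩
  have := Int.le_of_dvd one_pos this
  have := hp.two_le
  omega
theorem fixab_nf [NumberField K] (ℓ : ℕ) (hℓ : ℓ.Prime) (hchar : (ℓ : K) ≠ 0) (ω : K) (hω : IsPrimitiveRoot ω ℓ) :
    ∃ a b : K, a ≠ 0 ∧ b ≠ 0 ∧
      (∀ v : FinPlace K, vz v a = 0 ∨ vz v b = 0) ∧
      ((¬ ∃ t : K, a = t ^ ℓ) ∧ (¬ ∃ t : K, b = t ^ ℓ) ∧ ¬ ∃ t : K, a = b * t ^ ℓ) ∧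
      (∃ u w : K, (∀ v : FinPlace K, 0 ≤ vz v u) ∧
        (∀ v : FinPlace K, 0 ≤ vz v w) ∧ a = 1 + ℓ ^ 3 * u ∧ b = 1 + ℓ ^ 3 * w) ∧
      ∀ α β : AlgebraicClosure K,
        α ^ ℓ = ϖ K (AlgebraicClosure K) a →
        β ^ ℓ = ϖ K (AlgebraicClosure K) b →
        ∀ σ : (IntermediateField.adjoin K {α, β} : IntermediateField K (AlgebraicClosure K))
            ≃ₐ[K] (IntermediateField.adjoin K {α, β} : IntermediateField K (AlgebraicClosure K)),
        ∀ D : FinPlace K → ℤ, {v : FinPlace K | D v ≠ 0}.Finite →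
          ∃ p : FinPlace K, UnramifiedIn p (IntermediateField.adjoin K {α, β}) ∧
            IsFrobeniusAt p σ ∧
            ∃ x : K, x ≠ 0 ∧ ∀ w : FinPlace K,
              vz w x = (if w = p then 1 else 0) - D w := by
  let H := ℌ (𝓞 K)
  have hplc : Function.Injective (plc K : H → FinPlace K) := by
    intro P Q h
    apply HeightOneSpectrum.ext
    ext x
    rw [← plc_lt_one_iff (K := K), ← plc_lt_one_iff (K := K), h]
  have hlA : (ℓ : 𝓞 K) ≠ 0 := by exact_mod_cast hℓ.ne_zero
  let bad : Set H := {P | Ideal.absNorm P.asIdeal ≤ ℓ + 1} ∪ {P | (ℓ : 𝓞 K) ∈ P.asIdeal}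
  have hbad : bad.Finite := by
    refine Set.Finite.union ?_ ?_
    · refine Set.Finite.of_finite_image (f := fun p : H => p.asIdeal) ((Ideal.finite_setOf_absNorm_le (S := 𝓞 K) (ℓ+1)).subset ?_) fun p _ q _ h => HeightOneSpectrum.ext h
      rintro _ ⟨p, hp, rfl⟩
      exact hp
    · refine (vz_fin (𝓞 K) (K := K) (x := (ℓ : K)) hchar).subset fun P hP h => ?_
      have := (plc_lt_one_iff (K := K) P (ℓ : 𝓞 K)).2 hP
      rw [map_natCast, val_exp _ hchar, h] at this
      simp at this
  let S : Option (Option (ClassGroup (𝓞 K) × ℕ × ℕ)) → Set H := fun o => match o with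
    | some (some k) => {P | prc P = Additive.ofMul k.1} \ bad
    | _ => {P | prc P = 0} \ bad
  let ι := ClassGroup (𝓞 K) × Fin ℓ × Fin ℓ
  obtain ⟨f, hf, hfS⟩ := inj_choice (ι := Option (Option ι)) (fun o => S (o.map (Option.map fun k => (k.1, (k.2.1 : ℕ), (k.2.2 : ℕ))))) (by
    rintro (_ | _ | k)
    · exact (nf_primes K 1).sdiff hbad
    · exact (nf_primes K 1).sdiff hbad
    · exact (nf_primes K k.1).sdiff hbad)
  have hfb : ∀ o, f o ∉ bad := by
    rintro (_ | _ | k)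
    · exact (hfS none).2
    · exact (hfS (some none)).2
    · exact (hfS (some (some k))).2
  have hfl : ∀ o, (ℓ : 𝓞 K) ∉ (f o).asIdeal := fun o h => hfb o (Or.inr h)
  have hlv : ∀ P : H, (ℓ : 𝓞 K) ∉ P.asIdeal → (plc K P).val (ℓ : K) = 1 := fun P h => by
    have := (plc_eq_one_iff (K := K) P (ℓ:𝓞 K)).2 h; simpa using this
  have hfin : ∀ P : H, Finite (IsLocalRing.ResidueField (plc K P).val.valuationSubring) := by
    intro P
    have : Finite (𝓞 K ⧸ P.asIdeal) := Ideal.finiteQuotientOfFreeOfNeBot _ P.ne_bot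
    exact plc_fin P
  have hcard : ∀ o, ℓ + 1 < resCard (plc K (f o)) := by
    intro o
    rw [plc_card]
    exact not_le.1 fun h => hfb o (Or.inl h)
  have hroot : ∀ o, ∀ i : ℕ, ∃ u : K, (plc K (f o)).val u = 1 ∧ (plc K (f o)).val (u - 1) = 1 ∧
      (plc K (f o)).val (u ^ ((resCard (plc K (f o)) - 1) / ℓ) - ω ^ i) < 1 := fun o i => by
    have := hfin (f o)
    exact res_root _ hℓ hω (hlv _ (hfl o)) (hcard o) i
  choose r hr1 hr2 hr3 using hroot
  let T0 : Finset H := Finset.univ.image fun k : ι => f (some (some k))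
  have hU : ∀ e : ι → ℕ, ∃ u : H → K, (∀ k, u (f (some (some k))) = r (some (some k)) (e k)) ∧ ∀ P ∉ T0, u P = ω := by
    intro e
    refine ⟨fun P => if h : ∃ k, f (some (some k)) = P then r (some (some h.choose)) (e h.choose) else ω, fun k => ?_, fun P hP => ?_⟩
    · have h : ∃ k', f (some (some k')) = f (some (some k)) := ⟨k, rfl⟩
      have h2 : h.choose = k := by have := hf h.choose_spec; simpa using this
      simp only
      rw [dif_pos h, h2]
    · refine dif_neg fun ⟨k, hk⟩ => hP ?_
      simp only [T0, Finset.mem_image]; exact ⟨k, by simp, hk⟩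
  have hpick : ∀ (e : ι → ℕ) (T : Finset H) (P0 : H), (∀ P ∈ T, (ℓ : 𝓞 K) ∉ P.asIdeal) → ((ℓ : 𝓞 K) ∉ P0.asIdeal) → P0 ∉ T → P0 ∉ T0 →
      (∀ P ∈ T, P ∉ T0) → ∃ a : K, a ≠ 0 ∧ (∃ c : 𝓞 K, c ≠ 0 ∧ a = 1 + (ℓ:K) ^ 3 * (ϖ (𝓞 K) K c)⁻¹) ∧ (∀ P : H, (ℓ:𝓞 K) ∈ P.asIdeal → (plc K P).val a = 1) ∧
      vz (plc K P0) a = 1 ∧ (∀ P ∈ T, (plc K P).val a = 1) ∧ ∀ k, (plc K (f (some (some k)))).val a = 1 ∧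
        (plc K (f (some (some k)))).val (a ^ ((resCard (plc K (f (some (some k)))) - 1) / ℓ) - ω ^ e k) < 1 := by
    intro e T P0 hT hP0 hP0T hP00 hTT
    obtain ⟨u, hu1, hu2⟩ := hU e
    obtain ⟨a, h1, h2, h3, h4, h5⟩ := nf_pick (K := K) ℓ hℓ.ne_zero (T ∪ T0) P0 (by
        intro P hP
        rcases Finset.mem_union.1 hP with h | h
        · exact hT P h
        · obtain ⟨k, -, rfl⟩ := Finset.mem_image.1 h
          exact hfl _) hP0 (by simp [hP0T, hP00]) u (by
        intro P hP
        by_cases h : P ∈ T0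
        · obtain ⟨k, -, rfl⟩ := Finset.mem_image.1 h
          rw [hu1]; exact hr1 _ _
        · rw [hu2 P h]
          exact (prim_one _ hℓ hω (hlv P (hT P ((Finset.mem_union.1 hP).resolve_right h)))).1) (by
        intro P hP
        by_cases h : P ∈ T0
        · obtain ⟨k, -, rfl⟩ := Finset.mem_image.1 h
          rw [hu1]; exact hr2 _ _
        · rw [hu2 P h]
          exact (prim_one _ hℓ hω (hlv P (hT P ((Finset.mem_union.1 hP).resolve_right h)))).2)
    refine ⟨a, h1, h2, h3, h4, fun P hP => ?_, fun k => ?_⟩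
    · refine one_of_lt _ (h5 P (Finset.mem_union_left _ hP)) ?_
      rw [hu2 P (hTT P hP)]; exact (prim_one _ hℓ hω (hlv P (hT P hP))).1
    · have h6 := h5 (f (some (some k))) (Finset.mem_union_right _ (Finset.mem_image_of_mem _ (Finset.mem_univ _)))
      rw [hu1] at h6
      refine ⟨one_of_lt _ h6 (hr1 _ _), ?_⟩
      have := Valuation.map_add_lt _ (pow_of_lt _ h6 (hr1 _ _) ((resCard (plc K (f (some (some k)))) - 1) / ℓ)) (hr3 (some (some k)) (e k))
      rwa [sub_add_sub_cancel] at this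
  have hnT : ∀ k : ι, f (some (some k)) ∈ T0 := fun k => Finset.mem_image_of_mem _ (Finset.mem_univ _)
  have hP1 : f none ∉ T0 := fun h => by
    obtain ⟨k, -, h⟩ := Finset.mem_image.1 h; exact absurd (hf h) (by simp)
  have hP2 : f (some none) ∉ T0 := fun h => by
    obtain ⟨k, -, h⟩ := Finset.mem_image.1 h; exact absurd (hf h) (by simp)
  have hP12 : f none ≠ f (some none) := fun h => absurd (hf h) (by simp)
  obtain ⟨a, ha0, ⟨c, hc0, hac⟩, hal, ha1, haT, hak⟩ := hpick (fun k => k.2.1) {f (some none)} (f none) (by simpa using hfl _) (hfl _) (by simpa using hP12) hP1 (by simpa using hP2)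
  have hfa := vz_fin (𝓞 K) ha0
  have hmem : ∀ P : H, P ∈ hfa.toFinset ↔ vz (plc K P) a ≠ 0 := fun P => hfa.mem_toFinset
  obtain ⟨b, hb0, ⟨d, hd0, hbd⟩, hbl, hb1, hbT, hbk⟩ := hpick (fun k => k.2.2) hfa.toFinset (f (some none))
    (fun P hP h => (hmem P).1 hP (vz_zero_of _ (hal P h))) (hfl _) (fun h => (hmem _).1 h (vz_zero_of _ (haT _ (by simp)))) hP2
    (fun P hP h => by
      obtain ⟨k, -, rfl⟩ := Finset.mem_image.1 h
      exact (hmem _).1 hP (vz_zero_of _ (hak k).1))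
  have hcop : ∀ v : FinPlace K, vz v a = 0 ∨ vz v b = 0 := by
    intro v
    obtain ⟨P, rfl⟩ := nf_places v
    by_cases h : vz (plc K P) a = 0
    · exact Or.inl h
    · exact Or.inr (vz_zero_of _ (hbT P ((hmem P).2 h)))
  have hb1' : vz (plc K (f none)) b = 0 := (hcop _).resolve_left (by rw [ha1]; norm_num)
  have hinv : ∀ c : 𝓞 K, c ≠ 0 → ∀ v : FinPlace K, 0 ≤ vz v (ϖ (𝓞 K) K c)⁻¹ := by
    intro c hc v
    obtain ⟨P, rfl⟩ := nf_places v
    rw [← one_div, vz_div _ one_ne_zero (by simpa using hc), vz_one]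
    have := vz_nonpos _ (plc_le_one (K := K) P c)
    omega
  refine ⟨a, b, ha0, hb0, hcop, ⟨?_, ?_, ?_⟩, ⟨_, _, hinv c hc0, hinv d hd0, hac, hbd⟩, ?_⟩
  · rintro ⟨t, ht⟩
    exact not_pow hℓ (fun h => ha0 (by rw [ht, h, zero_pow hℓ.ne_zero])) ha1 ht
  · rintro ⟨t, ht⟩
    exact not_pow hℓ (fun h => hb0 (by rw [ht, h, zero_pow hℓ.ne_zero])) hb1 ht
  · rintro ⟨t, ht⟩
    refine not_pow (v := plc K (f none)) (a := a / b) (t := t) hℓ (fun h => ha0 (by rw [ht, h, zero_pow hℓ.ne_zero, mul_zero])) ?_ (by rw [ht]; field_simp)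
    rw [vz_div _ ha0 hb0, ha1, hb1']; norm_num
  · intro α β hα hβ σ D hD
    obtain ⟨i, j, hij⟩ := frob_final hℓ hω hchar ha0 hb0 hα hβ σ
    obtain ⟨γ, hγ⟩ := div_cls K (fun P : H => D (plc K P)) (hD.preimage hplc.injOn)
    let k : ι := (γ, ⟨i % ℓ, Nat.mod_lt _ hℓ.pos⟩, ⟨j % ℓ, Nat.mod_lt _ hℓ.pos⟩)
    have hωi : ∀ i, ω ^ (i % ℓ) = ω ^ i := fun i => by
      conv_lhs => rw [hω.eq_orderOf]
      exact pow_mod_orderOf ω i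
    obtain ⟨x, hx0, hx⟩ := hγ (f (some (some k))) (hfS (some (some k))).1
    have h1 := (hak k).2
    have h2 := (hbk k).2
    simp only [k, hωi] at h1 h2
    obtain ⟨hunr, hfr⟩ := hij (plc K (f (some (some k)))) (hfin _) (hak k).1 (hbk k).1 (hlv _ (hfl _)) h1 h2
    refine ⟨_, hunr, hfr, x, hx0, fun w => ?_⟩
    obtain ⟨P, rfl⟩ := nf_places w
    rw [hx P]
    simp only [hplc.eq_iff]
end NF5
section FF0
open WithZero
structure FQ (B : Type*) [CommRing B] [Algebra B K] (Q : FinPlace K) : Prop where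
  inj : Function.Injective (ϖ B K)
  resfin : Finite (IsLocalRing.ResidueField Q.val.valuationSubring)
  zero : ∀ b : B, Q.val (ϖ B K b) < 1 → b = 0
  lead : ∀ J : Ideal B, J ≠ ⊥ → ∃ n0 : ℕ, ∀ g : K, g ≠ 0 → n0 ≤ vz Q g →
    ∃ j ∈ J, Q.val (ϖ B K j - g) < Q.val g
variable {B : Type*} [CommRing B] [Algebra B K]
def Fil (Q : FinPlace K) (J : Ideal B) (n : ℤ) : AddSubgroup B where
  carrier := {b | b ∈ J ∧ Q.val (ϖ B K b) ≤ exp n}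
  zero_mem' := ⟨zero_mem _, by simp⟩
  add_mem' := fun {a b} ha hb => ⟨add_mem ha.1 hb.1, by
    rw [map_add]; exact Valuation.map_add_le _ ha.2 hb.2⟩
  neg_mem' := fun {a} ha => ⟨neg_mem ha.1, by rw [map_neg, Valuation.map_neg]; exact ha.2⟩
lemma mem_Fil {Q : FinPlace K} {J : Ideal B} {n : ℤ} {b : B} : b ∈ Fil Q J n ↔ b ∈ J ∧ Q.val (ϖ B K b) ≤ exp n := Iff.rfl
lemma lt_exp_iff (x : WithZero (Multiplicative ℤ)) (n : ℤ) : x < exp n ↔ x ≤ exp (n - 1) := by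
  by_cases h : x = 0
  · simp [h]
  · obtain ⟨m, rfl⟩ : ∃ m : ℤ, x = exp m := ⟨_, (exp_log h).symm⟩
    rw [exp_lt_exp, exp_le_exp]; omega
lemma card_ker {G H : Type*} [AddGroup G] [AddGroup H] (f : G →+ H) : Nat.card G = Nat.card f.ker * Nat.card f.range := by
  rw [← AddSubgroup.index_ker, AddSubgroup.card_mul_index]
lemma exists_unif (Q : FinPlace K) (n : ℤ) : ∃ t : K, t ≠ 0 ∧ Q.val t = exp n := by
  obtain ⟨t, ht⟩ := Q.surj (exp n)
  exact ⟨t, by rintro rfl; rw [map_zero] at ht; exact exp_ne_zero ht.symm, ht⟩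
def ldc (Q : FinPlace K) (J : Ideal B) (n : ℤ) (t : K) (ht : Q.val t = exp n) : Fil Q J n →+ IsLocalRing.ResidueField Q.val.valuationSubring where
  toFun b := IsLocalRing.residue _ ⟨ϖ B K b / t, by
    rw [Valuation.mem_valuationSubring_iff, map_div₀, ht]; exact div_le_one_of_le₀ b.2.2 zero_le⟩
  map_zero' := by
    rw [← map_zero (IsLocalRing.residue _)]; congr 1; ext; simp
  map_add' a b := by
    rw [← map_add]; congr 1; ext; simp [add_div]
lemma ldc_ker (Q : FinPlace K) (J : Ideal B) (n : ℤ) (t : K) (ht : Q.val t = exp n) (b : Fil Q J n) :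
    b ∈ (ldc Q J n t ht).ker ↔ (b : B) ∈ Fil Q J (n - 1) := by
  rw [AddMonoidHom.mem_ker, mem_Fil, ← lt_exp_iff, ← ht]
  change IsLocalRing.residue _ _ = 0 ↔ _
  have ht0 : 0 < Q.val t := by rw [ht]; exact exp_pos
  rw [← map_zero (IsLocalRing.residue _), residue_eq_iff]
  simp only [ZeroMemClass.coe_zero, sub_zero, map_div₀]
  rw [div_lt_one₀ ht0]
  exact (and_iff_right b.2.1).symm
lemma ldc_card (Q : FinPlace K) (J : Ideal B) (n : ℤ) (t : K) (ht : Q.val t = exp n) :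
    Nat.card (Fil Q J n) = Nat.card (Fil Q J (n - 1)) * Nat.card (ldc Q J n t ht).range := by
  rw [card_ker (ldc Q J n t ht)]
  congr 1
  refine Nat.card_congr ⟨fun b => ⟨b.1.1, (ldc_ker Q J n t ht b.1).1 b.2⟩, fun b => ⟨⟨b.1, b.2.1, b.2.2.trans (exp_le_exp.2 (by omega))⟩, (ldc_ker Q J n t ht _).2 b.2⟩, fun b => rfl, fun b => rfl⟩
variable {Q : FinPlace K} (H : FQ B Q)
include H
lemma FQ.fin (J : Ideal B) (n : ℤ) : Finite (Fil Q J n) := by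
  have := H.resfin
  have key : ∀ n : ℕ, Nat.card (Fil Q J ((n:ℤ) - 1)) ≠ 0 := by
    intro n
    induction n with
    | zero =>
      have : Subsingleton (Fil Q J (((0:ℕ):ℤ) - 1)) := ⟨fun a b => by
        have h : ∀ c : Fil Q J (((0:ℕ):ℤ) - 1), (c : B) = 0 := fun c => H.zero _ (by
          have := c.2.2; rw [← lt_exp_iff] at this; simpa using this)
        exact Subtype.ext (by rw [h a, h b])⟩
      exact Nat.card_pos.ne'
    | succ n ih =>
      obtain ⟨t, -, ht⟩ := exists_unif Q (((n+1:ℕ):ℤ) - 1)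
      rw [ldc_card Q J _ t ht]
      have h1 : (((n+1:ℕ):ℤ) - 1) - 1 = (n:ℤ) - 1 := by push_cast; ring
      have h2 : Nat.card (ldc Q J _ t ht).range ≠ 0 := Nat.card_pos.ne'
      rw [h1]
      exact mul_ne_zero ih h2
  have h1 := Nat.finite_of_card_ne_zero (key (n + 1).toNat)
  exact Finite.of_injective (fun b : Fil Q J n => (⟨b.1, b.2.1, b.2.2.trans (exp_le_exp.2 (by omega))⟩ : Fil Q J (((n+1).toNat:ℤ) - 1))) fun a b h => Subtype.ext (congrArg (fun c : Fil Q J (((n+1).toNat:ℤ) - 1) => (c : B)) h)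
lemma FQ.one_lt : 1 < resCard Q := by
  have := H.resfin
  exact Finite.one_lt_card
lemma FQ.step {J : Ideal B} (hJ : J ≠ ⊥) : ∃ n0 : ℕ, ∀ n : ℤ, n0 ≤ n → Nat.card (Fil Q J n) = Nat.card (Fil Q J (n - 1)) * resCard Q := by
  obtain ⟨n0, h0⟩ := H.lead J hJ
  refine ⟨n0, fun n hn => ?_⟩
  obtain ⟨t, ht0, ht⟩ := exists_unif Q n
  rw [ldc_card Q J n t ht]
  congr 1
  rw [resCard]
  suffices (ldc Q J n t ht).range = ⊤ by rw [this]; exact Nat.card_congr AddSubgroup.topEquiv.toEquiv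
  rw [AddMonoidHom.range_eq_top]
  intro u
  obtain ⟨⟨u, hu⟩, rfl⟩ := IsLocalRing.residue_surjective u
  have htp : 0 < Q.val t := by rw [ht]; exact exp_pos
  by_cases h : Q.val u < 1
  · refine ⟨0, ?_⟩
    rw [map_zero, ← map_zero (IsLocalRing.residue _), residue_eq_iff]; simpa using h
  · have hu1 : Q.val u = 1 := le_antisymm hu (not_lt.1 h)
    have hu0 : u ≠ 0 := by rintro rfl; simp at hu1
    have hg : Q.val (u * t) = exp n := by rw [map_mul, hu1, one_mul, ht]
    obtain ⟨j, hj, hjv⟩ := h0 (u * t) (mul_ne_zero hu0 ht0) (by rw [vz_of Q hg]; exact hn)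
    have hjn : Q.val (ϖ B K j) ≤ exp n := by
      have h3 := Valuation.map_add Q.val (ϖ B K j - u * t) (u * t)
      rw [sub_add_cancel] at h3
      exact h3.trans (max_le (hjv.le.trans hg.le) hg.le)
    refine ⟨⟨j, hj, hjn⟩, ?_⟩
    refine (residue_eq_iff Q _ _).2 ?_
    change Q.val (ϖ B K j / t - u) < 1
    have : ϖ B K j / t - u = (ϖ B K j - u * t) / t := by field_simp
    rw [this, map_div₀, div_lt_one₀ htp, ht, ← hg]; exact hjv
lemma FQ.red {J : Ideal B} (hJ : J ≠ ⊥) : ∃ n0 : ℕ, ∀ n : ℤ, n0 ≤ n → ∀ b : B, ∃ c : B, b - c ∈ J ∧ Q.val (ϖ B K c) ≤ exp n := by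
  obtain ⟨n0, h0⟩ := H.lead J hJ
  refine ⟨n0, fun n hn => ?_⟩
  suffices ∀ r : ℕ, ∀ b : B, Q.val (ϖ B K b) ≤ exp (n + r) → ∃ c : B, b - c ∈ J ∧ Q.val (ϖ B K c) ≤ exp n by
    intro b
    refine this (vz Q (ϖ B K b) - n).toNat b ?_
    by_cases hb : ϖ B K b = 0
    · rw [hb]; simp
    · rw [val_exp Q hb, exp_le_exp]; omega
  intro r
  induction r with
  | zero => exact fun b hb => ⟨b, by simp, by simpa using hb⟩
  | succ r ih =>
    intro b hb
    by_cases hlt : Q.val (ϖ B K b) < exp (n + (r + 1 : ℕ))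
    · exact ih b (by rw [lt_exp_iff] at hlt; convert hlt using 2; push_cast; ring)
    · have heq := le_antisymm hb (not_lt.1 hlt)
      have hb0 : ϖ B K b ≠ 0 := by intro h; rw [h, map_zero] at heq; exact exp_ne_zero heq.symm
      obtain ⟨j, hj, hjv⟩ := h0 _ hb0 (by rw [vz_of Q heq]; omega)
      rw [heq, lt_exp_iff] at hjv
      obtain ⟨c, hc, hcv⟩ := ih (b - j) (by
        rw [map_sub, Valuation.map_sub_swap]; convert hjv using 2; push_cast; ring)
      exact ⟨c, by have := add_mem hc hj; convert this using 1; ring, hcv⟩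
lemma FQ.quot_fin {J : Ideal B} (hJ : J ≠ ⊥) : Finite (B ⧸ J) := by
  obtain ⟨n0, h0⟩ := H.red hJ
  have := H.fin ⊤ n0
  refine Finite.of_surjective (fun b : Fil Q (⊤ : Ideal B) n0 => Ideal.Quotient.mk J b.1) fun x => ?_
  obtain ⟨b, rfl⟩ := Ideal.Quotient.mk_surjective x
  obtain ⟨c, hc, hcv⟩ := h0 n0 le_rfl b
  exact ⟨⟨c, trivial, hcv⟩, (Ideal.Quotient.eq.2 hc).symm⟩
lemma FQ.index {J : Ideal B} (hJ : J ≠ ⊥) : ∃ n0 : ℕ, ∀ n : ℤ, n0 ≤ n → Nat.card (Fil Q (⊤ : Ideal B) n) = Nat.card (Fil Q J n) * Nat.card (B ⧸ J) := by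
  obtain ⟨n0, h0⟩ := H.red hJ
  refine ⟨n0, fun n hn => ?_⟩
  let f : Fil Q (⊤ : Ideal B) n →+ B ⧸ J := (Ideal.Quotient.mk J : B →+ B ⧸ J).comp (Fil Q (⊤ : Ideal B) n).subtype
  rw [card_ker f]
  have hk : ∀ b : Fil Q (⊤ : Ideal B) n, b ∈ f.ker ↔ (b : B) ∈ J := fun b => Ideal.Quotient.eq_zero_iff_mem
  congr 1
  · exact Nat.card_congr ⟨fun b => ⟨b.1.1, (hk b.1).1 b.2, b.1.2.2⟩, fun b => ⟨⟨b.1, trivial, b.2.2⟩, (hk _).2 b.2.1⟩, fun b => rfl, fun b => rfl⟩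
  · have : f.range = ⊤ := by
      rw [AddMonoidHom.range_eq_top]
      intro x
      obtain ⟨b, rfl⟩ := Ideal.Quotient.mk_surjective x
      obtain ⟨c, hc, hcv⟩ := h0 n hn b
      exact ⟨⟨c, trivial, hcv⟩, (Ideal.Quotient.eq.2 hc).symm⟩
    rw [this]; exact Nat.card_congr AddSubgroup.topEquiv.toEquiv
lemma FQ.count : ∃ A : ℝ, 0 < A ∧ ∀ J : Ideal B, J ≠ ⊥ → ∃ n0 : ℕ, ∀ n : ℤ, n0 ≤ n →
    (Nat.card (Fil Q J n) : ℝ) * Nat.card (B ⧸ J) = A * (resCard Q : ℝ) ^ n := by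
  by_cases hB : (⊤ : Ideal B) = ⊥
  · exact ⟨1, one_pos, fun J hJ => absurd (eq_bot_iff.2 (hB ▸ le_top)) hJ⟩
  have hq : (0:ℝ) < resCard Q := by exact_mod_cast zero_lt_one.trans H.one_lt
  obtain ⟨n1, h1⟩ := H.step hB
  have hf := H.fin ⊤ n1
  have hc : (0:ℝ) < Nat.card (Fil Q (⊤ : Ideal B) n1) := by exact_mod_cast Nat.card_pos
  refine ⟨Nat.card (Fil Q (⊤ : Ideal B) n1) / (resCard Q : ℝ) ^ (n1 : ℤ), by positivity, fun J hJ => ?_⟩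
  obtain ⟨n2, h2⟩ := H.index hJ
  refine ⟨max n1 n2, fun n hn => ?_⟩
  have h3 := h2 n (by push_cast at hn; omega)
  rw [← Nat.cast_mul, ← h3]
  obtain ⟨r, rfl⟩ : ∃ r : ℕ, n = n1 + r := ⟨(n - n1).toNat, by push_cast at hn; omega⟩
  clear hn h3
  induction r with
  | zero => rw [Nat.cast_zero, add_zero, div_mul_cancel₀]; positivity
  | succ r ih =>
    rw [h1 _ (by push_cast; omega)]
    have : (n1:ℤ) + ((r+1:ℕ):ℤ) - 1 = n1 + r := by push_cast; ring
    rw [this, Nat.cast_mul, ih]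
    push_cast
    rw [← add_assoc, zpow_add_one₀ hq.ne']; ring
lemma FQ.coset : ∃ A : ℝ, 0 < A ∧ ∀ J : Ideal B, J ≠ ⊥ → ∀ c : B, ∃ n0 : ℕ, ∀ n : ℤ, n0 ≤ n →
    (Nat.card {b : B // b - c ∈ J ∧ Q.val (ϖ B K b) = exp n} : ℝ) * Nat.card (B ⧸ J) = A * (resCard Q : ℝ) ^ n := by
  obtain ⟨A, hA, h⟩ := H.count
  have hq : (1:ℝ) < resCard Q := by exact_mod_cast H.one_lt
  have hq0 : (0:ℝ) < resCard Q := by linarith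
  refine ⟨A * (1 - (resCard Q : ℝ)⁻¹), mul_pos hA (sub_pos.2 (inv_lt_one_of_one_lt₀ hq)), fun J hJ c => ?_⟩
  obtain ⟨n0, h0⟩ := h J hJ
  obtain ⟨n1, h1⟩ := H.red hJ
  obtain ⟨c', hc', hcv⟩ := h1 n1 le_rfl c
  have hcard : ∀ n : ℤ, n1 ≤ n → Nat.card {b : B // b - c ∈ J ∧ Q.val (ϖ B K b) ≤ exp n} = Nat.card (Fil Q J n) := by
    intro n hn
    have hcv' := hcv.trans (exp_le_exp.2 hn)
    refine Nat.card_congr ⟨fun b => ⟨b.1 - c', ?_, ?_⟩, fun b => ⟨b.1 + c', ?_, ?_⟩, fun b => by simp, fun b => by simp⟩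
    · have := add_mem b.2.1 hc'; convert this using 1; ring
    · rw [map_sub]; exact Valuation.map_sub_le _ b.2.2 hcv'
    · have := sub_mem b.2.1 hc'; convert this using 1; ring
    · rw [map_add]; exact Valuation.map_add_le _ b.2.2 hcv'
  refine ⟨max n0 n1 + 1, fun n hn => ?_⟩
  push_cast at hn
  have hfin : ∀ m : ℤ, {b : B | b - c ∈ J ∧ Q.val (ϖ B K b) ≤ exp m}.Finite := fun m => by
    have := H.fin ⊤ m
    refine Set.Finite.subset (Set.toFinite (Fil Q (⊤ : Ideal B) m : Set B)) fun b hb => ⟨trivial, hb.2⟩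
  have hsplit : Nat.card {b : B // b - c ∈ J ∧ Q.val (ϖ B K b) ≤ exp n} = Nat.card {b : B // b - c ∈ J ∧ Q.val (ϖ B K b) ≤ exp (n-1)} +
      Nat.card {b : B // b - c ∈ J ∧ Q.val (ϖ B K b) = exp n} := by
    have hu : {b : B | b - c ∈ J ∧ Q.val (ϖ B K b) ≤ exp n} = {b : B | b - c ∈ J ∧ Q.val (ϖ B K b) ≤ exp (n-1)} ∪ {b : B | b - c ∈ J ∧ Q.val (ϖ B K b) = exp n} := by
      ext b
      simp only [Set.mem_union, Set.mem_ofPred_eq, ← lt_exp_iff]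
      rw [le_iff_lt_or_eq]; tauto
    have hd : Disjoint {b : B | b - c ∈ J ∧ Q.val (ϖ B K b) ≤ exp (n-1)} {b : B | b - c ∈ J ∧ Q.val (ϖ B K b) = exp n} := by
      rw [Set.disjoint_left]
      rintro b ⟨-, h1⟩ ⟨-, h2⟩
      rw [← lt_exp_iff, h2] at h1; exact lt_irrefl _ h1
    have := Set.ncard_union_eq hd (hfin _) ((hfin n).subset fun b hb => ⟨hb.1, hb.2.le⟩)
    rw [← hu] at this
    exact this
  rw [hcard n (by omega), hcard (n-1) (by omega)] at hsplit
  have e1 := h0 n (by omega)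
  have e2 := h0 (n-1) (by omega)
  rw [zpow_sub_one₀ hq0.ne'] at e2
  have : (Nat.card (Fil Q J n) : ℝ) = Nat.card (Fil Q J (n-1)) + Nat.card {b : B // b - c ∈ J ∧ Q.val (ϖ B K b) = exp n} := by exact_mod_cast hsplit
  linear_combination e1 - e2 - Nat.card (B ⧸ J) * this
end FF0
section FF1
open WithZero IsDedekindDomain Polynomial
variable {B : Type*} [CommRing B] [IsDomain B] [Algebra B K] {Q : FinPlace K}
lemma FQ.hfq (H : FQ B Q) : Ring.HasFiniteQuotients B := ⟨fun h => H.quot_fin h⟩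
lemma FQ.dedekind [IsIntegrallyClosed B] (H : FQ B Q) : IsDedekindDomain B := by
  have := H.hfq
  exact { }
variable {k : Type*} [Field k] [Finite k] [Algebra k K]
lemma fin_val (w : FinPlace K) {c : k} (hc : c ≠ 0) : w.val (ϖ k K c) = 1 := by
  have := Fintype.ofFinite k
  have h1 : w.val (ϖ k K c) ^ (Fintype.card k - 1) = 1 := by
    rw [← map_pow, ← map_pow, FiniteField.pow_card_sub_one_eq_one c hc, map_one, map_one]
  exact (pow_eq_one_iff.1 h1).resolve_right (by have := Fintype.one_lt_card (α := k); omega)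
lemma fin_val_le (w : FinPlace K) (c : k) : w.val (ϖ k K c) ≤ 1 := by
  by_cases h : c = 0
  · simp [h]
  · exact (fin_val w h).le
variable [Algebra k B] [IsScalarTower k B K] [Algebra k[X] B] [IsScalarTower k k[X] B]
lemma FQ.poly_inj (hy : 1 < Q.val (ϖ B K (ϖ k[X] B X))) : Function.Injective (ϖ k[X] B) := by
  rw [injective_iff_map_eq_zero]
  intro f hf
  by_contra hf0
  have hf' : aeval (ϖ k[X] B X) f = 0 := by
    rw [← hf, aeval_algebraMap_apply, aeval_X_left_apply]
  have h2 : IsAlgebraic k (ϖ B K (ϖ k[X] B X)) := ⟨f, hf0, by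
    rw [aeval_algebraMap_apply, hf', map_zero]⟩
  exact absurd (Q.int_le (R := k) (fin_val_le Q) _ h2.isIntegral) (not_le.2 hy)
lemma FQ.poly_fin (H : FQ B Q) (hy : 1 < Q.val (ϖ B K (ϖ k[X] B X))) : Module.Finite k[X] B := by
  set y := ϖ k[X] B X with hyd
  have hy0 : y ≠ 0 := by intro h; rw [h] at hy; simp at hy
  obtain ⟨n0, h0⟩ := H.red (J := Ideal.span {y}) (by simpa using hy0)
  have := H.fin ⊤ n0
  have hF : (Fil Q (⊤ : Ideal B) n0 : Set B).Finite := Set.toFinite _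
  refine ⟨⟨hF.toFinset, ?_⟩⟩
  rw [hF.coe_toFinset, eq_top_iff]
  suffices ∀ r : ℕ, ∀ b : B, Q.val (ϖ B K b) ≤ exp (n0 + r : ℤ) → b ∈ Submodule.span k[X] (Fil Q (⊤ : Ideal B) n0 : Set B) by
    intro b _
    refine this (vz Q (ϖ B K b) - n0).toNat b ?_
    by_cases hb : ϖ B K b = 0
    · rw [hb]; simp
    · rw [val_exp Q hb, exp_le_exp]; omega
  intro r
  induction r with
  | zero => exact fun b hb => Submodule.subset_span ⟨trivial, by simpa using hb⟩
  | succ r ih =>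
    intro b hb
    obtain ⟨c, hc, hcv⟩ := h0 n0 le_rfl b
    obtain ⟨d, hd⟩ := Ideal.mem_span_singleton.1 hc
    have hb' : b = c + (X : k[X]) • d := by rw [Algebra.smul_def, ← hyd, ← hd]; ring
    rw [hb']
    refine add_mem (Submodule.subset_span ⟨trivial, hcv⟩) (Submodule.smul_mem _ _ (ih d ?_))
    have h1 : Q.val (ϖ B K (y * d)) ≤ exp ((n0:ℤ) + (r+1:ℕ)) := by
      rw [← hd, map_sub]
      exact Valuation.map_sub_le _ hb (hcv.trans (exp_le_exp.2 (by push_cast; omega)))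
    by_cases hd0 : ϖ B K d = 0
    · rw [hd0]; simp
    have hy0' : ϖ B K y ≠ 0 := by intro h; rw [h] at hy; simp at hy
    rw [map_mul, map_mul, val_exp Q hd0, val_exp Q hy0', ← exp_add, exp_le_exp] at h1
    rw [val_exp Q hy0', ← exp_zero, exp_lt_exp] at hy
    rw [val_exp Q hd0, exp_le_exp]; push_cast at h1; omega
omit [IsDomain B] [Algebra B K] in
lemma norm_sub_eval {F : Type*} [Field F] [Algebra k F] [FiniteDimensional k F] (x : F) (s : ℕ) (hs : s * (minpoly k x).natDegree = Module.finrank k F) (c : k) :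
    Algebra.norm k (x - ϖ k F c) = (-1) ^ Module.finrank k F * (minpoly k x ^ s).eval c := by
  have hi := Algebra.IsIntegral.isIntegral (R := k) (x - ϖ k F c)
  have hmp := minpoly.sub_algebraMap x c
  have hdeg : (minpoly k (x - ϖ k F c)).natDegree = (minpoly k x).natDegree := by
    rw [hmp, natDegree_comp]; simp
  have hpos : 0 < (minpoly k x).natDegree := minpoly.natDegree_pos (Algebra.IsIntegral.isIntegral x)
  have h1 := Module.finrank_mul_finrank k k⟮x - ϖ k F c⟯ F
  rw [adjoin.finrank hi, hdeg, ← hs, mul_comm] at h1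
  rw [Algebra.norm_eq_norm_adjoin, Nat.eq_of_mul_eq_mul_right hpos h1]
  have h2 := Algebra.PowerBasis.norm_gen_eq_coeff_zero_minpoly (adjoin.powerBasis hi)
  rw [adjoin.powerBasis_gen, adjoin.powerBasis_dim, minpoly_gen, hdeg] at h2
  rw [h2, mul_pow, ← pow_mul, ← hs, mul_comm s, eval_pow, hmp, coeff_zero_eq_eval_zero, eval_comp]
  simp
lemma FQ.clfin [IsIntegrallyClosed B] (H : FQ B Q) (hy : 1 < Q.val (ϖ B K (ϖ k[X] B X))) : Finite (ClassGroup B) := by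
  have := H.dedekind
  have := H.poly_fin hy
  have hinj := FQ.poly_inj (k := k) hy
  have : Module.IsTorsionFree k[X] B := Module.isTorsionFree_iff_algebraMap_injective.2 hinj
  have := Fintype.ofFinite k
  have := ClassGroup.fintypeOfAdmissibleOfAlgebraic (Module.Free.chooseBasis k[X] B) (cardPowDegreeIsAdmissible (Fq := k))
  exact Finite.of_fintype _
end FF1
section FF1b
open WithZero IsDedekindDomain Polynomial Module
variable {B : Type*} [CommRing B] [IsDedekindDomain B] {k : Type*} [Field k] [Finite k] [Algebra k B] [Algebra k[X] B] [IsScalarTower k k[X] B]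
  [Module.Finite k[X] B] [IsTorsionFree k[X] B]
lemma aeval_y {F : Type*} [CommRing F] [Algebra k F] (g : B →ₐ[k] F) (f : k[X]) : g (ϖ k[X] B f) = aeval (g (ϖ k[X] B X)) f := by
  rw [aeval_algHom_apply, aeval_algebraMap_apply, aeval_X_left_apply]
lemma nuP [Finite (ClassGroup B)] [Ring.HasFiniteQuotients B] (P : ℌ B) : ∃ ν : k[X], ν.Monic ∧ Ideal.relNorm k[X] P.asIdeal = Ideal.span {ν} ∧
    ∀ c, Algebra.norm k (Ideal.Quotient.mk P.asIdeal (ϖ k[X] B (X - C c))) = (-1) ^ finrank k (B ⧸ P.asIdeal) * ν.eval c := by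
  have hPm : P.asIdeal.IsMaximal := P.isPrime.isMaximal P.ne_bot
  letI := Ideal.Quotient.field P.asIdeal
  have hfin : Finite (B ⧸ P.asIdeal) := Ring.HasFiniteQuotients.finiteQuotient P.ne_bot
  set x : B ⧸ P.asIdeal := Ideal.Quotient.mk P.asIdeal (ϖ k[X] B X) with hx
  have hev : ∀ f : k[X], Ideal.Quotient.mk P.asIdeal (ϖ k[X] B f) = aeval x f := fun f => aeval_y (Ideal.Quotient.mkₐ k P.asIdeal) f
  have hp : P.asIdeal.under k[X] = Ideal.span {minpoly k x} := by
    ext f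
    rw [Ideal.mem_span_singleton, minpoly.dvd_iff, ← hev, Ideal.Quotient.eq_zero_iff_mem]; rfl
  have hpp : (P.asIdeal.under k[X]).IsPrime := inferInstance
  obtain ⟨s, hs⟩ := Ideal.exists_relNorm_eq_pow_of_isPrime P.asIdeal (P.asIdeal.under k[X])
  rw [hp, Ideal.span_singleton_pow] at hs
  have hmon : (minpoly k x).Monic := minpoly.monic (Algebra.IsIntegral.isIntegral x)
  refine ⟨_, hmon.pow s, hs, fun c => ?_⟩
  have : Ideal.Quotient.mk P.asIdeal (ϖ k[X] B (X - C c)) = x - ϖ k _ c := by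
    rw [hev]; simp
  rw [this]
  refine norm_sub_eval x s ?_ c
  obtain ⟨h, hh, z, hz⟩ : ∃ h : ℕ, 0 < h ∧ ∃ z : B, P.asIdeal ^ h = Ideal.span {z} := by
    let g := ClassGroup.mk0 ⟨P.asIdeal, mem_nonZeroDivisors_of_ne_zero P.ne_bot⟩
    refine ⟨orderOf g, orderOf_pos g, ?_⟩
    have h1 : g ^ orderOf g = 1 := pow_orderOf_eq_one g
    rw [← map_pow, ClassGroup.mk0_eq_one_iff] at h1
    exact ⟨_, h1.principal.choose_spec⟩
  have hz0 : z ≠ 0 := by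
    rintro rfl
    have : P.asIdeal ^ h = ⊥ := by simpa using hz
    exact P.ne_bot (eq_zero_of_pow_eq_zero this)
  have h1 := finrank_quotient_span_eq_natDegree_norm (F := k) (Free.chooseBasis k[X] B) hz0
  have h2 := congrArg (Ideal.relNorm k[X]) hz
  rw [map_pow, hs, Ideal.relNorm_singleton, Algebra.intNorm_eq_norm, Ideal.span_singleton_pow, Ideal.span_singleton_eq_span_singleton] at h2
  have h3 := natDegree_eq_of_degree_eq (degree_eq_degree_of_associated h2)
  rw [← h1, ← hz, natDegree_pow, natDegree_pow] at h3
  have h4 : Submodule.cardQuot (P.asIdeal ^ h) = _ := cardQuot_pow_of_prime P.ne_bot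
  have hf2 : Finite (B ⧸ P.asIdeal ^ h) := Ring.HasFiniteQuotients.finiteQuotient (pow_ne_zero _ P.ne_bot)
  rw [Submodule.cardQuot_apply, Submodule.cardQuot_apply, Module.natCard_eq_pow_finrank (K := k), Module.natCard_eq_pow_finrank (K := k) (V := B ⧸ P.asIdeal), ← pow_mul] at h4
  have h5 := Nat.pow_right_injective (Finite.one_lt_card (α := k)) h4
  rw [← h3, mul_comm] at h5
  exact Nat.eq_of_mul_eq_mul_right hh h5
end FF1b
section FF2
open WithZero IsDedekindDomain Polynomial Module
variable {B : Type*} [CommRing B] [IsDedekindDomain B] {k : Type*} [Field k] [Finite k] [Algebra k B] [Algebra k[X] B] [IsScalarTower k k[X] B]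
  [Module.Finite k[X] B] [IsTorsionFree k[X] B]
lemma norm_eval (z : B) (c : k) : (Algebra.norm k[X] z).eval c = Algebra.norm k (Ideal.Quotient.mk (Ideal.span {ϖ k[X] B (X - C c)}) z) := by
  set b := Free.chooseBasis k[X] B with hb
  set J := Ideal.span {ϖ k[X] B (X - C c)} with hJ
  let φ : B →ₗ[k] (Free.ChooseBasisIndex k[X] B → k) :=
    { toFun := fun x i => (b.repr x i).eval c
      map_add' := fun x y => by ext i; simp
      map_smul' := fun r x => by
        ext i
        have : r • x = (C r : k[X]) • x := by rw [← algebraMap_eq, algebraMap_smul]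
        simp [this] }
  have hφs : Function.Surjective φ := fun f => ⟨∑ i, (C (f i) : k[X]) • b i, by
    ext i
    change (b.repr _ i).eval c = _
    rw [b.repr_sum_self]; simp⟩
  have hφk : ∀ x, φ x = 0 ↔ x ∈ J := by
    intro x
    constructor
    · intro h
      have h1 : ∀ i, ∃ g : k[X], b.repr x i = (X - C c) * g := fun i => dvd_iff_isRoot.2 (congrFun h i)
      choose g hg using h1
      rw [Ideal.mem_span_singleton]
      refine ⟨∑ i, g i • b i, ?_⟩
      conv_lhs => rw [← b.sum_repr x]
      simp_rw [hg, mul_smul, ← Finset.smul_sum]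
      rw [Algebra.smul_def]
    · intro h
      obtain ⟨w, rfl⟩ := Ideal.mem_span_singleton.1 h
      ext i
      change (b.repr _ i).eval c = 0
      rw [← Algebra.smul_def]; simp
  let e : (B ⧸ J) ≃ₗ[k] (Free.ChooseBasisIndex k[X] B → k) :=
    (Submodule.quotEquivOfEq (J.restrictScalars k) _ (by ext x; exact (hφk x).symm)).trans (φ.quotKerEquivOfSurjective hφs)
  have he : ∀ x, e (Ideal.Quotient.mk J x) = φ x := fun x => rfl
  rw [Algebra.norm_eq_matrix_det b, Algebra.norm_apply, ← LinearMap.det_conj _ e, ← coe_evalRingHom, RingHom.map_det, ← LinearMap.det_toLin']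
  congr 1
  refine LinearMap.ext fun v => ?_
  obtain ⟨x, rfl⟩ := hφs v
  have : (e.toLinearMap ∘ₗ (Algebra.lmul k (B ⧸ J)) (Ideal.Quotient.mk J z) ∘ₗ e.symm.toLinearMap) (φ x) = φ (z * x) := by
    simp only [LinearMap.comp_apply, LinearEquiv.coe_coe]
    rw [← he x, e.symm_apply_apply]; exact he (z * x)
  rw [this, Matrix.toLin'_apply]
  ext i
  change _ = (b.repr (z * x) i).eval c
  rw [← Algebra.leftMulMatrix_mulVec_repr b z x]
  simp [Matrix.mulVec, dotProduct, eval_finset_sum, φ]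
omit [IsDedekindDomain B] [Module.Finite k[X] B] [IsTorsionFree k[X] B] [Algebra k[X] B] [IsScalarTower k k[X] B] in
lemma norm_quot (I P C : Ideal B) (hI : C * P ≤ I) (hIP : I ≤ P) [Finite (B ⧸ I)] (x : B) (hx : x - 1 ∈ C) :
    Algebra.norm k (Ideal.Quotient.mk I x) = Algebra.norm k (Ideal.Quotient.mk P x) := by
  let f : (B ⧸ I) →ₗ[k] (B ⧸ P) := (Ideal.Quotient.factorₐ k hIP).toLinearMap
  have hf : ∀ b, f (Ideal.Quotient.mk I b) = Ideal.Quotient.mk P b := fun b => rfl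
  have hfs : Function.Surjective f := fun u => by
    obtain ⟨b, rfl⟩ := Ideal.Quotient.mk_surjective u
    exact ⟨_, hf b⟩
  set e := Algebra.lmul k (B ⧸ I) (Ideal.Quotient.mk I x) with he
  have hW : ∀ w, f w = 0 → e w = w := by
    intro w hw
    obtain ⟨b, rfl⟩ := Ideal.Quotient.mk_surjective w
    rw [hf, Ideal.Quotient.eq_zero_iff_mem] at hw
    change Ideal.Quotient.mk I x * Ideal.Quotient.mk I b = _
    rw [← map_mul, Ideal.Quotient.eq]
    apply hI
    have := Ideal.mul_mem_mul hx hw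
    convert this using 1; ring
  have hle : LinearMap.ker f ≤ (LinearMap.ker f).comap e := fun w hw => by
    rw [Submodule.mem_comap, hW w hw]; exact hw
  rw [Algebra.norm_apply, Algebra.norm_apply, LinearMap.det_eq_det_mul_det _ e hle]
  have h1 : e.restrict hle = LinearMap.id := LinearMap.ext fun w => Subtype.ext (hW w.1 w.2)
  rw [h1, LinearMap.det_id, one_mul, ← LinearMap.det_conj _ (f.quotKerEquivOfSurjective hfs)]
  congr 1
  refine LinearMap.ext fun v => ?_
  obtain ⟨w, rfl⟩ := hfs v
  obtain ⟨b, rfl⟩ := Ideal.Quotient.mk_surjective w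
  simp only [LinearMap.comp_apply, LinearEquiv.coe_coe]
  have h2 : f (Ideal.Quotient.mk I b) = f.quotKerEquivOfSurjective hfs (Submodule.Quotient.mk (Ideal.Quotient.mk I b)) := rfl
  rw [h2, LinearEquiv.symm_apply_apply]
  rfl
end FF2
section FF3
open WithZero IsDedekindDomain Module
variable {B : Type*} [CommRing B] [IsDedekindDomain B] [Algebra B K] {Q : FinPlace K}
def nrm (I : Ideal B) : ℕ := Nat.card (B ⧸ I)
lemma cop_idl (L : Ideal B) (I : ℌ B →₀ ℕ) (h : ∀ P ∈ I.support, IsCoprime L P.asIdeal) : IsCoprime L (idl I) :=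
  IsCoprime.prod_right fun P hP => (h P hP).pow_right
lemma nrm_idl (I : ℌ B →₀ ℕ) : nrm (idl I) = I.prod fun P n => nrm P.asIdeal ^ n := by
  induction I using Finsupp.induction with
  | zero => simp only [idl, Finsupp.prod_zero_index, Ideal.one_eq_top]; exact Nat.card_unique
  | single_add p n f hp hn ih =>
    have h3 : (Finsupp.single p n).prod (fun P n => nrm P.asIdeal ^ n) = nrm p.asIdeal ^ n := Finsupp.prod_single_index (pow_zero _)
    rw [idl_add, Finsupp.prod_add_index' (fun _ => pow_zero _) (fun _ _ _ => pow_add _ _ _), ← ih, h3, idl_single]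
    refine (cardQuot_mul_of_coprime ?_).trans (congrArg (· * _) (cardQuot_pow_of_prime p.ne_bot))
    refine cop_idl _ _ fun P hP => IsCoprime.pow_left ?_
    have h1 : p.asIdeal.IsMaximal := p.isPrime.isMaximal p.ne_bot
    have h2 : P.asIdeal.IsMaximal := P.isPrime.isMaximal P.ne_bot
    exact Ideal.isCoprime_of_isMaximal fun h => hp (by rwa [HeightOneSpectrum.ext h])
lemma nrm_mul {I J : Ideal B} (hI : I ≠ ⊥) (hJ : J ≠ ⊥) : nrm (I * J) = nrm I * nrm J := by
  obtain ⟨X, rfl⟩ := idl_surj hI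
  obtain ⟨Y, rfl⟩ := idl_surj hJ
  rw [← idl_add, nrm_idl, nrm_idl, nrm_idl, Finsupp.prod_add_index' (fun _ => pow_zero _) (fun _ _ _ => pow_add _ _ _)]
variable (H : FQ B Q)
include H
lemma FQ.nrm_pos {I : Ideal B} (hI : I ≠ ⊥) : 0 < nrm I := by
  have := H.quot_fin hI
  exact Nat.card_pos
lemma FQ.ne {z : B} (hz : z ≠ 0) : ϖ B K z ≠ 0 := fun h => hz (H.inj (by rw [h, map_zero]))
lemma FQ.deg {z : B} (hz : z ≠ 0) : 0 ≤ vz Q (ϖ B K z) := by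
  by_contra h
  refine hz (H.zero z ?_)
  rw [val_exp Q (H.ne hz), ← exp_zero, exp_lt_exp]; omega
lemma FQ.nrm_span {z : B} (hz : z ≠ 0) : (nrm (Ideal.span {z}) : ℝ) = (resCard Q : ℝ) ^ vz Q (ϖ B K z) := by
  obtain ⟨A, hA, h⟩ := H.count
  have hs : Ideal.span {z} ≠ ⊥ := by simpa using hz
  obtain ⟨n1, h1⟩ := h ⊤ top_ne_bot
  obtain ⟨n2, h2⟩ := h _ hs
  set d := vz Q (ϖ B K z) with hd
  have hd0 := H.deg hz
  obtain ⟨m, hm1, hm2⟩ : ∃ m : ℤ, n1 ≤ m ∧ n2 ≤ m := ⟨max n1 n2, by simp, by simp⟩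
  have e1 := h1 m hm1
  have e2 := h2 (m + d) (by omega)
  have hq : (0:ℝ) < resCard Q := by exact_mod_cast zero_lt_one.trans H.one_lt
  have hc : Nat.card (Fil Q (⊤ : Ideal B) m) = Nat.card (Fil Q (Ideal.span {z}) (m + d)) := by
    have hm : ∀ b : B, Q.val (ϖ B K (z * b)) ≤ exp (m + d) ↔ Q.val (ϖ B K b) ≤ exp m := by
      intro b
      rw [map_mul, map_mul, val_exp Q (H.ne hz), ← hd, add_comm, exp_add]
      exact mul_le_mul_iff_right₀ exp_pos
    refine Nat.card_congr (Equiv.ofBijective (fun b => ⟨z * b.1, Ideal.mem_span_singleton.2 ⟨_, rfl⟩, (hm _).2 b.2.2⟩) ⟨fun a b hab => ?_, fun c => ?_⟩)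
    · exact Subtype.ext (mul_left_cancel₀ hz (congrArg Subtype.val hab))
    · obtain ⟨b, hb⟩ := Ideal.mem_span_singleton.1 c.2.1
      exact ⟨⟨b, trivial, (hm b).1 (hb ▸ c.2.2)⟩, Subtype.ext hb.symm⟩
  have ht : Nat.card (B ⧸ (⊤ : Ideal B)) = 1 := Nat.card_unique
  rw [ht, hc] at e1
  rw [zpow_add₀ hq.ne', ← mul_assoc, ← e1] at e2
  have hp : (0:ℝ) < Nat.card (Fil Q (Ideal.span {z}) (m + d)) := by
    rw [Nat.cast_one, mul_one] at e1; rw [e1]; positivity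
  rw [Nat.cast_one, mul_one] at e2
  exact mul_left_cancel₀ hp.ne' e2
lemma FQ.cosetp (J : Ideal B) (hJ : J ≠ ⊥) (c : B) : ∃ n0 : ℕ, ∀ n : ℤ, n0 ≤ n → ∃ b, b - c ∈ J ∧ Q.val (ϖ B K b) = exp n := by
  obtain ⟨A, hA, h⟩ := H.coset
  obtain ⟨n0, h⟩ := h J hJ c
  refine ⟨n0, fun n hn => ?_⟩
  by_contra hne
  have : IsEmpty {b : B // b - c ∈ J ∧ Q.val (ϖ B K b) = exp n} := ⟨fun b => hne ⟨b.1, b.2⟩⟩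
  have h1 := h n hn
  have hq : (0:ℝ) < resCard Q := by exact_mod_cast zero_lt_one.trans H.one_lt
  rw [Nat.card_of_isEmpty, Nat.cast_zero, zero_mul] at h1
  have : 0 < A * (resCard Q : ℝ) ^ n := by positivity
  linarith
lemma FQ.pick {J L : Ideal B} (hJ : J ≠ ⊥) (hL : L ≠ ⊥) (h : IsCoprime J L) (u : B) (M : ℕ) (hM : 0 < M) (r : ℤ) :
    ∃ z, z ≠ 0 ∧ z ∈ J ∧ z - u ∈ L ∧ (M : ℤ) ∣ vz Q (ϖ B K z) - r := by
  obtain ⟨j, hj, l, hl, hjl⟩ := Ideal.isCoprime_iff_exists.1 h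
  obtain ⟨n0, h0⟩ := H.cosetp (J * L) (mul_ne_zero hJ hL) (j * u)
  obtain ⟨b, hb, hbv⟩ := h0 (r + M * (n0 + |r|)) (by
    have := neg_abs_le r
    have : (1:ℤ) ≤ M := by exact_mod_cast hM
    nlinarith [abs_nonneg r])
  refine ⟨b, ?_, ?_, ?_, ?_⟩
  · rintro rfl; rw [map_zero, map_zero] at hbv; exact exp_ne_zero hbv.symm
  · have := add_mem (Ideal.mul_le_left hb) (J.mul_mem_right u hj)
    simpa using this
  · have := sub_mem (Ideal.mul_le_right hb) (L.mul_mem_right u hl)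
    convert this using 1
    linear_combination u * hjl
  · rw [vz_of Q hbv]; simp
end FF3
section FF4
open WithZero IsDedekindDomain Module
variable {B : Type*} [CommRing B] [IsDedekindDomain B] [Algebra B K] {Q : FinPlace K} {μ : B} {M : ℕ}
variable (μ) in
abbrev PM := {P : ℌ B // μ ∉ P.asIdeal}
def jd (I : PM μ →₀ ℕ) : Ideal B := idl (I.mapDomain Subtype.val)
lemma jd_add (I J : PM μ →₀ ℕ) : jd (I + J) = jd I * jd J := by
  rw [jd, Finsupp.mapDomain_add, idl_add]; rfl
lemma jd_ne (I : PM μ →₀ ℕ) : jd I ≠ ⊥ := idl_ne _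
lemma jd_zero : jd (0 : PM μ →₀ ℕ) = 1 := by simp [jd, idl]
lemma jd_single (p : PM μ) : jd (Finsupp.single p 1) = p.1.asIdeal := by
  rw [jd, Finsupp.mapDomain_single, idl_single, pow_one]
lemma jd_inj : Function.Injective (jd : (PM μ →₀ ℕ) → Ideal B) := fun I J h =>
  Finsupp.mapDomain_injective Subtype.val_injective (idl_inj h)
lemma jd_cop (I : PM μ →₀ ℕ) : IsCoprime (Ideal.span {μ}) (jd I) := by
  refine cop_idl _ _ fun P hP => ?_
  obtain ⟨p, -, rfl⟩ := Finset.mem_image.1 (Finsupp.mapDomain_support hP)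
  have h1 : p.1.asIdeal.IsMaximal := p.1.isPrime.isMaximal p.1.ne_bot
  refine Ideal.isCoprime_iff_sup_eq.2 (h1.out.2 _ (lt_of_le_of_ne le_sup_right fun h => p.2 ?_))
  rw [h]; exact Ideal.mem_sup_left (Ideal.mem_span_singleton_self μ)
lemma jd_surj {a : Ideal B} (ha : a ≠ ⊥) (h : IsCoprime (Ideal.span {μ}) a) : ∃ I : PM μ →₀ ℕ, jd I = a := by
  obtain ⟨X, rfl⟩ := idl_surj ha
  refine ⟨X.comapDomain Subtype.val Subtype.val_injective.injOn, ?_⟩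
  rw [jd, Finsupp.mapDomain_comapDomain _ Subtype.val_injective]
  intro P hP
  refine ⟨⟨P, fun hm => P.isPrime.ne_top (top_le_iff.1 ?_)⟩, rfl⟩
  rw [← Ideal.isCoprime_iff_sup_eq.1 h]
  refine sup_le ((Ideal.span_singleton_le_iff_mem _).2 hm) (Ideal.le_of_dvd ?_)
  have := (pow_dvd_idl P X 1).2 (Nat.one_le_iff_ne_zero.2 (Finsupp.mem_support_iff.1 hP))
  rwa [pow_one] at this
variable (Q μ M) in
def Sm : Submonoid B where
  carrier := {z | ϖ B K z ≠ 0 ∧ z - 1 ∈ Ideal.span {μ} ∧ (M : ℤ) ∣ vz Q (ϖ B K z)}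
  one_mem' := ⟨by simp, by simp, by rw [map_one, vz_one]; simp⟩
  mul_mem' := fun {a b} ha hb => ⟨by rw [map_mul]; exact mul_ne_zero ha.1 hb.1, by
    have := add_mem (Ideal.mul_mem_left _ b ha.2.1) hb.2.1
    convert this using 1; ring, by rw [map_mul, vz_mul Q ha.1 hb.1]; exact dvd_add ha.2.2 hb.2.2⟩
variable (Q μ M) in
def Rc : AddCon (PM μ →₀ ℕ) where
  r I J := ∃ z1 ∈ Sm Q μ M, ∃ z2 ∈ Sm Q μ M, jd I * Ideal.span {z2} = jd J * Ideal.span {z1}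
  iseqv := ⟨fun I => ⟨1, one_mem _, 1, one_mem _, rfl⟩, fun ⟨a, ha, b, hb, h⟩ => ⟨b, hb, a, ha, h.symm⟩,
    fun ⟨a, ha, b, hb, h⟩ ⟨c, hc, d, hd, h'⟩ => ⟨a * c, mul_mem ha hc, b * d, mul_mem hb hd, by
      rw [← span_smul, ← span_smul, ← mul_assoc, h, mul_right_comm, h']; ring⟩⟩
  add' := fun ⟨a, ha, b, hb, h⟩ ⟨c, hc, d, hd, h'⟩ => ⟨a * c, mul_mem ha hc, b * d, mul_mem hb hd, by
      rw [← span_smul, ← span_smul, jd_add, jd_add, mul_mul_mul_comm, h, h']; ring⟩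
lemma mk_eq (I J : PM μ →₀ ℕ) : ((I : (Rc Q μ M).Quotient) = J) ↔ ∃ z1 ∈ Sm Q μ M, ∃ z2 ∈ Sm Q μ M, jd I * Ideal.span {z2} = jd J * Ideal.span {z1} :=
  (Rc Q μ M).eq
abbrev acg (G : Type*) [AddCommMonoid G] (h : ∀ x : G, ∃ y, y + x = 0) : AddCommGroup G :=
  letI : Neg G := ⟨fun x => Classical.choose (h x)⟩
  { (inferInstance : AddCommMonoid G) with
    zsmul := zsmulRec
    neg_add_cancel := fun x => Classical.choose_spec (h x) }
variable (H : FQ B Q)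
include H
lemma mk_zero (I : PM μ →₀ ℕ) : ((I : (Rc Q μ M).Quotient) = 0) ↔ ∃ z ∈ Sm Q μ M, jd I = Ideal.span {z} := by
  rw [← AddCon.coe_zero, mk_eq, jd_zero]
  constructor
  · rintro ⟨z1, h1, z2, h2, h⟩
    rw [one_mul] at h
    have h3 : z1 ∈ Ideal.span {z2} := by
      rw [← Ideal.span_singleton_le_iff_mem, ← h]; exact Ideal.le_of_dvd (dvd_mul_left _ _)
    obtain ⟨w, rfl⟩ := Ideal.mem_span_singleton.1 h3
    have h20 : z2 ≠ 0 := by rintro rfl; exact h2.1 (map_zero _)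
    have hw : ϖ B K w ≠ 0 := fun h0 => h1.1 (by rw [map_mul, h0, mul_zero])
    refine ⟨w, ⟨hw, ?_, ?_⟩, ?_⟩
    · have := sub_mem h1.2.1 (Ideal.mul_mem_left _ w h2.2.1)
      convert this using 1; ring
    · have := h1.2.2
      rw [map_mul, vz_mul Q h2.1 hw] at this
      exact (Int.dvd_add_right h2.2.2).1 this
    · rw [← span_smul, mul_comm] at h
      exact mul_left_cancel₀ (by simpa using h20) h
  · rintro ⟨z, hz, h⟩
    exact ⟨z, hz, 1, one_mem _, by rw [h]; simp⟩
lemma exists_inv (hμ : μ ≠ 0) (hM : 0 < M) (I : PM μ →₀ ℕ) : ∃ J : PM μ →₀ ℕ, ∃ z ∈ Sm Q μ M, jd (J + I) = Ideal.span {z} := by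
  obtain ⟨z, hz0, hzJ, hz1, hzM⟩ := H.pick (jd_ne I) (by simpa using hμ : Ideal.span {μ} ≠ ⊥) (jd_cop I).symm 1 M hM 0
  obtain ⟨J', hJ'⟩ := Ideal.dvd_iff_le.2 ((Ideal.span_singleton_le_iff_mem _).2 hzJ)
  have hJ0 : J' ≠ ⊥ := by
    rintro rfl
    rw [Ideal.mul_bot, Ideal.span_singleton_eq_bot] at hJ'; exact hz0 hJ'
  obtain ⟨J, rfl⟩ := jd_surj (μ := μ) hJ0 (by
    have : IsCoprime (Ideal.span {μ}) (Ideal.span {z}) := Ideal.isCoprime_iff_exists.2 ⟨1 - z, by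
      rw [← neg_sub]; exact neg_mem hz1, z, Ideal.mem_span_singleton_self z, by ring⟩
    exact this.of_isCoprime_of_dvd_right ⟨_, hJ'.trans (mul_comm _ _)⟩)
  exact ⟨J, z, ⟨H.ne hz0, hz1, by simpa using hzM⟩, by rw [jd_add, hJ', mul_comm]⟩
lemma gam_inv (hμ : μ ≠ 0) (hM : 0 < M) (x : (Rc Q μ M).Quotient) : ∃ y, y + x = 0 := by
  induction x using AddCon.induction_on with
  | H I =>
    obtain ⟨J, h⟩ := exists_inv H hμ hM I
    exact ⟨J, (mk_zero H (J + I)).2 h⟩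
set_option maxHeartbeats 600000 in
lemma gam_fin [Finite (ClassGroup B)] (hμ : μ ≠ 0) (hM : 0 < M) : Finite (Rc Q μ M).Quotient := by
  have hs : ∀ c : ClassGroup B, ∃ J : PM μ →₀ ℕ, ∀ I : PM μ →₀ ℕ, idlc (I.mapDomain Subtype.val) = c → ∃ z : B, jd I * jd J = Ideal.span {z} := by
    intro c
    by_cases h : ∃ I : PM μ →₀ ℕ, idlc (I.mapDomain Subtype.val) = c
    · obtain ⟨I0, h0⟩ := h
      obtain ⟨J, z, -, hz⟩ := exists_inv (M := 1) H hμ one_pos I0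
      refine ⟨J, fun I hI => ?_⟩
      have h1 : idlc ((I + J).mapDomain Subtype.val) = 1 := by
        have h2 : idlc ((J + I0).mapDomain Subtype.val) = 1 := by
          refine ClassGroup.mk0_eq_one_iff _ |>.2 ⟨z, ?_⟩
          exact hz
        rw [Finsupp.mapDomain_add, idlc_add] at h2 ⊢
        rw [hI, ← h0, mul_comm, h2]
      obtain ⟨w, hw⟩ := (ClassGroup.mk0_eq_one_iff _).1 h1
      exact ⟨w, by rw [← jd_add]; exact hw⟩
    · push Not at h
      exact ⟨0, fun I hI => absurd hI (h I)⟩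
  choose s hs using hs
  choose z hz using fun I : PM μ →₀ ℕ => hs _ I rfl
  have hz0 : ∀ I, z I ≠ 0 := fun I h0 => by
    have := hz I
    rw [h0, Set.singleton_zero, Ideal.span_zero] at this
    exact mul_ne_zero (jd_ne _) (jd_ne _) this
  have hμ' : Ideal.span {μ} ≠ ⊥ := by simpa using hμ
  have := H.quot_fin hμ'
  have : NeZero M := ⟨hM.ne'⟩
  set f : (PM μ →₀ ℕ) → ClassGroup B × (B ⧸ Ideal.span {μ}) × ZMod M := fun I => (idlc (I.mapDomain Subtype.val), Ideal.Quotient.mk _ (z I), (vz Q (ϖ B K (z I)) : ZMod M)) with hf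
  suffices hh : ∀ I I', f I = f I' → (I : (Rc Q μ M).Quotient) = I' by
    choose o ho using (Rc Q μ M).mk'_surjective
    exact Finite.of_injective (fun γ => f (o γ)) fun γ γ' h => by rw [← ho γ, ← ho γ']; exact hh _ _ h
  intro I I' h
  simp only [hf, Prod.mk.injEq] at h
  obtain ⟨hc, hq, hv⟩ := h
  clear hf
  clear f
  have e1 := hz I
  have e2 := hz I'
  rw [← hc] at e2
  set J := s (idlc (I.mapDomain Subtype.val))
  have hco : IsCoprime (Ideal.span {z I}) (Ideal.span {μ}) := by
    rw [← e1]; exact ((jd_cop I).mul_right (jd_cop J)).symm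
  obtain ⟨a, ha⟩ : ∃ a, a * z I - 1 ∈ Ideal.span {μ} := by
    obtain ⟨a, ha, b, hb, hab⟩ := Ideal.isCoprime_iff_exists.1 hco
    obtain ⟨c, rfl⟩ := Ideal.mem_span_singleton.1 ha
    refine ⟨c, ?_⟩
    convert neg_mem hb using 1
    linear_combination hab
  obtain ⟨t, ht0, -, hta, htM⟩ := H.pick (J := ⊤) top_ne_bot hμ' (Ideal.isCoprime_iff_sup_eq.2 (by simp)) a M hM (-vz Q (ϖ B K (z I)))
  have hq' : z I' - z I ∈ Ideal.span {μ} := by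
    rw [← Ideal.Quotient.eq, hq]
  have hS : ∀ x, x ≠ 0 → x - z I ∈ Ideal.span {μ} → (M:ℤ) ∣ vz Q (ϖ B K x) - vz Q (ϖ B K (z I)) → t * x ∈ Sm Q μ M := by
    intro x hx0 hx hxM
    refine ⟨H.ne (mul_ne_zero ht0 hx0), ?_, ?_⟩
    · have := add_mem (add_mem (Ideal.mul_mem_left _ x hta) (Ideal.mul_mem_left _ a hx)) ha
      convert this using 1; ring
    · rw [map_mul, vz_mul Q (H.ne ht0) (H.ne hx0)]
      have := dvd_add htM hxM
      have e : ∀ a b c : ℤ, a - -c + (b - c) = a + b := by intros; ring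
      rwa [e] at this
  refine (mk_eq I I').2 ⟨t * z I, hS _ (hz0 I) (by simp) (by simp), t * z I', hS _ (hz0 I') hq' ?_, ?_⟩
  · exact (ZMod.intCast_eq_intCast_iff_dvd_sub _ _ _).1 hv
  · refine mul_right_cancel₀ (jd_ne J) ?_
    rw [mul_right_comm, e1, mul_right_comm, e2, span_smul, span_smul]
    congr 2; ring
end FF4
section FF5
open WithZero IsDedekindDomain Module
variable {B : Type*} [CommRing B] [IsDedekindDomain B] [Algebra B K] {Q : FinPlace K} {μ : B} {M : ℕ}
lemma atC_con {P : Type*} (c : AddCon (P →₀ ℕ)) (h : ∀ x : c.Quotient, ∃ y, y + x = 0) (I : P →₀ ℕ) :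
    @atC P c.Quotient (acg _ h) (fun p => (Finsupp.single p 1 : P →₀ ℕ)) I = I := by
  change _ = c.mk' I
  conv_rhs => rw [← I.sum_single, map_finsuppSum]
  refine Finset.sum_congr rfl fun p _ => ?_
  have : Finsupp.single p (I p) = I p • Finsupp.single p 1 := by simp
  change _ = c.mk' (Finsupp.single p (I p))
  rw [this, map_nsmul]
  rfl
variable (H : FQ B Q)
include H
lemma atL_jd (I : PM μ →₀ ℕ) : atL (fun p : PM μ => nrm p.1.asIdeal) I = Real.log (nrm (jd I)) := by
  induction I using Finsupp.induction_linear with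
  | zero => rw [jd_zero, atL, Finsupp.sum_zero_index]; simp [nrm, Ideal.one_eq_top]
  | add f g hf hg =>
    have h : atL (fun p : PM μ => nrm p.1.asIdeal) (f + g) = atL (fun p : PM μ => nrm p.1.asIdeal) f + atL (fun p : PM μ => nrm p.1.asIdeal) g :=
      Finsupp.sum_add_index' (by simp) (by intros; push_cast; ring)
    have h1 := H.nrm_pos (jd_ne f)
    have h2 := H.nrm_pos (jd_ne g)
    rw [h, hf, hg, jd_add, nrm_mul (jd_ne f) (jd_ne g), Nat.cast_mul, Real.log_mul (by positivity) (by positivity)]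
  | single p n =>
    have h : atL (fun p : PM μ => nrm p.1.asIdeal) (Finsupp.single p n) = n * Real.log (nrm p.1.asIdeal) := Finsupp.sum_single_index (by simp)
    have h2 : nrm (p.1.asIdeal ^ n) = nrm p.1.asIdeal ^ n := cardQuot_pow_of_prime p.1.ne_bot
    rw [h, jd, Finsupp.mapDomain_single, idl_single, h2, Nat.cast_pow, Real.log_pow]
lemma card_F {c0 : B} (J : PM μ →₀ ℕ) (hc : c0 ∈ jd J) (hc1 : c0 - 1 ∈ Ideal.span {μ}) (n : ℤ) (hn : (M : ℤ) ∣ n) :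
    Nat.card {b : B // b - c0 ∈ jd J * Ideal.span {μ} ∧ Q.val (ϖ B K b) = exp n} =
    Nat.card {I : PM μ →₀ ℕ // ((I + J : PM μ →₀ ℕ) : (Rc Q μ M).Quotient) = 0 ∧ (nrm (jd I) * nrm (jd J) : ℝ) = (resCard Q : ℝ) ^ n} * Nat.card {u : Bˣ // (u : B) - 1 ∈ Ideal.span {μ}} := by
  have hq : (1:ℝ) < resCard Q := by exact_mod_cast H.one_lt
  rw [← Nat.card_prod]
  symm
  have hg : ∀ I : {I : PM μ →₀ ℕ // ((I + J : PM μ →₀ ℕ) : (Rc Q μ M).Quotient) = 0 ∧ (nrm (jd I) * nrm (jd J) : ℝ) = (resCard Q : ℝ) ^ n}, ∃ z ∈ Sm Q μ M, jd (I.1 + J) = Ideal.span {z} := fun I => (mk_zero H _).1 I.2.1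
  choose g hgS hg using hg
  have hS0 : ∀ z ∈ Sm Q μ M, z ≠ 0 := by rintro z hz rfl; exact hz.1 (map_zero _)
  have hval : ∀ z : B, z ≠ 0 → (nrm (Ideal.span {z}) : ℝ) = (resCard Q : ℝ) ^ n → Q.val (ϖ B K z) = exp n := by
    intro z hz h
    rw [H.nrm_span hz] at h
    rw [val_exp Q (H.ne hz), zpow_right_injective₀ (by linarith) hq.ne' h]
  have hinf : ∀ x, x ∈ jd J → x ∈ Ideal.span {μ} → x ∈ jd J * Ideal.span {μ} := fun x h1 h2 => by
    rw [← Ideal.inf_eq_mul_of_isCoprime (jd_cop J).symm]; exact ⟨h1, h2⟩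
  have hsp : ∀ I (u : Bˣ), Ideal.span {(u : B) * g I} = jd (I.1 + J) := fun I u => by
    rw [Ideal.span_singleton_mul_left_unit u.isUnit, hg]
  refine Nat.card_congr (Equiv.ofBijective (fun x => ⟨(x.2.1 : B) * g x.1, ?_, ?_⟩) ⟨?_, ?_⟩)
  · refine hinf _ (sub_mem ?_ hc) ?_
    · have h1 : jd (x.1.1 + J) ≤ jd J := by rw [jd_add]; exact Ideal.le_of_dvd (dvd_mul_left _ _)
      exact h1 (by rw [← hsp x.1 x.2.1]; exact Ideal.mem_span_singleton_self _)
    · have := sub_mem (add_mem (Ideal.mul_mem_left _ (g x.1) x.2.2) (hgS x.1).2.1) hc1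
      convert this using 1; ring
  · refine hval _ (mul_ne_zero x.2.1.ne_zero (hS0 _ (hgS _))) ?_
    rw [hsp, jd_add, nrm_mul (jd_ne _) (jd_ne _), Nat.cast_mul]; exact x.1.2.2
  · intro x y h
    have h1 : (x.2.1 : B) * g x.1 = y.2.1 * g y.1 := congrArg Subtype.val h
    have h2 : x.1 = y.1 := by
      have := hsp x.1 x.2.1
      rw [h1, hsp y.1] at this
      exact Subtype.ext (add_right_cancel (jd_inj this)).symm
    refine Prod.ext h2 (Subtype.ext (Units.ext ?_))
    rw [← h2] at h1
    exact mul_right_cancel₀ (hS0 _ (hgS _)) h1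
  · rintro ⟨b, hb, hbn⟩
    have hb0 : b ≠ 0 := by rintro rfl; rw [map_zero, map_zero] at hbn; exact exp_ne_zero hbn.symm
    have hbJ : b ∈ jd J := by simpa using add_mem (Ideal.le_of_dvd (dvd_mul_right _ _) hb) hc
    have hb1 : b - 1 ∈ Ideal.span {μ} := by simpa using add_mem (Ideal.le_of_dvd (dvd_mul_left _ _) hb) hc1
    obtain ⟨I', hI'⟩ := Ideal.dvd_iff_le.2 ((Ideal.span_singleton_le_iff_mem _).2 hbJ)
    have hJ0 : I' ≠ ⊥ := by
      rintro rfl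
      rw [Ideal.mul_bot, Ideal.span_singleton_eq_bot] at hI'; exact hb0 hI'
    obtain ⟨I, rfl⟩ := jd_surj (μ := μ) hJ0 (by
      have : IsCoprime (Ideal.span {μ}) (Ideal.span {b}) := Ideal.isCoprime_iff_exists.2 ⟨1 - b, by
        rw [← neg_sub]; exact neg_mem hb1, b, Ideal.mem_span_singleton_self b, by ring⟩
      exact this.of_isCoprime_of_dvd_right ⟨_, hI'.trans (mul_comm _ _)⟩)
    have hbS : b ∈ Sm Q μ M := ⟨H.ne hb0, hb1, by rwa [vz_of Q hbn]⟩
    have hIJ : jd (I + J) = Ideal.span {b} := by rw [jd_add, hI', mul_comm]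
    have hIF : ((I + J : PM μ →₀ ℕ) : (Rc Q μ M).Quotient) = 0 ∧ (nrm (jd I) * nrm (jd J) : ℝ) = (resCard Q : ℝ) ^ n := by
      refine ⟨(mk_zero H _).2 ⟨b, hbS, hIJ⟩, ?_⟩
      rw [← Nat.cast_mul, ← nrm_mul (jd_ne _) (jd_ne _), ← jd_add, hIJ, H.nrm_span hb0, vz_of Q hbn]
    obtain ⟨u, hu⟩ := Ideal.span_singleton_eq_span_singleton.1 ((hg ⟨I, hIF⟩).symm.trans hIJ)
    refine ⟨(⟨I, hIF⟩, ⟨u, ?_⟩), Subtype.ext ((mul_comm _ _).trans hu)⟩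
    have := sub_mem hb1 (Ideal.mul_mem_left _ (u : B) (hgS ⟨I, hIF⟩).2.1)
    convert this using 1; rw [← hu]; ring
def Fw (w s : ℝ) : ℝ := (Set.Ico 0 w).indicator ℯ s
set_option maxHeartbeats 1000000 in
lemma FQ.key (hμ : μ ≠ 0) (hM : 0 < M) : ∃ κ > 0, ∀ γ : (Rc Q μ M).Quotient, ∃ C, ∀ t : ℝ, |(∑' I : PM μ →₀ ℕ, if (I : (Rc Q μ M).Quotient) = γ then Fw (M * Real.log (resCard Q)) (t - Real.log (nrm (jd I))) else 0) - κ * ℯ t| ≤ C := by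
  have hq : (1:ℝ) < resCard Q := by exact_mod_cast H.one_lt
  have hq0 : (0:ℝ) < resCard Q := by linarith
  have hμ' : Ideal.span {μ} ≠ ⊥ := by simpa using hμ
  have hL := Real.log_pos hq
  set q : ℝ := (resCard Q : ℝ)
  set L := Real.log q with hLd
  have hM0 : (0:ℝ) < M := by exact_mod_cast hM
  obtain ⟨A, hA, hco⟩ := H.coset
  set W : ℕ := Nat.card {u : Bˣ // (u : B) - 1 ∈ Ideal.span {μ}} with hWd
  have hnμ : (0:ℝ) < nrm (Ideal.span {μ}) := by exact_mod_cast H.nrm_pos hμ'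
  have hcnt : ∀ J : PM μ →₀ ℕ, ∃ n0 : ℕ, ∀ n : ℤ, n0 ≤ n → (M : ℤ) ∣ n →
      (Nat.card {I : PM μ →₀ ℕ // ((I + J : PM μ →₀ ℕ) : (Rc Q μ M).Quotient) = 0 ∧ (nrm (jd I) * nrm (jd J) : ℝ) = q ^ n} : ℝ) * W * (nrm (jd J) * nrm (Ideal.span {μ})) = A * q ^ n := by
    intro J
    obtain ⟨a, ha, b, hb, hab⟩ := Ideal.isCoprime_iff_exists.1 (jd_cop J)
    obtain ⟨n0, h0⟩ := hco (jd J * Ideal.span {μ}) (mul_ne_zero (jd_ne J) hμ') b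
    refine ⟨n0, fun n hn hMn => ?_⟩
    rw [← h0 n hn, card_F H J hb (by rw [← hab]; simpa using ha) n hMn, ← Nat.cast_mul, ← Nat.cast_mul (nrm _), ← nrm_mul (jd_ne J) hμ']
    rfl
  have hW : (0:ℝ) < W := by
    obtain ⟨n0, h0⟩ := hcnt 0
    have h1 := h0 (M * n0) (by nlinarith [show (1:ℤ) ≤ M by exact_mod_cast hM]) ⟨_, rfl⟩
    have h2 : 0 < A * q ^ ((M : ℤ) * n0) := by positivity
    refine lt_of_le_of_ne (Nat.cast_nonneg _) fun h => ?_
    rw [← h1, ← h] at h2; simp at h2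
  refine ⟨A / (nrm (Ideal.span {μ}) * W), by positivity, fun γ => ?_⟩
  obtain ⟨J, hJ⟩ : ∃ J : PM μ →₀ ℕ, ∀ I : PM μ →₀ ℕ, (I : (Rc Q μ M).Quotient) = γ ↔ ((I + J : PM μ →₀ ℕ) : (Rc Q μ M).Quotient) = 0 := by
    obtain ⟨y, hy⟩ := gam_inv H hμ hM γ
    obtain ⟨J, rfl⟩ := (Rc Q μ M).mk'_surjective y
    refine ⟨J, fun I => ⟨?_, fun h => ?_⟩⟩
    · rintro rfl; rw [add_comm]; exact hy
    · have h2 : (I : (Rc Q μ M).Quotient) + (Rc Q μ M).mk' J = 0 := h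
      calc (I : (Rc Q μ M).Quotient) = I + ((Rc Q μ M).mk' J + γ) := by rw [hy, add_zero]
        _ = γ := by rw [← add_assoc, h2, zero_add]
  obtain ⟨n0, h0⟩ := hcnt J
  set F : ℤ → Set (PM μ →₀ ℕ) := fun n => {I | ((I + J : PM μ →₀ ℕ) : (Rc Q μ M).Quotient) = 0 ∧ (nrm (jd I) * nrm (jd J) : ℝ) = q ^ n} with hF
  have hNJ : (0:ℝ) < nrm (jd J) := by exact_mod_cast H.nrm_pos (jd_ne J)
  have hNI : ∀ I : PM μ →₀ ℕ, (0:ℝ) < nrm (jd I) := fun I => by exact_mod_cast H.nrm_pos (jd_ne I)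
  set κ := A / (nrm (Ideal.span {μ}) * W)
  have hκ : 0 < κ := by positivity
  refine ⟨(∑ i ∈ Finset.range n0, (Nat.card (F i) : ℝ)) * q ^ M + κ * (q ^ n0 * q ^ M / nrm (jd J)), fun t => ?_⟩
  set T := t + Real.log (nrm (jd J)) with hT
  set m : ℤ := M * ⌊T / (M * L)⌋ with hm
  have hm1 : m * L ≤ T := by
    have := Int.floor_le (T / (M * L))
    rw [le_div_iff₀ (by positivity)] at this
    rw [hm]; push_cast; linarith
  have hm2 : T < m * L + M * L := by
    have := Int.lt_floor_add_one (T / (M * L))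
    rw [div_lt_iff₀ (by positivity)] at this
    rw [hm]; push_cast; linarith
  have hexT : ℯ T = ℯ t * nrm (jd J) := by rw [hT, Real.exp_add, Real.exp_log hNJ]
  have hexz : ∀ n : ℤ, ℯ (n * L) = q ^ n := fun n => by rw [mul_comm, hLd, Real.exp_mul, Real.exp_log hq0, Real.rpow_intCast]
  have hterm : ∀ I : PM μ →₀ ℕ, (if (I : (Rc Q μ M).Quotient) = γ then Fw (M * L) (t - Real.log (nrm (jd I))) else 0) = (F m).indicator (fun _ => ℯ (T - m * L)) I := by
    intro I
    by_cases hI : ((I + J : PM μ →₀ ℕ) : (Rc Q μ M).Quotient) = 0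
    · rw [if_pos ((hJ I).2 hI)]
      obtain ⟨z, hz, hzI⟩ := (mk_zero H _).1 hI
      have hz0 : z ≠ 0 := by rintro rfl; exact hz.1 (map_zero _)
      have hn : (nrm (jd I) * nrm (jd J) : ℝ) = q ^ vz Q (ϖ B K z) := by
        rw [← H.nrm_span hz0, ← hzI, jd_add, nrm_mul (jd_ne _) (jd_ne _), Nat.cast_mul]
      set n := vz Q (ϖ B K z)
      have hlog : t - Real.log (nrm (jd I)) = T - n * L := by
        have := congrArg Real.log hn
        rw [Real.log_mul (hNI I).ne' hNJ.ne', Real.log_zpow] at this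
        linarith
      have hmem : I ∈ F m ↔ n = m := by
        simp only [hF, Set.mem_ofPred_eq, hI, true_and, hn]
        exact (zpow_right_injective₀ hq0 hq.ne').eq_iff
      obtain ⟨j, hj⟩ := hz.2.2
      rw [Fw, hlog]
      by_cases hnm : n = m
      · rw [Set.indicator_of_mem (hmem.2 hnm), Set.indicator_of_mem, hnm]
        rw [hnm]; exact ⟨by linarith, by linarith⟩
      · rw [Set.indicator_of_notMem (fun h => hnm (hmem.1 h)), Set.indicator_of_notMem]
        rintro ⟨h1, h2⟩
        apply hnm
        have hj' : n = M * j := hj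
        rw [hj', hm]
        congr 1
        symm
        rw [Int.floor_eq_iff, le_div_iff₀ (by positivity), div_lt_iff₀ (by positivity)]
        rw [hj'] at h1 h2
        push_cast at h1 h2
        constructor <;> nlinarith
    · rw [if_neg (fun h => hI ((hJ I).1 h)), Set.indicator_of_notMem (fun h => hI h.1)]
  simp_rw [hterm]
  rw [← tsum_subtype, tsum_const, nsmul_eq_mul, Real.exp_sub, hexT, hexz]
  have hmM : (M : ℤ) ∣ m := ⟨_, rfl⟩
  have hS : 0 ≤ ∑ i ∈ Finset.range n0, (Nat.card (F i) : ℝ) := by positivity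
  rcases le_or_gt (n0 : ℤ) m with h | h
  · have h1 := h0 m h hmM
    have h2 : (Nat.card (F m) : ℝ) * (ℯ t * nrm (jd J) / q ^ m) = κ * ℯ t := by
      have h3 : (Nat.card (F m) : ℝ) * W * (nrm (jd J) * nrm (Ideal.span {μ})) = A * q ^ m := h1
      simp only [κ]
      have : (0:ℝ) < q ^ m := by positivity
      field_simp
      linear_combination h3
    rw [h2, sub_self, abs_zero]; positivity
  · have hlt : ℯ t * nrm (jd J) < q ^ m * q ^ M := by
      rw [← hexT, ← hexz, ← zpow_natCast q M, ← hexz, ← Real.exp_add, Real.exp_lt_exp]; push_cast; linarith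
    have hqm : q ^ m ≤ q ^ n0 := by rw [← zpow_natCast q n0]; exact zpow_le_zpow_right₀ hq.le h.le
    have h1 : (Nat.card (F m) : ℝ) * (ℯ t * nrm (jd J) / q ^ m) ≤ (∑ i ∈ Finset.range n0, (Nat.card (F i) : ℝ)) * q ^ M := by
      have h2 : ℯ t * nrm (jd J) / q ^ m ≤ q ^ M := by rw [div_le_iff₀ (by positivity)]; linarith
      have h3 : (Nat.card (F m) : ℝ) ≤ ∑ i ∈ Finset.range n0, (Nat.card (F i) : ℝ) := by
        rcases lt_or_ge m 0 with hm0 | hm0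
        · have : IsEmpty (F m) := ⟨fun ⟨I, hI⟩ => by
            have h5 : (1:ℝ) ≤ nrm (jd I) * nrm (jd J) := by exact_mod_cast Nat.mul_pos (H.nrm_pos (jd_ne I)) (H.nrm_pos (jd_ne J))
            rw [hI.2] at h5
            have := zpow_lt_one_of_neg₀ hq hm0
            linarith⟩
          rw [Nat.card_of_isEmpty]; simpa using hS
        · obtain ⟨m', hm'⟩ := Int.eq_ofNat_of_zero_le hm0
          rw [hm'] at h ⊢
          exact Finset.single_le_sum (f := fun i : ℕ => (Nat.card (F i) : ℝ)) (fun _ _ => Nat.cast_nonneg _) (Finset.mem_range.2 (by exact_mod_cast h))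
      exact mul_le_mul h3 h2 (by positivity) hS
    have h4 : κ * ℯ t ≤ κ * (q ^ n0 * q ^ M / nrm (jd J)) := by
      refine mul_le_mul_of_nonneg_left ?_ hκ.le
      rw [le_div_iff₀ hNJ]
      refine hlt.le.trans ?_
      gcongr
    have h6 : 0 ≤ (Nat.card (F m) : ℝ) * (ℯ t * nrm (jd J) / q ^ m) := by positivity
    have h7 : 0 < κ * ℯ t := by positivity
    rw [abs_le]; constructor <;> linarith [mul_nonneg hS (pow_nonneg hq0.le M)]
lemma FQ.ray [Finite (ClassGroup B)] (hμ : μ ≠ 0) (hM : 0 < M) (J : PM μ →₀ ℕ) :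
    {P : PM μ | ∃ z1 ∈ Sm Q μ M, ∃ z2 ∈ Sm Q μ M, P.1.asIdeal * Ideal.span {z2} = jd J * Ideal.span {z1}}.Infinite := by
  have hq : (1:ℝ) < resCard Q := by exact_mod_cast H.one_lt
  have hL := Real.log_pos hq
  have hM0 : (0:ℝ) < M := by exact_mod_cast hM
  obtain ⟨κ, hκ, h⟩ := H.key (M := M) hμ hM
  choose C hC using h
  have hfin := gam_fin (M := M) H hμ hM
  obtain ⟨C1, hC1⟩ := (Set.finite_range C).bddAbove
  have hi := H.inj
  have := H.hfq
  set w := M * Real.log (resCard Q)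
  have hw : 0 < w := by positivity
  letI : AddCommGroup (Rc Q μ M).Quotient := acg _ (gam_inv H hμ hM)
  have : Fintype (Rc Q μ M).Quotient := Fintype.ofFinite _
  have hat : ATd (fun p : PM μ => nrm p.1.asIdeal) (fun p => ((Finsupp.single p 1 : PM μ →₀ ℕ) : (Rc Q μ M).Quotient)) (Fw w) κ (max C1 (ℯ w)) w := by
    constructor
    · intro p
      have h0 := H.nrm_pos p.1.ne_bot
      have h1 : nrm p.1.asIdeal ≠ 1 := fun h => by
        have := (Nat.card_eq_one_iff_unique.1 h).1
        exact p.1.isPrime.ne_top (Ideal.Quotient.subsingleton_iff.1 this)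
      change 2 ≤ nrm p.1.asIdeal
      omega
    · intro x
      have := Ring.HasFiniteQuotients.finite_cardQuot_le (R := B) x
      refine Set.Finite.of_finite_image (f := fun p : PM μ => p.1.asIdeal) (this.subset ?_) fun p _ q _ h => Subtype.ext (HeightOneSpectrum.ext h)
      rintro _ ⟨p, hp, rfl⟩
      exact hp
    · exact Real.measurable_exp.indicator measurableSet_Ico
    · exact fun t => Set.indicator_nonneg (fun _ _ => (Real.exp_pos _).le) _
    · intro t
      refine le_trans ?_ (le_max_right _ _)
      refine Set.indicator_apply_le' (fun h => Real.exp_le_exp.2 h.2.le) fun _ => (Real.exp_pos _).le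
    · intro t ht
      refine Set.indicator_of_notMem (fun h => ?_) _
      rw [abs_of_nonneg h.1] at ht; linarith [h.2]
    · simp only [Fw]
      rw [MeasureTheory.integral_indicator measurableSet_Ico, MeasureTheory.integral_Ico_eq_integral_Ioc, ← intervalIntegral.integral_of_le hw.le, integral_exp]
      have := Real.add_one_le_exp w
      rw [Real.exp_zero]; linarith
    · exact hκ
    · exact hw
    · intro γ t
      refine le_trans ?_ ((hC1 ⟨γ, rfl⟩).trans (le_max_left _ _))
      refine le_of_eq_of_le (congrArg (fun x => |x - κ * ℯ t|) (tsum_congr fun I => ?_)) (hC γ t)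
      rw [atC_con, atL_jd H]
      congr
  refine (hat.infinite (J : (Rc Q μ M).Quotient)).mono fun P hP => ?_
  have := (mk_eq _ _).1 hP
  rwa [jd_single] at this
end FF5
section FF6
open WithZero IsDedekindDomain Polynomial Module
variable {B : Type*} [CommRing B] [IsDedekindDomain B] {k : Type*} [Field k] [Finite k] [Algebra k B] [Algebra k[X] B] [IsScalarTower k k[X] B]
  [Module.Finite k[X] B] [IsTorsionFree k[X] B]
variable (B) in
def Yc (c : k) : B := ϖ k[X] B (X - C c)
lemma ev_congr {z z' : B} {c : k} (h : z - z' ∈ Ideal.span {Yc B c}) : (Algebra.norm k[X] z).eval c = (Algebra.norm k[X] z').eval c := by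
  rw [norm_eval, norm_eval, (Ideal.Quotient.eq (I := Ideal.span {ϖ k[X] B (X - C c)})).2 h]
lemma ev_one {z : B} {c : k} {m : B} (hm : Yc B c ∣ m) (h : z - 1 ∈ Ideal.span {m}) : (Algebra.norm k[X] z).eval c = 1 := by
  rw [ev_congr (z' := 1) (Ideal.span_singleton_le_span_singleton.2 hm h), map_one, eval_one]
lemma usel [Ring.HasFiniteQuotients B] (P : ℌ B) (c : k) (hP : Yc B c ∈ P.asIdeal) (hP2 : Yc B c ∉ P.asIdeal ^ 2) {m : B} (hm : m ∉ P.asIdeal) {s : k} (hs : s ≠ 0) :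
    ∃ u : B, u - 1 ∈ Ideal.span {m} ∧ IsCoprime (Ideal.span {Yc B c * m}) (Ideal.span {u}) ∧ (Algebra.norm k[X] u).eval c = s := by
  obtain ⟨C', hC⟩ := Ideal.dvd_iff_le.2 ((Ideal.span_singleton_le_iff_mem _).2 hP)
  have hmax : P.asIdeal.IsMaximal := P.isPrime.isMaximal P.ne_bot
  have hco : ∀ L : Ideal B, ¬ L ≤ P.asIdeal → IsCoprime P.asIdeal L := fun L hL =>
    Ideal.isCoprime_iff_sup_eq.2 (hmax.out.2 _ (lt_of_le_of_ne le_sup_left fun h => hL (by rw [h]; exact le_sup_right)))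
  have hY0 : Yc B c ≠ 0 := by rintro h; exact hP2 (h ▸ zero_mem _)
  have : Finite (B ⧸ P.asIdeal) := Ring.HasFiniteQuotients.finiteQuotient P.ne_bot
  have : Finite (B ⧸ Ideal.span {Yc B c}) := Ring.HasFiniteQuotients.finiteQuotient (by simpa using hY0)
  obtain ⟨u0, hu0⟩ : ∃ u0 : B, Algebra.norm k (Ideal.Quotient.mk P.asIdeal u0) = s := by
    letI := Ideal.Quotient.field P.asIdeal
    obtain ⟨x, hx⟩ := FiniteField.norm_surjective k (B ⧸ P.asIdeal) s
    obtain ⟨u0, rfl⟩ := Ideal.Quotient.mk_surjective x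
    exact ⟨u0, hx⟩
  have hu0P : u0 ∉ P.asIdeal := fun h => hs (by
    letI := Ideal.Quotient.field P.asIdeal
    have h2 := Algebra.norm_zero (R := k) (S := B ⧸ P.asIdeal)
    rw [← hu0, Ideal.Quotient.eq_zero_iff_mem.2 h, h2])
  have hcC : IsCoprime P.asIdeal C' := hco _ fun h => hP2 (by
    rw [← Ideal.span_singleton_le_iff_mem, hC, pow_two]; exact Ideal.mul_mono le_rfl h)
  have hcm : IsCoprime P.asIdeal (Ideal.span {m}) := hco _ fun h => hm ((Ideal.span_singleton_le_iff_mem _).1 h)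
  obtain ⟨p, hp, l, hl, hpl⟩ := Ideal.isCoprime_iff_exists.1 (hcC.mul_right hcm)
  have hu1 : p + l * u0 - 1 ∈ C' * Ideal.span {m} := by
    have := Ideal.mul_mem_right (u0 - 1) _ hl
    convert this using 1; linear_combination hpl
  have huP : p + l * u0 - u0 ∈ P.asIdeal := by
    have := Ideal.mul_mem_right (1 - u0) _ hp
    convert this using 1; linear_combination u0 * hpl
  have hone : ∀ L : Ideal B, p + l * u0 - 1 ∈ L → IsCoprime L (Ideal.span {p + l * u0}) := fun L hL =>
    Ideal.isCoprime_iff_exists.2 ⟨-(p + l * u0 - 1), neg_mem hL, p + l * u0, Ideal.mem_span_singleton_self _, by ring⟩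
  refine ⟨p + l * u0, Ideal.le_of_dvd (dvd_mul_left _ _) hu1, ?_, ?_⟩
  · rw [← span_smul, hC, mul_assoc]
    refine IsCoprime.mul_left (hco _ fun h => hu0P ?_) (hone _ hu1)
    have := sub_mem ((Ideal.span_singleton_le_iff_mem _).1 h) huP
    simpa using this
  · rw [norm_eval]
    change Algebra.norm k (Ideal.Quotient.mk (Ideal.span {Yc B c}) _) = s
    rw [norm_quot _ P.asIdeal C' (by rw [hC, mul_comm]) (by rw [hC]; exact Ideal.le_of_dvd (dvd_mul_right _ _)) _ (Ideal.le_of_dvd (dvd_mul_right _ _) hu1),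
      (Ideal.Quotient.eq (I := P.asIdeal)).2 huP, hu0]
lemma rn_span (z : B) : Ideal.relNorm k[X] (Ideal.span {z}) = Ideal.span {Algebra.norm k[X] z} := by
  rw [Ideal.relNorm_singleton, Algebra.intNorm_eq_norm]
lemma rn_gen (J : Ideal B) : ∃ f : k[X], Ideal.relNorm k[X] J = Ideal.span {f} :=
  (IsPrincipalIdealRing.principal _).principal
lemma rn_ne {μ : B} (J : PM μ →₀ ℕ) {f : k[X]} (hf : Ideal.relNorm k[X] (jd J) = Ideal.span {f}) {c : k} (hc : Yc B c ∣ μ) : f.eval c ≠ 0 := by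
  obtain ⟨a, ha, b, hb, hab⟩ := Ideal.isCoprime_iff_exists.1 (jd_cop J)
  have h1 : (Algebra.norm k[X] b).eval c = 1 := ev_one hc (by rw [← hab]; simpa using ha)
  have h2 := Ideal.relNorm_mono k[X] ((Ideal.span_singleton_le_iff_mem _).2 hb)
  rw [rn_span, hf, Ideal.span_singleton_le_span_singleton] at h2
  obtain ⟨g, hg⟩ := h2
  intro h
  rw [hg, eval_mul, h, zero_mul] at h1
  exact zero_ne_one h1
lemma move {μ : B} (J1 J2 : Ideal B) (h1 : J1 ≠ ⊥) (h2 : J2 ≠ ⊥) (hμ : μ ≠ 0) : ∃ J0 : PM μ →₀ ℕ, ∃ z e : B, z ≠ 0 ∧ e ≠ 0 ∧ J1 * Ideal.span {z} = Ideal.span {e} * J2 * jd J0 := by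
  obtain ⟨e, he, he0⟩ := Submodule.exists_mem_ne_zero_of_ne_bot h1
  obtain ⟨J1', hJ1⟩ := Ideal.dvd_iff_le.2 ((Ideal.span_singleton_le_iff_mem _).2 he)
  have h1' : J1' ≠ ⊥ := by rintro rfl; rw [Ideal.mul_bot, Ideal.span_singleton_eq_bot] at hJ1; exact he0 hJ1
  set E := J1' * J2
  have hE : E ≠ ⊥ := mul_ne_zero h1' h2
  have hEμ : E * Ideal.span {μ} ≠ ⊥ := mul_ne_zero hE (by simpa using hμ)
  obtain ⟨z, hz⟩ := IsDedekindDomain.exists_sup_span_eq (Ideal.le_of_dvd (dvd_mul_right E (Ideal.span {μ}))) hEμ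
  obtain ⟨J, hJ⟩ := Ideal.dvd_iff_le.2 (show Ideal.span {z} ≤ E by rw [← hz]; exact le_sup_right)
  have hco : IsCoprime (Ideal.span {μ}) J := by
    rw [Ideal.isCoprime_iff_sup_eq]
    refine mul_left_cancel₀ hE ?_
    rw [Ideal.mul_sup, ← hJ, hz, Ideal.mul_top]
  by_cases hz0 : z = 0
  · have hJb : J = ⊥ := by
      rw [hz0, Set.singleton_zero, Ideal.span_zero] at hJ
      exact (mul_eq_zero.1 hJ.symm).resolve_left hE
    rw [hJb, Ideal.isCoprime_iff_sup_eq, sup_bot_eq] at hco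
    obtain ⟨z', hz', hz0'⟩ := Submodule.exists_mem_ne_zero_of_ne_bot hE
    obtain ⟨J', hJ'⟩ := Ideal.dvd_iff_le.2 ((Ideal.span_singleton_le_iff_mem _).2 hz')
    obtain ⟨J0, rfl⟩ := jd_surj (μ := μ) (a := J') (by rintro rfl; rw [Ideal.mul_bot, Ideal.span_singleton_eq_bot] at hJ'; exact hz0' hJ')
      (by rw [hco, Ideal.isCoprime_iff_sup_eq, top_sup_eq])
    exact ⟨J0, z', e, hz0', he0, by rw [hJ', hJ1]; simp only [E]; ring⟩
  · obtain ⟨J0, rfl⟩ := jd_surj (μ := μ) (a := J) (by rintro rfl; rw [Ideal.mul_bot, Ideal.span_singleton_eq_bot] at hJ; exact hz0 hJ) hco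
    exact ⟨J0, z, e, hz0, he0, by rw [hJ, hJ1]; simp only [E]; ring⟩
end FF6
section FF7
open WithZero IsDedekindDomain Polynomial Module
variable {B : Type*} [CommRing B] [IsDedekindDomain B] {k : Type*} [Field k] [Finite k] [Algebra k B] [Algebra k[X] B] [IsScalarTower k k[X] B]
  [Module.Finite k[X] B] [IsTorsionFree k[X] B] [Algebra B K] {Q : FinPlace K}
lemma Yc_sub (c d : k) : Yc B c - Yc B d = ϖ k B (d - c) := by
  rw [Yc, Yc, ← map_sub, IsScalarTower.algebraMap_apply k k[X] B, algebraMap_eq]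
  congr 1; rw [C_sub]; ring
lemma Yc_not (P : Ideal B) (hP : P.IsPrime) {c d : k} (h : c ≠ d) (hc : Yc B c ∈ P) : Yc B d ∉ P := fun hd =>
  hP.ne_top (Ideal.eq_top_of_isUnit_mem _ (Yc_sub (B := B) c d ▸ sub_mem hc hd) ((isUnit_iff_ne_zero.2 (sub_ne_zero.2 h.symm)).map _))
lemma sy [Finite (ClassGroup B)] [Ring.HasFiniteQuotients B] (P : ℌ B) {f : k[X]} {c0 c1 s t : k} {ℓ : ℕ}
    (hf : Ideal.relNorm k[X] P.asIdeal = Ideal.span {f}) (h : f.eval c0 = s * f.eval c1) (hl : ℓ ∣ Nat.card k - 1)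
    (hs : s ^ ((Nat.card k - 1) / ℓ) = t) :
    Yc B c0 ^ ((Nat.card (B ⧸ P.asIdeal) - 1) / ℓ) - ϖ k B t * Yc B c1 ^ ((Nat.card (B ⧸ P.asIdeal) - 1) / ℓ) ∈ P.asIdeal := by
  have hmax : P.asIdeal.IsMaximal := P.isPrime.isMaximal P.ne_bot
  letI := Ideal.Quotient.field P.asIdeal
  have : Finite (B ⧸ P.asIdeal) := Ring.HasFiniteQuotients.finiteQuotient P.ne_bot
  obtain ⟨ν, -, h1, h2⟩ := nuP (k := k) P
  rw [h1, Ideal.span_singleton_eq_span_singleton] at hf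
  obtain ⟨w, hw⟩ := hf
  have h3 : ν.eval c0 = s * ν.eval c1 := by
    obtain ⟨d, hd, hd2⟩ := Polynomial.isUnit_iff.1 w.isUnit
    have : d ≠ 0 := hd.ne_zero
    rw [← hw, ← hd2, eval_mul, eval_mul, eval_C, eval_C] at h
    exact mul_right_cancel₀ this (by rw [h]; ring)
  have h4 : Algebra.norm k (Ideal.Quotient.mk P.asIdeal (Yc B c0)) = s * Algebra.norm k (Ideal.Quotient.mk P.asIdeal (Yc B c1)) := by
    rw [Yc, Yc]
    refine (h2 c0).trans (Eq.trans ?_ (congrArg (s * ·) (h2 c1).symm))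
    rw [h3]; ring
  have h5 := congrArg (ϖ k (B ⧸ P.asIdeal)) h4
  rw [map_mul, FiniteField.algebraMap_norm_eq_pow, FiniteField.algebraMap_norm_eq_pow] at h5
  have hdv : Nat.card k - 1 ∣ Nat.card (B ⧸ P.asIdeal) - 1 := by
    have := Fintype.ofFinite k
    have := Fintype.ofFinite (B ⧸ P.asIdeal)
    rw [Nat.card_eq_fintype_card, Nat.card_eq_fintype_card, Module.card_eq_pow_finrank (K := k) (V := B ⧸ P.asIdeal)]
    simpa using Nat.sub_dvd_pow_sub_pow (Fintype.card k) 1 (finrank k (B ⧸ P.asIdeal))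
  have he : (Nat.card (B ⧸ P.asIdeal) - 1) / ℓ = (Nat.card (B ⧸ P.asIdeal) - 1) / (Nat.card k - 1) * ((Nat.card k - 1) / ℓ) :=
    (Nat.div_mul_div_comm hdv hl).symm ▸ by
      rw [mul_comm (Nat.card k - 1) ℓ, Nat.mul_div_mul_right]
      have := Finite.one_lt_card (α := k); omega
  rw [← Ideal.Quotient.eq_zero_iff_mem, map_sub, sub_eq_zero, map_mul, map_pow, map_pow, he, pow_mul, pow_mul, h5, mul_pow, ← map_pow, hs]
  rfl
lemma gJ (H : FQ B Q) {c : Fin 4 → k} (hc : Function.Injective c) {μ : B} (hμ : μ = Yc B (c 0) * Yc B (c 1) * Yc B (c 2) * Yc B (c 3)) (P1 P2 : ℌ B)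
    (h1 : Yc B (c 0) ∈ P1.asIdeal) (h1' : Yc B (c 0) ∉ P1.asIdeal ^ 2) (h2 : Yc B (c 2) ∈ P2.asIdeal) (h2' : Yc B (c 2) ∉ P2.asIdeal ^ 2)
    (hμ0 : μ ≠ 0) (J1 J2 : Ideal B) (hJ1 : J1 ≠ ⊥) (hJ2 : J2 ≠ ⊥) {M : ℕ} (hM : 0 < M) (r : ℤ) {s s' : k} (hs : s ≠ 0) (hs' : s' ≠ 0) :
    ∃ J : PM μ →₀ ℕ, ∃ z e : B, z ≠ 0 ∧ e ≠ 0 ∧ J1 * Ideal.span {z} = Ideal.span {e} * J2 * jd J ∧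
      (M : ℤ) ∣ vz Q (ϖ B K z) - vz Q (ϖ B K e) - r ∧
      ∃ f : k[X], Ideal.relNorm k[X] (jd J) = Ideal.span {f} ∧ f.eval (c 0) = s * f.eval (c 1) ∧ f.eval (c 2) = s' * f.eval (c 3) := by
  have := H.hfq
  have hne : ∀ i j, i ≠ j → c i ≠ c j := fun i j h h' => h (hc h')
  obtain ⟨J0, z, e, hz, he, hJ⟩ := move (μ := μ) J1 J2 hJ1 hJ2 hμ0
  obtain ⟨f0, hf0⟩ := rn_gen (k := k) (jd J0)
  have hd0 : Yc B (c 0) ∣ μ := ⟨Yc B (c 1) * Yc B (c 2) * Yc B (c 3), by rw [hμ]; ring⟩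
  have hd1 : Yc B (c 1) ∣ μ := ⟨Yc B (c 0) * Yc B (c 2) * Yc B (c 3), by rw [hμ]; ring⟩
  have hd2 : Yc B (c 2) ∣ μ := ⟨Yc B (c 0) * Yc B (c 1) * Yc B (c 3), by rw [hμ]; ring⟩
  have hd3 : Yc B (c 3) ∣ μ := ⟨Yc B (c 0) * Yc B (c 1) * Yc B (c 2), by rw [hμ]; ring⟩
  have e0 := rn_ne J0 hf0 hd0
  have e1 := rn_ne J0 hf0 hd1
  have e2 := rn_ne J0 hf0 hd2
  have e3 := rn_ne J0 hf0 hd3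
  have nm : ∀ (P : ℌ B) (x y w : B), x ∉ P.asIdeal → y ∉ P.asIdeal → w ∉ P.asIdeal → x * y * w ∉ P.asIdeal := fun P x y w hx hy hw h =>
    (P.isPrime.mem_or_mem h).elim (fun h => (P.isPrime.mem_or_mem h).elim hx hy) hw
  have ny := fun (P : ℌ B) i j (h : i ≠ j) => Yc_not P.asIdeal P.isPrime (hne i j h)
  obtain ⟨u1, hu1, hu1c, hu1n⟩ := usel P1 (c 0) h1 h1' (m := Yc B (c 1) * Yc B (c 2) * Yc B (c 3))
    (nm _ _ _ _ (ny P1 0 1 (by decide) h1) (ny P1 0 2 (by decide) h1) (ny P1 0 3 (by decide) h1)) (s := s * f0.eval (c 1) / f0.eval (c 0)) (div_ne_zero (mul_ne_zero hs e1) e0)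
  obtain ⟨u2, hu2, hu2c, hu2n⟩ := usel P2 (c 2) h2 h2' (m := Yc B (c 0) * Yc B (c 1) * Yc B (c 3))
    (nm _ _ _ _ (ny P2 2 0 (by decide) h2) (ny P2 2 1 (by decide) h2) (ny P2 2 3 (by decide) h2)) (s := s' * f0.eval (c 3) / f0.eval (c 2)) (div_ne_zero (mul_ne_zero hs' e3) e2)
  rw [show Yc B (c 0) * (Yc B (c 1) * Yc B (c 2) * Yc B (c 3)) = μ by rw [hμ]; ring] at hu1c
  rw [show Yc B (c 2) * (Yc B (c 0) * Yc B (c 1) * Yc B (c 3)) = μ by rw [hμ]; ring] at hu2c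
  have hL : Ideal.span {μ} ≠ ⊥ := by simpa using hμ0
  obtain ⟨x, hx, -, hxu, hxd⟩ := H.pick (J := ⊤) top_ne_bot hL (Ideal.isCoprime_iff_sup_eq.2 (by simp)) (u1 * u2) M hM (r + vz Q (ϖ B K e) - vz Q (ϖ B K z))
  have hxc : IsCoprime (Ideal.span {μ}) (Ideal.span {x}) := by
    have h := hu1c.mul_right hu2c
    rw [span_smul] at h
    obtain ⟨p, hp, w, hw, hpw⟩ := Ideal.isCoprime_iff_exists.1 h
    obtain ⟨t, rfl⟩ := Ideal.mem_span_singleton.1 hw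
    exact Ideal.isCoprime_iff_exists.2 ⟨p - (x - u1 * u2) * t, sub_mem hp (Ideal.mul_mem_right _ _ hxu), x * t, Ideal.mul_mem_right _ _ (Ideal.mem_span_singleton_self _), by
      linear_combination hpw⟩
  obtain ⟨X3, hX3⟩ := jd_surj (μ := μ) (a := Ideal.span {x}) (by simpa using hx) hxc
  have ev : ∀ c', Yc B c' ∣ μ → (Algebra.norm k[X] x).eval c' = (Algebra.norm k[X] u1).eval c' * (Algebra.norm k[X] u2).eval c' := fun c' h => by
    rw [ev_congr (z' := u1 * u2) (Ideal.span_singleton_le_span_singleton.2 h hxu), map_mul, eval_mul]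
  refine ⟨J0 + X3, z * x, e, mul_ne_zero hz hx, he, ?_, ?_, f0 * Algebra.norm k[X] x, ?_, ?_, ?_⟩
  · rw [jd_add, hX3, ← span_smul, ← mul_assoc, hJ]; ring
  · rw [map_mul, vz_mul Q (H.ne hz) (H.ne hx)]
    convert hxd using 1; ring
  · rw [jd_add, map_mul, hf0, hX3, rn_span, span_smul]
  · rw [eval_mul, eval_mul, ev _ hd0, ev _ hd1, hu1n, ev_one (c := c 0) ⟨Yc B (c 1) * Yc B (c 3), by ring⟩ hu2, ev_one (c := c 1) ⟨Yc B (c 2) * Yc B (c 3), by ring⟩ hu1,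
      ev_one (c := c 1) ⟨Yc B (c 0) * Yc B (c 3), by ring⟩ hu2]
    field_simp
  · rw [eval_mul, eval_mul, ev _ hd2, ev _ hd3, hu2n, ev_one (c := c 2) ⟨Yc B (c 1) * Yc B (c 3), by ring⟩ hu1, ev_one (c := c 3) ⟨Yc B (c 1) * Yc B (c 2), by ring⟩ hu1,
      ev_one (c := c 3) ⟨Yc B (c 0) * Yc B (c 1), by ring⟩ hu2]
    field_simp
lemma gP (H : FQ B Q) [Finite (ClassGroup B)] {c : Fin 4 → k} (hc : Function.Injective c) {μ : B} (hμ : μ = Yc B (c 0) * Yc B (c 1) * Yc B (c 2) * Yc B (c 3)) (P1 P2 : ℌ B)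
    (h1 : Yc B (c 0) ∈ P1.asIdeal) (h1' : Yc B (c 0) ∉ P1.asIdeal ^ 2) (h2 : Yc B (c 2) ∈ P2.asIdeal) (h2' : Yc B (c 2) ∉ P2.asIdeal ^ 2)
    (hμ0 : μ ≠ 0) (J1 J2 : Ideal B) (hJ1 : J1 ≠ ⊥) (hJ2 : J2 ≠ ⊥) {M : ℕ} (hM : 0 < M) (r : ℤ) {s s' : k} (hs : s ≠ 0) (hs' : s' ≠ 0) :
    ∃ P : ℌ B, μ ∉ P.asIdeal ∧ ∃ z e : B, z ≠ 0 ∧ e ≠ 0 ∧ Ideal.span {e} * J2 * P.asIdeal = Ideal.span {z} * J1 ∧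
      (M : ℤ) ∣ vz Q (ϖ B K z) - vz Q (ϖ B K e) - r ∧
      ∃ f : k[X], Ideal.relNorm k[X] P.asIdeal = Ideal.span {f} ∧ f.eval (c 0) = s * f.eval (c 1) ∧ f.eval (c 2) = s' * f.eval (c 3) := by
  obtain ⟨J, z, e, hz, he, hJ, hd, f, hf, hf1, hf2⟩ := gJ H hc hμ P1 P2 h1 h1' h2 h2' hμ0 J1 J2 hJ1 hJ2 hM r hs hs'
  obtain ⟨P, z1, hz1, z2, hz2, h⟩ := (H.ray hμ0 hM J).nonempty
  have n1 : z1 ≠ 0 := by rintro rfl; exact hz1.1 (map_zero _)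
  have n2 : z2 ≠ 0 := by rintro rfl; exact hz2.1 (map_zero _)
  obtain ⟨g, hg⟩ := rn_gen (k := k) P.1.asIdeal
  have hr := congrArg (Ideal.relNorm k[X]) h
  rw [map_mul, map_mul, rn_span, rn_span, hf, hg, span_smul, span_smul, Ideal.span_singleton_eq_span_singleton] at hr
  obtain ⟨w, hw⟩ := hr
  obtain ⟨d, hdu, hd2⟩ := Polynomial.isUnit_iff.1 w.isUnit
  have hev : ∀ c', Yc B c' ∣ μ → g.eval c' * d = f.eval c' := fun c' h' => by
    have := congrArg (Polynomial.eval c') hw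
    rwa [← hd2, eval_mul, eval_mul, eval_mul, eval_C, ev_one h' hz1.2.1, ev_one h' hz2.2.1, mul_one, mul_one] at this
  have hd0 : Yc B (c 0) ∣ μ := ⟨Yc B (c 1) * Yc B (c 2) * Yc B (c 3), by rw [hμ]; ring⟩
  have hd1 : Yc B (c 1) ∣ μ := ⟨Yc B (c 0) * Yc B (c 2) * Yc B (c 3), by rw [hμ]; ring⟩
  have hd2 : Yc B (c 2) ∣ μ := ⟨Yc B (c 0) * Yc B (c 1) * Yc B (c 3), by rw [hμ]; ring⟩
  have hd3 : Yc B (c 3) ∣ μ := ⟨Yc B (c 0) * Yc B (c 1) * Yc B (c 2), by rw [hμ]; ring⟩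
  refine ⟨P.1, P.2, z * z1, e * z2, mul_ne_zero hz n1, mul_ne_zero he n2, ?_, ?_, g, hg, ?_, ?_⟩
  · rw [← span_smul, ← span_smul]
    calc _ = Ideal.span {e} * J2 * (P.1.asIdeal * Ideal.span {z2}) := by ring
      _ = (J1 * Ideal.span {z}) * Ideal.span {z1} := by rw [h, hJ]; ring
      _ = _ := by rw [mul_assoc, mul_comm]
  · rw [map_mul, map_mul, vz_mul Q (H.ne hz) hz1.1, vz_mul Q (H.ne he) hz2.1]
    obtain ⟨q, hq⟩ := dvd_add hd (dvd_sub hz1.2.2 hz2.2.2)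
    exact ⟨q, by linear_combination hq⟩
  · rw [← hev _ hd0, ← hev _ hd1] at hf1
    exact mul_right_cancel₀ hdu.ne_zero (by rw [hf1]; ring)
  · rw [← hev _ hd2, ← hev _ hd3] at hf2
    exact mul_right_cancel₀ hdu.ne_zero (by rw [hf2]; ring)
end FF7
section FF8
open WithZero IsDedekindDomain Polynomial Module
variable {B : Type*} [CommRing B] [IsDedekindDomain B] {k : Type*} [Field k] [Finite k] [Algebra k B] [Algebra k[X] B] [IsScalarTower k k[X] B]
  [Module.Finite k[X] B] [IsTorsionFree k[X] B] [Algebra B K] [IsFractionRing B K] {Q : FinPlace K}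
lemma plc_inj : Function.Injective (plc K : ℌ B → FinPlace K) := by
  intro P Q h
  apply HeightOneSpectrum.ext
  ext x
  rw [← plc_lt_one_iff (K := K), ← plc_lt_one_iff (K := K), h]
lemma vz_zpow (v : FinPlace K) {x : K} (hx : x ≠ 0) (n : ℤ) : vz v (x ^ n) = n * vz v x := by
  refine vz_of v ?_
  rw [map_zpow₀, val_exp v hx, ← exp_zsmul, smul_eq_mul]
lemma cls_e0 (H : FQ B Q) [Finite (ClassGroup B)] (P : ℌ B) : ∃ e : B, e ≠ 0 ∧ 0 < vz Q (ϖ B K e) ∧ ∀ P' : ℌ B, P' ≠ P → vz (plc K P') (ϖ B K e) = 0 := by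
  have h1 := pow_card_eq_one' (x := ClassGroup.mk0 ⟨P.asIdeal, mem_nonZeroDivisors_of_ne_zero P.ne_bot⟩)
  rw [← map_pow, ClassGroup.mk0_eq_one_iff] at h1
  obtain ⟨e, he⟩ := h1.principal
  have he' : P.asIdeal ^ Nat.card (ClassGroup B) = Ideal.span {e} := he
  have hc : Nat.card (ClassGroup B) ≠ 0 := Nat.card_pos.ne'
  have he0 : e ≠ 0 := by
    rintro rfl
    rw [Set.singleton_zero, Ideal.span_zero] at he'
    exact P.ne_bot (pow_eq_zero_iff hc |>.1 he')
  refine ⟨e, he0, lt_of_le_of_ne (H.deg he0) fun h => ?_, fun P' hP' => ?_⟩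
  · have h2 := H.nrm_span he0
    rw [← h, zpow_zero] at h2
    have h3 : Nat.card (B ⧸ Ideal.span {e}) = 1 := by exact_mod_cast h2
    have := (Nat.card_eq_one_iff_unique.1 h3).1
    rw [Ideal.Quotient.subsingleton_iff, ← he'] at this
    exact P.isPrime.ne_top (top_le_iff.1 (this ▸ Ideal.pow_le_self hc))
  · rw [vz_plc P' (X := Finsupp.single P (Nat.card (ClassGroup B))) (by rw [idl_single, he']), Finsupp.single_eq_of_ne hP']; simp
lemma gX (H : FQ B Q) (hB : ∀ w : FinPlace K, w ≠ Q → ∀ b : B, w.val (ϖ B K b) ≤ 1) (hy : ∃ b : B, 1 < Q.val (ϖ B K b))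
    [Finite (ClassGroup B)] {c : Fin 4 → k} (hc : Function.Injective c) {μ : B} (hμ : μ = Yc B (c 0) * Yc B (c 1) * Yc B (c 2) * Yc B (c 3)) (P1 P2 : ℌ B)
    (h1 : Yc B (c 0) ∈ P1.asIdeal) (h1' : Yc B (c 0) ∉ P1.asIdeal ^ 2) (h2 : Yc B (c 2) ∈ P2.asIdeal) (h2' : Yc B (c 2) ∉ P2.asIdeal ^ 2)
    (hμ0 : μ ≠ 0) {s s' : k} (hs : s ≠ 0) (hs' : s' ≠ 0) (q0 : FinPlace K) (D : FinPlace K → ℤ) (hD : {v : FinPlace K | D v ≠ 0}.Finite) :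
    ∃ P : ℌ B, μ ∉ P.asIdeal ∧ (∃ f : k[X], Ideal.relNorm k[X] P.asIdeal = Ideal.span {f} ∧ f.eval (c 0) = s * f.eval (c 1) ∧ f.eval (c 2) = s' * f.eval (c 3)) ∧
      ∃ x : K, x ≠ 0 ∧ ∀ w : FinPlace K, w ≠ q0 → vz w x = (if w = plc K P then 1 else 0) - D w := by
  have hD' : {P : ℌ B | D (plc K P) ≠ 0}.Finite := hD.preimage plc_inj.injOn
  have hplQ : ∀ P : ℌ B, plc K P ≠ Q := fun P h => by
    obtain ⟨b, hb⟩ := hy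
    exact absurd (plc_le_one (K := K) P b) (by rw [h]; exact not_le.2 hb)
  let Dp : ℌ B →₀ ℕ := Finsupp.ofSupportFinite (fun P => (D (plc K P)).toNat) (hD'.subset fun P h h' => h (by simp [h']))
  let Dm : ℌ B →₀ ℕ := Finsupp.ofSupportFinite (fun P => (-D (plc K P)).toNat) (hD'.subset fun P h h' => h (by simp [h']))
  have hg : ∀ (M : ℕ) (hM : 0 < M) (r : ℤ), ∃ P : ℌ B, μ ∉ P.asIdeal ∧ (∃ f : k[X], Ideal.relNorm k[X] P.asIdeal = Ideal.span {f} ∧ f.eval (c 0) = s * f.eval (c 1) ∧ f.eval (c 2) = s' * f.eval (c 3)) ∧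
      ∃ x : K, x ≠ 0 ∧ (M : ℤ) ∣ vz Q x + r ∧ ∀ P' : ℌ B, vz (plc K P') x = (if plc K P' = plc K P then 1 else 0) - D (plc K P') := by
    intro M hM r
    obtain ⟨P, hP, z, e, hz, he, h, hd, hf⟩ := gP H hc hμ P1 P2 h1 h1' h2 h2' hμ0 (idl Dp) (idl Dm) (idl_ne _) (idl_ne _) hM r hs hs'
    obtain ⟨Z, hZ⟩ := idl_surj (J := Ideal.span {z}) (by simpa using hz)
    obtain ⟨E, hE⟩ := idl_surj (J := Ideal.span {e}) (by simpa using he)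
    have hP' : P.asIdeal = idl (Finsupp.single P 1) := by rw [idl_single, pow_one]
    rw [← hZ, ← hE, hP', ← idl_add, ← idl_add, ← idl_add] at h
    refine ⟨P, hP, hf, ϖ B K e / ϖ B K z, div_ne_zero (H.ne he) (H.ne hz), ?_, fun P' => ?_⟩
    · obtain ⟨q, hq⟩ := hd
      exact ⟨-q, by rw [vz_div Q (H.ne he) (H.ne hz)]; linear_combination -hq⟩
    · rw [vz_div _ (H.ne he) (H.ne hz), vz_plc P' hZ.symm, vz_plc P' hE.symm]
      have h3 := DFunLike.congr_fun (idl_inj h) P'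
      simp only [Finsupp.add_apply, Finsupp.single_apply] at h3
      have h4 : (Dp P' : ℤ) - Dm P' = D (plc K P') := by
        change ((D (plc K P')).toNat : ℤ) - (-D (plc K P')).toNat = _
        omega
      by_cases h5 : P = P'
      · subst h5; rw [if_pos rfl] at h3 ⊢; omega
      · rw [if_neg h5] at h3; rw [if_neg fun h => h5 (plc_inj h).symm]; omega
  by_cases hq : q0 = Q
  · obtain ⟨P, hP, hf, x, hx, -, h⟩ := hg 1 one_pos 0
    refine ⟨P, hP, hf, x, hx, fun w hw => ?_⟩
    obtain ⟨P', rfl⟩ := FinPlace.eq_plc (A := B) w (hB w (hq ▸ hw))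
    exact h P'
  · obtain ⟨P0, rfl⟩ := FinPlace.eq_plc (A := B) q0 (hB q0 hq)
    obtain ⟨e0, he0, hpos, hv⟩ := cls_e0 H P0
    obtain ⟨M, hM⟩ := Int.eq_ofNat_of_zero_le hpos.le
    obtain ⟨P, hP, hf, x, hx, ⟨m, hm⟩, h⟩ := hg M (by omega) (D Q)
    refine ⟨P, hP, hf, x * ϖ B K e0 ^ (-m), mul_ne_zero hx (zpow_ne_zero _ (H.ne he0)), fun w hw => ?_⟩
    rw [vz_mul w hx (zpow_ne_zero _ (H.ne he0)), vz_zpow w (H.ne he0)]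
    by_cases hwQ : w = Q
    · subst hwQ
      rw [hM, if_neg fun h => hplQ P h.symm]
      linear_combination hm
    · obtain ⟨P', rfl⟩ := FinPlace.eq_plc (A := B) w (hB w hwQ)
      rw [hv P' (fun h => hw (by rw [h])), h P']; ring
lemma ff_core [Algebra k K] [IsScalarTower k B K] (H : FQ B Q) (hB : ∀ w : FinPlace K, w ≠ Q → ∀ b : B, w.val (ϖ B K b) ≤ 1)
    [Finite (ClassGroup B)] {ℓ : ℕ} (hℓ : ℓ.Prime) (hodd : Odd ℓ) (hchar : (ℓ : K) ≠ 0) {ζ : k} (hζ : IsPrimitiveRoot ζ ℓ) (hω : IsPrimitiveRoot (ϖ k K ζ) ℓ)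
    (hy : 1 < Q.val (ϖ B K (ϖ k[X] B X))) (P1 P2 : ℌ B)
    (h1 : Yc B (0 : k) ∈ P1.asIdeal) (h1' : Yc B (0 : k) ∉ P1.asIdeal ^ 2) (h2 : Yc B ζ ∈ P2.asIdeal) (h2' : Yc B ζ ∉ P2.asIdeal ^ 2) :
    FFc K ℓ := by
  have := H.hfq
  have h3 : 3 ≤ ℓ := by
    have := hℓ.two_le
    rcases hodd with ⟨m, hm⟩; omega
  have z1 : ζ ≠ 1 := fun h => by have := hζ.pow_ne_one_of_pos_of_lt one_ne_zero (by omega); rw [pow_one] at this; exact this h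
  have z2 : ζ ^ 2 ≠ 1 := hζ.pow_ne_one_of_pos_of_lt two_ne_zero (by omega)
  have z0 : ζ ≠ 0 := hζ.ne_zero (by omega)
  have z3 : ζ ^ 2 ≠ ζ := fun h => z1 (mul_left_cancel₀ z0 (by rw [mul_one, ← pow_two]; exact h))
  let c : Fin 4 → k := ![0, 1, ζ, ζ ^ 2]
  have hc : Function.Injective c := by
    intro i j h
    fin_cases i <;> fin_cases j <;> first | rfl | (exfalso; simp [c] at h; done) | (exfalso; simp [c] at h; grind)
  have hQY : ∀ d : k, Q.val (ϖ B K (Yc B d)) = Q.val (ϖ B K (ϖ k[X] B X)) := fun d => by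
    rw [Yc, map_sub, map_sub, ← algebraMap_eq, ← IsScalarTower.algebraMap_apply k k[X] B, ← IsScalarTower.algebraMap_apply k B K]
    exact Valuation.map_sub_eq_of_lt_left _ ((fin_val_le Q d).trans_lt hy)
  have hYK : ∀ d : k, ϖ B K (Yc B d) ≠ 0 := fun d h => by
    have := hQY d; rw [h, map_zero] at this; rw [← this] at hy; simp at hy
  have hY0 : ∀ d : k, Yc B d ≠ 0 := fun d h => hYK d (by rw [h, map_zero])
  set μ := Yc B (c 0) * Yc B (c 1) * Yc B (c 2) * Yc B (c 3) with hμ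
  have hμ0 : μ ≠ 0 := mul_ne_zero (mul_ne_zero (mul_ne_zero (hY0 _) (hY0 _)) (hY0 _)) (hY0 _)
  let Y := fun i => ϖ B K (Yc B (c i))
  have hY : ∀ i, Y i ≠ 0 := fun i => hYK _
  have hVQ : ∀ i j, vz Q (Y i) = vz Q (Y j) := fun i j => by
    refine vz_of _ ?_
    rw [hQY, ← hQY (c j)]; exact val_exp Q (hY j)
  have ny := fun (P : ℌ B) i j (h : i ≠ j) => Yc_not P.asIdeal P.isPrime (fun h' => h (hc h') : c i ≠ c j)
  have v0 : ∀ (P : ℌ B) i, Yc B (c i) ∉ P.asIdeal → (plc K P).val (Y i) = 1 := fun P i h => (plc_eq_one_iff P _).2 h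
  have v1 : ∀ (P : ℌ B) i, Yc B (c i) ∈ P.asIdeal → Yc B (c i) ∉ P.asIdeal ^ 2 → vz (plc K P) (Y i) = -1 := fun P i h h' => by
    have e1 := (plc_le_iff (K := K) P (Yc B (c i)) 1).2 (by rwa [pow_one])
    have e2 := mt (plc_le_iff (K := K) P (Yc B (c i)) 2).1 h'
    change (plc K P).val (Y i) ≤ _ at e1
    change ¬ (plc K P).val (Y i) ≤ _ at e2
    rw [val_exp _ (hY i), exp_le_exp] at e1 e2
    push_cast at e1 e2; omega
  have ha0 : Y 0 / Y 1 ≠ 0 := div_ne_zero (hY _) (hY _)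
  have hb0 : Y 2 / Y 3 ≠ 0 := div_ne_zero (hY _) (hY _)
  have va : ∀ v, vz v (Y 0 / Y 1) = vz v (Y 0) - vz v (Y 1) := fun v => vz_div _ (hY _) (hY _)
  have vb : ∀ v, vz v (Y 2 / Y 3) = vz v (Y 2) - vz v (Y 3) := fun v => vz_div _ (hY _) (hY _)
  have hnp : ∀ (v : FinPlace K) (x t : K), x ≠ 0 → vz v x = -1 → x ≠ t ^ ℓ := fun v x t hx h h' => by
    have ht : t ≠ 0 := by rintro rfl; rw [zero_pow hℓ.ne_zero] at h'; exact hx h'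
    refine not_pow (v := v) (a := x⁻¹) hℓ (inv_ne_zero ht) ?_ (by rw [h', inv_pow])
    rw [← one_div, vz_div v one_ne_zero hx, vz_one, h]; norm_num
  have p1 : ∀ i, i ≠ 0 → vz (plc K P1) (Y i) = 0 := fun i hi => vz_zero_of _ (v0 _ _ (ny P1 0 i hi.symm h1))
  have p2 : ∀ i, i ≠ 2 → vz (plc K P2) (Y i) = 0 := fun i hi => vz_zero_of _ (v0 _ _ (ny P2 2 i hi.symm h2))
  have q1 : vz (plc K P1) (Y 0) = -1 := v1 P1 0 h1 h1'
  have q2 : vz (plc K P2) (Y 2) = -1 := v1 P2 2 h2 h2'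
  refine ⟨Y 0 / Y 1, Y 2 / Y 3, ha0, hb0, fun v => ?_, ⟨?_, ?_, ?_⟩, ?_⟩
  · rw [va, vb]
    by_cases hv : v = Q
    · left; rw [hv, hVQ 0 1, sub_self]
    · obtain ⟨P, rfl⟩ := FinPlace.eq_plc (A := B) v (hB v hv)
      by_cases h : Yc B (c 0) ∈ P.asIdeal ∨ Yc B (c 1) ∈ P.asIdeal
      · right
        have : ∀ i, i = 2 ∨ i = 3 → Yc B (c i) ∉ P.asIdeal := by
          rintro i (rfl | rfl) <;> exact h.elim (ny P 0 _ (by decide)) (ny P 1 _ (by decide))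
        rw [vz_zero_of _ (v0 P 2 (this 2 (by simp))), vz_zero_of _ (v0 P 3 (this 3 (by simp))), sub_self]
      · left
        push Not at h
        rw [vz_zero_of _ (v0 P 0 h.1), vz_zero_of _ (v0 P 1 h.2), sub_self]
  · rintro ⟨t, ht⟩
    exact hnp (plc K P1) _ t ha0 (by rw [va, q1, p1 1 (by decide)]; norm_num) ht
  · rintro ⟨t, ht⟩
    exact hnp (plc K P2) _ t hb0 (by rw [vb, q2, p2 3 (by decide)]; norm_num) ht
  · rintro ⟨t, ht⟩
    refine hnp (plc K P1) (Y 0 / Y 1 / (Y 2 / Y 3)) t (div_ne_zero ha0 hb0) ?_ (by rw [ht, mul_div_cancel_left₀ _ hb0])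
    rw [vz_div _ ha0 hb0, va, vb, q1, p1 1 (by decide), p1 2 (by decide), p1 3 (by decide)]; norm_num
  intro α β hα hβ q0 σ D hD
  obtain ⟨i, j, hij⟩ := frob_final hℓ hω hchar ha0 hb0 hα hβ σ
  have hlk : ℓ ∣ Nat.card k - 1 := by
    rw [← Nat.card_units]
    exact (hζ.isUnit_unit (by omega)).eq_orderOf ▸ orderOf_dvd_natCard _
  have hroot : ∀ n : ℕ, ∃ s : k, s ≠ 0 ∧ s ^ ((Nat.card k - 1) / ℓ) = ζ ^ n := fun n => by
    by_cases h : ℓ + 1 < Nat.card k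
    · obtain ⟨u, hu, -, h⟩ := cyc_root hℓ hlk h (ζ ^ n) (by rw [← pow_mul, mul_comm, pow_mul, hζ.pow_eq_one, one_pow])
      exact ⟨u, hu, h⟩
    · have : Nat.card k - 1 = ℓ := by
        have := Nat.le_of_dvd (by have := Finite.one_lt_card (α := k); omega) hlk
        omega
      exact ⟨ζ ^ n, pow_ne_zero _ z0, by rw [this, Nat.div_self (by omega), pow_one]⟩
  obtain ⟨s, hs, hsi⟩ := hroot i
  obtain ⟨s', hs', hsj⟩ := hroot j
  obtain ⟨P, hP, ⟨f, hf, hf1, hf2⟩, hx⟩ := gX H hB ⟨_, hy⟩ hc hμ P1 P2 h1 h1' h2 h2' hμ0 hs hs' q0 D hD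
  have hYP : ∀ i, Yc B (c i) ∉ P.asIdeal := fun i h => hP (by
    rw [hμ]; fin_cases i
    exacts [Ideal.mul_mem_right _ _ (Ideal.mul_mem_right _ _ (Ideal.mul_mem_right _ _ h)), Ideal.mul_mem_right _ _ (Ideal.mul_mem_right _ _ (Ideal.mul_mem_left _ _ h)),
      Ideal.mul_mem_right _ _ (Ideal.mul_mem_left _ _ h), Ideal.mul_mem_left _ _ h])
  have : Finite (B ⧸ P.asIdeal) := Ring.HasFiniteQuotients.finiteQuotient P.ne_bot
  have sym : ∀ i j (s t : k), f.eval (c i) = s * f.eval (c j) → s ^ ((Nat.card k - 1) / ℓ) = t →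
      (plc K P).val ((Y i / Y j) ^ ((resCard (plc K P) - 1) / ℓ) - ϖ k K t) < 1 := fun i j s t h h' => by
    have h4 := (plc_lt_one_iff (K := K) P _).2 (sy P hf h hlk h')
    rw [plc_card, div_pow]
    set n := (Nat.card (B ⧸ P.asIdeal) - 1) / ℓ
    rw [map_sub, map_mul, map_pow, map_pow, ← IsScalarTower.algebraMap_apply k B K] at h4
    have h5 : Y i ^ n / Y j ^ n - ϖ k K t = (Y i ^ n - ϖ k K t * Y j ^ n) / Y j ^ n := by
      field_simp [hY j]
    rw [h5, map_div₀, map_pow, v0 P j (hYP j), one_pow, div_one]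
    exact h4
  have hv := hij (plc K P) (plc_fin P) (by rw [map_div₀, v0 P 0 (hYP 0), v0 P 1 (hYP 1), div_one]) (by rw [map_div₀, v0 P 2 (hYP 2), v0 P 3 (hYP 3), div_one])
    (by rw [← map_natCast (ϖ k K)]; exact fin_val _ fun h => hchar (by rw [← map_natCast (ϖ k K), h, map_zero]))
    (by rw [← map_pow]; exact sym 0 1 s _ hf1 hsi) (by rw [← map_pow]; exact sym 2 3 s' _ hf2 hsj)
  exact ⟨plc K P, hv.1, hv.2, hx⟩
end FF8
section FF9
open WithZero IsDedekindDomain Polynomial Module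
variable {B : Type*} [CommRing B] [IsDomain B] [IsIntegrallyClosed B] {k : Type*} [Field k] [Finite k] [Algebra k B]
  [Algebra B K] [IsFractionRing B K] {Q : FinPlace K}
lemma ff_wrap [Algebra k K] [IsScalarTower k B K] (H : FQ B Q) (hB : ∀ w : FinPlace K, w ≠ Q → ∀ b : B, w.val (ϖ B K b) ≤ 1)
    {ℓ : ℕ} (hℓ : ℓ.Prime) (hodd : Odd ℓ) (hchar : (ℓ : K) ≠ 0) {ζ : k} (hζ : IsPrimitiveRoot ζ ℓ) (hω : IsPrimitiveRoot (ϖ k K ζ) ℓ) :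
    FFc K ℓ := by
  have hd := H.dedekind
  obtain ⟨n0, hn0⟩ := H.cosetp ⊤ top_ne_bot 0
  obtain ⟨y0, -, hy0⟩ := hn0 (n0 + 1) (by omega)
  have hy1 : 1 < Q.val (ϖ B K y0) := by rw [hy0, ← exp_zero, exp_lt_exp]; omega
  have hnu : ∀ z : B, 1 < Q.val (ϖ B K z) → ¬ IsUnit z := by
    rintro z hz ⟨u, rfl⟩
    have h1 : Q.val (ϖ B K (u : B)) * Q.val (ϖ B K (u⁻¹ : Bˣ)) = 1 := by rw [← map_mul, ← map_mul]; simp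
    have h2 : Q.val (ϖ B K (u⁻¹ : Bˣ)) < 1 := by
      by_contra h
      exact (one_lt_mul_of_lt_of_le hz (not_lt.1 h)).ne' h1
    exact u⁻¹.ne_zero (H.zero _ h2)
  have hpr : ∀ z : B, 1 < Q.val (ϖ B K z) → ∃ P : ℌ B, z ∈ P.asIdeal := fun z hz => by
    obtain ⟨M, hM, hzM⟩ := exists_max_ideal_of_mem_nonunits (hnu z hz)
    exact ⟨⟨M, hM.isPrime, by rintro rfl; rw [Ideal.mem_bot] at hzM; rw [hzM] at hz; simp at hz⟩, hzM⟩
  obtain ⟨P1, hP1⟩ := hpr y0 hy1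
  obtain ⟨P2, hP2⟩ := hpr (y0 - 1) (by rw [map_sub, Valuation.map_sub_eq_of_lt_left _ (by simpa using hy1)]; exact hy1)
  have hne : P1 ≠ P2 := by
    rintro rfl
    refine P1.isPrime.ne_top ((Ideal.eq_top_iff_one _).2 ?_)
    have := sub_mem hP1 hP2; simpa using this
  have hun : ∀ P : ℌ B, ∃ π ∈ P.asIdeal, π ∉ P.asIdeal ^ 2 := fun P => by
    have h : P.asIdeal ^ 2 < P.asIdeal ^ 1 := Ideal.pow_right_strictAnti _ P.ne_bot P.isPrime.ne_top (by norm_num)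
    obtain ⟨π, h1, h2⟩ := SetLike.exists_of_lt h
    exact ⟨π, by simpa using h1, h2⟩
  obtain ⟨π1, h1, h1'⟩ := hun P1
  obtain ⟨π2, h2, h2'⟩ := hun P2
  obtain ⟨y, hy⟩ := crt {P1, P2} (fun P => if P = P1 then π1 else ϖ k B ζ + π2) 2
  have e1 := hy P1 (by simp)
  have e2 := hy P2 (by simp)
  rw [if_pos rfl] at e1
  rw [if_neg hne.symm] at e2
  obtain ⟨m0, hm0⟩ := H.cosetp (P1.asIdeal ^ 2 * P2.asIdeal ^ 2) (mul_ne_zero (pow_ne_zero _ P1.ne_bot) (pow_ne_zero _ P2.ne_bot)) y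
  obtain ⟨b, hb, hbQ⟩ := hm0 (m0 + 1) (by omega)
  have f1 : b - π1 ∈ P1.asIdeal ^ 2 := by
    have := add_mem (Ideal.mul_le_left hb) e1
    simpa using this
  have f2 : b - ϖ k B ζ - π2 ∈ P2.asIdeal ^ 2 := by
    have := add_mem (Ideal.mul_le_right hb) e2
    rw [sub_add_sub_cancel] at this; rwa [sub_sub]
  letI : Algebra k[X] B := (aeval b : k[X] →ₐ[k] B).toRingHom.toAlgebra
  have : IsScalarTower k k[X] B := IsScalarTower.of_algebraMap_eq fun c => ((aeval b : k[X] →ₐ[k] B).commutes c).symm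
  have hX : ϖ k[X] B X = b := aeval_X (R := k) b
  have hbQ' : 1 < Q.val (ϖ B K (ϖ k[X] B X)) := by rw [hX, hbQ, ← exp_zero, exp_lt_exp]; omega
  have := H.poly_fin hbQ'
  have : IsTorsionFree k[X] B := (Module.isTorsionFree_iff_algebraMap_injective).2 (FQ.poly_inj hbQ')
  have := H.clfin hbQ'
  have hYc : ∀ c : k, Yc B c = b - ϖ k B c := fun c => by
    rw [Yc, map_sub, hX, ← algebraMap_eq, ← IsScalarTower.algebraMap_apply k k[X] B]
  have g1 : ∀ (P : Ideal B) (u v : B), u - v ∈ P ^ 2 → v ∈ P → v ∉ P ^ 2 → u ∈ P ∧ u ∉ P ^ 2 := fun P u v h hv hv' =>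
    ⟨by have := add_mem (Ideal.pow_le_self two_ne_zero h) hv; simpa using this, fun hu => hv' (by have := sub_mem hu h; simpa using this)⟩
  have k1 := g1 P1.asIdeal (Yc B (0 : k)) π1 (by rw [hYc, map_zero, sub_zero]; exact f1) h1 h1'
  have k2 := g1 P2.asIdeal (Yc B ζ) π2 (by rw [hYc]; exact f2) h2 h2'
  exact ff_core H hB hℓ hodd hchar hζ hω hbQ' P1 P2 k1.1 k1.2 k2.1 k2.2
end FF9
section FG1
open WithZero IsDedekindDomain Polynomial Module
variable {F : Type*} [Field F] [Algebra F K]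
lemma fg_alg {f : K} (h : ∀ V : ValuationSubring K, (∀ c : F, ϖ F K c ∈ V) → f ∈ V) : IsIntegral F f := by
  have h1 := iInf_valuationSubring_superset (K := K) (s := Set.range (ϖ F K))
  have h2 : f ∈ (integralClosure (Subring.closure (Set.range (ϖ F K))) K).toSubring := by
    rw [← h1, Subring.mem_iInf]
    exact fun V => h V.1 (fun c => V.2 ⟨c, rfl⟩)
  rw [← RingHom.coe_range, Subring.closure_eq] at h2
  obtain ⟨p, hp, hp0⟩ : IsIntegral (ϖ F K).range f := h2
  have := lifts_and_degree_eq_and_monic (f := (ϖ F K).rangeRestrict) (p := p) (by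
    rw [lifts_iff_coeffs_subset_range]; intro i _; exact RingHom.rangeRestrict_surjective _ i) hp
  obtain ⟨q, hq, -, hqm⟩ := this
  refine ⟨q, hqm, ?_⟩
  rw [← hq, eval₂_map] at hp0
  exact hp0
lemma fg_intV {y f : K} (V : ValuationSubring K) (hV : ∀ c : F, ϖ F K c ∈ V) (hy : y ∈ V)
    (hf : IsIntegral (Algebra.adjoin F {y}) f) : f ∈ V := by
  have h1 : ∀ a : Algebra.adjoin F {y}, (a : K) ∈ V := fun a => by
    refine Algebra.adjoin_induction (p := fun a _ => a ∈ V) ?_ hV (fun _ _ _ _ => add_mem) (fun _ _ _ _ => mul_mem) a.2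
    rintro z rfl; exact hy
  have h := IsIntegral.map_of_comp_eq ((ϖ _ K).codRestrict V h1 : Algebra.adjoin F {y} →+* V) (RingHom.id K) (by ext; rfl) hf
  obtain ⟨z, hz⟩ := IsIntegrallyClosed.isIntegral_iff.1 h
  rw [RingHom.id_apply] at hz; rw [← hz]; exact z.2
lemma fg_both {y f : K} (h1 : IsIntegral (Algebra.adjoin F {y}) f) (h2 : IsIntegral (Algebra.adjoin F {y⁻¹}) f) : IsIntegral F f :=
  fg_alg fun V hV => (V.mem_or_inv_mem y).elim (fun h => fg_intV V hV h h1) (fun h => fg_intV V hV h h2)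
lemma fg_val1 [Finite F] (w : FinPlace K) {f : K} (h : IsIntegral F f) (h0 : f ≠ 0) : w.val f = 1 := by
  have := adjoin.finiteDimensional h
  have : Finite F⟮f⟯ := Module.finite_of_finite F
  have := fin_val (k := F⟮f⟯) w (c := AdjoinSimple.gen F f) (fun h => h0 (by rw [← AdjoinSimple.algebraMap_gen F f, h, map_zero]))
  simpa using this
lemma fg_le [Finite F] (w : FinPlace K) {y : K} (hy : w.val y ≤ 1) (a : Algebra.adjoin F {y}) : w.val (ϖ _ K a) ≤ 1 := by
  refine Algebra.adjoin_induction (p := fun a _ => a ∈ w.val.valuationSubring) ?_ (fun c => fin_val_le w c) (fun _ _ _ _ => add_mem) (fun _ _ _ _ => mul_mem) a.2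
  rintro z rfl; exact hy
open scoped algebraAdjoinAdjoin in
lemma fg_ded {y : K} (hy : Transcendental F y) [FiniteDimensional F⟮y⟯ K] [Algebra.IsSeparable F⟮y⟯ K] :
    IsDedekindDomain (integralClosure (Algebra.adjoin F {y}) K) ∧ IsFractionRing (integralClosure (Algebra.adjoin F {y}) K) K ∧
    Module.Finite (Algebra.adjoin F {y}) (integralClosure (Algebra.adjoin F {y}) K) := by
  have hP : IsPrincipalIdealRing (Algebra.adjoin F {y}) := by
    refine IsPrincipalIdealRing.of_surjective ((aeval y : F[X] →ₐ[F] K).codRestrict (Algebra.adjoin F {y}) (fun p => aeval_mem_adjoin_singleton F y)) ?_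
    rintro ⟨a, ha⟩
    obtain ⟨p, hp⟩ := (Algebra.adjoin_singleton_eq_range_aeval F y ▸ ha : a ∈ (aeval y).range)
    exact ⟨p, Subtype.ext hp⟩
  exact ⟨integralClosure.isDedekindDomain _ F⟮y⟯ K, integralClosure.isFractionRing_of_finite_extension F⟮y⟯ K, IsIntegralClosure.finite _ F⟮y⟯ K _⟩
lemma fg_quo {A S : Type*} [CommRing A] [CommRing S] [Algebra A S] [Module.Finite A S] (I : Ideal S) [Finite (A ⧸ I.under A)] : Finite (S ⧸ I) := by
  have : Module.Finite (A ⧸ I.under A) (S ⧸ I) := Module.Finite.of_restrictScalars_finite A _ _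
  exact Module.finite_of_finite (A ⧸ I.under A)
variable [Finite F]
lemma fg_int {y : K} (hy : Transcendental F y) [FiniteDimensional F⟮y⟯ K] [Algebra.IsSeparable F⟮y⟯ K] {f : K}
    (hf : ∀ w : FinPlace K, w.val y ≤ 1 → w.val f ≤ 1) : IsIntegral (Algebra.adjoin F {y}) f := by
  obtain ⟨i1, i2, -⟩ := fg_ded hy
  obtain ⟨z, rfl⟩ := HeightOneSpectrum.mem_integers_of_valuation_le_one (R := integralClosure (Algebra.adjoin F {y}) K) K f
    (fun P => hf (plc K P) (plc_le_one P (ϖ (Algebra.adjoin F {y}) _ ⟨y, Algebra.self_mem_adjoin_singleton F y⟩)))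
  exact z.2
lemma fg_pl {y : K} (w : FinPlace K) (hw : w.val y ≤ 1) (z : integralClosure (Algebra.adjoin F {y}) K) : w.val (ϖ _ K z) ≤ 1 :=
  w.int_le (fg_le w hw) _ z.2
lemma fg_ex {y : K} (hy : Transcendental F y) [FiniteDimensional F⟮y⟯ K] [Algebra.IsSeparable F⟮y⟯ K] :
    ∃ w : FinPlace K, w.val y < 1 := by
  by_contra! h
  have h1 := fg_int hy (f := y⁻¹) (fun w _ => by rw [map_inv₀]; exact inv_le_one_of_one_le₀ (h w))
  have h2 : IsIntegral F y⁻¹ := fg_alg fun V hV => (V.mem_or_inv_mem y).elim (fun h => fg_intV V hV h h1) id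
  exact hy (by simpa using h2.isAlgebraic.inv)
lemma fg_resfin {y : K} (hy : Transcendental F y) [FiniteDimensional F⟮y⟯ K] [Algebra.IsSeparable F⟮y⟯ K] (w : FinPlace K) (hw : w.val y < 1) :
    Finite (IsLocalRing.ResidueField w.val.valuationSubring) := by
  obtain ⟨i1, i2, i3⟩ := fg_ded hy
  obtain ⟨P, rfl⟩ := w.eq_plc (A := integralClosure (Algebra.adjoin F {y}) K) (fg_pl w hw.le)
  set A := Algebra.adjoin F {y}
  let y' : A := ⟨y, Algebra.self_mem_adjoin_singleton F y⟩
  have hyP : y' ∈ P.asIdeal.under A := (plc_lt_one_iff (K := K) P (ϖ A _ y')).1 hw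
  have : Finite (A ⧸ P.asIdeal.under A) := by
    refine Finite.of_surjective (fun c : F => Ideal.Quotient.mk _ (ϖ F A c)) (fun z => ?_)
    obtain ⟨⟨a, ha⟩, rfl⟩ := Ideal.Quotient.mk_surjective z
    obtain ⟨p, rfl⟩ : a ∈ (aeval (R := F) y).range := Algebra.adjoin_singleton_eq_range_aeval F y ▸ (show a ∈ Algebra.adjoin F {y} from ha)
    refine ⟨p.coeff 0, (Ideal.Quotient.eq.2 ?_).symm⟩
    convert Ideal.mul_mem_right (aeval y' p.divX) _ hyP using 1
    apply Subtype.ext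
    have := congrArg (aeval y) (divX_mul_X_add p)
    rw [map_add, map_mul, aeval_X, aeval_C] at this
    simp only [AddSubgroupClass.coe_sub, MulMemClass.coe_mul, Subalgebra.coe_algebraMap, y']
    rw [← Subalgebra.coe_val (S := A), ← aeval_algHom_apply (A.val)]
    change aeval y p - _ = y * aeval y _
    rw [← this]; ring
  have := fg_quo (A := A) P.asIdeal
  exact plc_fin P
lemma fg_sep {y : K} (hy : Transcendental F y) [FiniteDimensional F⟮y⟯ K] [Algebra.IsSeparable F⟮y⟯ K] (Q : FinPlace K) (hQ : Q.val y < 1) :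
    ∃ t : K, Q.val t > 1 ∧ ∀ w : FinPlace K, w.val y < 1 → w ≠ Q → w.val t ≤ 1 := by
  obtain ⟨i1, i2, i3⟩ := fg_ded hy
  have hy0 : y ≠ 0 := by rintro rfl; exact hy isAlgebraic_zero
  have key : ∀ w : FinPlace K, w.val y < 1 → ∃ P : ℌ (integralClosure (Algebra.adjoin F {y}) K), plc K P = w :=
    fun w hw => w.eq_plc (A := integralClosure (Algebra.adjoin F {y}) K) (fg_pl w hw.le)
  obtain ⟨P, rfl⟩ := key Q hQ
  have hfin := vz_fin (A := integralClosure (Algebra.adjoin F {y}) K) hy0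
  obtain ⟨g, hg⟩ := crt hfin.toFinset (fun R => if R = P then 0 else 1) 1
  have hm : ∀ R : ℌ _, (plc K R).val y < 1 → R ∈ hfin.toFinset := fun R hR => by
    rw [hfin.mem_toFinset]
    intro h
    rw [val_exp _ hy0, h] at hR
    exact absurd hR (by simp)
  have h1 := hg P (hm P hQ)
  rw [if_pos rfl, sub_zero, pow_one, ← plc_lt_one_iff (K := K)] at h1
  have h2 : ∀ R : ℌ _, (plc K R).val y < 1 → R ≠ P → (plc K R).val (ϖ _ K g) = 1 := fun R hR hRP => by
    have := hg R (hm R hR)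
    rw [if_neg hRP, pow_one] at this
    rw [plc_eq_one_iff]
    intro h
    have := sub_mem h this
    rw [sub_sub_cancel] at this
    exact R.isPrime.ne_top ((Ideal.eq_top_iff_one _).2 this)
  by_cases hg0 : ϖ _ K g = 0
  · refine ⟨y⁻¹, by rw [map_inv₀]; exact (one_lt_inv₀ ((Valuation.pos_iff _).2 hy0)).2 hQ, fun w hw hne => ?_⟩
    obtain ⟨R, rfl⟩ := key w hw
    have := h2 R hw (fun h => hne (by rw [h]))
    rw [hg0] at this; simp at this
  · refine ⟨(ϖ _ K g)⁻¹, by rw [map_inv₀]; exact (one_lt_inv₀ ((Valuation.pos_iff _).2 hg0)).2 h1, fun w hw hne => ?_⟩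
    obtain ⟨R, rfl⟩ := key w hw
    rw [map_inv₀, h2 R hw (fun h => hne (by rw [h])), inv_one]
end FG1
section FG2
open WithZero IsDedekindDomain Polynomial Module
variable {F : Type*} [Field F] [Algebra F K]
open scoped algebraAdjoinAdjoin in
lemma fg_tb {x : K} (hx : Transcendental F x) (h : Algebra.IsAlgebraic F⟮x⟯ K) : IsTranscendenceBasis F (fun _ : Unit => x) := by
  rw [isTranscendenceBasis_iff_algebraicIndependent_isAlgebraic]
  refine ⟨algebraicIndependent_unique_type_iff.2 hx, ?_⟩
  rw [Set.range_const]
  exact (IsFractionRing.comap_isAlgebraic_iff (A := Algebra.adjoin F {x}) (K := F⟮x⟯) (C := K)).2 h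
lemma fg_alga {x : K} (hx : Transcendental F x) (h : Algebra.IsAlgebraic F⟮x⟯ K) {y : K} (hy : Transcendental F y) : Algebra.IsAlgebraic F⟮y⟯ K := by
  have h1 := (fg_tb hx h).lift_cardinalMk_eq_trdeg
  have h2 := ((algebraicIndependent_unique_type_iff (ι := Unit) (x := fun _ => y)).2 hy).isTranscendenceBasis_of_lift_trdeg_le_of_finite (by simpa using h1.ge)
  have := h2.isAlgebraic_field
  rwa [Set.range_const] at this
lemma fg_ess {x : K} (h : FiniteDimensional F⟮x⟯ K) : Algebra.EssFiniteType F K := by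
  have : Algebra.EssFiniteType F F⟮x⟯ := essFiniteType_iff.2 ⟨{x}, by simp⟩
  exact .comp F F⟮x⟯ K
lemma fg_sepx [Finite F] {x0 : K} (hx : Transcendental F x0) (h : FiniteDimensional F⟮x0⟯ K) :
    ∃ x : K, Transcendental F x ∧ FiniteDimensional F⟮x⟯ K ∧ Algebra.IsSeparable F⟮x⟯ K := by
  have := fg_ess h
  obtain ⟨s, hs, hs'⟩ := exists_isTranscendenceBasis_and_isSeparable_of_perfectField F K
  have h1 := (fg_tb hx inferInstance).lift_cardinalMk_eq hs
  have h2 : s.card = 1 := by simpa using h1.symm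
  obtain ⟨x, rfl⟩ := Finset.card_eq_one.1 h2
  rw [Finset.coe_singleton] at hs'
  have : Algebra.EssFiniteType F⟮x⟯ K := .of_comp F F⟮x⟯ K
  refine ⟨x, ?_, Algebra.finite_of_essFiniteType_of_isAlgebraic, hs'⟩
  exact hs.1.transcendental ⟨x, by simp⟩
variable [Finite F]
lemma fg_poly (w : FinPlace K) {y : K} (hy : 1 < w.val y) (p : F[X]) (n : ℕ) (hn : p.natDegree ≤ n) : w.val (aeval y p) ≤ w.val y ^ n := by
  rw [aeval_eq_sum_range]
  refine w.val.map_sum_le fun i hi => ?_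
  rw [Algebra.smul_def, map_mul, map_pow]
  exact (mul_le_of_le_one_left' (fin_val_le w _)).trans (pow_le_pow_right₀ hy.le (by simp at hi; omega))
lemma fg_lead (w : FinPlace K) {y : K} (hy : 1 < w.val y) {p : F[X]} (hp : p ≠ 0) :
    w.val (aeval y p - ϖ F K p.leadingCoeff * y ^ p.natDegree) < w.val y ^ p.natDegree := by
  have h : aeval y p - ϖ F K p.leadingCoeff * y ^ p.natDegree = aeval y p.eraseLead := by
    have := congrArg (aeval y) p.eraseLead_add_monomial_natDegree_leadingCoeff
    rw [map_add, aeval_monomial] at this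
    linear_combination -this
  rw [h]
  by_cases h0 : p.natDegree = 0
  · rw [eq_C_of_natDegree_eq_zero h0]; simp
  · exact (fg_poly w hy _ _ p.eraseLead_natDegree_le).trans_lt (pow_lt_pow_right₀ hy (by omega))
lemma fg_pv (w : FinPlace K) {y : K} (hy : 1 < w.val y) {p : F[X]} (hp : p ≠ 0) : w.val (aeval y p) = w.val y ^ p.natDegree := by
  have h1 := fg_lead w hy hp
  have h2 : w.val (ϖ F K p.leadingCoeff * y ^ p.natDegree) = w.val y ^ p.natDegree := by
    rw [map_mul, fin_val w (leadingCoeff_ne_zero.2 hp), one_mul, map_pow]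
  rw [← h2] at h1 ⊢
  exact Valuation.map_eq_of_sub_lt _ h1
lemma fg_trans (w : FinPlace K) {y : K} (hy : 1 < w.val y) : Transcendental F y := by
  rintro ⟨p, hp, h⟩
  have := fg_pv w hy hp
  rw [h, map_zero] at this
  exact pow_ne_zero _ (zero_lt_one.trans hy).ne' this.symm
end FG2
section FG3
open WithZero IsDedekindDomain Polynomial Module
variable {F : Type*} [Field F] [Algebra F K] [Finite F]
lemma fg_dec {x : K} (hx : Transcendental F x) (N : ℕ) {c : K} (hc : c ∈ F⟮x⟯) : ∃ (q1 : F[X]) (q0 : degreeLT F N) (r : K),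
    (∀ w : FinPlace K, 1 < w.val x → w.val r ≤ 1) ∧ x ^ N * c = x ^ N * aeval x q1 + aeval x q0.1 + r := by
  obtain ⟨a, b, rfl⟩ := (mem_adjoin_simple_iff F c).1 hc
  by_cases hb : b = 0
  · exact ⟨0, 0, 0, by simp, by simp [hb]⟩
  have hm : (X ^ N : F[X]).Monic := monic_X_pow N
  have hb' : aeval x b ≠ 0 := fun h => hx ⟨b, hb, h⟩
  refine ⟨(X ^ N * a / b) /ₘ X ^ N, ⟨(X ^ N * a / b) %ₘ X ^ N, ?_⟩, aeval x (X ^ N * a % b) / aeval x b, fun w hw => ?_, ?_⟩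
  · rw [mem_degreeLT]
    have := degree_modByMonic_lt (X ^ N * a / b) hm
    rwa [degree_X_pow] at this
  · by_cases h0 : X ^ N * a % b = 0
    · simp [h0]
    rw [map_div₀, fg_pv w hw hb, fg_pv w hw h0]
    exact div_le_one_of_le₀ (pow_le_pow_right₀ hw.le (natDegree_le_natDegree (EuclideanDomain.mod_lt _ hb).le)) zero_le
  · have h1 := congrArg (aeval x) (EuclideanDomain.div_add_mod (X ^ N * a) b)
    have h2 := congrArg (aeval x) (modByMonic_add_div (X ^ N * a / b) (X ^ N : F[X]))
    simp only [map_add, map_mul, map_pow, aeval_X] at h1 h2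
    field_simp
    linear_combination -h1 - aeval x b * h2
lemma fg_arch (w : FinPlace K) {x : K} (hx : 1 < w.val x) (e : K) : ∃ n : ℕ, w.val e ≤ w.val x ^ n := by
  have := MulArchimedean.arch (w.val e) hx
  exact this
lemma fg_inf {y : K} (hy : Transcendental F y) [FiniteDimensional F⟮y⟯ K] [Algebra.IsSeparable F⟮y⟯ K] : {w : FinPlace K | w.val y < 1}.Finite := by
  obtain ⟨i1, i2, i3⟩ := fg_ded hy
  have hy0 : y ≠ 0 := by rintro rfl; exact hy isAlgebraic_zero
  refine ((vz_fin (A := integralClosure (Algebra.adjoin F {y}) K) hy0).image (plc K)).subset fun w hw => ?_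
  obtain ⟨P, rfl⟩ := w.eq_plc (A := integralClosure (Algebra.adjoin F {y}) K) (fg_pl w (le_of_lt hw))
  refine ⟨P, fun h => ?_, rfl⟩
  rw [Set.mem_setOf_eq, val_exp _ hy0, h] at hw
  exact absurd hw (by simp)
open scoped algebraAdjoinAdjoin in
lemma fg_y0 {x : K} (hx : Transcendental F x) [FiniteDimensional F⟮x⟯ K] [Algebra.IsSeparable F⟮x⟯ K] :
    ∃ (Q : FinPlace K) (y : K), Finite (IsLocalRing.ResidueField Q.val.valuationSubring) ∧ 1 < Q.val y ∧ (∀ w : FinPlace K, w ≠ Q → w.val y ≤ 1) ∧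
      ∀ f : K, (∀ w : FinPlace K, w.val f ≤ 1) → IsIntegral F f := by
  have hx0 : x ≠ 0 := by rintro rfl; exact hx isAlgebraic_zero
  have e : F⟮x⁻¹⟯ = F⟮x⟯ := le_antisymm (adjoin_simple_le_iff.2 (inv_mem (mem_adjoin_simple_self F x)))
    (adjoin_simple_le_iff.2 (by simpa using inv_mem (mem_adjoin_simple_self F x⁻¹)))
  have i1 : FiniteDimensional F⟮x⁻¹⟯ K := by rw [e]; infer_instance
  have i2 : Algebra.IsSeparable F⟮x⁻¹⟯ K := by rw [e]; infer_instance
  have hx' : Transcendental F x⁻¹ := fun h => hx (by simpa using h.inv)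
  have hlt : ∀ w : FinPlace K, w.val x⁻¹ < 1 ↔ 1 < w.val x := fun w => by
    rw [map_inv₀]; exact inv_lt_one₀ ((Valuation.pos_iff _).2 hx0)
  obtain ⟨Q, hQ⟩ := fg_ex hx'
  obtain ⟨t, ht, ht'⟩ := fg_sep hx' Q hQ
  have hfin := fg_inf hx'
  obtain ⟨s, b, hb⟩ := FiniteDimensional.exists_is_basis_integral (Algebra.adjoin F {x}) F⟮x⟯ K
  have hN : ∃ N : ℕ, ∀ w ∈ hfin.toFinset, ∀ i, w.val (b i) ≤ w.val x ^ N := by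
    have : ∀ w : FinPlace K, ∀ i, ∃ n : ℕ, 1 < w.val x → w.val (b i) ≤ w.val x ^ n := fun w i => by
      by_cases h : 1 < w.val x
      · obtain ⟨n, hn⟩ := fg_arch w h (b i); exact ⟨n, fun _ => hn⟩
      · exact ⟨0, fun h' => absurd h' h⟩
    choose n hn using this
    refine ⟨∑ w ∈ hfin.toFinset, ∑ i, n w i, fun w hw i => ?_⟩
    have h1 : 1 < w.val x := (hlt w).1 (hfin.mem_toFinset.1 hw)
    refine (hn w i h1).trans (pow_le_pow_right₀ h1.le ?_)
    exact (Finset.single_le_sum (f := fun i => n w i) (fun _ _ => Nat.zero_le _) (Finset.mem_univ i)).trans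
      (Finset.single_le_sum (f := fun w => ∑ i, n w i) (fun _ _ => Nat.zero_le _) hw)
  obtain ⟨N, hN⟩ := hN
  choose q1 q0 r hr hc using fun (m : ℕ) (i : s) => fg_dec hx N (b.repr (t ^ m) i).2
  have : Finite (degreeLT F N) := Finite.of_equiv _ (degreeLTEquiv F N).symm.toEquiv
  obtain ⟨m, n, hmn, hq⟩ : ∃ m n : ℕ, n < m ∧ q0 m = q0 n := by
    obtain ⟨m, n, h, hq⟩ := Finite.exists_ne_map_eq_of_infinite q0
    rcases lt_or_gt_of_ne h with h | h
    exacts [⟨n, m, h, hq.symm⟩, ⟨m, n, h, hq⟩]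
  set g : K := ∑ i, aeval x (q1 m i - q1 n i) * b i with hg
  have hgi : IsIntegral (Algebra.adjoin F {x}) g := IsIntegral.sum _ fun i _ =>
    IsIntegral.mul (isIntegral_algebraMap (x := (⟨_, aeval_mem_adjoin_singleton F x⟩ : Algebra.adjoin F {x}))) (hb i)
  have hsum : ∀ m, t ^ m = ∑ i, (b.repr (t ^ m) i : K) * b i := fun m => by
    conv_lhs => rw [← b.sum_repr (t ^ m)]
    rfl
  have hh : x ^ N * (t ^ m - t ^ n - g) = ∑ i, (r m i - r n i) * b i := by
    rw [hsum m, hsum n, hg, ← Finset.sum_sub_distrib, ← Finset.sum_sub_distrib, Finset.mul_sum]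
    refine Finset.sum_congr rfl fun i _ => ?_
    have h1 := hc m i
    have h2 := hc n i
    rw [hq] at h1
    rw [map_sub]
    linear_combination b i * (h1 - h2)
  have hw : ∀ w : FinPlace K, 1 < w.val x → w.val (t ^ m - t ^ n - g) ≤ 1 := fun w h => by
    have h1 : w.val (x ^ N * (t ^ m - t ^ n - g)) ≤ w.val x ^ N := by
      rw [hh]
      refine w.val.map_sum_le fun i _ => ?_
      rw [map_mul]
      exact (mul_le_of_le_one_left' (w.val.map_sub_le (hr m i w h) (hr n i w h))).trans (hN w (hfin.mem_toFinset.2 ((hlt w).2 h)) i)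
    rw [map_mul, map_pow] at h1
    have h0 : 0 < w.val x ^ N := pow_pos (zero_lt_one.trans h) N
    exact le_of_mul_le_mul_left (by rwa [mul_one]) h0
  refine ⟨Q, g, fg_resfin hx' Q hQ, ?_, fun w hne => ?_, fun f hf => fg_both (fg_int hx fun w _ => hf w) (fg_int hx' fun w _ => hf w)⟩
  · have h1 := hw Q ((hlt Q).1 hQ)
    have h2 : Q.val (t ^ m - t ^ n) = Q.val (t ^ m) := Valuation.map_sub_eq_of_lt_left _ (by
      rw [map_pow, map_pow]; exact pow_lt_pow_right₀ ht hmn)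
    have h3 : 1 < Q.val (t ^ m - t ^ n) := by rw [h2, map_pow]; exact one_lt_pow₀ ht (by omega)
    by_contra! h4
    have := Q.val.map_add_le h1 h4
    rw [sub_add_cancel] at this
    exact absurd h3 this.not_gt
  · by_cases h : 1 < w.val x
    · have h1 := ht' w ((hlt w).2 h) hne
      have h2 := w.val.map_sub_le (w.val.map_sub_le (x := t ^ m) (y := t ^ n) (g := 1) (by rw [map_pow]; exact pow_le_one₀ zero_le h1) (by rw [map_pow]; exact pow_le_one₀ zero_le h1)) (hw w h)
      rwa [sub_sub_cancel] at h2
    · exact fg_pl w (not_lt.1 h) ⟨g, hgi⟩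
end FG3
section FG4
open WithZero IsDedekindDomain Polynomial Module
def BQ (Q : FinPlace K) : Subring K where
  carrier := {f | ∀ w : FinPlace K, w ≠ Q → w.val f ≤ 1}
  mul_mem' h1 h2 w hw := by rw [map_mul]; exact mul_le_one' (h1 w hw) (h2 w hw)
  one_mem' w _ := by rw [map_one]
  add_mem' h1 h2 w hw := w.val.map_add_le (h1 w hw) (h2 w hw)
  zero_mem' w _ := by rw [map_zero]; exact zero_le
  neg_mem' h w hw := by rw [Valuation.map_neg]; exact h w hw
variable {F : Type*} [Field F] [Algebra F K] [Finite F] {Q : FinPlace K} {y : K}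
lemma bq_aeval (hw : ∀ w : FinPlace K, w ≠ Q → w.val y ≤ 1) (p : F[X]) : aeval y p ∈ BQ Q := fun w h =>
  fg_le w (hw w h) ⟨_, aeval_mem_adjoin_singleton F y⟩
lemma bq_mult (hy : 1 < Q.val y) (hw : ∀ w : FinPlace K, w ≠ Q → w.val y ≤ 1) (ha : Algebra.IsAlgebraic F⟮y⟯ K) (f : K) :
    ∃ p : F[X], p ≠ 0 ∧ aeval y p * f ∈ BQ Q := by
  have h1 := (fg_tb (fg_trans (F := F) Q hy) ha).isAlgebraic
  rw [Set.range_const] at h1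
  obtain ⟨⟨z, hz'⟩, h0, hz⟩ := (h1.isAlgebraic f).exists_integral_multiple
  obtain ⟨p, rfl⟩ : z ∈ (aeval (R := F) y).range := Algebra.adjoin_singleton_eq_range_aeval F y ▸ hz'
  refine ⟨p, ?_, fun w h => w.int_le (fg_le w (hw w h)) _ hz⟩
  rintro rfl
  exact h0 (Subtype.ext (map_zero _))
lemma bq_frac (hy : 1 < Q.val y) (hw : ∀ w : FinPlace K, w ≠ Q → w.val y ≤ 1) (ha : Algebra.IsAlgebraic F⟮y⟯ K) : IsFractionRing (BQ Q) K := by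
  refine .of_field _ _ fun f => ?_
  obtain ⟨p, hp, h⟩ := bq_mult hy hw ha f
  have h0 : aeval y p ≠ 0 := fun h => fg_trans (F := F) Q hy ⟨p, hp, h⟩
  exact ⟨⟨_, h⟩, ⟨_, bq_aeval hw p⟩, by change f = (aeval y p * f) / aeval y p; field_simp⟩
lemma bq_closed (hf : IsFractionRing (BQ Q) K) : IsIntegrallyClosed (BQ Q) := by
  rw [isIntegrallyClosed_iff K]
  exact fun {f} h => ⟨⟨f, fun w hw => w.int_le (R := BQ Q) (fun r => r.2 w hw) f h⟩, rfl⟩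
lemma bq_zero (hi : ∀ f : K, (∀ w : FinPlace K, w.val f ≤ 1) → IsIntegral F f) (b : BQ Q) (hb : Q.val (b : K) < 1) : b = 0 := by
  by_contra h
  have h0 : (b : K) ≠ 0 := fun h' => h (Subtype.ext h')
  have := fg_val1 Q (hi b fun w => by
    by_cases hw : w = Q
    · rw [hw]; exact hb.le
    · exact b.2 w hw) h0
  exact hb.ne this
lemma bq_step (hy : 1 < Q.val y) (hw : ∀ w : FinPlace K, w ≠ Q → w.val y ≤ 1) (ha : Algebra.IsAlgebraic F⟮y⟯ K) (J : Ideal (BQ Q)) (hJ : J ≠ ⊥)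
    (g : K) (hg : g ≠ 0) : ∃ s0 : ℕ, ∀ s ≥ s0, ∃ j ∈ J, Q.val ((j : K) - g * y ^ s) < Q.val (g * y ^ s) := by
  obtain ⟨j, hj, hj0⟩ := Submodule.exists_mem_ne_zero_of_ne_bot hJ
  have hj0' : (j : K) ≠ 0 := fun h' => hj0 (Subtype.ext h')
  obtain ⟨p, hp, h⟩ := bq_mult (F := F) hy hw ha (g / j)
  refine ⟨p.natDegree, fun s hs => ?_⟩
  have hyB : y ∈ BQ Q := by simpa using bq_aeval (F := F) hw X
  have hlc := leadingCoeff_ne_zero.2 hp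
  have hlc' : ϖ F K p.leadingCoeff ≠ 0 := by simpa using hlc
  have hcB : (ϖ F K p.leadingCoeff)⁻¹ ∈ BQ Q := by simpa using bq_aeval (F := F) hw (C p.leadingCoeff⁻¹)
  refine ⟨(⟨_, hcB⟩ * ⟨y, hyB⟩ ^ (s - p.natDegree) * ⟨_, h⟩) * j, J.mul_mem_left _ hj, ?_⟩
  have h1 := fg_lead Q hy hp
  have h2 : (((⟨_, hcB⟩ * ⟨y, hyB⟩ ^ (s - p.natDegree) * ⟨_, h⟩) * j : BQ Q) : K) - g * y ^ s =
      (ϖ F K p.leadingCoeff)⁻¹ * (y ^ (s - p.natDegree) * g) * (aeval y p - ϖ F K p.leadingCoeff * y ^ p.natDegree) := by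
    change (ϖ F K p.leadingCoeff)⁻¹ * y ^ (s - p.natDegree) * (aeval y p * (g / j)) * j - _ = _
    have : y ^ s = y ^ (s - p.natDegree) * y ^ p.natDegree := by rw [← pow_add]; congr 1; omega
    rw [this]
    field_simp
  have h3 : Q.val (ϖ F K p.leadingCoeff)⁻¹ = 1 := by rw [map_inv₀, fin_val Q hlc, inv_one]
  have h4 : g * y ^ s = (y ^ (s - p.natDegree) * g) * y ^ p.natDegree := by
    rw [mul_right_comm, ← pow_add, mul_comm]; congr 2; omega
  rw [h2, h4, map_mul, map_mul _ (_⁻¹), h3, one_mul, map_mul _ (_ * g), map_pow _ _ p.natDegree]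
  refine mul_lt_mul_of_pos_left h1 ((Valuation.pos_iff _).2 (mul_ne_zero (pow_ne_zero _ ?_) hg))
  rintro rfl; simp at hy
lemma bq_FQ (hr : Finite (IsLocalRing.ResidueField Q.val.valuationSubring)) (hy : 1 < Q.val y) (hw : ∀ w : FinPlace K, w ≠ Q → w.val y ≤ 1)
    (ha : Algebra.IsAlgebraic F⟮y⟯ K) (hi : ∀ f : K, (∀ w : FinPlace K, w.val f ≤ 1) → IsIntegral F f) : FQ (BQ Q) Q where
  inj := Subtype.val_injective
  resfin := hr
  zero := bq_zero hi
  lead J hJ := by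
    have hy0 : y ≠ 0 := by rintro rfl; simp at hy
    set d := vz Q y with hd
    have hyv := val_exp Q hy0
    have hd0 : 0 < d := by
      rw [hyv, ← exp_zero, exp_lt_exp] at hy; exact hy
    choose T hT0 hT using fun n : ℤ => exists_unif Q n
    let u : IsLocalRing.ResidueField Q.val.valuationSubring → K := fun c => (IsLocalRing.residue_surjective c).choose
    have hu : ∀ c : Q.val.valuationSubring, Q.val ((c : K) - u (IsLocalRing.residue _ c)) < 1 := fun c =>
      (residue_eq_iff _ _ _).1 (IsLocalRing.residue_surjective (IsLocalRing.residue _ c)).choose_spec.symm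
    have hS : ∀ i : Fin d.toNat × IsLocalRing.ResidueField Q.val.valuationSubring, ∃ s0 : ℕ, u i.2 ≠ 0 → ∀ s ≥ s0, ∃ j ∈ J,
        Q.val ((j : K) - T i.1 * u i.2 * y ^ s) < Q.val (T i.1 * u i.2 * y ^ s) := fun i => by
      by_cases h : u i.2 = 0
      · exact ⟨0, fun h' => absurd h h'⟩
      · obtain ⟨s0, h0⟩ := bq_step (F := F) hy hw ha J hJ _ (mul_ne_zero (hT0 i.1) h)
        exact ⟨s0, fun _ => h0⟩
    choose S hS using hS
    obtain ⟨M, hM⟩ := Finite.exists_le S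
    refine ⟨(M + 1) * d.toNat, fun g hg hn => ?_⟩
    have hdd : (d.toNat : ℤ) = d := Int.toNat_of_nonneg hd0.le
    push_cast at hn
    rw [hdd] at hn
    have hr0 := Int.emod_nonneg (vz Q g) hd0.ne'
    have hr1 := Int.emod_lt_of_pos (vz Q g) hd0
    have hq := Int.mul_ediv_add_emod (vz Q g) d
    have hq1 : (M : ℤ) ≤ vz Q g / d := (Int.le_ediv_iff_mul_le hd0).2 (by nlinarith)
    set r := vz Q g % d
    obtain ⟨s, hs⟩ := Int.eq_ofNat_of_zero_le (a := vz Q g / d) (by omega)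
    have hs' : M ≤ s := by omega
    have ht : Q.val (T r * y ^ s) = Q.val g := by
      rw [map_mul, map_pow, hT, hyv, val_exp Q hg, ← exp_nsmul, ← exp_add]
      congr 1; rw [← hq, hs, nsmul_eq_mul]; ring
    have ht0 : T r * y ^ s ≠ 0 := mul_ne_zero (hT0 _) (pow_ne_zero _ hy0)
    have hv1 : Q.val (g / (T r * y ^ s)) = 1 := by
      rw [map_div₀, ht, div_self ((Valuation.ne_zero_iff _).2 hg)]
    have h1 := hu ⟨g / (T r * y ^ s), hv1.le⟩
    set c := IsLocalRing.residue _ (⟨g / (T r * y ^ s), hv1.le⟩ : Q.val.valuationSubring)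
    have h2 : Q.val (u c) = 1 := by
      have h1' : Q.val (u c - g / (T r * y ^ s)) < Q.val (g / (T r * y ^ s)) := by
        rw [hv1, Valuation.map_sub_swap]; exact h1
      exact (Valuation.map_eq_of_sub_lt _ h1').trans hv1
    obtain ⟨j, hj, hjl⟩ := hS (⟨r.toNat, by omega⟩, c) (fun h => by simp only at h; rw [h] at h2; simp at h2) s ((hM _).trans hs')
    have hrr : ((r.toNat : ℕ) : ℤ) = r := Int.toNat_of_nonneg hr0
    simp only [hrr] at hjl
    refine ⟨j, hj, ?_⟩
    rw [mul_right_comm, map_mul _ (_ * _), h2, mul_one, ht] at hjl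
    have h3 : Q.val (T r * y ^ s * u c - g) < Q.val g := by
      have : T r * y ^ s * u c - g = (T r * y ^ s) * -(g / (T r * y ^ s) - u c) := by
        have e : T r * y ^ s * (g / (T r * y ^ s)) = g := by rw [mul_div_assoc', mul_div_cancel_left₀ _ ht0]
        linear_combination e
      rw [this, map_mul, Valuation.map_neg, ht]
      exact mul_lt_of_lt_one_right ((Valuation.pos_iff _).2 hg) h1
    have := Q.val.map_add_lt hjl h3
    rwa [sub_add_sub_cancel] at this
lemma fixab_ff (F₀ : Subfield K) (hF : Finite F₀) (x : K) (hx : Transcendental F₀ x) (hfd : FiniteDimensional F₀⟮x⟯ K)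
    {ℓ : ℕ} (hℓ : ℓ.Prime) (hodd : Odd ℓ) (hchar : (ℓ : K) ≠ 0) {ω : K} (hω : IsPrimitiveRoot ω ℓ) :
    FFc K ℓ := by
  obtain ⟨x, hx, i1, i2⟩ := fg_sepx hx hfd
  obtain ⟨Q, y, hr, hy, hw, hi⟩ := fg_y0 hx
  have ha : Algebra.IsAlgebraic F₀⟮y⟯ K := fg_alga hx inferInstance (fg_trans Q hy)
  have H := bq_FQ hr hy hw ha hi
  have hf := bq_frac hy hw ha
  have hc := bq_closed hf
  have hωi : IsIntegral F₀ ω := ⟨X ^ ℓ - 1, monic_X_pow_sub_C 1 hℓ.ne_zero, by simp [hω.pow_eq_one]⟩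
  have := adjoin.finiteDimensional hωi
  have : Finite F₀⟮ω⟯ := Module.finite_of_finite F₀
  let φ : F₀⟮ω⟯ →+* BQ Q := (ϖ F₀⟮ω⟯ K).codRestrict (BQ Q) (fun c w _ => fin_val_le w c)
  letI := φ.toAlgebra
  have : IsScalarTower F₀⟮ω⟯ (BQ Q) K := .of_algebraMap_eq fun _ => rfl
  have hω' : IsPrimitiveRoot (ϖ F₀⟮ω⟯ K (AdjoinSimple.gen F₀ ω)) ℓ := by rwa [AdjoinSimple.algebraMap_gen]
  exact ff_wrap H (fun w h b => b.2 w h) hℓ hodd hchar (hω'.of_map_of_injective (ϖ F₀⟮ω⟯ K).injective) hω'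
end FG4
end Aux

/-- Proposition `fixab`. For an odd prime `ℓ` and a global field `K` with
`char K ≠ ℓ` containing a primitive `ℓ`-th root of unity, there are `a, b ∈ K^*` such that:
(i) `(a)` and `(b)` are coprime; (ii) `a, b` have distinct nontrivial images in
`K^*/K^{*ℓ}`; (iii) `a, b ∈ 1 + ℓ³O_K` if `K` is a number field; and (iv) for
`L := K(a^{1/ℓ}, b^{1/ℓ})`, every prime `𝔮` of `K` unramified in `L` (with `A := O_K` in
the number field case and `A := O_{{𝔮}}` in the function field case), every `σ ∈ Gal(L/K)`
and every ideal class of `Cl(A)` — represented by a divisor `D` supported away from `𝔮` in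
the function field case — there is a prime `𝔭` of `K`, unramified in `L`, whose Frobenius
is `σ` and such that `𝔭 ∩ A` lies in the given class, i.e. the divisor `𝔭 - D` is
principal on `Spec A`. -/
theorem fixab (hK : IsGlobalField K)
    (ℓ : ℕ) (hℓ : ℓ.Prime) (hodd : Odd ℓ) (hchar : (ℓ : K) ≠ 0)
    (ω : K) (hω : IsPrimitiveRoot ω ℓ) :
    ∃ a b : K, a ≠ 0 ∧ b ≠ 0 ∧
      -- (i) the fractional ideals (a) and (b) are coprime
      (∀ v : FinPlace K, vz v a = 0 ∨ vz v b = 0) ∧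
      -- (ii) distinct, nontrivial images in K^*/K^{*ℓ}
      ((¬ ∃ t : K, a = t ^ ℓ) ∧ (¬ ∃ t : K, b = t ^ ℓ) ∧ ¬ ∃ t : K, a = b * t ^ ℓ) ∧
      -- (iii) congruence condition in the number field case
      (NumberField K → ∃ u w : K, (∀ v : FinPlace K, 0 ≤ vz v u) ∧
        (∀ v : FinPlace K, 0 ≤ vz v w) ∧ a = 1 + ℓ ^ 3 * u ∧ b = 1 + ℓ ^ 3 * w) ∧
      -- (iv) Chebotarev-type condition for L = K(a^{1/ℓ}, b^{1/ℓ})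
      ∀ α β : AlgebraicClosure K,
        α ^ ℓ = algebraMap K (AlgebraicClosure K) a →
        β ^ ℓ = algebraMap K (AlgebraicClosure K) b →
        ∀ q0 : FinPlace K, UnramifiedIn q0 (IntermediateField.adjoin K {α, β}) →
        ∀ σ : (IntermediateField.adjoin K {α, β} : IntermediateField K (AlgebraicClosure K))
            ≃ₐ[K] (IntermediateField.adjoin K {α, β} : IntermediateField K (AlgebraicClosure K)),
        ∀ D : FinPlace K → ℤ, {v : FinPlace K | D v ≠ 0}.Finite →
          (¬ NumberField K → D q0 = 0) →
          ∃ p : FinPlace K, UnramifiedIn p (IntermediateField.adjoin K {α, β}) ∧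
            IsFrobeniusAt p σ ∧
            ∃ x : K, x ≠ 0 ∧ ∀ w : FinPlace K, (NumberField K ∨ w ≠ q0) →
              vz w x = (if w = p then 1 else 0) - D w := by
  by_cases hn : NumberField K
  · obtain ⟨a, b, h1, h2, h3, h4, h5, h6⟩ := fixab_nf ℓ hℓ hchar ω hω
    refine ⟨a, b, h1, h2, h3, h4, fun _ => h5, fun α β hα hβ q0 _ σ D hD _ => ?_⟩
    obtain ⟨p, h7, h8, x, hx, h9⟩ := h6 α β hα hβ σ D hD
    exact ⟨p, h7, h8, x, hx, fun w _ => h9 w⟩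
  · obtain ⟨F₀, hF, x, hx, hfd⟩ := hK.resolve_left hn
    obtain ⟨a, b, h1, h2, h3, h4, h6⟩ := fixab_ff F₀ hF x hx hfd hℓ hodd hchar hω
    refine ⟨a, b, h1, h2, h3, h4, fun h => absurd h hn, fun α β hα hβ q0 _ σ D hD _ => ?_⟩
    obtain ⟨p, h7, h8, x, hx, h9⟩ := h6 α β hα hβ q0 σ D hD
    exact ⟨p, h7, h8, x, hx, fun w hw => h9 w (hw.resolve_left hn)⟩
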